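/- For every simple (non-weak) pseudoline arrangement (L₁, …, Lₙ) in ℝ² there exist a homeomorphism h : ℝ² → ℝ² and sets C₁, …, Cₙ with h(Lᵢ) = Cᵢ for every i, where each Cᵢ is an unbounded simple curve that is the union of two closed rays and at most n − 2 line segments (hence a polygonal chain of complexity at most n, with at most n − 1 bend points) and is contained in the boundary of some closed convex subset of ℝ² with nonempty interior (i.e., each chain is convex). -/

import Mathlib

open Set

/-- The Euclidean plane. -/
abbrev Plane := EuclideanSpace ℝ (Fin 2)

/-- A straight line in the plane. -/
def IsLine (S : Set Plane) : Prop :=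
  ∃ a u : Plane, u ≠ 0 ∧ S = {p | ∃ t : ℝ, p = a + t • u}

/-- A pseudoline: image of a straight line under a self-homeomorphism of the plane. -/
def IsPseudoline (L : Set Plane) : Prop :=
  ∃ (h : Plane ≃ₜ Plane) (ℓ : Set Plane), IsLine ℓ ∧ L = h '' ℓ

/-- Two curves cross at `p`: `p` lies on both, and each of them meets every
connected component of the complement of the other. -/
def CrossAt (L M : Set Plane) (p : Plane) : Prop :=
  p ∈ L ∩ M ∧
  (∀ x ∈ Mᶜ, (L ∩ connectedComponentIn Mᶜ x).Nonempty) ∧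
  (∀ x ∈ Lᶜ, (M ∩ connectedComponentIn Lᶜ x).Nonempty)

/-- A weak pseudoline arrangement: pairwise distinct pseudolines, any two of which
intersect in at most one point, and cross wherever they intersect. -/
def IsWeakArrangement {n : ℕ} (L : Fin n → Set Plane) : Prop :=
  Function.Injective L ∧
  (∀ i, IsPseudoline (L i)) ∧
  (∀ i j, i ≠ j → (L i ∩ L j).Subsingleton) ∧
  (∀ i j, i ≠ j → ∀ p ∈ L i ∩ L j, CrossAt (L i) (L j) p)

/-- A (non-weak) pseudoline arrangement: a weak arrangement in which any two
pseudolines intersect (in exactly one point, where they cross). -/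
def IsArrangement {n : ℕ} (L : Fin n → Set Plane) : Prop :=
  IsWeakArrangement L ∧ ∀ i j, i ≠ j → (L i ∩ L j).Nonempty

/-- Simplicity: no point lies on three distinct pseudolines of the family. -/
def IsSimple {n : ℕ} (L : Fin n → Set Plane) : Prop :=
  ∀ (p : Plane) (i j k : Fin n),
    p ∈ L i → p ∈ L j → p ∈ L k → i = j ∨ i = k ∨ j = k

/-- Outerplanarity: every intersection point of two pseudolines of the family lies
in the closure of some unbounded connected component of the complement of the union. -/
def IsOuterplanar {n : ℕ} (L : Fin n → Set Plane) : Prop :=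
  ∀ i j, i ≠ j → ∀ p ∈ L i ∩ L j,
    ∃ x ∈ (⋃ k, L k)ᶜ,
      ¬ Bornology.IsBounded (connectedComponentIn (⋃ k, L k)ᶜ x) ∧
      p ∈ closure (connectedComponentIn (⋃ k, L k)ᶜ x)

/-- A closed ray in the plane. -/
def IsRay (R : Set Plane) : Prop :=
  ∃ a u : Plane, u ≠ 0 ∧ R = {p | ∃ t : ℝ, 0 ≤ t ∧ p = a + t • u}

/-- A closed line segment in the plane. -/
def IsSegment (S : Set Plane) : Prop :=
  ∃ a b : Plane, S = segment ℝ a b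

/-- A convex curve: one contained in the boundary of a closed convex set with
nonempty interior. -/
def InConvexBoundary (C : Set Plane) : Prop :=
  ∃ K : Set Plane, IsClosed K ∧ Convex ℝ K ∧ (interior K).Nonempty ∧ C ⊆ frontier K


open Set
namespace CPR
open Complex Metric Topology Filter

/-- Two points lie in a common preconnected subset of `F`. -/
def Conn {α : Type*} [TopologicalSpace α] (F : Set α) (x y : α) : Prop :=
  ∃ S, IsPreconnected S ∧ S ⊆ F ∧ x ∈ S ∧ y ∈ S

theorem Conn.symm {α : Type*} [TopologicalSpace α] {F : Set α} {x y : α} (h : Conn F x y) :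
    Conn F y x := by
  obtain ⟨S, h1, h2, h3, h4⟩ := h
  exact ⟨S, h1, h2, h4, h3⟩

theorem Conn.trans {α : Type*} [TopologicalSpace α] {F : Set α} {x y z : α} (h : Conn F x y)
    (h' : Conn F y z) : Conn F x z := by
  obtain ⟨S, h1, h2, h3, h4⟩ := h
  obtain ⟨T, k1, k2, k3, k4⟩ := h'
  exact ⟨S ∪ T, h1.union y h4 k3 k1, union_subset h2 k2, Or.inl h3, Or.inr k4⟩

theorem Conn.mono {α : Type*} [TopologicalSpace α] {F G : Set α} {x y : α} (h : Conn F x y)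
    (hFG : F ⊆ G) : Conn G x y := by
  obtain ⟨S, h1, h2, h3, h4⟩ := h
  exact ⟨S, h1, h2.trans hFG, h3, h4⟩

theorem Conn.image {α β : Type*} [TopologicalSpace α] [TopologicalSpace β] {F : Set α} {G : Set β}
    {x y : α} (h : Conn F x y) {f : α → β} (hf : ContinuousOn f F) (hm : MapsTo f F G) :
    Conn G (f x) (f y) := by
  obtain ⟨S, h1, h2, h3, h4⟩ := h
  exact ⟨f '' S, h1.image f (hf.mono h2), by
    rintro _ ⟨z, hz, rfl⟩; exact hm (h2 hz), mem_image_of_mem f h3, mem_image_of_mem f h4⟩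

theorem Conn.left_mem {α : Type*} [TopologicalSpace α] {F : Set α} {x y : α} (h : Conn F x y) :
    x ∈ F := by
  obtain ⟨S, h1, h2, h3, h4⟩ := h
  exact h2 h3

theorem Conn.right_mem {α : Type*} [TopologicalSpace α] {F : Set α} {x y : α} (h : Conn F x y) :
    y ∈ F := by
  obtain ⟨S, h1, h2, h3, h4⟩ := h
  exact h2 h4

theorem conn_iff {α : Type*} [TopologicalSpace α] {F : Set α} {x y : α} :
    Conn F x y ↔ y ∈ connectedComponentIn F x := by
  constructor
  · rintro ⟨S, h1, h2, h3, h4⟩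
    exact h1.subset_connectedComponentIn h3 h2 h4
  · intro h
    have hx : x ∈ F := by
      by_contra hx
      rw [connectedComponentIn_eq_empty hx] at h
      exact h
    exact ⟨_, isPreconnected_connectedComponentIn, connectedComponentIn_subset F x,
      mem_connectedComponentIn hx, h⟩

theorem isPreconnected_of_conn {α : Type*} [TopologicalSpace α] {F : Set α}
    (h : ∀ x ∈ F, ∀ y ∈ F, Conn F x y) : IsPreconnected F := by
  refine isPreconnected_of_forall_pair fun x hx y hy => ?_
  obtain ⟨S, h1, h2, h3, h4⟩ := h x hx y hy
  exact ⟨S, h2, h3, h4, h1⟩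

theorem exp_eq_close {u v : ℂ} (h : exp u = exp v) (h' : ‖u - v‖ < 1) : u = v := by
  obtain ⟨n, hn⟩ := Complex.exp_eq_exp_iff_exists_int.1 h
  have h2 : u - v = n * (2 * Real.pi * I) := by rw [hn]; ring
  rw [h2] at h'
  simp only [norm_mul, norm_intCast, Complex.norm_I, Complex.norm_real, Complex.norm_two] at h'
  have h3 : |(n:ℝ)| < 1 := by
    have : ‖Real.pi‖ = Real.pi := by simp [Real.pi_pos.le]
    rw [this] at h'
    nlinarith [Real.pi_gt_three, abs_nonneg (n:ℝ)]
  have h4 : n = 0 := by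
    have : |n| < 1 := by exact_mod_cast h3
    exact Int.abs_lt_one_iff.1 this
  rw [hn, h4]; simp

theorem const_of_exp_eq {α : Type*} [TopologicalSpace α] {S : Set α} (hS : IsPreconnected S)
    {f : α → ℂ} (hf : ContinuousOn f S) {c : ℂ} (h : ∀ x ∈ S, exp (f x) = c) {x y : α}
    (hx : x ∈ S) (hy : y ∈ S) : f x = f y := by
  refine hS.induction₂' (fun x y => f x = f y) (fun x hx => ?_) ?_ hx hy
  · have h1 : ∀ᶠ y in 𝓝[S] x, ‖f y - f x‖ < 1 := by
      have := (hf x hx).eventually (Metric.ball_mem_nhds (f x) one_pos)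
      simpa [dist_eq_norm] using this
    filter_upwards [h1, self_mem_nhdsWithin] with y h1 h2
    have := exp_eq_close ((h y h2).trans (h x hx).symm) h1
    exact ⟨this.symm, this⟩
  · intro x y z _ _ _ h1 h2
    exact h1.trans h2

/-- existence of a continuous logarithm of `(z-a)/(z-b)` on `X`. -/
def HasLog (X : Set ℂ) (a b : ℂ) : Prop :=
  ∃ g : ℂ → ℂ, ContinuousOn g X ∧ ∀ z ∈ X, exp (g z) * (z - b) = z - a

theorem HasLog.symm {X : Set ℂ} {a b : ℂ} (h : HasLog X a b) : HasLog X b a := by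
  obtain ⟨g, hg, h⟩ := h
  refine ⟨fun z => - g z, hg.neg, fun z hz => ?_⟩
  rw [← h z hz, ← mul_assoc, ← Complex.exp_add]; simp

theorem HasLog.trans {X : Set ℂ} {a b c : ℂ} (h : HasLog X a b) (h' : HasLog X b c) :
    HasLog X a c := by
  obtain ⟨g, hg, h⟩ := h
  obtain ⟨k, hk, h'⟩ := h'
  refine ⟨fun z => g z + k z, hg.add hk, fun z hz => ?_⟩
  rw [Complex.exp_add, mul_assoc, h' z hz, h z hz]

theorem HasLog.mono {X Y : Set ℂ} {a b : ℂ} (h : HasLog X a b) (hY : Y ⊆ X) : HasLog Y a b := by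
  obtain ⟨g, hg, h⟩ := h
  exact ⟨g, hg.mono hY, fun z hz => h z (hY hz)⟩

theorem HasLog.near {X : Set ℂ} {a b : ℂ} (h : ∀ z ∈ X, ‖b - a‖ < ‖z - b‖) : HasLog X a b := by
  have hne : ∀ z ∈ X, z - b ≠ 0 := fun z hz h0 => by
    have := h z hz
    rw [h0, norm_zero] at this
    exact absurd this (not_lt.2 (norm_nonneg _))
  have hsl : ∀ z ∈ X, (z - a) / (z - b) ∈ Complex.slitPlane := by
    intro z hz
    have h1 : (z - a) / (z - b) = 1 + (b - a) / (z - b) := by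
      field_simp [hne z hz]; ring
    rw [h1]
    apply Complex.mem_slitPlane_of_norm_lt_one
    rw [norm_div, div_lt_one (norm_pos_iff.2 (hne z hz))]
    exact h z hz
  refine ⟨fun z => Complex.log ((z - a) / (z - b)), ?_, fun z hz => ?_⟩
  · apply ContinuousOn.clog _ hsl
    exact ContinuousOn.div (by fun_prop) (by fun_prop) hne
  · rw [Complex.exp_log (Complex.slitPlane_ne_zero (hsl z hz)), div_mul_cancel₀ _ (hne z hz)]

theorem HasLog.of_conn {X : Set ℂ} (hX : IsCompact X) {a b : ℂ} (h : Conn Xᶜ a b) :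
    HasLog X a b := by
  obtain ⟨S, hS, hSX, ha, hb⟩ := h
  refine hS.induction₂' (fun x y => HasLog X x y) (fun x hx => ?_) ?_ ha hb
  · have hx' : Xᶜ ∈ 𝓝 x := hX.isClosed.isOpen_compl.mem_nhds (hSX hx)
    obtain ⟨r, hr, hrX⟩ := Metric.mem_nhds_iff.1 hx'
    have : ball x r ∈ 𝓝[S] x := mem_nhdsWithin_of_mem_nhds (Metric.ball_mem_nhds x hr)
    filter_upwards [this] with y hy
    have h1 : HasLog X y x := HasLog.near fun z hz => by
      have h2 : z ∉ ball x r := fun h => hrX h hz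
      rw [mem_ball, not_lt, dist_eq_norm] at h2
      rw [mem_ball, dist_eq_norm, norm_sub_rev] at hy
      linarith
    exact ⟨h1.symm, h1⟩
  · intro x y z _ _ _ h1 h2
    exact h1.trans h2

theorem HasLog.union {X Y : Set ℂ} (hX : IsClosed X) (hY : IsClosed Y)
    (hXY : IsPreconnected (X ∩ Y)) {a b : ℂ} (hb : b ∉ X) (h : HasLog X a b) (h' : HasLog Y a b) :
    HasLog (X ∪ Y) a b := by
  classical
  obtain ⟨g, hg, h⟩ := h
  obtain ⟨k, hk, h'⟩ := h'
  have hexp : ∀ z ∈ X ∩ Y, exp (g z - k z) = 1 := by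
    intro z hz
    have hzb : z - b ≠ 0 := by
      intro h0
      rw [sub_eq_zero] at h0
      exact hb (h0 ▸ hz.1)
    have h1 : exp (g z) = exp (k z) :=
      mul_right_cancel₀ hzb ((h z hz.1).trans (h' z hz.2).symm)
    rw [Complex.exp_sub, h1, div_self (Complex.exp_ne_zero _)]
  obtain ⟨c, hc, hgk⟩ : ∃ c : ℂ, exp c = 1 ∧ ∀ z ∈ X ∩ Y, g z = k z + c := by
    rcases (X ∩ Y).eq_empty_or_nonempty with he | ⟨z₀, hz₀⟩
    · exact ⟨0, by simp, by simp [he]⟩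
    · refine ⟨g z₀ - k z₀, hexp z₀ hz₀, fun z hz => ?_⟩
      have := const_of_exp_eq hXY (f := fun z => g z - k z)
        ((hg.mono inter_subset_left).sub (hk.mono inter_subset_right)) hexp hz hz₀
      rw [← this]; ring
  refine ⟨fun z => if z ∈ X then g z else k z + c, ?_, fun z hz => ?_⟩
  · refine ContinuousOn.union_of_isClosed ?_ ?_ hX hY
    · exact hg.congr fun z hz => by simp [hz]
    · refine (hk.add (continuousOn_const (c := c))).congr fun z hz => ?_
      by_cases hzX : z ∈ X
      · simp [hzX, hgk z ⟨hzX, hz⟩]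
      · simp [hzX]
  · by_cases hzX : z ∈ X
    · simp [hzX, h z hzX]
    · have hzY : z ∈ Y := hz.resolve_left hzX
      simp only [hzX, if_false]
      rw [Complex.exp_add, hc, mul_one, h' z hzY]

theorem exists_log_univ {φ : ℂ → ℂ} (hφ : Continuous φ) (h0 : ∀ z, φ z ≠ 0) :
    ∃ ψ : ℂ → ℂ, Continuous ψ ∧ ∀ z, exp (ψ z) = φ z := by
  have hsc : IsSimplyConnected (univ : Set ℂ) := by
    have : ContractibleSpace (univ : Set ℂ) :=
      (convex_univ (𝕜 := ℝ) (E := ℂ)).contractibleSpace ⟨0, mem_univ _⟩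
    show SimplyConnectedSpace _
    infer_instance
  obtain ⟨f, hf, hfe⟩ := Complex.exists_continuousOn_eqOn_exp_comp hsc isOpen_univ
    hφ.continuousOn (by rintro ⟨z, -, hz⟩; exact h0 z hz)
  exact ⟨f, continuousOn_univ.1 hf, fun z => hfe (mem_univ z)⟩

theorem no_log_circle {φ : ℂ → ℂ} (hφ : Continuous φ) (h0 : ∀ z, φ z ≠ 0) {p : ℂ} {R : ℝ}
    (hR : 0 < R) (h : ∀ z, ‖z - p‖ = R → φ z = z - p) : False := by
  obtain ⟨ψ, hψ, hψe⟩ := exists_log_univ hφ h0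
  let c : ℝ → ℂ := fun θ => p + R * exp (θ * I)
  have hc : ∀ θ, ‖c θ - p‖ = R := fun θ => by
    simp [c, Complex.norm_exp_ofReal_mul_I, abs_of_pos hR]
  have hcc : Continuous c := by fun_prop
  have h1 : ∀ θ ∈ (univ : Set ℝ), exp (ψ (c θ) - θ * I) = R := by
    intro θ _
    rw [Complex.exp_sub, hψe, h _ (hc θ)]
    simp only [c, add_sub_cancel_left]
    rw [mul_div_assoc, div_self (Complex.exp_ne_zero _), mul_one]
  have h2 := const_of_exp_eq isPreconnected_univ (f := fun θ : ℝ => ψ (c θ) - θ * I)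
    (by apply Continuous.continuousOn; fun_prop) h1 (mem_univ 0) (mem_univ (2 * Real.pi))
  have h3 : c (2 * Real.pi) = c 0 := by
    simp only [c]
    have : ((2 * Real.pi : ℝ) : ℂ) * I = 2 * Real.pi * I := by push_cast; ring
    rw [this, Complex.exp_two_pi_mul_I]; simp
  simp only [h3] at h2
  have h4 : ((2 * Real.pi : ℝ) : ℂ) * I = 0 := by
    have : ((0:ℝ):ℂ) * I = 0 := by simp
    rw [this] at h2
    linear_combination h2
  have h5 : (2 * Real.pi : ℝ) = 0 := by
    rcases mul_eq_zero.1 h4 with h | h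
    · exact_mod_cast h
    · exact absurd h Complex.I_ne_zero
  linarith [Real.pi_pos]

theorem isPreconnected_compl_closedBall (p : ℂ) (R : ℝ) :
    IsPreconnected (closedBall p R)ᶜ := by
  have h : (closedBall p R)ᶜ = (fun q : ℝ × ℝ => p + q.1 * exp (q.2 * I)) '' (Ioi R ×ˢ univ) := by
    ext z
    simp only [mem_compl_iff, mem_closedBall, not_le, dist_eq_norm, mem_image, Prod.exists,
      mem_prod, mem_Ioi, mem_univ, and_true]
    constructor
    · intro hz
      refine ⟨‖z - p‖, (z - p).arg, hz, ?_⟩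
      rw [Complex.norm_mul_exp_arg_mul_I]; ring
    · rintro ⟨r, θ, hr, rfl⟩
      simp only [add_sub_cancel_left, norm_mul, Complex.norm_exp_ofReal_mul_I, mul_one,
        Complex.norm_real, Real.norm_eq_abs]
      exact hr.trans_le (le_abs_self r)
  rw [h]
  apply IsPreconnected.image
  · exact isPreconnected_Ioi.prod isPreconnected_univ
  · apply Continuous.continuousOn; fun_prop

/-- the frontier of a component of an open set is disjoint from that set -/
theorem frontier_component {U : Set ℂ} (hU : IsOpen U) (a : ℂ) :
    frontier (connectedComponentIn U a) ⊆ Uᶜ := by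
  intro z hz hzU
  have ho : IsOpen (connectedComponentIn U a) := hU.connectedComponentIn
  have hoz : IsOpen (connectedComponentIn U z) := hU.connectedComponentIn
  rw [ho.frontier_eq] at hz
  obtain ⟨w, hw1, hw2⟩ := mem_closure_iff.1 hz.1 _ hoz (mem_connectedComponentIn hzU)
  apply hz.2
  rw [connectedComponentIn_eq hw2, ← connectedComponentIn_eq hw1]
  exact mem_connectedComponentIn hzU

theorem conn_of_hasLog_aux {X : Set ℂ} (hX : IsCompact X) {a b : ℂ} (ha : a ∉ X) (hb : b ∉ X)
    (h : HasLog X a b) (hbd : Bornology.IsBounded (connectedComponentIn Xᶜ a)) : Conn Xᶜ a b := by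
  classical
  by_contra hcon
  rw [conn_iff] at hcon
  set V := connectedComponentIn Xᶜ a with hV
  have hVo : IsOpen V := hX.isClosed.isOpen_compl.connectedComponentIn
  have haV : a ∈ V := mem_connectedComponentIn ha
  have hfr : frontier V ⊆ X := by
    have := frontier_component hX.isClosed.isOpen_compl a
    rwa [compl_compl] at this
  obtain ⟨g, hg, hge⟩ := h
  obtain ⟨G, hG⟩ := ContinuousMap.exists_restrict_eq hX.isClosed
    (⟨X.domRestrict g, continuousOn_iff_continuous_domRestrict.1 hg⟩ : C(X, ℂ))
  have hGg : ∀ z ∈ X, G z = g z := fun z hz => by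
    have := DFunLike.congr_fun hG ⟨z, hz⟩
    simpa using this
  let φ : ℂ → ℂ := fun z => if z ∈ V then exp (G z) * (z - b) else z - a
  have hφ : Continuous φ := by
    apply Continuous.if
    · intro z hz
      have hzX := hfr hz
      rw [hGg z hzX, hge z hzX]
    · have := G.continuous; fun_prop
    · fun_prop
  have hφ0 : ∀ z, φ z ≠ 0 := by
    intro z
    by_cases hz : z ∈ V
    · simp only [φ, hz, if_true]
      refine mul_ne_zero (Complex.exp_ne_zero _) (sub_ne_zero.2 ?_)
      rintro rfl; exact hcon hz
    · simp only [φ, hz, if_false]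
      refine sub_ne_zero.2 ?_
      rintro rfl; exact hz haV
  obtain ⟨R, hR⟩ := hbd.subset_ball a
  have hR0 : 0 < R := by
    have := hR haV
    simpa using this
  refine no_log_circle hφ hφ0 (p := a) hR0 fun z hz => ?_
  have : z ∉ V := fun hzV => by
    have := hR hzV
    rw [mem_ball, dist_eq_norm] at this
    linarith
  simp [φ, this]

theorem conn_of_unbounded {X : Set ℂ} (hX : Bornology.IsBounded X) {a b : ℂ}
    (ha : ¬ Bornology.IsBounded (connectedComponentIn Xᶜ a))
    (hb : ¬ Bornology.IsBounded (connectedComponentIn Xᶜ b)) : Conn Xᶜ a b := by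
  obtain ⟨R, hR0, hR⟩ := hX.subset_closedBall_lt 0 0
  have key : ∀ c, ¬ Bornology.IsBounded (connectedComponentIn Xᶜ c) →
      ∃ z ∈ (closedBall (0:ℂ) R)ᶜ, Conn Xᶜ c z := by
    intro c hc
    by_contra hcon
    push Not at hcon
    apply hc
    refine (Metric.isBounded_closedBall (x := (0:ℂ)) (r := R)).subset fun z hz => ?_
    by_contra hz'
    exact hcon z hz' (conn_iff.2 hz)
  obtain ⟨z, hz, h1⟩ := key a ha
  obtain ⟨w, hw, h2⟩ := key b hb
  have h3 : Conn Xᶜ z w := ⟨_, isPreconnected_compl_closedBall 0 R,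
    compl_subset_compl.2 hR, hz, hw⟩
  exact (h1.trans h3).trans h2.symm

theorem conn_of_hasLog {X : Set ℂ} (hX : IsCompact X) {a b : ℂ} (ha : a ∉ X) (hb : b ∉ X)
    (h : HasLog X a b) : Conn Xᶜ a b := by
  by_cases h1 : Bornology.IsBounded (connectedComponentIn Xᶜ a)
  · exact conn_of_hasLog_aux hX ha hb h h1
  by_cases h2 : Bornology.IsBounded (connectedComponentIn Xᶜ b)
  · exact (conn_of_hasLog_aux hX hb ha h.symm h2).symm
  exact conn_of_unbounded hX.isBounded h1 h2

theorem janiszewski {X Y : Set ℂ} (hX : IsCompact X) (hY : IsCompact Y)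
    (hXY : IsPreconnected (X ∩ Y)) {a b : ℂ} (h : Conn Xᶜ a b) (h' : Conn Yᶜ a b) :
    Conn (X ∪ Y)ᶜ a b := by
  refine conn_of_hasLog (hX.union hY) ?_ ?_ ?_
  · exact fun h1 => h1.elim h.left_mem h'.left_mem
  · exact fun h1 => h1.elim h.right_mem h'.right_mem
  · exact HasLog.union hX.isClosed hY.isClosed hXY h.right_mem (HasLog.of_conn hX h)
      (HasLog.of_conn hY h')

theorem no_retraction {h : ℂ → ℂ} (hc : ContinuousOn h (closedBall 0 1))
    (hid : ∀ z, ‖z‖ = 1 → h z = z) {p : ℂ} (hp : ‖p‖ ≤ 1) : p ∈ h '' closedBall 0 1 := by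
  classical
  by_contra hcon
  let φ : ℂ → ℂ := fun z => if ‖z‖ ≤ 1 then h z - p else z - p
  have hφ : Continuous φ := by
    apply continuous_if
    · intro z hz
      have hz1 : ‖z‖ = 1 := by
        have hz' : z ∈ frontier (closedBall (0:ℂ) 1) := by
          convert hz using 2
          ext w; simp
        rw [frontier_closedBall _ one_ne_zero] at hz'
        simpa using hz'
      rw [hid z hz1]
    · have : closure {x : ℂ | ‖x‖ ≤ 1} = closedBall 0 1 := by
        have : {x : ℂ | ‖x‖ ≤ 1} = closedBall 0 1 := by ext w; simp
        rw [this, isClosed_closedBall.closure_eq]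
      rw [this]
      exact hc.sub continuousOn_const
    · fun_prop
  have hφ0 : ∀ z, φ z ≠ 0 := by
    intro z
    by_cases hz : ‖z‖ ≤ 1
    · simp only [φ, hz, if_true]
      intro h0
      exact hcon ⟨z, by simpa using hz, sub_eq_zero.1 h0⟩
    · simp only [φ, hz, if_false]
      intro h0
      rw [sub_eq_zero.1 h0] at hz
      exact hz hp
  refine no_log_circle hφ hφ0 (p := p) (R := 3) (by norm_num) fun z hz => ?_
  have : ¬ ‖z‖ ≤ 1 := fun h1 => by
    have := norm_sub_le z p
    linarith
  simp [φ, this]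

end CPR

open Set
namespace CPR
open Complex Metric Topology Filter

theorem subset_of_frontier {α : Type*} [TopologicalSpace α] {S V : Set α} (hS : IsPreconnected S)
    (hd : ∀ z ∈ S, z ∉ frontier V) {x : α} (hx : x ∈ S) (hxV : x ∈ V) : S ⊆ V := by
  have h1 : S ⊆ interior V ∪ (closure V)ᶜ := by
    intro z hz
    have := hd z hz
    rw [frontier, Set.mem_sdiff, not_and, not_not] at this
    by_cases hc : z ∈ closure V
    · exact Or.inl (this hc)
    · exact Or.inr hc
  have hdj : Disjoint (interior V) (closure V)ᶜ := by
    rw [disjoint_compl_right_iff_subset]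
    exact interior_subset.trans subset_closure
  refine (hS.subset_left_of_subset_union isOpen_interior isClosed_closure.isOpen_compl hdj h1
    ⟨x, hx, ?_⟩).trans interior_subset
  rcases h1 hx with h | h
  · exact h
  · exact absurd (subset_closure hxV) h

/-- bounded univalent functions on `V` -/
structure Fam (V : Set ℂ) (F : ℂ → ℂ) : Prop where
  holo : DifferentiableOn ℂ F V
  inj : InjOn F V
  lt : ∀ z ∈ V, ‖F z‖ < 1
  der : ∀ z ∈ V, deriv F z ≠ 0

theorem Fam.strict {V : Set ℂ} (hVo : IsOpen V) {F : ℂ → ℂ} (hF : Fam V F) {z : ℂ} (hz : z ∈ V) :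
    HasStrictDerivAt F (deriv F z) z := by
  have h1 : AnalyticAt ℂ F z := hF.holo.analyticAt (hVo.mem_nhds hz)
  exact h1.hasStrictDerivAt

theorem Fam.image_nhds {V : Set ℂ} (hVo : IsOpen V) {F : ℂ → ℂ} (hF : Fam V F) {z : ℂ}
    (hz : z ∈ V) : F '' V ∈ 𝓝 (F z) := by
  rw [← (hF.strict hVo hz).map_nhds_eq (hF.der z hz)]
  exact image_mem_map (hVo.mem_nhds hz)

theorem exists_hull {V K : Set ℂ} (hVb : Bornology.IsBounded V)
    (hVc : IsPreconnected Vᶜ) (hK : IsCompact K) (hKV : K ⊆ V) :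
    ∃ H : Set ℂ, IsCompact H ∧ K ⊆ H ∧ H ⊆ V ∧ IsPreconnected Hᶜ := by
  have hub : ¬ Bornology.IsBounded Vᶜ := by
    intro h
    have := hVb.union h
    rw [union_compl_self] at this
    exact NormedSpace.unbounded_univ ℝ ℂ this
  set U : Set ℂ := {z | ¬ Bornology.IsBounded (connectedComponentIn Kᶜ z)} with hU
  have hUK : U ⊆ Kᶜ := by
    intro z hz hzK
    apply hz
    rw [connectedComponentIn_eq_empty (by simpa using hzK)]
    exact Bornology.isBounded_empty
  have hVU : Vᶜ ⊆ U := by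
    intro z hz hb
    exact hub (hb.subset (hVc.subset_connectedComponentIn hz (compl_subset_compl.2 hKV)))
  have hUo : IsOpen U := by
    rw [isOpen_iff_mem_nhds]
    intro z hz
    have ho : IsOpen (connectedComponentIn Kᶜ z) := hK.isClosed.isOpen_compl.connectedComponentIn
    filter_upwards [ho.mem_nhds (mem_connectedComponentIn (hUK hz))] with w hw
    show ¬ _
    rw [← connectedComponentIn_eq hw]
    exact hz
  have hUc : IsPreconnected U := by
    refine isPreconnected_of_conn fun x hx y hy => ?_
    obtain ⟨S, h1, h2, h3, h4⟩ := conn_of_unbounded hK.isBounded hx hy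
    refine ⟨S, h1, fun z hz => ?_, h3, h4⟩
    intro hb
    refine hx (hb.subset ?_)
    rw [connectedComponentIn_eq (h1.subset_connectedComponentIn h3 h2 hz)]
  refine ⟨Uᶜ, ?_, ?_, ?_, ?_⟩
  · refine Metric.isCompact_of_isClosed_isBounded hUo.isClosed_compl (hVb.subset ?_)
    exact compl_subset_comm.1 hVU
  · exact subset_compl_comm.1 hUK
  · exact compl_subset_comm.1 hVU
  · rwa [compl_compl]

theorem exists_log_compact {V : Set ℂ} (hVo : IsOpen V) (hVp : IsPreconnected V)
    (hVb : Bornology.IsBounded V) (hVc : IsPreconnected Vᶜ) {F : ℂ → ℂ} (hF : Fam V F)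
    (h0 : ∀ z ∈ V, F z ≠ 0) {K : Set ℂ} (hK : IsCompact K) (hKV : K ⊆ V) (hKn : K.Nonempty) :
    ∃ g : ℂ → ℂ, ContinuousOn g K ∧ ∀ z ∈ K, exp (g z) = F z := by
  obtain ⟨H, hH, hKH, hHV, hHc⟩ := exists_hull hVb hVc hK hKV
  have hVcl : IsCompact (frontier V) := by
    refine Metric.isCompact_of_isClosed_isBounded isClosed_frontier ?_
    exact hVb.closure.subset frontier_subset_closure
  have hfrV : ∀ z ∈ V, z ∉ frontier V := fun z hz h => by
    rw [hVo.frontier_eq] at h; exact h.2 hz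
  have hQ : IsPreconnected (V \ H) := by
    refine isPreconnected_of_conn fun x hx y hy => ?_
    have h1 : Conn (frontier V)ᶜ x y := ⟨V, hVp, hfrV, hx.1, hy.1⟩
    have h2 : Conn Hᶜ x y := ⟨Hᶜ, hHc, subset_rfl, hx.2, hy.2⟩
    have h3 : IsPreconnected (frontier V ∩ H) := by
      have : frontier V ∩ H = ∅ := by
        ext z; constructor
        · rintro ⟨h, h'⟩; exact hfrV z (hHV h') h
        · simp
      rw [this]; exact isPreconnected_empty
    obtain ⟨S, k1, k2, k3, k4⟩ := janiszewski hVcl hH h3 h1 h2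
    have k5 : S ⊆ V := subset_of_frontier k1 (fun z hz h => k2 hz (Or.inl h)) k3 hx.1
    exact ⟨S, k1, fun z hz => ⟨k5 hz, fun h => k2 hz (Or.inr h)⟩, k3, k4⟩
  have hFc : ContinuousOn F V := hF.holo.continuousOn
  have hFQ : IsPreconnected (F '' (V \ H)) := hQ.image F (hFc.mono sdiff_subset)
  have hFH : IsCompact (F '' H) := hH.image_of_continuousOn (hFc.mono hHV)
  have key : ∀ c, c ∉ F '' V → ∃ z ∈ V \ H, Conn (F '' H)ᶜ c (F z) := by
    intro c hc
    have hcH : c ∈ (F '' H)ᶜ := fun h => hc (image_mono hHV h)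
    set W := connectedComponentIn (F '' H)ᶜ c with hW
    have hcW : c ∈ W := mem_connectedComponentIn hcH
    have hne : (frontier W).Nonempty := by
      rw [nonempty_frontier_iff]
      refine ⟨⟨c, hcW⟩, fun h => ?_⟩
      obtain ⟨k, hk⟩ := hKn
      have h1 : F k ∈ W := by rw [h]; exact mem_univ _
      exact connectedComponentIn_subset _ _ h1 (mem_image_of_mem F (hKH hk))
    obtain ⟨p, hp⟩ := hne
    have hpH := frontier_component hFH.isClosed.isOpen_compl c hp
    rw [compl_compl] at hpH
    obtain ⟨z, hz, rfl⟩ := hpH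
    have h2 := hF.image_nhds hVo (hHV hz)
    obtain ⟨q, hq1, hq2⟩ := mem_closure_iff_nhds.1 (frontier_subset_closure hp) _ h2
    obtain ⟨w, hw, rfl⟩ := hq1
    refine ⟨w, ⟨hw, fun h => ?_⟩, conn_iff.2 hq2⟩
    exact connectedComponentIn_subset _ _ hq2 (mem_image_of_mem F h)
  have hd : ∀ z ∈ V \ H, ∀ w ∈ V \ H, Conn (F '' H)ᶜ (F z) (F w) := by
    intro z hz w hw
    refine ⟨_, hFQ, ?_, mem_image_of_mem F hz, mem_image_of_mem F hw⟩
    rintro _ ⟨x, hx, rfl⟩ ⟨y, hy, hxy⟩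
    exact hx.2 (hF.inj (hHV hy) hx.1 hxy ▸ hy)
  obtain ⟨z, hz, h1⟩ := key 0 (by rintro ⟨z, hz, h⟩; exact h0 z hz h)
  obtain ⟨w, hw, h2⟩ := key 2 (by
    rintro ⟨z, hz, h⟩
    have := hF.lt z hz
    rw [h] at this
    norm_num at this)
  have h3 : Conn (F '' H)ᶜ 0 2 := (h1.trans (hd z hz w hw)).trans h2.symm
  obtain ⟨g, hg, hge⟩ := HasLog.of_conn hFH h3
  have hsl : ∀ z ∈ V, 2 - F z ∈ slitPlane := by
    intro z hz
    left
    have h4 := (abs_re_le_norm (F z)).trans_lt (hF.lt z hz)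
    have h5 := le_abs_self (F z).re
    simp
    linarith
  refine ⟨fun z => g (F z) + (Complex.log (2 - F z) + Real.pi * I), ?_, fun z hz => ?_⟩
  · refine ContinuousOn.add ?_ (ContinuousOn.add (ContinuousOn.clog ?_ ?_) continuousOn_const)
    · exact hg.comp (hFc.mono hKV) fun z hz => mem_image_of_mem F (hKH hz)
    · exact continuousOn_const.sub (hFc.mono hKV)
    · exact fun z hz => hsl z (hKV hz)
  · have h6 := hge (F z) (mem_image_of_mem F (hKH hz))
    rw [Complex.exp_add, Complex.exp_add, Complex.exp_pi_mul_I,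
      Complex.exp_log (slitPlane_ne_zero (hsl z (hKV hz)))]
    linear_combination h6

theorem exists_log_holo {V : Set ℂ} (hVo : IsOpen V) (hVp : IsPreconnected V)
    (hVb : Bornology.IsBounded V) (hVc : IsPreconnected Vᶜ) {F : ℂ → ℂ} (hF : Fam V F)
    (h0 : ∀ z ∈ V, F z ≠ 0) {v₀ : ℂ} (hv₀ : v₀ ∈ V) :
    ∃ g : ℂ → ℂ, DifferentiableOn ℂ g V ∧ ∀ z ∈ V, exp (g z) = F z := by
  have hpath : IsPathConnected V := hVo.isConnected_iff_isPathConnected.1 ⟨⟨v₀, hv₀⟩, hVp⟩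
  have hlog : ∀ K : Set ℂ, IsCompact K → K ⊆ V → v₀ ∈ K →
      ∃ g : ℂ → ℂ, ContinuousOn g K ∧ (∀ z ∈ K, exp (g z) = F z) ∧ g v₀ = Complex.log (F v₀) := by
    intro K hK hKV hvK
    obtain ⟨g, hg, hge⟩ := exists_log_compact hVo hVp hVb hVc hF h0 hK hKV ⟨v₀, hvK⟩
    have h1 : exp (Complex.log (F v₀) - g v₀) = 1 := by
      rw [Complex.exp_sub, hge v₀ hvK, Complex.exp_log (h0 v₀ hv₀), div_self (h0 v₀ hv₀)]
    refine ⟨fun z => g z + (Complex.log (F v₀) - g v₀), hg.add continuousOn_const,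
      fun z hz => ?_, by ring⟩
    rw [Complex.exp_add, h1, mul_one, hge z hz]
  choose! G hGc hGe hG0 using hlog
  have hKex : ∀ z ∈ V, ∃ K : Set ℂ, IsCompact K ∧ K ⊆ V ∧ v₀ ∈ K ∧ IsPreconnected K ∧ z ∈ K := by
    intro z hz
    obtain ⟨p, hp⟩ := hpath.joinedIn v₀ hv₀ z hz
    refine ⟨range p, isCompact_range p.continuous, ?_, ⟨0, p.source⟩,
      isPreconnected_range p.continuous, ⟨1, p.target⟩⟩
    rintro _ ⟨t, rfl⟩
    exact hp t
  choose! Kz hKc hKV hKv hKp hKz using hKex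
  have huniq : ∀ K L : Set ℂ, IsCompact K → K ⊆ V → v₀ ∈ K → IsPreconnected K →
      IsCompact L → L ⊆ V → K ⊆ L → ∀ z ∈ K, G K z = G L z := by
    intro K L hK hKV hvK hKp hL hLV hKL z hz
    have := const_of_exp_eq hKp (f := fun z => G K z - G L z)
      ((hGc K hK hKV hvK).sub ((hGc L hL hLV (hKL hvK)).mono hKL)) (c := 1) (fun w hw => by
        rw [Complex.exp_sub, hGe K hK hKV hvK w hw, hGe L hL hLV (hKL hvK) w (hKL hw),
          div_self (h0 w (hKV hw))]) hz hvK
    simp only [hG0 K hK hKV hvK, hG0 L hL hLV (hKL hvK), sub_self] at this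
    exact sub_eq_zero.1 this
  have huniq2 : ∀ K L : Set ℂ, IsCompact K → K ⊆ V → v₀ ∈ K → IsPreconnected K →
      IsCompact L → L ⊆ V → v₀ ∈ L → IsPreconnected L → ∀ z ∈ K, z ∈ L → G K z = G L z := by
    intro K L hK hKV hvK hKp hL hLV hvL hLp z hzK hzL
    rw [huniq K (K ∪ L) hK hKV hvK hKp (hK.union hL) (union_subset hKV hLV) subset_union_left z hzK,
      huniq L (K ∪ L) hL hLV hvL hLp (hK.union hL) (union_subset hKV hLV) subset_union_right z hzL]
  refine ⟨fun z => G (Kz z) z, ?_, fun z hz => hGe _ (hKc z hz) (hKV z hz) (hKv z hz) z (hKz z hz)⟩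
  set g : ℂ → ℂ := fun z => G (Kz z) z with hg
  have hge : ∀ z ∈ V, exp (g z) = F z :=
    fun z hz => hGe _ (hKc z hz) (hKV z hz) (hKv z hz) z (hKz z hz)
  have hgc : ∀ z ∈ V, ContinuousAt g z := by
    intro z hz
    obtain ⟨r, hr, hrV⟩ := Metric.nhds_basis_closedBall.mem_iff.1 (hVo.mem_nhds hz)
    set K := Kz z ∪ closedBall z r with hKdef
    have hK1 : IsCompact K := (hKc z hz).union (isCompact_closedBall z r)
    have hK2 : K ⊆ V := union_subset (hKV z hz) hrV
    have hK3 : v₀ ∈ K := Or.inl (hKv z hz)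
    have hK4 : IsPreconnected K := (hKp z hz).union z (hKz z hz) (mem_closedBall_self hr.le)
      isPreconnected_closedBall
    have hnb : closedBall z r ∈ 𝓝 z := closedBall_mem_nhds z hr
    have hKn : K ∈ 𝓝 z := mem_of_superset hnb subset_union_right
    refine ((hGc K hK1 hK2 hK3).continuousAt hKn).congr ?_
    filter_upwards [hnb] with w hw
    have hwV := hrV hw
    exact huniq2 K (Kz w) hK1 hK2 hK3 hK4 (hKc w hwV) (hKV w hwV) (hKv w hwV) (hKp w hwV) w
      (Or.inr hw) (hKz w hwV)
  intro z hz
  apply DifferentiableAt.differentiableWithinAt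
  have hFd : DifferentiableAt ℂ F z := (hF.holo z hz).differentiableAt (hVo.mem_nhds hz)
  have h1 : DifferentiableAt ℂ (fun w => g z + Complex.log (F w / F z)) z := by
    apply DifferentiableAt.const_add
    apply DifferentiableAt.clog
    · exact hFd.div_const _
    · rw [div_self (h0 z hz)]; exact one_mem_slitPlane
  refine h1.congr_of_eventuallyEq ?_
  have h2 : ContinuousAt (fun w => g w - (g z + Complex.log (F w / F z))) z :=
    (hgc z hz).sub h1.continuousAt
  have h3 : ∀ᶠ w in 𝓝 z, ‖g w - (g z + Complex.log (F w / F z))‖ < 1 := by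
    have h4 : ‖g z - (g z + Complex.log (F z / F z))‖ < 1 := by
      simp [div_self (h0 z hz)]
    exact h2.norm.eventually_lt_const h4
  filter_upwards [h3, hVo.mem_nhds hz] with w hw hwV
  refine exp_eq_close ?_ hw
  rw [Complex.exp_add, hge w hwV, hge z hz, Complex.exp_log (div_ne_zero (h0 w hwV) (h0 z hz)),
    mul_div_cancel₀ _ (h0 z hz)]

end CPR

open Set
namespace CPR
open Complex Metric Topology Filter
open scoped ComplexConjugate

theorem hurwitz {U : Set ℂ} (hU : IsOpen U) {p : Filter ℕ} [NeBot p] {G : ℕ → ℂ → ℂ} {g : ℂ → ℂ}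
    (hconv : TendstoLocallyUniformlyOn G g p U) (hd : ∀ n, DifferentiableOn ℂ (G n) U)
    (hz : ∀ n, ∀ z ∈ U, G n z ≠ 0) {b : ℂ} (hb : b ∈ U) (hgb : g b = 0) :
    ∀ᶠ z in 𝓝 b, g z = 0 := by
  have hgd : DifferentiableOn ℂ g U :=
    hconv.differentiableOn (Eventually.of_forall hd) hU
  have hga : AnalyticAt ℂ g b := hgd.analyticAt (hU.mem_nhds hb)
  rcases hga.eventually_eq_zero_or_eventually_ne_zero with h | h
  · exact h
  exfalso
  rw [eventually_nhdsWithin_iff] at h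
  obtain ⟨r, hr, hrU⟩ := Metric.nhds_basis_closedBall.mem_iff.1
    ((h.and (hU.mem_nhds hb)) : _ ∈ 𝓝 b)
  have hrU' : closedBall b r ⊆ U := fun z hz => (hrU hz).2
  have hne : ∀ z ∈ sphere b r, g z ≠ 0 := fun z hz =>
    (hrU (sphere_subset_closedBall hz)).1 (ne_of_mem_sphere hz hr.ne')
  have hsn : (sphere b r).Nonempty := NormedSpace.sphere_nonempty.2 hr.le
  obtain ⟨z₀, hz₀, hmin⟩ := (isCompact_sphere b r).exists_isMinOn hsn
    (hgd.continuousOn.mono (sphere_subset_closedBall.trans hrU')).norm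
  set δ := ‖g z₀‖ with hδ
  have hδ0 : 0 < δ := norm_pos_iff.2 (hne z₀ hz₀)
  have hu := (tendstoLocallyUniformlyOn_iff_tendstoUniformlyOn_of_compact
    (isCompact_closedBall b r)).1 (hconv.mono hrU')
  obtain ⟨n, hn⟩ := (Metric.tendstoUniformlyOn_iff.1 hu (δ / 2) (by positivity)).exists
  have h1 : ‖(G n b)⁻¹‖ ≤ (δ / 2)⁻¹ := by
    refine Complex.norm_le_of_forall_mem_frontier_norm_le (U := ball b r)
      (f := fun z => (G n z)⁻¹) isBounded_ball ?_ ?_ (subset_closure (mem_ball_self hr))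
    · apply DifferentiableOn.diffContOnCl
      rw [closure_ball b hr.ne']
      exact ((hd n).mono hrU').inv fun z hz' => hz n z (hrU' hz')
    · intro z hz'
      rw [frontier_ball b hr.ne'] at hz'
      have h2 := hn z (sphere_subset_closedBall hz')
      have h3 : δ ≤ ‖g z‖ := hmin hz'
      have h4 : ‖g z‖ ≤ ‖G n z‖ + ‖g z - G n z‖ := by
        have := norm_add_le (G n z) (g z - G n z)
        simpa using this
      rw [dist_eq_norm] at h2
      rw [norm_inv]
      apply inv_anti₀ (by positivity)
      linarith
  have h5 := hn b (mem_closedBall_self hr.le)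
  rw [hgb, dist_zero_left] at h5
  rw [norm_inv] at h1
  have h6 : 0 < ‖G n b‖ := norm_pos_iff.2 (hz n b hb)
  have h7 := (inv_le_inv₀ h6 (by positivity)).1 h1
  linarith

theorem montel {V : Set ℂ} (hV : IsOpen V) {F : ℕ → ℂ → ℂ} (hd : ∀ n, DifferentiableOn ℂ (F n) V)
    (hb : ∀ n, ∀ z ∈ V, ‖F n z‖ ≤ 1) (p : Ultrafilter ℕ) :
    ∃ G : ℂ → ℂ, TendstoLocallyUniformlyOn F G p V := by
  have hlim : ∀ z ∈ V, ∃ w, Tendsto (fun n => F n z) p (𝓝 w) := by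
    intro z hz
    obtain ⟨w, -, hw⟩ := (isCompact_closedBall (0:ℂ) 1).ultrafilter_le_nhds
      (p.map (fun n => F n z)) (by
        rw [le_principal_iff]
        exact Filter.mem_map.2 (Filter.univ_mem' fun n => by simpa using hb n z hz))
    exact ⟨w, hw⟩
  choose! G hG using hlim
  refine ⟨G, Metric.tendstoLocallyUniformlyOn_iff.2 fun ε hε z hz => ?_⟩
  obtain ⟨r, hr, hrV⟩ := Metric.nhds_basis_closedBall.mem_iff.1 (hV.mem_nhds hz)
  have hLip : ∀ n, ∀ y ∈ ball z (r / 2), ‖F n y - F n z‖ ≤ (1 / (r / 2)) * ‖y - z‖ := by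
    intro n y hy
    have hsub : ∀ x ∈ ball z (r / 2), closedBall x (r / 2) ⊆ V := by
      intro x hx
      refine (closedBall_subset_closedBall' ?_).trans hrV
      rw [mem_ball] at hx
      linarith
    refine Convex.norm_image_sub_le_of_norm_deriv_le (s := ball z (r / 2)) ?_ ?_
      (convex_ball z _) (mem_ball_self (by positivity)) hy
    · intro x hx
      exact (hd n).differentiableAt
        (mem_of_superset (closedBall_mem_nhds x (by positivity)) (hsub x hx))
    · intro x hx
      refine Complex.norm_deriv_le_of_forall_mem_sphere_norm_le (by positivity) ?_ ?_
      · apply DifferentiableOn.diffContOnCl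
        rw [closure_ball x (by positivity)]
        exact (hd n).mono (hsub x hx)
      · intro w hw
        exact hb n w (hsub x hx (sphere_subset_closedBall hw))
  have hLip' : ∀ y ∈ ball z (r / 2), ‖G y - G z‖ ≤ (1 / (r / 2)) * ‖y - z‖ := by
    intro y hy
    have hyV : y ∈ V := hrV (ball_subset_closedBall (ball_subset_ball (by linarith) hy))
    exact le_of_tendsto ((hG y hyV).sub (hG z hz)).norm (Eventually.of_forall fun n => hLip n y hy)
  refine ⟨ball z (min (r / 2) (ε * (r / 2) / 4)),
    mem_nhdsWithin_of_mem_nhds (ball_mem_nhds z (by positivity)), ?_⟩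
  have h1 := (hG z hz).eventually (ball_mem_nhds (G z) (show 0 < ε / 4 by positivity))
  filter_upwards [h1] with n hn y hy
  have hy1 : y ∈ ball z (r / 2) := ball_subset_ball (min_le_left _ _) hy
  have hy2 : ‖y - z‖ < ε * (r / 2) / 4 := by
    have := ball_subset_ball (min_le_right _ _) hy
    rwa [mem_ball, dist_eq_norm] at this
  have h3 : (1 / (r / 2)) * ‖y - z‖ < ε / 4 := by
    calc (1 / (r / 2)) * ‖y - z‖ < (1 / (r / 2)) * (ε * (r / 2) / 4) := by gcongr
      _ = ε / 4 := by field_simp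
  have h4 := hLip n y hy1
  have h5 := hLip' y hy1
  rw [dist_eq_norm] at hn
  rw [dist_eq_norm]
  have h6 : G y - F n y = (G y - G z) - (F n z - G z) - (F n y - F n z) := by ring
  rw [h6]
  have h7 := norm_sub_le ((G y - G z) - (F n z - G z)) (F n y - F n z)
  have h8 := norm_sub_le (G y - G z) (F n z - G z)
  linarith

/-- disc automorphism -/
noncomputable def mob (a w : ℂ) : ℂ := (w - a) / (1 - conj a * w)

theorem mob_den {a w : ℂ} (ha : ‖a‖ < 1) (hw : ‖w‖ < 1) : 1 - conj a * w ≠ 0 := by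
  intro h
  have h1 : ‖conj a * w‖ = 1 := by
    rw [← sub_eq_zero.1 h]; simp
  rw [norm_mul, RCLike.norm_conj] at h1
  nlinarith [norm_nonneg a, norm_nonneg w]

theorem mob_lt {a w : ℂ} (ha : ‖a‖ < 1) (hw : ‖w‖ < 1) : ‖mob a w‖ < 1 := by
  rw [mob, norm_div, div_lt_one (norm_pos_iff.2 (mob_den ha hw))]
  have h1 : ‖w - a‖ ^ 2 < ‖1 - conj a * w‖ ^ 2 := by
    have ha2 : ‖a‖ ^ 2 < 1 := by nlinarith [norm_nonneg a]
    have hw2 : ‖w‖ ^ 2 < 1 := by nlinarith [norm_nonneg w]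
    rw [← Complex.normSq_eq_norm_sq, Complex.normSq_apply] at ha2 hw2 ⊢
    rw [← Complex.normSq_eq_norm_sq, Complex.normSq_apply]
    simp
    nlinarith [mul_pos (sub_pos.2 ha2) (sub_pos.2 hw2)]
  exact lt_of_pow_lt_pow_left₀ 2 (norm_nonneg _) h1

theorem mob_deriv {a w : ℂ} (ha : ‖a‖ < 1) (hw : ‖w‖ < 1) :
    HasDerivAt (mob a) ((1 - conj a * a) / (1 - conj a * w) ^ 2) w := by
  have h1 := ((hasDerivAt_id w).sub_const a).div
    (((hasDerivAt_id w).const_mul (conj a)).const_sub 1) (mob_den ha hw)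
  convert! h1 using 1
  congr 1
  simp
  ring

theorem one_sub_ne {a : ℂ} (ha : ‖a‖ < 1) : 1 - conj a * a ≠ 0 := mob_den ha ha

theorem mob_inj {a w z : ℂ} (ha : ‖a‖ < 1) (hw : ‖w‖ < 1) (hz : ‖z‖ < 1) (h : mob a w = mob a z) :
    w = z := by
  rw [mob, mob, div_eq_div_iff (mob_den ha hw) (mob_den ha hz)] at h
  have h1 : (w - z) * (1 - conj a * a) = 0 := by linear_combination h
  rcases mul_eq_zero.1 h1 with h2 | h2
  · exact sub_eq_zero.1 h2
  · exact absurd h2 (one_sub_ne ha)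

theorem Fam.hasDeriv {V : Set ℂ} (hVo : IsOpen V) {F : ℂ → ℂ} (hF : Fam V F) {z : ℂ}
    (hz : z ∈ V) : HasDerivAt F (deriv F z) z :=
  (hF.strict hVo hz).hasDerivAt

theorem Fam.mob_hasDeriv {V : Set ℂ} (hVo : IsOpen V) {F : ℂ → ℂ} (hF : Fam V F) {a : ℂ}
    (ha : ‖a‖ < 1) {z : ℂ} (hz : z ∈ V) : HasDerivAt (fun z => mob a (F z))
      ((1 - conj a * a) / (1 - conj a * F z) ^ 2 * deriv F z) z :=
  (mob_deriv ha (hF.lt z hz)).comp z (hF.hasDeriv hVo hz)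

theorem Fam.mob {V : Set ℂ} (hVo : IsOpen V) {F : ℂ → ℂ} (hF : Fam V F) {a : ℂ} (ha : ‖a‖ < 1) :
    Fam V (fun z => mob a (F z)) where
  holo z hz := (hF.mob_hasDeriv hVo ha hz).differentiableAt.differentiableWithinAt
  inj z hz w hw h := hF.inj hz hw (mob_inj ha (hF.lt z hz) (hF.lt w hw) h)
  lt z hz := mob_lt ha (hF.lt z hz)
  der z hz := by
    rw [(hF.mob_hasDeriv hVo ha hz).deriv]
    exact mul_ne_zero (div_ne_zero (one_sub_ne ha) (pow_ne_zero _ (mob_den ha (hF.lt z hz))))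
      (hF.der z hz)

theorem koebe {V : Set ℂ} (hVo : IsOpen V) (hVp : IsPreconnected V)
    (hVb : Bornology.IsBounded V) (hVc : IsPreconnected Vᶜ) {F : ℂ → ℂ} (hF : Fam V F)
    {v₀ : ℂ} (hv₀ : v₀ ∈ V) (hF0 : F v₀ = 0) {a : ℂ} (ha : ‖a‖ < 1) (haF : ∀ z ∈ V, F z ≠ a) :
    ∃ E : ℂ → ℂ, Fam V E ∧ E v₀ = 0 ∧ ‖deriv F v₀‖ < ‖deriv E v₀‖ := by
  have hM := hF.mob hVo ha
  have hM0 : ∀ z ∈ V, CPR.mob a (F z) ≠ 0 := fun z hz =>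
    div_ne_zero (sub_ne_zero.2 (haF z hz)) (mob_den ha (hF.lt z hz))
  obtain ⟨g, hg, hge⟩ := exists_log_holo hVo hVp hVb hVc hM hM0 hv₀
  set S : ℂ → ℂ := fun z => exp (g z / 2) with hS
  have hS2 : ∀ z ∈ V, S z * S z = CPR.mob a (F z) := by
    intro z hz
    simp only [hS]
    rw [← Complex.exp_add, add_halves, hge z hz]
  have hSd : DifferentiableOn ℂ S V := (hg.div_const 2).cexp
  have hSder : ∀ z ∈ V, 2 * S z * deriv S z = deriv (fun z => CPR.mob a (F z)) z := by
    intro z hz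
    have h1 : HasDerivAt S (deriv S z) z := (hSd.differentiableAt (hVo.mem_nhds hz)).hasDerivAt
    have h2 := (h1.mul h1).congr_of_eventuallyEq (f₁ := fun z => CPR.mob a (F z)) (by
      filter_upwards [hVo.mem_nhds hz] with w hw
      exact (hS2 w hw).symm)
    rw [h2.deriv]; ring
  have hSF : Fam V S := by
    refine ⟨hSd, ?_, ?_, ?_⟩
    · intro z hz w hw h
      apply hM.inj hz hw
      show CPR.mob a (F z) = CPR.mob a (F w)
      rw [← hS2 z hz, ← hS2 w hw, h]
    · intro z hz
      have h1 := hM.lt z hz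
      simp only [← hS2 z hz, norm_mul] at h1
      nlinarith [norm_nonneg (S z)]
    · intro z hz h0
      apply hM.der z hz
      rw [← hSder z hz, h0, mul_zero]
  set c := S v₀ with hc
  have hcl : ‖c‖ < 1 := hSF.lt v₀ hv₀
  have hc0 : c ≠ 0 := Complex.exp_ne_zero _
  refine ⟨fun z => CPR.mob c (S z), hSF.mob hVo hcl, by simp [CPR.mob, ← hc], ?_⟩
  have h1 := hSder v₀ hv₀
  rw [(hF.mob_hasDeriv hVo ha hv₀).deriv, hF0] at h1
  rw [(hSF.mob_hasDeriv hVo hcl hv₀).deriv, ← hc]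
  have h2 : c * c = - a := by
    rw [hc, hS2 v₀ hv₀, hF0]; simp [CPR.mob]
  have hna : ‖a‖ = ‖c‖ ^ 2 := by
    rw [← norm_neg, ← h2, norm_mul, sq]
  have e1 : ∀ b : ℂ, 1 - conj b * b = ((1 - ‖b‖ ^ 2 : ℝ) : ℂ) := by
    intro b
    rw [Complex.conj_mul' b]; push_cast; ring
  have h3 : ‖(2 * c * deriv S v₀)‖ = ‖(1 - conj a * a) / (1 - conj a * 0) ^ 2 * deriv F v₀‖ := by
    rw [h1]
  have hcp : 0 < ‖c‖ := norm_pos_iff.2 hc0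
  have hc2 : ‖c‖ ^ 2 < 1 := by nlinarith
  have hc4 : (‖c‖ ^ 2) ^ 2 < 1 := by nlinarith [sq_nonneg ‖c‖]
  have hdp : 0 < ‖deriv F v₀‖ := norm_pos_iff.2 (hF.der v₀ hv₀)
  have h4 : 2 * ‖c‖ * ‖deriv S v₀‖ = (1 - (‖c‖ ^ 2) ^ 2) * ‖deriv F v₀‖ := by
    rw [e1, hna] at h3
    simp only [norm_mul, Complex.norm_two, mul_zero, sub_zero, one_pow, div_one, Complex.norm_real,
      Real.norm_eq_abs] at h3
    rw [h3, abs_of_pos (by linarith)]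
  have h5 : ‖(1 - conj c * c) / (1 - conj c * c) ^ 2 * deriv S v₀‖ =
      ‖deriv S v₀‖ / (1 - ‖c‖ ^ 2) := by
    rw [e1]
    have hpos : (0:ℝ) < 1 - ‖c‖ ^ 2 := by linarith
    rw [norm_mul, norm_div, norm_pow, Complex.norm_real, Real.norm_eq_abs, abs_of_pos hpos]
    field_simp
  rw [h5, lt_div_iff₀ (by linarith)]
  have h6 : ‖deriv S v₀‖ = (1 - (‖c‖ ^ 2) ^ 2) * ‖deriv F v₀‖ / (2 * ‖c‖) := by
    rw [← h4]; field_simp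
  rw [h6, lt_div_iff₀ (by positivity)]
  have h7 : (1 - (‖c‖ ^ 2) ^ 2) * ‖deriv F v₀‖ - ‖deriv F v₀‖ * (1 - ‖c‖ ^ 2) * (2 * ‖c‖) =
    ‖deriv F v₀‖ * (1 - ‖c‖ ^ 2) * (1 - ‖c‖) ^ 2 := by ring
  have h8 : 0 < ‖deriv F v₀‖ * (1 - ‖c‖ ^ 2) * (1 - ‖c‖) ^ 2 := by
    have : 0 < 1 - ‖c‖ ^ 2 := by linarith
    have : 0 < 1 - ‖c‖ := by linarith
    positivity
  linarith

theorem exists_extremal {V : Set ℂ} (hVo : IsOpen V) (hVp : IsPreconnected V)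
    (hVb : Bornology.IsBounded V) {v₀ : ℂ} (hv₀ : v₀ ∈ V) :
    ∃ F : ℂ → ℂ, Fam V F ∧ F v₀ = 0 ∧
      ∀ E : ℂ → ℂ, Fam V E → E v₀ = 0 → ‖deriv E v₀‖ ≤ ‖deriv F v₀‖ := by
  set D : Set ℝ := {x | ∃ F : ℂ → ℂ, Fam V F ∧ F v₀ = 0 ∧ ‖deriv F v₀‖ = x} with hD
  obtain ⟨x₀, hx₀D, hx₀⟩ : ∃ x ∈ D, 0 < x := by
    obtain ⟨R, hR0, hR⟩ := hVb.subset_ball_lt 0 v₀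
    have hder : ∀ z : ℂ, HasDerivAt (fun z : ℂ => (z - v₀) / R) (1 / R) z := fun z =>
      ((hasDerivAt_id z).sub_const v₀).div_const _
    have hRc : (R:ℂ) ≠ 0 := by exact_mod_cast hR0.ne'
    refine ⟨_, ⟨fun z => (z - v₀) / R, ⟨?_, ?_, ?_, ?_⟩, by simp, rfl⟩, ?_⟩
    · exact fun z _ => (hder z).differentiableAt.differentiableWithinAt
    · intro z _ w _ h
      simp only at h
      rw [div_left_inj' hRc] at h
      simpa using h
    · intro z hz
      have := hR hz
      rw [mem_ball, dist_eq_norm] at this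
      rw [norm_div, Complex.norm_real, Real.norm_eq_abs, abs_of_pos hR0, div_lt_one hR0]
      exact this
    · intro z _
      rw [(hder z).deriv]
      exact one_div_ne_zero hRc
    · rw [(hder v₀).deriv, norm_pos_iff]
      exact one_div_ne_zero hRc
  have hbdd : BddAbove D := by
    obtain ⟨r, hr, hrV⟩ := Metric.nhds_basis_closedBall.mem_iff.1 (hVo.mem_nhds hv₀)
    refine ⟨1 / r, ?_⟩
    rintro _ ⟨F, hF, -, rfl⟩
    refine Complex.norm_deriv_le_of_forall_mem_sphere_norm_le hr ?_ ?_
    · apply DifferentiableOn.diffContOnCl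
      rw [closure_ball _ hr.ne']
      exact hF.holo.mono hrV
    · exact fun w hw => (hF.lt w (hrV (sphere_subset_closedBall hw))).le
  obtain ⟨u, -, hu, huD⟩ := exists_seq_tendsto_sSup ⟨x₀, hx₀D⟩ hbdd
  choose F hF hF0 hFu using huD
  obtain ⟨G, hG⟩ := montel hVo (fun n => (hF n).holo) (fun n z hz => ((hF n).lt z hz).le)
    (hyperfilter ℕ)
  have hGd : DifferentiableOn ℂ G V :=
    hG.differentiableOn (Eventually.of_forall fun n => (hF n).holo) hVo
  have hG' := hG.deriv (Eventually.of_forall fun n => (hF n).holo) hVo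
  have hG0 : G v₀ = 0 := by
    refine tendsto_nhds_unique (hG.tendsto_at hv₀) ?_
    simp only [hF0]
    exact tendsto_const_nhds
  have hGs : ‖deriv G v₀‖ = sSup D := by
    have h1 := (hG'.tendsto_at hv₀).norm
    refine tendsto_nhds_unique h1 ?_
    simp only [Function.comp, hFu]
    exact hu.mono_left Nat.hyperfilter_le_atTop
  have hpos : 0 < ‖deriv G v₀‖ := by
    rw [hGs]; exact hx₀.trans_le (le_csSup hbdd hx₀D)
  have hGan : AnalyticOnNhd ℂ G V := hGd.analyticOnNhd hVo
  have hnc : ∀ b ∈ V, ¬ ∀ᶠ z in 𝓝 b, G z = G b := by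
    intro b hb h
    have h1 := hGan.eqOn_of_preconnected_of_eventuallyEq
      (analyticOnNhd_const (v := G b)) hVp hb h
    have h2 : G =ᶠ[𝓝 v₀] fun _ => G b := by
      filter_upwards [hVo.mem_nhds hv₀] with z hz using h1 hz
    rw [h2.deriv_eq] at hpos
    simp at hpos
  refine ⟨G, ⟨hGd, ?_, ?_, ?_⟩, hG0, ?_⟩
  · intro a ha b hb hab
    by_contra hne
    apply hnc b hb
    have hU : IsOpen (V \ {a}) := hVo.sdiff isClosed_singleton
    have hconv : TendstoLocallyUniformlyOn (fun n z => F n z - F n a) (fun z => G z - G a)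
        (hyperfilter ℕ) (V \ {a}) := by
      have h1 := hG.mono (sdiff_subset : V \ {a} ⊆ V)
      have h2 : TendstoLocallyUniformlyOn (fun n _ => F n a) (fun _ : ℂ => G a)
          (hyperfilter ℕ : Filter ℕ) (V \ {a}) := by
        have h3 : Tendsto (fun n => F n a) (hyperfilter ℕ) (𝓝 (G a)) := hG.tendsto_at ha
        exact (TendstoUniformlyOn.tendstoLocallyUniformlyOn
          (Metric.tendstoUniformlyOn_iff.2 fun ε hε => by
            have := h3.eventually (ball_mem_nhds _ hε)
            filter_upwards [this] with n hn x _
            rw [dist_comm]; exact hn))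
      exact h1.sub h2
    have := hurwitz hU hconv (fun n => ((hF n).holo.mono sdiff_subset).sub_const _)
      (fun n z hz h0 => hz.2 ((hF n).inj hz.1 ha (sub_eq_zero.1 h0))) (b := b)
      ⟨hb, fun h => hne h.symm⟩ (by rw [hab, sub_self])
    filter_upwards [this] with z hz
    rw [← hab]; exact sub_eq_zero.1 hz
  · intro z hz
    have hle : ∀ w ∈ V, ‖G w‖ ≤ 1 := fun w hw =>
      le_of_tendsto (hG.tendsto_at hw).norm (Eventually.of_forall fun n => ((hF n).lt w hw).le)
    refine lt_of_le_of_ne (hle z hz) fun h1 => ?_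
    apply hnc z hz
    have := Complex.eqOn_of_isPreconnected_of_isMaxOn_norm hVp hVo hGd hz
      (fun w hw => by simpa [h1] using hle w hw)
    filter_upwards [hVo.mem_nhds hz] with w hw using this hw
  · intro z hz h0
    have h1 := hurwitz hVo hG' (fun n => (hF n).holo.deriv hVo) (fun n z hz => (hF n).der z hz) hz h0
    have h2 := (hGd.deriv hVo).analyticOnNhd hVo
    have h3 := h2.eqOn_of_preconnected_of_eventuallyEq
      (analyticOnNhd_const (v := (0:ℂ))) hVp hz h1
    have h4 := h3 hv₀
    simp only at h4
    rw [h4] at hpos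
    simp at hpos
  · intro E hE hE0
    rw [hGs]
    exact le_csSup hbdd ⟨E, hE, hE0, rfl⟩

theorem rmt {V : Set ℂ} (hVo : IsOpen V) (hVp : IsPreconnected V) (hVn : V.Nonempty)
    (hVb : Bornology.IsBounded V) (hVc : IsPreconnected Vᶜ) :
    ∃ f F : ℂ → ℂ, DifferentiableOn ℂ f (ball 0 1) ∧ ContinuousOn F V ∧
      MapsTo f (ball 0 1) V ∧ MapsTo F V (ball 0 1) ∧
      (∀ z ∈ ball (0:ℂ) 1, F (f z) = z) ∧ ∀ z ∈ V, f (F z) = z := by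
  obtain ⟨v₀, hv₀⟩ := hVn
  obtain ⟨F, hF, hF0, hmax⟩ := exists_extremal hVo hVp hVb hv₀
  have hsurj : ∀ a ∈ ball (0:ℂ) 1, ∃ z ∈ V, F z = a := by
    intro a ha
    by_contra hcon
    push Not at hcon
    obtain ⟨E, hE, hE0, hlt⟩ := koebe hVo hVp hVb hVc hF hv₀ hF0 (by simpa using ha) hcon
    exact absurd (hmax E hE hE0) (not_le.2 hlt)
  choose! f hfV hfF using hsurj
  have hleft : ∀ z ∈ V, f (F z) = z := by
    intro z hz
    have h1 : F z ∈ ball (0:ℂ) 1 := by simpa using hF.lt z hz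
    exact hF.inj (hfV _ h1) hz (hfF _ h1)
  refine ⟨f, F, ?_, hF.holo.continuousOn, hfV, fun z hz => by simpa using hF.lt z hz, hfF, hleft⟩
  intro a ha
  have h1 := (hF.strict hVo (hfV a ha)).to_local_left_inverse (hF.der _ (hfV a ha)) (g := f) (by
    filter_upwards [hVo.mem_nhds (hfV a ha)] with z hz using hleft z hz)
  rw [hfF a ha] at h1
  exact h1.hasDerivAt.differentiableAt.differentiableWithinAt

end CPR

open Set
namespace CPR
open Complex Metric Topology Filter
open MeasureTheory

theorem area_finite {k : ℂ → ℂ} {B : Set ℂ} (hB : IsOpen B) (hd : DifferentiableOn ℂ k B)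
    (hi : InjOn k B) (hb : Bornology.IsBounded (k '' B)) :
    ∫⁻ z, (B.indicator (fun z => ‖deriv k z‖ₑ ^ 2)) z < ⊤ := by
  have h1 := lintegral_image_eq_lintegral_abs_det_fderiv_mul (E := ℂ) volume hB.measurableSet
    (f := k) (f' := fun z => (fderiv ℂ k z).restrictScalars ℝ)
    (fun z hz => (((hd.differentiableAt (hB.mem_nhds hz)).hasFDerivAt).restrictScalars ℝ).hasFDerivWithinAt) hi
    (fun _ => 1)
  rw [lintegral_indicator hB.measurableSet]
  have h2 : ∀ z, ‖deriv k z‖ₑ ^ 2 =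
      ENNReal.ofReal |((fderiv ℂ k z).restrictScalars ℝ).det| * 1 := by
    intro z
    have : ((fderiv ℂ k z).restrictScalars ℝ).det = ‖deriv k z‖ ^ 2 := by
      rw [ContinuousLinearMap.det]
      have e : (((fderiv ℂ k z).restrictScalars ℝ : ℂ →L[ℝ] ℂ) : ℂ →ₗ[ℝ] ℂ) =
        ((fderiv ℂ k z : ℂ →L[ℂ] ℂ) : ℂ →ₗ[ℂ] ℂ).restrictScalars ℝ := rfl
      rw [e, LinearMap.det_restrictScalars]
      have : LinearMap.det ((fderiv ℂ k z : ℂ →L[ℂ] ℂ) : ℂ →ₗ[ℂ] ℂ) = deriv k z := by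
        rw [LinearMap.det_ring]; simp
      rw [this, Algebra.norm_complex_apply, Complex.normSq_eq_norm_sq]
    rw [this, abs_of_nonneg (by positivity), ENNReal.ofReal_pow (norm_nonneg _), ofReal_norm, mul_one]
  simp_rw [h2]
  rw [← h1]
  simp only [lintegral_const, one_mul, Measure.restrict_apply MeasurableSet.univ, univ_inter]
  exact hb.measure_lt_top

theorem enn_amgm {x l : ENNReal} (h0 : l ≠ 0) (ht : l ≠ ⊤) : x ≤ l + l⁻¹ * x ^ 2 := by
  rcases le_total x l with h | h
  · exact h.trans le_self_add
  · calc x = (l⁻¹ * l) * x := by rw [ENNReal.inv_mul_cancel h0 ht, one_mul]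
      _ ≤ (l⁻¹ * x) * x := by gcongr
      _ = l⁻¹ * x ^ 2 := by ring
      _ ≤ _ := le_add_self

theorem lint_inv {ρ : ℝ} (hρ : 0 < ρ) : ∫⁻ r in Ioo 0 ρ, ENNReal.ofReal r⁻¹ = ⊤ := by
  by_contra h
  have h1 : IntegrableOn (fun r : ℝ => r⁻¹) (Ioo 0 ρ) := by
    refine ⟨by fun_prop, ?_⟩
    rw [hasFiniteIntegral_iff_ofReal]
    · exact lt_top_iff_ne_top.2 h
    · exact (ae_restrict_iff' measurableSet_Ioo).2 (Eventually.of_forall fun r hr => (inv_pos.2 hr.1).le)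
  have h2 : IntervalIntegrable (fun r : ℝ => r⁻¹) volume 0 ρ := by
    rw [intervalIntegrable_iff_integrableOn_Ioo_of_le hρ.le]; exact h1
  rw [intervalIntegrable_inv_iff] at h2
  rcases h2 with h2 | h2
  · exact hρ.ne h2
  · exact h2 (left_mem_uIcc)

theorem mem_B_iff {r θ : ℝ} (hr : 0 < r) :
    (r : ℂ) * exp (θ * I) ∈ ball (1:ℂ) 1 ↔ r / 2 < Real.cos θ := by
  rw [mem_ball, dist_eq_norm, ← sq_lt_one_iff₀ (norm_nonneg _), Complex.sq_norm, Complex.normSq_apply]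
  simp only [exp_mul_I, ← ofReal_cos, ← ofReal_sin, sub_re, mul_re, add_re, ofReal_re, I_re, ofReal_im, I_im, sub_im, mul_im, add_im, one_re, one_im]
  have e := Real.sin_sq_add_cos_sq θ
  have e2 : (r * (Real.cos θ + (Real.sin θ * 0 - 0 * 1)) - 0 * (0 + (Real.sin θ * 1 + 0 * 0)) - 1) *
        (r * (Real.cos θ + (Real.sin θ * 0 - 0 * 1)) - 0 * (0 + (Real.sin θ * 1 + 0 * 0)) - 1) +
      (r * (0 + (Real.sin θ * 1 + 0 * 0)) + 0 * (Real.cos θ + (Real.sin θ * 0 - 0 * 1)) - 0) *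
        (r * (0 + (Real.sin θ * 1 + 0 * 0)) + 0 * (Real.cos θ + (Real.sin θ * 0 - 0 * 1)) - 0) =
      r * (r - 2 * Real.cos θ) + 1 := by linear_combination r ^ 2 * e
  rw [e2]
  constructor
  · intro h
    by_contra h'
    have : 0 ≤ r * (r - 2 * Real.cos θ) := mul_nonneg hr.le (by linarith)
    linarith
  · intro h
    have : r * (r - 2 * Real.cos θ) < 0 := mul_neg_of_pos_of_neg hr (by linarith)
    linarith

theorem arc_est {k : ℂ → ℂ} (hd : DifferentiableOn ℂ k (ball 1 1)) {r θ₁ θ₂ : ℝ} (hr : 0 < r)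
    (h1 : -Real.pi ≤ θ₁) (h12 : θ₁ ≤ θ₂) (h2 : θ₂ ≤ Real.pi)
    (m1 : (r : ℂ) * exp (θ₁ * I) ∈ ball (1:ℂ) 1) (m2 : (r : ℂ) * exp (θ₂ * I) ∈ ball (1:ℂ) 1) :
    ‖k ((r : ℂ) * exp (θ₂ * I)) - k ((r : ℂ) * exp (θ₁ * I))‖ₑ ≤
      ∫⁻ θ in Ioo (-Real.pi) Real.pi, ENNReal.ofReal r *
        ((ball (1:ℂ) 1).indicator (fun z => ‖deriv k z‖ₑ)) ((r:ℂ) * exp (θ * I)) := by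
  have hm : ∀ θ ∈ Icc θ₁ θ₂, (r : ℂ) * exp (θ * I) ∈ ball (1:ℂ) 1 := by
    intro θ hθ
    rw [mem_B_iff hr] at *
    rcases le_total 0 θ with h | h
    · exact m2.trans_le (Real.cos_le_cos_of_nonneg_of_le_pi h h2 hθ.2)
    · rw [← Real.cos_neg θ]; rw [← Real.cos_neg] at m1
      exact m1.trans_le (Real.cos_le_cos_of_nonneg_of_le_pi (by linarith) (by linarith) (by linarith [hθ.1]))
  have hder : ∀ θ ∈ uIcc θ₁ θ₂, HasDerivAt (fun θ : ℝ => k ((r : ℂ) * exp (θ * I)))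
      (deriv k ((r : ℂ) * exp (θ * I)) * ((r : ℂ) * exp (θ * I) * I)) θ := by
    intro θ hθ
    rw [uIcc_of_le h12] at hθ
    have a := (hd.differentiableAt (isOpen_ball.mem_nhds (hm θ hθ))).hasDerivAt
    have b : HasDerivAt (fun θ : ℝ => (r : ℂ) * exp (θ * I)) ((r : ℂ) * exp (θ * I) * I) θ := by
      have c : HasDerivAt (fun θ : ℝ => (θ : ℂ) * I) I θ := by
        simpa using (Complex.ofRealCLM.hasDerivAt (x := θ)).mul_const I
      have := (c.cexp).const_mul (r:ℂ)
      rw [← mul_assoc] at this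
      exact this
    exact a.comp θ b
  have hcont : ContinuousOn (fun θ : ℝ => deriv k ((r : ℂ) * exp (θ * I)) * ((r : ℂ) * exp (θ * I) * I)) (uIcc θ₁ θ₂) := by
    rw [uIcc_of_le h12]
    refine ContinuousOn.mul ?_ (by fun_prop)
    exact (hd.deriv isOpen_ball).continuousOn.comp (by fun_prop) hm
  rw [← intervalIntegral.integral_eq_sub_of_hasDerivAt hder hcont.intervalIntegrable,
    intervalIntegral.integral_of_le h12]
  refine (enorm_integral_le_lintegral_enorm _).trans ?_
  rw [← setLIntegral_congr (Ioo_ae_eq_Ioc (a := θ₁) (b := θ₂))]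
  refine (setLIntegral_mono' measurableSet_Ioo ?_).trans (lintegral_mono_set (Ioo_subset_Ioo h1 h2))
  intro θ hθ
  rw [indicator_of_mem (hm θ (Ioo_subset_Icc_self hθ))]
  simp only [enorm_mul]
  have e1 : ‖exp (θ * I)‖ₑ = 1 := by
    rw [← ofReal_norm, norm_exp_ofReal_mul_I]; simp
  have e2 : ‖I‖ₑ = 1 := by rw [← ofReal_norm, norm_I]; simp
  have e3 : ‖(r:ℂ)‖ₑ = ENNReal.ofReal r := by
    rw [← ofReal_norm, norm_real, Real.norm_of_nonneg hr.le]
  rw [e1, e2, e3, mul_one, mul_one, mul_comm]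

theorem wolff0 {k : ℂ → ℂ} (hd : DifferentiableOn ℂ k (ball 1 1)) (hi : InjOn k (ball 1 1))
    (hb : Bornology.IsBounded (k '' ball 1 1)) {ε ρ : ℝ} (hε : 0 < ε) (hρ : 0 < ρ) :
    ∃ r ∈ Ioo 0 ρ, ∀ z ∈ ball (1:ℂ) 1, ∀ w ∈ ball (1:ℂ) 1, ‖z‖ = r → ‖w‖ = r → dist (k z) (k w) ≤ ε := by
  by_contra! hcon
  have hA := area_finite isOpen_ball hd hi hb
  set G1 : ℂ → ENNReal := (ball (1:ℂ) 1).indicator (fun z => ‖deriv k z‖ₑ) with hG1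
  have hG1m : Measurable G1 := ((measurable_deriv k).enorm).indicator measurableSet_ball
  have hG2 : ((ball (1:ℂ) 1).indicator (fun z => ‖deriv k z‖ₑ ^ 2)) = fun z => G1 z ^ 2 := by
    funext z; by_cases hz : z ∈ ball (1:ℂ) 1 <;> simp [hG1, hz]
  rw [hG2, ← Complex.lintegral_comp_polarCoord_symm] at hA
  have hpm : Measurable (fun p : ℝ × ℝ => (p.1 : ℂ) * exp (p.2 * I)) := by
    apply Continuous.measurable; fun_prop
  have hA2 : ∫⁻ r in Ioi (0:ℝ), ∫⁻ θ in Ioo (-Real.pi) Real.pi,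
      ENNReal.ofReal r * G1 ((r:ℂ) * exp (θ * I)) ^ 2 < ⊤ := by
    convert hA using 1
    rw [show polarCoord.target = Ioi (0:ℝ) ×ˢ Ioo (-Real.pi) Real.pi from rfl, Measure.volume_eq_prod, ← Measure.prod_restrict, lintegral_prod]
    · simp [Complex.polarCoord_symm_apply, Complex.exp_mul_I]
    · apply Measurable.aemeasurable
      simp only [Complex.polarCoord_symm_apply, smul_eq_mul]
      refine (ENNReal.measurable_ofReal.comp measurable_fst).mul ((hG1m.comp ?_).pow_const 2)
      convert hpm using 2 with p
      simp [Complex.exp_mul_I]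
  have key : ∀ r ∈ Ioo 0 ρ, ENNReal.ofReal (ε ^ 2 / (8 * Real.pi)) * ENNReal.ofReal r⁻¹ ≤
      ∫⁻ θ in Ioo (-Real.pi) Real.pi, ENNReal.ofReal r * G1 ((r:ℂ) * exp (θ * I)) ^ 2 := by
    intro r hr
    have hr0 := hr.1
    obtain ⟨z, hz, w, hw, hzr, hwr, hzw⟩ := hcon r hr
    have hpol : ∀ z : ℂ, ‖z‖ = r → (r:ℂ) * exp (arg z * I) = z := fun z h => by
      rw [← h]; exact norm_mul_exp_arg_mul_I z
    have e1 : ENNReal.ofReal ε ≤ ∫⁻ θ in Ioo (-Real.pi) Real.pi, ENNReal.ofReal r * G1 ((r:ℂ) * exp (θ * I)) := by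
      rcases le_total (arg z) (arg w) with h | h
      · have := arc_est hd hr0 (neg_pi_lt_arg z).le h (arg_le_pi w) (by rwa [hpol z hzr]) (by rwa [hpol w hwr])
        rw [hpol z hzr, hpol w hwr] at this
        refine le_trans ?_ this
        rw [← ofReal_norm]
        apply ENNReal.ofReal_le_ofReal
        rw [← dist_eq_norm, dist_comm]; exact hzw.le
      · have := arc_est hd hr0 (neg_pi_lt_arg w).le h (arg_le_pi z) (by rwa [hpol w hwr]) (by rwa [hpol z hzr])
        rw [hpol z hzr, hpol w hwr] at this
        refine le_trans ?_ this
        rw [← ofReal_norm]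
        apply ENNReal.ofReal_le_ofReal
        rw [← dist_eq_norm]; exact hzw.le
    set X := ∫⁻ θ in Ioo (-Real.pi) Real.pi, ENNReal.ofReal r * G1 ((r:ℂ) * exp (θ * I)) ^ 2 with hX
    by_cases hXt : X = ⊤
    · rw [hXt]; exact le_top
    have hl : 0 < ε / (4 * Real.pi) := by positivity
    set l := ENNReal.ofReal (ε / (4 * Real.pi)) with hldef
    have hl0 : l ≠ 0 := by rw [hldef]; simpa using hl
    have hlt : l ≠ ⊤ := ENNReal.ofReal_ne_top
    have e2 : ∫⁻ θ in Ioo (-Real.pi) Real.pi, ENNReal.ofReal r * G1 ((r:ℂ) * exp (θ * I)) ≤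
        ENNReal.ofReal (ε / 2) + l⁻¹ * ENNReal.ofReal r * X := by
      calc _ ≤ ∫⁻ θ in Ioo (-Real.pi) Real.pi, (l + l⁻¹ * ENNReal.ofReal r * (ENNReal.ofReal r * G1 ((r:ℂ) * exp (θ * I)) ^ 2)) := by
            apply lintegral_mono
            intro θ
            refine (enn_amgm hl0 hlt).trans (le_of_eq ?_)
            ring
        _ = _ := by
            rw [lintegral_add_left measurable_const, lintegral_const_mul', ← hX]
            · congr 1
              rw [setLIntegral_const, Real.volume_Ioo, hldef, ← ENNReal.ofReal_mul hl.le]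
              congr 1
              field_simp
              ring
            · exact ENNReal.mul_ne_top (ENNReal.inv_ne_top.2 hl0) ENNReal.ofReal_ne_top
    have e3 := e1.trans e2
    obtain ⟨x, hx0, hx⟩ : ∃ x : ℝ, 0 ≤ x ∧ X = ENNReal.ofReal x :=
      ⟨X.toReal, ENNReal.toReal_nonneg, (ENNReal.ofReal_toReal hXt).symm⟩
    rw [hx, hldef, ← ENNReal.ofReal_inv_of_pos hl, ← ENNReal.ofReal_mul (by positivity), ← ENNReal.ofReal_mul (by positivity),
      ← ENNReal.ofReal_add (by positivity) (by positivity), ENNReal.ofReal_le_ofReal_iff (by positivity)] at e3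
    rw [hx, ← ENNReal.ofReal_mul (by positivity)]
    apply ENNReal.ofReal_le_ofReal
    rw [← div_eq_mul_inv, div_le_iff₀ hr0, div_le_iff₀ (by positivity)]
    have e4 : ε / 2 ≤ (4 * Real.pi) / ε * r * x := by rw [inv_div] at e3; linarith
    have e5 : ε / 2 * ε ≤ (4 * Real.pi) * r * x := by
      have := mul_le_mul_of_nonneg_right e4 hε.le
      have e6 : 4 * Real.pi / ε * r * x * ε = (4 * Real.pi) * r * x := by field_simp
      linarith
    nlinarith
  have : (⊤:ENNReal) ≤ ∫⁻ r in Ioi (0:ℝ), ∫⁻ θ in Ioo (-Real.pi) Real.pi,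
      ENNReal.ofReal r * G1 ((r:ℂ) * exp (θ * I)) ^ 2 := by
    calc (⊤:ENNReal) = ENNReal.ofReal (ε ^ 2 / (8 * Real.pi)) * ∫⁻ r in Ioo 0 ρ, ENNReal.ofReal r⁻¹ := by
          rw [lint_inv hρ, ENNReal.mul_top]
          have : 0 < ε ^ 2 / (8 * Real.pi) := by positivity
          simpa using this
      _ = ∫⁻ r in Ioo 0 ρ, ENNReal.ofReal (ε ^ 2 / (8 * Real.pi)) * ENNReal.ofReal r⁻¹ := by
          rw [lintegral_const_mul' _ _ ENNReal.ofReal_ne_top]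
      _ ≤ ∫⁻ r in Ioo 0 ρ, ∫⁻ θ in Ioo (-Real.pi) Real.pi, ENNReal.ofReal r * G1 ((r:ℂ) * exp (θ * I)) ^ 2 :=
          setLIntegral_mono' measurableSet_Ioo key
      _ ≤ _ := lintegral_mono_set (fun r hr => hr.1)
  exact (hA2.trans_le this).false

theorem wolff {f : ℂ → ℂ} (hd : DifferentiableOn ℂ f (ball 0 1)) (hi : InjOn f (ball 0 1))
    (hb : Bornology.IsBounded (f '' ball 0 1)) {ζ : ℂ} (hζ : ‖ζ‖ = 1) {ε ρ : ℝ} (hε : 0 < ε) (hρ : 0 < ρ) :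
    ∃ r ∈ Ioo 0 ρ, ∀ z ∈ ball (0:ℂ) 1, ∀ w ∈ ball (0:ℂ) 1, dist z ζ = r → dist w ζ = r →
      dist (f z) (f w) ≤ ε := by
  have hζ0 : ζ ≠ 0 := by rintro rfl; simp at hζ
  have hm : MapsTo (fun z => ζ * (1 - z)) (ball 1 1) (ball 0 1) := by
    intro z hz
    simp only [mem_ball, dist_zero_right, norm_mul, hζ, one_mul] at *
    rwa [dist_comm, dist_eq_norm] at hz
  obtain ⟨r, hr, h⟩ := wolff0 (k := fun z => f (ζ * (1 - z)))
    (hd.comp (by fun_prop) hm) (fun z hz w hw hzw => by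
      have := hi (hm hz) (hm hw) hzw
      have := mul_left_cancel₀ hζ0 this
      exact sub_right_injective this)
    (hb.subset (by rintro _ ⟨z, hz, rfl⟩; exact ⟨_, hm hz, rfl⟩)) hε hρ
  refine ⟨r, hr, fun z hz w hw hzr hwr => ?_⟩
  have inv : ∀ z : ℂ, ζ * (1 - (1 - z / ζ)) = z := fun z => by field_simp; ring
  have nrm : ∀ z : ℂ, ‖1 - z / ζ‖ = dist z ζ := fun z => by
    rw [dist_comm, dist_eq_norm]
    have : ζ - z = ζ * (1 - z / ζ) := by field_simp
    rw [this, norm_mul, hζ, one_mul]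
  have mem : ∀ z ∈ ball (0:ℂ) 1, 1 - z / ζ ∈ ball (1:ℂ) 1 := fun z hz => by
    simp only [mem_ball, dist_zero_right] at *
    rw [dist_eq_norm]; simpa [hζ] using hz
  have := h _ (mem z hz) _ (mem w hw) ((nrm z).trans hzr) ((nrm w).trans hwr)
  simpa only [inv] using this

end CPR

open Set
namespace CPR
open Complex Metric Topology Filter

theorem arc_preconnected {u : ℂ} (hu : ‖u‖ = 1) (σ : ℝ) :
    IsPreconnected (sphere (0:ℂ) 1 ∩ closedBall u σ) := by
  rcases lt_or_ge σ 0 with hσ | hσ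
  · rw [closedBall_eq_empty.2 hσ, inter_empty]; exact isPreconnected_empty
  have hd : ∀ θ : ℝ, dist (u * exp (θ * I)) u ≤ σ ↔ 1 - σ ^ 2 / 2 ≤ Real.cos θ := by
    intro θ
    have e : u * exp (θ * I) - u = u * (exp (θ * I) - 1) := by ring
    rw [dist_eq_norm, e, norm_mul, hu, one_mul, ← abs_of_nonneg hσ, ← abs_norm, ← sq_le_sq,
      Complex.sq_norm, Complex.normSq_apply]
    simp only [exp_mul_I, ← ofReal_cos, ← ofReal_sin, sub_re, mul_re, add_re, ofReal_re, I_re, ofReal_im, I_im, sub_im, mul_im, add_im, one_re, one_im]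
    have := Real.sin_sq_add_cos_sq θ
    rw [sq_abs] 
    constructor <;> intro h <;> nlinarith
  have hA : OrdConnected {θ : ℝ | θ ∈ Icc (-Real.pi) Real.pi ∧ 1 - σ ^ 2 / 2 ≤ Real.cos θ} := by
    constructor
    rintro a ⟨ha, ha'⟩ b ⟨hb, hb'⟩ θ hθ
    refine ⟨⟨ha.1.trans hθ.1, hθ.2.trans hb.2⟩, ?_⟩
    rcases le_total 0 θ with h | h
    · exact hb'.trans (Real.cos_le_cos_of_nonneg_of_le_pi h hb.2 hθ.2)
    · rw [← Real.cos_neg θ]; rw [← Real.cos_neg] at ha'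
      exact ha'.trans (Real.cos_le_cos_of_nonneg_of_le_pi (by linarith) (by linarith [ha.1]) (by linarith [hθ.1]))
  have := hA.isPreconnected.image (fun θ : ℝ => u * exp (θ * I)) (by fun_prop)
  convert this using 1
  ext z
  simp only [mem_inter_iff, mem_sphere, dist_zero_right, mem_closedBall, mem_image, mem_ofPred_eq]
  have hu0 : u ≠ 0 := by rintro rfl; simp at hu
  constructor
  · rintro ⟨h1, h2⟩
    have e : u * exp (arg (z / u) * I) = z := by
      have := norm_mul_exp_arg_mul_I (z / u)
      rw [norm_div, h1, hu] at this
      simp only [div_one, ofReal_one, one_mul] at this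
      rw [this]; field_simp
    exact ⟨arg (z / u), ⟨⟨(neg_pi_lt_arg _).le, arg_le_pi _⟩, (hd _).1 (by rwa [e])⟩, e⟩
  · rintro ⟨θ, ⟨_, h2⟩, rfl⟩
    refine ⟨?_, (hd _).2 h2⟩
    rw [norm_mul, hu, norm_exp_ofReal_mul_I, one_mul]

theorem small_arcs {γ : ℂ → ℂ} (hγ : ContinuousOn γ (sphere 0 1)) (hγi : InjOn γ (sphere 0 1))
    {δ : ℝ} (hδ : 0 < δ) : ∃ η > 0, ∀ T ⊆ γ '' sphere 0 1, (∀ x ∈ T, ∀ y ∈ T, dist x y ≤ η) →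
      ∀ t ∈ T, ∃ J, IsCompact J ∧ IsPreconnected J ∧ T ⊆ J ∧ J ⊆ γ '' sphere 0 1 ∧ J ⊆ closedBall t δ := by
  have hS : IsCompact (sphere (0:ℂ) 1) := isCompact_sphere _ _
  have huc := hS.uniformContinuousOn_of_continuous hγ
  rw [Metric.uniformContinuousOn_iff] at huc
  obtain ⟨σ', hσ', hσ1⟩ := huc δ hδ
  obtain ⟨σ, hσ, hσσ⟩ := exists_between hσ'
  have hK : IsCompact ((sphere (0:ℂ) 1 ×ˢ sphere (0:ℂ) 1) ∩ {p | σ ≤ dist p.1 p.2}) :=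
    (hS.prod hS).inter_right (isClosed_le continuous_const (by fun_prop))
  have hη : ∃ η > 0, ∀ u ∈ sphere (0:ℂ) 1, ∀ v ∈ sphere (0:ℂ) 1, dist (γ u) (γ v) ≤ η → dist u v ≤ σ := by
    rcases ((sphere (0:ℂ) 1 ×ˢ sphere (0:ℂ) 1) ∩ {p | σ ≤ dist p.1 p.2}).eq_empty_or_nonempty with he | hne
    · refine ⟨1, one_pos, fun u hu v hv _ => ?_⟩
      by_contra h
      have : (u, v) ∈ (∅ : Set (ℂ × ℂ)) := he ▸ ⟨⟨hu, hv⟩, le_of_not_ge h⟩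
      exact this
    · have hc : ContinuousOn (fun p : ℂ × ℂ => dist (γ p.1) (γ p.2)) ((sphere (0:ℂ) 1 ×ˢ sphere (0:ℂ) 1) ∩ {p | σ ≤ dist p.1 p.2}) := by
        exact continuous_dist.comp_continuousOn
          ((hγ.comp continuousOn_fst (fun p hp => hp.1.1)).prodMk
            (hγ.comp continuousOn_snd (fun p hp => hp.1.2)))
      obtain ⟨p, hp, hmin⟩ := hK.exists_isMinOn hne hc
      have hpos : 0 < dist (γ p.1) (γ p.2) := by
        rw [dist_pos]; intro h
        have := hγi hp.1.1 hp.1.2 h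
        have h2 := hp.2
        simp only [mem_ofPred_eq, this, dist_self] at h2
        linarith
      refine ⟨dist (γ p.1) (γ p.2) / 2, by linarith, fun u hu v hv h => ?_⟩
      by_contra h'
      have := hmin (show (u, v) ∈ _ from ⟨⟨hu, hv⟩, le_of_not_ge h'⟩)
      simp only [mem_ofPred_eq] at this
      linarith
  obtain ⟨η, hη, hη1⟩ := hη
  refine ⟨η, hη, fun T hT hTd t ht => ?_⟩
  obtain ⟨u, hu, rfl⟩ := hT ht
  refine ⟨γ '' (sphere 0 1 ∩ closedBall u σ), ?_, ?_, ?_, ?_, ?_⟩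
  · exact (hS.inter_right isClosed_closedBall).image_of_continuousOn (hγ.mono inter_subset_left)
  · exact (arc_preconnected (by simpa using hu) σ).image _ (hγ.mono inter_subset_left)
  · intro x hx
    obtain ⟨v, hv, rfl⟩ := hT hx
    exact ⟨v, ⟨hv, hη1 _ hv _ hu (hTd _ hx _ ht)⟩, rfl⟩
  · exact image_mono inter_subset_left
  · rintro _ ⟨v, ⟨hv, hv'⟩, rfl⟩
    exact (hσ1 v hv u hu (lt_of_le_of_lt hv' hσσ)).le

structure Carat (V : Set ℂ) (γ f F : ℂ → ℂ) : Prop where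
  hVo : IsOpen V
  hVp : IsPreconnected V
  hVb : Bornology.IsBounded V
  hf : DifferentiableOn ℂ f (ball 0 1)
  hF : ContinuousOn F V
  mf : MapsTo f (ball 0 1) V
  mF : MapsTo F V (ball 0 1)
  Ff : ∀ z ∈ ball 0 1, F (f z) = z
  fF : ∀ z ∈ V, f (F z) = z
  hγ : ContinuousOn γ (sphere 0 1)
  hγi : InjOn γ (sphere 0 1)
  hfr : frontier V ⊆ γ '' sphere 0 1
  hVΓ : ∀ z ∈ V, z ∉ γ '' sphere 0 1

namespace Carat
variable {V : Set ℂ} {γ f F : ℂ → ℂ}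

theorem cpt (h : Carat V γ f F) : IsCompact (γ '' sphere 0 1) :=
  (isCompact_sphere _ _).image_of_continuousOn h.hγ

theorem inj (h : Carat V γ f F) : InjOn f (ball 0 1) := fun z hz w hw e => by
  rw [← h.Ff z hz, e, h.Ff w hw]

theorem osc (h : Carat V γ f F) {ζ : ℂ} (hζ : ‖ζ‖ = 1) {ε : ℝ} (hε : 0 < ε) :
    ∃ r > 0, ∀ z ∈ ball (0:ℂ) 1, ∀ w ∈ ball (0:ℂ) 1, dist z ζ < r → dist w ζ < r →
      dist (f z) (f w) ≤ ε := by
  have h0 : (0:ℂ) ∈ ball (0:ℂ) 1 := by simp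
  have hf0 := h.mf h0
  obtain ⟨d, hd, hdV⟩ : ∃ d > 0, ∀ x, dist x (f 0) < d → x ∈ V ∧ ‖F x‖ < 1 / 2 := by
    have h1 : ∀ᶠ x in 𝓝 (f 0), x ∈ V := h.hVo.mem_nhds hf0
    have h2 : ∀ᶠ x in 𝓝 (f 0), ‖F x‖ < 1 / 2 := by
      have := (h.hF.continuousAt (h.hVo.mem_nhds hf0)).norm
      apply this.eventually_lt_const
      show ‖F (f 0)‖ < 1 / 2
      rw [h.Ff 0 h0]; simp
    obtain ⟨d, hd, hdd⟩ := Metric.eventually_nhds_iff.1 (h1.and h2)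
    exact ⟨d, hd, fun x hx => hdd hx⟩
  obtain ⟨κ, hκ, hκε, hκd⟩ : ∃ κ > 0, 2 * κ ≤ ε ∧ κ < d :=
    ⟨min (ε / 2) (d / 2), by positivity, by linarith [min_le_left (ε/2) (d/2)], by linarith [min_le_right (ε/2) (d/2)]⟩
  obtain ⟨η, hη, hJ⟩ := small_arcs h.hγ h.hγi (δ := κ) hκ
  obtain ⟨r, hr, hW⟩ := wolff h.hf h.inj (h.hVb.subset (image_subset_iff.2 h.mf)) hζ
    (ε := min η κ) (ρ := 1 / 2) (by positivity) (by norm_num)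
  set A := f '' {z | z ∈ ball (0:ℂ) 1 ∧ dist z ζ = r} with hA
  have hAne : A.Nonempty := by
    refine ⟨_, mem_image_of_mem f (show ((1 - r : ℝ) : ℂ) * ζ ∈ _ from ⟨?_, ?_⟩)⟩
    · rw [mem_ball, dist_zero_right, norm_mul, hζ, norm_real, mul_one, Real.norm_eq_abs, abs_lt]
      constructor <;> linarith [hr.1, hr.2]
    · rw [dist_eq_norm]
      have : ((1 - r : ℝ) : ℂ) * ζ - ζ = ((-r : ℝ) : ℂ) * ζ := by push_cast; ring
      rw [this, norm_mul, hζ, norm_real, mul_one, norm_neg, Real.norm_of_nonneg hr.1.le]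
  have hAd : ∀ x ∈ closure A, ∀ y ∈ closure A, dist x y ≤ min η κ := by
    intro x hx y hy
    have hc : IsClosed {p : ℂ × ℂ | dist p.1 p.2 ≤ min η κ} := isClosed_le (by fun_prop) continuous_const
    have : closure (A ×ˢ A) ⊆ {p : ℂ × ℂ | dist p.1 p.2 ≤ min η κ} := by
      apply closure_minimal _ hc
      rintro ⟨_, _⟩ ⟨⟨z, hz, rfl⟩, ⟨w, hw, rfl⟩⟩
      exact hW z hz.1 w hw.1 hz.2 hw.2
    rw [closure_prod_eq] at this
    exact this (show (x, y) ∈ _ from ⟨hx, hy⟩)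
  have hAf : ∀ x ∈ closure A, d ≤ dist x (f 0) := by
    have hc : IsClosed {x : ℂ | d ≤ dist x (f 0)} := isClosed_le continuous_const (by fun_prop)
    apply closure_minimal _ hc
    rintro _ ⟨z, hz, rfl⟩
    by_contra hlt
    have := (hdV (f z) (not_le.1 hlt)).2
    rw [h.Ff z hz.1] at this
    have h3 : dist ζ 0 ≤ dist z 0 + dist ζ z := by rw [add_comm]; exact dist_triangle _ _ _
    rw [dist_zero_right, dist_zero_right, hζ, dist_comm, hz.2] at h3
    linarith [hr.2]
  have hAcpt : IsCompact (closure A) := by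
    apply Bornology.IsBounded.isCompact_closure
    exact h.hVb.subset (by rintro _ ⟨z, hz, rfl⟩; exact h.mf hz.1)
  obtain ⟨t, ht, J, hJc, hJp, hJA, hJΓ, hJb⟩ : ∃ t ∈ closure A, ∃ J, IsCompact J ∧ IsPreconnected J ∧
      closure A ∩ γ '' sphere 0 1 ⊆ J ∧ J ⊆ γ '' sphere 0 1 ∧ J ⊆ closedBall t κ := by
    rcases (closure A ∩ γ '' sphere 0 1).eq_empty_or_nonempty with he | ⟨t, ht⟩
    · obtain ⟨t, ht⟩ := hAne.closure
      exact ⟨t, ht, ∅, isCompact_empty, isPreconnected_empty, he.subset, empty_subset _, empty_subset _⟩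
    · obtain ⟨J, h1, h2, h3, h4, h5⟩ := hJ _ inter_subset_right
        (fun x hx y hy => (hAd x hx.1 y hy.1).trans (min_le_left _ _)) t ht
      exact ⟨t, ht.1, J, h1, h2, h3, h4, h5⟩
  have hAb : closure A ⊆ closedBall t κ := fun x hx => (hAd x hx t ht).trans (min_le_right _ _)
  have key : ∀ z ∈ ball (0:ℂ) 1, dist z ζ < r → dist (f z) t ≤ κ := by
    intro z hz hzr
    by_contra hcon
    have hYΓ : γ '' sphere 0 1 ∩ (closure A ∪ J) = J := by
      ext x; constructor
      · rintro ⟨h1, h2 | h2⟩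
        · exact hJA ⟨h2, h1⟩
        · exact h2
      · intro hx; exact ⟨hJΓ hx, Or.inr hx⟩
    have c1 : Conn (γ '' sphere 0 1)ᶜ (f z) (f 0) :=
      ⟨V, h.hVp, fun x hx => h.hVΓ x hx, h.mf hz, hf0⟩
    have c2 : Conn (closure A ∪ J)ᶜ (f z) (f 0) := by
      refine ⟨(closedBall t κ)ᶜ, isPreconnected_compl_closedBall t κ, ?_, hcon, ?_⟩
      · exact compl_subset_compl.2 (union_subset hAb hJb)
      · intro hh
        have := hAf t ht
        rw [mem_closedBall, dist_comm] at hh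
        linarith
    obtain ⟨S, hSp, hSs, hSz, hS0⟩ := janiszewski h.cpt (hAcpt.union hJc) (by rw [hYΓ]; exact hJp) c1 c2
    have hSV : S ⊆ V := subset_of_frontier hSp (fun x hx hx' => hSs hx (Or.inl (h.hfr hx'))) hSz (h.mf hz)
    have hFS : IsPreconnected (F '' S) := hSp.image _ (h.hF.mono hSV)
    have := hFS.intermediate_value (f := fun u => dist u ζ) ⟨f z, hSz, rfl⟩ ⟨f 0, hS0, rfl⟩ (by fun_prop)
    have hm : r ∈ Icc (dist (F (f z)) ζ) (dist (F (f 0)) ζ) := by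
      rw [h.Ff z hz, h.Ff 0 h0, dist_zero_left, hζ]
      exact ⟨hzr.le, by linarith [hr.2]⟩
    obtain ⟨_, ⟨s, hs, rfl⟩, hsr⟩ := this hm
    apply hSs hs
    right; left
    apply subset_closure
    exact ⟨F s, ⟨h.mF (hSV hs), hsr⟩, h.fF s (hSV hs)⟩
  refine ⟨r, hr.1, fun z hz w hw hzr hwr => ?_⟩
  linarith [dist_triangle_right (f z) (f w) t, key z hz hzr, key w hw hwr]

theorem extend (h : Carat V γ f F) : ∃ Φ : ℂ → ℂ, ContinuousOn Φ (closedBall 0 1) ∧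
    EqOn Φ f (ball 0 1) := by
  have hcl : closure (ball (0:ℂ) 1) = closedBall 0 1 := closure_ball _ one_ne_zero
  refine ⟨extendFrom (ball 0 1) f, ?_, ?_⟩
  · apply continuousOn_extendFrom hcl.ge
    intro ζ hζ
    rcases lt_or_eq_of_le (mem_closedBall_zero_iff.1 hζ) with hlt | heq
    · have hm : ζ ∈ ball (0:ℂ) 1 := mem_ball_zero_iff.2 hlt
      exact ⟨f ζ, h.hf.continuousOn ζ hm⟩
    · have hne : (𝓝[ball (0:ℂ) 1] ζ).NeBot := by
        rw [← mem_closure_iff_nhdsWithin_neBot, hcl]; exact hζ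
      apply CompleteSpace.complete
      rw [Metric.cauchy_iff]
      refine ⟨hne.map _, fun ε hε => ?_⟩
      obtain ⟨r, hr, ho⟩ := h.osc heq (half_pos hε)
      refine ⟨f '' (ball ζ r ∩ ball 0 1), image_mem_map ?_, ?_⟩
      · rw [inter_comm]; exact inter_mem_nhdsWithin _ (ball_mem_nhds _ hr)
      · rintro _ ⟨z, hz, rfl⟩ _ ⟨w, hw, rfl⟩
        exact (ho z hz.2 w hw.2 hz.1 hw.1).trans_lt (half_lt_self hε)
  · intro z hz
    apply extendFrom_eq (subset_closure hz)
    exact h.hf.continuousOn z hz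

end Carat
end CPR

open Set
namespace CPR
open Complex Metric Topology Filter
open scoped ComplexConjugate

theorem cont_inv {X Y : Type*} [TopologicalSpace X] [TopologicalSpace Y] [T2Space Y] [Nonempty X]
    {f : X → Y} {K : Set X} (hK : IsCompact K) (hf : ContinuousOn f K) (hi : InjOn f K) :
    ContinuousOn (Function.invFunOn f K) (f '' K) := by
  rw [continuousOn_iff_isClosed]
  intro t ht
  refine ⟨f '' (K ∩ t), ((hK.inter_right ht).image_of_continuousOn (hf.mono inter_subset_left)).isClosed, ?_⟩
  ext y; constructor
  · rintro ⟨h1, x, hx, rfl⟩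
    rw [mem_preimage, hi.leftInvOn_invFunOn hx] at h1
    exact ⟨⟨x, ⟨hx, h1⟩, rfl⟩, x, hx, rfl⟩
  · rintro ⟨⟨x, ⟨hx, hxt⟩, rfl⟩, h2⟩
    refine ⟨?_, h2⟩
    rw [mem_preimage, hi.leftInvOn_invFunOn hx]; exact hxt

/-- signed side of the chord from a to b -/
noncomputable def chl (a b z : ℂ) : ℝ := ((z - a) * conj (b - a)).im

theorem chl_cont (a b : ℂ) : Continuous (chl a b) := by unfold chl; fun_prop

theorem chl_swap (a b z : ℂ) : chl b a z = - chl a b z := by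
  simp [chl]; ring

theorem chl_seg (a b z w : ℂ) (t : ℝ) : chl a b (z + t * (w - z)) = (1 - t) * chl a b z + t * chl a b w := by
  simp [chl]; ring

theorem chl_line (a b : ℂ) (t : ℝ) : chl a b (a + t * (b - a)) = 0 := by
  simp [chl]; ring

theorem chord_norm {a b : ℂ} (ha : ‖a‖ = 1) (hb : ‖b‖ = 1) (t : ℝ) :
    ‖a + t * (b - a)‖ ^ 2 = 1 - t * (1 - t) * ‖b - a‖ ^ 2 := by
  have ha' : a.re * a.re + a.im * a.im = 1 := by
    rw [← Complex.normSq_apply, Complex.normSq_eq_norm_sq, ha]; norm_num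
  have hb' : b.re * b.re + b.im * b.im = 1 := by
    rw [← Complex.normSq_apply, Complex.normSq_eq_norm_sq, hb]; norm_num
  rw [Complex.sq_norm, Complex.sq_norm, Complex.normSq_apply, Complex.normSq_apply]
  simp
  linear_combination (1 - t) * ha' + t * hb'

theorem chord_mem_closed {a b : ℂ} (ha : ‖a‖ = 1) (hb : ‖b‖ = 1) {t : ℝ} (ht : t ∈ Icc (0:ℝ) 1) :
    a + t * (b - a) ∈ closedBall (0:ℂ) 1 := by
  rw [mem_closedBall_zero_iff, ← sq_le_one_iff₀ (norm_nonneg _), chord_norm ha hb]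
  have : 0 ≤ t * (1 - t) * ‖b - a‖ ^ 2 := mul_nonneg (mul_nonneg ht.1 (by linarith [ht.2])) (by positivity)
  linarith

theorem chord_mem_ball {a b : ℂ} (ha : ‖a‖ = 1) (hb : ‖b‖ = 1) (hab : a ≠ b) {t : ℝ} (ht : t ∈ Ioo (0:ℝ) 1) :
    a + t * (b - a) ∈ ball (0:ℂ) 1 := by
  rw [mem_ball_zero_iff, ← sq_lt_one_iff₀ (norm_nonneg _), chord_norm ha hb]
  have h1 : 0 < ‖b - a‖ := norm_pos_iff.2 (sub_ne_zero.2 hab.symm)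
  have : 0 < t * (1 - t) * ‖b - a‖ ^ 2 := mul_pos (mul_pos ht.1 (by linarith [ht.2])) (by positivity)
  linarith

theorem chord_of_chl {a b : ℂ} (ha : ‖a‖ = 1) (hb : ‖b‖ = 1) (hab : a ≠ b) {z : ℂ} (hz : ‖z‖ ≤ 1)
    (h0 : chl a b z = 0) : ∃ t ∈ Icc (0:ℝ) 1, z = a + t * (b - a) := by
  have h1 : 0 < ‖b - a‖ := norm_pos_iff.2 (sub_ne_zero.2 hab.symm)
  have hne : b - a ≠ 0 := sub_ne_zero.2 hab.symm
  set t : ℝ := ((z - a) * conj (b - a)).re / ‖b - a‖ ^ 2 with ht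
  have e : z = a + t * (b - a) := by
    have h2 : (z - a) * conj (b - a) = ((((z - a) * conj (b - a)).re : ℝ) : ℂ) := by
      apply Complex.ext
      · simp
      · rw [ofReal_im]; exact h0
    have h3 : (b - a) * conj (b - a) = ((‖b - a‖ ^ 2 : ℝ) : ℂ) := by
      rw [Complex.mul_conj, Complex.normSq_eq_norm_sq]
    have h4 : (t : ℂ) * ((‖b - a‖ ^ 2 : ℝ) : ℂ) = ((((z - a) * conj (b - a)).re : ℝ) : ℂ) := by
      rw [← ofReal_mul]; congr 1; rw [ht]; field_simp
    have h5 : conj (b - a) ≠ 0 := (map_ne_zero _).2 hne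
    apply sub_eq_zero.1
    apply (mul_eq_zero.1 (_ : (z - (a + t * (b - a))) * conj (b - a) = 0)).resolve_right h5
    linear_combination h2 - t * h3 - h4
  refine ⟨t, ?_, e⟩
  have h6 := chord_norm ha hb t
  rw [← e] at h6
  have h7 : 0 ≤ t * (1 - t) * ‖b - a‖ ^ 2 := by
    have : ‖z‖ ^ 2 ≤ 1 := by nlinarith [norm_nonneg z]
    linarith
  have h8 : 0 ≤ t * (1 - t) := nonneg_of_mul_nonneg_left h7 (by positivity)
  constructor <;> nlinarith

theorem chl_pos_exists {a b : ℂ} (ha : ‖a‖ = 1) (hb : ‖b‖ = 1) (hab : a ≠ b) :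
    ∃ ξ, ‖ξ‖ = 1 ∧ 0 < chl a b ξ := by
  have h1 : 0 < ‖b - a‖ := norm_pos_iff.2 (sub_ne_zero.2 hab.symm)
  refine ⟨I * (b - a) / ‖b - a‖, ?_, ?_⟩
  · rw [norm_div, norm_mul, norm_I, one_mul, norm_real, norm_norm, div_self h1.ne']
  have ha' : a.re * a.re + a.im * a.im = 1 := by
    rw [← Complex.normSq_apply, Complex.normSq_eq_norm_sq, ha]; norm_num
  have hb' : b.re * b.re + b.im * b.im = 1 := by
    rw [← Complex.normSq_apply, Complex.normSq_eq_norm_sq, hb]; norm_num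
  have hr : chl a b (I * (b - a) / ‖b - a‖) = ‖b - a‖ - (a * conj (b - a)).im := by
    have : chl a b (I * (b - a) / ‖b - a‖) = (I * ((b - a) * conj (b - a)) / ‖b - a‖ - a * conj (b - a)).im := by
      unfold chl; congr 1; ring
    rw [this, Complex.mul_conj, Complex.normSq_eq_norm_sq, sub_im]
    congr 1
    have : I * ((‖b - a‖ ^ 2 : ℝ) : ℂ) / ‖b - a‖ = ((‖b - a‖ : ℝ) : ℂ) * I := by
      have : (‖b - a‖ : ℂ) ≠ 0 := by exact_mod_cast h1.ne'
      push_cast; field_simp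
    rw [this]; simp
  rw [hr, sub_pos]
  have h2 : ‖a * conj (b - a)‖ = ‖b - a‖ := by rw [norm_mul, ha, one_mul, Complex.norm_conj]
  have h3 : (a * conj (b - a)).re = - ‖b - a‖ ^ 2 / 2 := by
    rw [Complex.sq_norm, Complex.normSq_apply]; simp
    linear_combination (-1/2) * ha' + (1/2) * hb'
  have h4 : ‖a * conj (b - a)‖ ^ 2 = (a * conj (b - a)).re ^ 2 + (a * conj (b - a)).im ^ 2 := by
    rw [Complex.sq_norm, Complex.normSq_apply]; ring
  rw [h2, h3] at h4
  apply lt_of_pow_lt_pow_left₀ 2 h1.le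
  have : 0 < (- ‖b - a‖ ^ 2 / 2) ^ 2 := by
    have : 0 < ‖b - a‖ ^ 2 := by positivity
    have : - ‖b - a‖ ^ 2 / 2 ≠ 0 := by linarith
    positivity
  linarith

theorem sphere_minus_preconnected {u : ℂ} (hu : ‖u‖ = 1) : IsPreconnected (sphere (0:ℂ) 1 \ {u}) := by
  have := (isPreconnected_Ioo (a := -Real.pi) (b := Real.pi)).image (fun θ : ℝ => -u * exp (θ * I)) (by fun_prop)
  convert this using 1
  have hu0 : u ≠ 0 := by rintro rfl; simp at hu
  ext z
  constructor
  · rintro ⟨h1, h2⟩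
    have h1' : ‖z‖ = 1 := by simpa using h1
    have e : -u * exp (arg (z / -u) * I) = z := by
      have := norm_mul_exp_arg_mul_I (z / -u)
      rw [norm_div, h1', norm_neg, hu] at this
      simp only [div_one, ofReal_one, one_mul] at this
      rw [this]; field_simp
    refine ⟨arg (z / -u), ⟨neg_pi_lt_arg _, lt_of_le_of_ne (arg_le_pi _) fun hpi => h2 ?_⟩, e⟩
    rw [hpi] at e
    rw [mem_singleton_iff, ← e]; simp
  · rintro ⟨θ, hθ, rfl⟩
    refine ⟨by simp [hu, norm_exp_ofReal_mul_I], ?_⟩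
    intro h
    have h2 : exp (θ * I) = -1 := by
      have h3 : -u * exp (θ * I) = u := h
      have : u * (exp (θ * I) + 1) = 0 := by linear_combination -h3
      rcases mul_eq_zero.1 this with h | h
      · exact absurd h hu0
      · linear_combination h
    have h4 : Real.cos θ = -1 := by
      have := congrArg re h2
      rwa [exp_ofReal_mul_I_re] at this
    have h5 : Real.cos θ = Real.cos |θ| := (Real.cos_abs θ).symm
    have h6 : |θ| < Real.pi := abs_lt.2 hθ
    have := Real.cos_lt_cos_of_nonneg_of_le_pi (abs_nonneg θ) le_rfl h6
    rw [Real.cos_pi] at this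
    linarith

theorem circle_surj {h : ℂ → ℂ} (hc : ContinuousOn h (sphere 0 1)) (hi : InjOn h (sphere 0 1))
    (hm : MapsTo h (sphere 0 1) (sphere 0 1)) : h '' sphere 0 1 = sphere 0 1 := by
  apply Subset.antisymm (image_subset_iff.2 hm)
  intro q hq
  by_contra hcon
  have hq1 : ‖q‖ = 1 := by simpa using hq
  have hq0 : q ≠ 0 := by rintro rfl; simp at hq1
  have hn : ∀ z ∈ sphere (0:ℂ) 1, ‖- h z / q‖ = 1 := fun z hz => by
    have : ‖h z‖ = 1 := by simpa using hm hz
    rw [norm_div, norm_neg, this, hq1, div_one]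
  have hsl : ∀ z ∈ sphere (0:ℂ) 1, - h z / q ∈ slitPlane := by
    intro z hz
    rw [mem_slitPlane_iff_arg]
    constructor
    · intro hpi
      have := norm_mul_exp_arg_mul_I (- h z / q)
      rw [hn z hz, hpi] at this
      simp only [ofReal_one, exp_pi_mul_I, one_mul] at this
      apply hcon
      refine ⟨z, hz, ?_⟩
      rw [eq_div_iff hq0] at this
      linear_combination this
    · intro h0; have := hn z hz; rw [h0] at this; simp at this
  set g : ℂ → ℝ := fun z => arg (- h z / q) with hg
  have hgc : ContinuousOn g (sphere 0 1) := by
    apply continuousOn_arg.comp _ hsl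
    exact (hc.neg).div_const q
  have hneg : MapsTo (fun z : ℂ => -z) (sphere 0 1) (sphere 0 1) := by intro z hz; simpa using hz
  have hexp : ∀ θ : ℝ, exp (θ * I) ∈ sphere (0:ℂ) 1 := fun θ => by simp [norm_exp_ofReal_mul_I]
  have hdc : ContinuousOn (fun θ : ℝ => g (exp (θ * I)) - g (-exp (θ * I))) (Icc 0 Real.pi) := by
    apply ContinuousOn.sub
    · exact hgc.comp (by fun_prop) (fun θ _ => hexp θ)
    · exact (hgc.comp continuousOn_neg hneg).comp (by fun_prop) (fun θ _ => hexp θ)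
  have hend : (fun θ : ℝ => g (exp (θ * I)) - g (-exp (θ * I))) Real.pi
      = - ((fun θ : ℝ => g (exp (θ * I)) - g (-exp (θ * I))) 0) := by
    simp
  have hz : (0:ℝ) ∈ (fun θ : ℝ => g (exp (θ * I)) - g (-exp (θ * I))) '' Icc 0 Real.pi := by
    apply (isPreconnected_Icc.image _ hdc).ordConnected.uIcc_subset (mem_image_of_mem _ ⟨le_rfl, Real.pi_pos.le⟩)
      (mem_image_of_mem _ ⟨Real.pi_pos.le, le_rfl⟩)
    change (0:ℝ) ∈ uIcc ((fun θ : ℝ => g (exp (θ * I)) - g (-exp (θ * I))) 0)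
      ((fun θ : ℝ => g (exp (θ * I)) - g (-exp (θ * I))) Real.pi)
    rw [hend, mem_uIcc]
    generalize (fun θ : ℝ => g (exp (θ * I)) - g (-exp (θ * I))) 0 = x
    rcases le_total 0 x with h | h
    · right; exact ⟨by linarith, h⟩
    · left; exact ⟨h, by linarith⟩
  obtain ⟨θ, -, hθ⟩ := hz
  have hz1 := hexp θ
  have hz2 := hneg hz1
  have e : - h (exp (θ * I)) / q = - h (-exp (θ * I)) / q :=
    ext_norm_arg ((hn _ hz1).trans (hn _ hz2).symm) (sub_eq_zero.1 hθ)
  have e2 : h (exp (θ * I)) = h (-exp (θ * I)) := by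
    field_simp at e
    exact neg_injective e
  have e3 := hi hz1 hz2 e2
  have : exp (θ * I) = 0 := by linear_combination (1/2) * e3
  exact exp_ne_zero _ this

end CPR

open Set
namespace CPR
open Complex Metric Topology Filter

namespace Carat
variable {V : Set ℂ} {γ f F : ℂ → ℂ}

theorem sphere_to {Φ : ℂ → ℂ} (h : Carat V γ f F) (hΦ : ContinuousOn Φ (closedBall 0 1))
    (hΦf : EqOn Φ f (ball 0 1)) : MapsTo Φ (sphere 0 1) (γ '' sphere 0 1) := by
  intro ζ hζ
  have hζc : ζ ∈ closedBall (0:ℂ) 1 := sphere_subset_closedBall hζ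
  have hcl : closure (ball (0:ℂ) 1) = closedBall 0 1 := closure_ball _ one_ne_zero
  have hne : (𝓝[ball (0:ℂ) 1] ζ).NeBot := by
    rw [← mem_closure_iff_nhdsWithin_neBot, hcl]; exact hζc
  have ht : Tendsto Φ (𝓝[ball 0 1] ζ) (𝓝 (Φ ζ)) := (hΦ ζ hζc).mono_left (nhdsWithin_mono _ ball_subset_closedBall)
  have hmem : ∀ᶠ z in 𝓝[ball (0:ℂ) 1] ζ, Φ z ∈ V :=
    eventually_nhdsWithin_of_forall fun z hz => by rw [hΦf hz]; exact h.mf hz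
  have hc : Φ ζ ∈ closure V := mem_closure_of_tendsto ht hmem
  by_cases hV : Φ ζ ∈ V
  · exfalso
    have hF : ContinuousAt F (Φ ζ) := h.hF.continuousAt (h.hVo.mem_nhds hV)
    have h1 : Tendsto (fun z => F (Φ z)) (𝓝[ball 0 1] ζ) (𝓝 (F (Φ ζ))) := hF.tendsto.comp ht
    have h2 : Tendsto (fun z => F (Φ z)) (𝓝[ball 0 1] ζ) (𝓝 ζ) := by
      have : Tendsto (fun z : ℂ => z) (𝓝[ball 0 1] ζ) (𝓝 ζ) := tendsto_id.mono_left nhdsWithin_le_nhds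
      refine this.congr' (eventually_nhdsWithin_of_forall fun z hz => ?_)
      simp only [hΦf hz, h.Ff z hz]
    have h3 := tendsto_nhds_unique h1 h2
    have h4 := h.mF hV
    rw [h3] at h4
    simp only [mem_ball, mem_sphere] at h4 hζ
    linarith
  · apply h.hfr
    rw [frontier, h.hVo.interior_eq]
    exact ⟨hc, hV⟩

theorem const_arc {Φ : ℂ → ℂ} (h : Carat V γ f F) (hΦ : ContinuousOn Φ (closedBall 0 1))
    (hΦf : EqOn Φ f (ball 0 1)) {a b : ℂ} (ha : ‖a‖ = 1) (hb : ‖b‖ = 1) (hab : a ≠ b) {w : ℂ}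
    (hw : w ∈ γ '' sphere 0 1)
    (hc : ∀ ξ, ‖ξ‖ = 1 → 0 < chl a b ξ → Φ ξ = w) : False := by
  obtain ⟨ξ, hξ, hξp⟩ := chl_pos_exists ha hb hab
  have hS : IsCompact (sphere (0:ℂ) 1) := isCompact_sphere _ _
  obtain ⟨t, ht⟩ := hS.elim_finite_subcover (fun u : sphere (0:ℂ) 1 => {z : ℂ | 0 < chl a b (u * z)})
    (fun u => isOpen_lt continuous_const ((chl_cont a b).comp (by fun_prop)))
    (fun z hz => by
      have hz1 : ‖z‖ = 1 := by simpa using hz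
      have hz0 : z ≠ 0 := by rintro rfl; simp at hz1
      refine mem_iUnion.2 ⟨⟨ξ / z, by simp [hξ, hz1]⟩, ?_⟩
      change 0 < chl a b (ξ / z * z)
      rwa [div_mul_cancel₀ _ hz0])
  set g : ℂ → ℂ := fun z => ∏ u ∈ t, (Φ (u * z) - w) with hg
  have hun : ∀ u : sphere (0:ℂ) 1, ‖(u:ℂ)‖ = 1 := fun u => by simpa using u.2
  have hcl : closure (ball (0:ℂ) 1) = closedBall 0 1 := closure_ball _ one_ne_zero
  have hgd : DiffContOnCl ℂ g (ball 0 1) := by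
    constructor
    · apply DifferentiableOn.fun_finsetProd
      intro u _
      refine DifferentiableOn.sub_const ?_ w
      have hm : MapsTo (fun z : ℂ => u * z) (ball 0 1) (ball 0 1) := fun z hz => by
        rw [mem_ball_zero_iff] at *; rwa [norm_mul, hun, one_mul]
      exact (h.hf.congr hΦf).comp (by fun_prop) hm
    · rw [hcl]
      apply continuousOn_finsetProd
      intro u _
      refine ContinuousOn.sub ?_ continuousOn_const
      have hm : MapsTo (fun z : ℂ => u * z) (closedBall 0 1) (closedBall 0 1) := fun z hz => by
        rw [mem_closedBall_zero_iff] at *; rwa [norm_mul, hun, one_mul]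
      exact hΦ.comp (by fun_prop) hm
  have h0 : ‖g 0‖ ≤ 0 := by
    apply Complex.norm_le_of_forall_mem_frontier_norm_le isBounded_ball hgd
    · intro z hz
      rw [frontier_ball _ one_ne_zero] at hz
      obtain ⟨u, hu⟩ := mem_iUnion.1 (ht hz)
      obtain ⟨hut, hu⟩ := mem_iUnion.1 hu
      have : g z = 0 := by
        rw [hg]
        apply Finset.prod_eq_zero hut
        rw [hc _ _ hu, sub_self]
        rw [norm_mul, hun, one_mul]; simpa using hz
      rw [this, norm_zero]
    · apply subset_closure; simp
  have h1 : g 0 = 0 := norm_le_zero_iff.1 h0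
  rw [hg] at h1
  simp only [mul_zero] at h1
  obtain ⟨u, -, hu⟩ := Finset.prod_eq_zero_iff.1 h1
  have h00 : (0:ℂ) ∈ ball (0:ℂ) 1 := by simp
  rw [hΦf h00, sub_eq_zero] at hu
  exact h.hVΓ _ (h.mf h00) (hu ▸ hw)

theorem inj_sphere {Φ : ℂ → ℂ} (h : Carat V γ f F) (hΦ : ContinuousOn Φ (closedBall 0 1))
    (hΦf : EqOn Φ f (ball 0 1)) : InjOn Φ (sphere 0 1) := by
  intro a ha b hb hab
  by_contra hne
  have hΓ := h.sphere_to hΦ hΦf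
  have ha1 : ‖a‖ = 1 := by simpa using ha
  have hb1 : ‖b‖ = 1 := by simpa using hb
  have hw := hΓ ha
  by_cases hp : ∀ ξ, ‖ξ‖ = 1 → 0 < chl a b ξ → Φ ξ = Φ a
  · exact h.const_arc hΦ hΦf ha1 hb1 hne hw hp
  by_cases hn : ∀ ξ, ‖ξ‖ = 1 → 0 < chl b a ξ → Φ ξ = Φ a
  · exact h.const_arc hΦ hΦf hb1 ha1 (Ne.symm hne) hw hn
  push Not at hp hn
  obtain ⟨ξ, hξ, hξp, hξw⟩ := hp
  obtain ⟨η, hη, hηp, hηw⟩ := hn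
  rw [chl_swap] at hηp
  have hbV : ∀ z ∈ ball (0:ℂ) 1, Φ z ∈ V := fun z hz => by rw [hΦf hz]; exact h.mf hz
  set seg : Set ℂ := (fun t : ℝ => a + t * (b - a)) '' Icc 0 1 with hseg
  have hsegc : IsCompact seg := isCompact_Icc.image (by fun_prop)
  have hsegs : seg ⊆ closedBall 0 1 := by
    rintro _ ⟨t, ht, rfl⟩; exact chord_mem_closed ha1 hb1 ht
  have hsegS : ∀ s ∈ seg, s ∉ ball (0:ℂ) 1 → Φ s = Φ a := by
    rintro _ ⟨t, ht, rfl⟩ hs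
    rcases eq_or_lt_of_le ht.1 with h0 | h0
    · subst h0; simp
    rcases eq_or_lt_of_le ht.2 with h1 | h1
    · subst h1; simp [hab]
    · exact absurd (chord_mem_ball ha1 hb1 hne ⟨h0, h1⟩) hs
  have hseg0 : ∀ s ∈ seg, chl a b s = 0 := by
    rintro _ ⟨t, ht, rfl⟩; exact chl_line a b t
  have hCc : IsCompact (Φ '' seg) := hsegc.image_of_continuousOn (hΦ.mono hsegs)
  have hCΓ : Φ '' seg ∩ γ '' sphere 0 1 = {Φ a} := by
    ext x; constructor
    · rintro ⟨⟨s, hs, rfl⟩, hx⟩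
      apply hsegS s hs
      intro hsb; exact h.hVΓ _ (hbV s hsb) hx
    · rintro rfl
      exact ⟨⟨a, ⟨0, ⟨le_rfl, zero_le_one⟩, by simp⟩, rfl⟩, hw⟩
  -- not in C
  have hnotC : ∀ z ∈ ball (0:ℂ) 1, chl a b z ≠ 0 → Φ z ∉ Φ '' seg := by
    rintro z hz hz0 ⟨s, hs, hsz⟩
    by_cases hsb : s ∈ ball (0:ℂ) 1
    · rw [hΦf hz, hΦf hsb] at hsz
      have := h.inj hsb hz hsz
      exact hz0 (this ▸ hseg0 s hs)
    · rw [hsegS s hs hsb] at hsz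
      exact h.hVΓ _ (hbV z hz) (hsz ▸ hw)
  have hnotC' : ∀ z ∈ γ '' sphere 0 1, z ≠ Φ a → z ∉ Φ '' seg := by
    intro z hz hza hzC
    exact hza (hCΓ.subset ⟨hzC, hz⟩)
  set m := a + ((1/2:ℝ):ℂ) * (b - a) with hm
  have hmb : m ∈ ball (0:ℂ) 1 := chord_mem_ball ha1 hb1 hne ⟨by norm_num, by norm_num⟩
  have hm0 : chl a b m = 0 := chl_line a b _
  have spoke : ∀ ξ, ‖ξ‖ = 1 → chl a b ξ ≠ 0 → Φ ξ ≠ Φ a →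
      (ξ + ((1/2:ℝ):ℂ) * (m - ξ)) ∈ ball (0:ℂ) 1 ∧ chl a b (ξ + ((1/2:ℝ):ℂ) * (m - ξ)) = chl a b ξ / 2 ∧
      Conn (Φ '' seg)ᶜ (Φ (ξ + ((1/2:ℝ):ℂ) * (m - ξ))) (Φ ξ) := by
    intro ξ hξ hξ0 hξa
    have hball : ∀ t ∈ Ioc (0:ℝ) (1/2), ξ + t * (m - ξ) ∈ ball (0:ℂ) 1 := by
      intro t ht
      rw [mem_ball_zero_iff] at *
      have e : ξ + t * (m - ξ) = ((1 - t : ℝ) : ℂ) * ξ + t * m := by push_cast; ring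
      rw [e]
      calc _ ≤ ‖((1 - t : ℝ) : ℂ) * ξ‖ + ‖t * m‖ := norm_add_le _ _
        _ = (1 - t) * 1 + t * ‖m‖ := by
          rw [norm_mul, norm_mul, hξ, norm_real, norm_real, Real.norm_of_nonneg (by linarith [ht.2]),
            Real.norm_of_nonneg ht.1.le]
        _ < 1 := by nlinarith [ht.1]
    have hchl : ∀ t : ℝ, chl a b (ξ + t * (m - ξ)) = (1 - t) * chl a b ξ := fun t => by
      rw [chl_seg, hm0]; ring
    refine ⟨hball _ ⟨by norm_num, le_rfl⟩, by rw [hchl]; ring, ?_⟩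
    have hcl : ∀ t ∈ Icc (0:ℝ) (1/2), ξ + t * (m - ξ) ∈ closedBall (0:ℂ) 1 := by
      intro t ht
      rcases eq_or_lt_of_le ht.1 with h0 | h0
      · subst h0; simp [hξ]
      · exact ball_subset_closedBall (hball t ⟨h0, ht.2⟩)
    refine ⟨(fun t : ℝ => Φ (ξ + t * (m - ξ))) '' Icc 0 (1/2), isPreconnected_Icc.image _ ?_, ?_, ?_, ?_⟩
    · exact hΦ.comp (by fun_prop) hcl
    · rintro _ ⟨t, ht, rfl⟩
      rcases eq_or_lt_of_le ht.1 with h0 | h0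
      · subst h0
        simp only [ofReal_zero, zero_mul, add_zero]
        exact hnotC' _ (hΓ (by simpa using hξ)) hξa
      · refine hnotC _ (hball t ⟨h0, ht.2⟩) ?_
        rw [hchl]
        exact mul_ne_zero (by linarith [ht.2]) hξ0
    · exact ⟨1/2, ⟨by norm_num, le_rfl⟩, rfl⟩
    · exact ⟨0, ⟨le_rfl, by norm_num⟩, by simp⟩
  obtain ⟨p1, p2, p3⟩ := spoke ξ hξ hξp.ne' hξw
  obtain ⟨q1, q2, q3⟩ := spoke η hη (by linarith) hηw
  set p := ξ + ((1/2:ℝ):ℂ) * (m - ξ)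
  set q := η + ((1/2:ℝ):ℂ) * (m - η)
  have hmid : Conn (Φ '' seg)ᶜ (Φ ξ) (Φ η) := by
    obtain ⟨u, hu, hua⟩ := hw
    refine ⟨γ '' (sphere 0 1 \ {u}), (sphere_minus_preconnected (by simpa using hu)).image _ (h.hγ.mono sdiff_subset), ?_, ?_, ?_⟩
    · rintro _ ⟨v, hv, rfl⟩
      apply hnotC' _ ⟨v, hv.1, rfl⟩
      rw [← hua]; intro e; exact hv.2 (h.hγi hv.1 hu e)
    · obtain ⟨v, hv, hv'⟩ := hΓ (show ξ ∈ sphere (0:ℂ) 1 by simpa using hξ)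
      refine ⟨v, ⟨hv, ?_⟩, hv'⟩
      rintro rfl; exact hξw (hv'.symm.trans hua)
    · obtain ⟨v, hv, hv'⟩ := hΓ (show η ∈ sphere (0:ℂ) 1 by simpa using hη)
      refine ⟨v, ⟨hv, ?_⟩, hv'⟩
      rintro rfl; exact hηw (hv'.symm.trans hua)
  have c1 : Conn (Φ '' seg)ᶜ (Φ p) (Φ q) := (p3.trans hmid).trans q3.symm
  have c2 : Conn (γ '' sphere 0 1)ᶜ (Φ p) (Φ q) :=
    ⟨V, h.hVp, fun x hx => h.hVΓ x hx, hbV p p1, hbV q q1⟩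
  obtain ⟨S, hSp, hSs, hSz, hS0⟩ := janiszewski hCc h.cpt (by rw [hCΓ]; exact isPreconnected_singleton) c1 c2
  have hSV : S ⊆ V := subset_of_frontier hSp (fun x hx hx' => hSs hx (Or.inr (h.hfr hx'))) hSz (hbV p p1)
  have hFS : IsPreconnected (F '' S) := hSp.image _ (h.hF.mono hSV)
  have := hFS.intermediate_value (f := chl a b) ⟨Φ q, hS0, rfl⟩ ⟨Φ p, hSz, rfl⟩ (chl_cont a b).continuousOn
  have hm : (0:ℝ) ∈ Icc (chl a b (F (Φ q))) (chl a b (F (Φ p))) := by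
    rw [hΦf p1, hΦf q1, h.Ff p p1, h.Ff q q1, p2, q2]
    constructor <;> linarith
  obtain ⟨_, ⟨s, hs, rfl⟩, hsr⟩ := this hm
  have hFs := h.mF (hSV hs)
  obtain ⟨t, ht, e⟩ := chord_of_chl ha1 hb1 hne (mem_ball_zero_iff.1 hFs).le hsr
  apply hSs hs
  left
  refine ⟨F s, ⟨t, ht, e.symm⟩, ?_⟩
  rw [hΦf hFs, h.fF s (hSV hs)]

end Carat

theorem caratheodory {V : Set ℂ} {γ : ℂ → ℂ} (hVo : IsOpen V) (hVp : IsPreconnected V) (hVn : V.Nonempty)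
    (hVb : Bornology.IsBounded V) (hVc : IsPreconnected Vᶜ) (hγ : ContinuousOn γ (sphere 0 1))
    (hγi : InjOn γ (sphere 0 1)) (hfr : frontier V ⊆ γ '' sphere 0 1) (hVΓ : ∀ z ∈ V, z ∉ γ '' sphere 0 1) :
    ∃ Φ : ℂ → ℂ, ContinuousOn Φ (closedBall 0 1) ∧ InjOn Φ (closedBall 0 1) ∧ Φ '' ball 0 1 = V ∧
      Φ '' sphere 0 1 = γ '' sphere 0 1 := by
  obtain ⟨f, F, hf, hF, mf, mF, Ff, fF⟩ := rmt hVo hVp hVn hVb hVc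
  have h : Carat V γ f F := ⟨hVo, hVp, hVb, hf, hF, mf, mF, Ff, fF, hγ, hγi, hfr, hVΓ⟩
  obtain ⟨Φ, hΦ, hΦf⟩ := h.extend
  have hS := h.sphere_to hΦ hΦf
  have hB : MapsTo Φ (ball 0 1) V := fun z hz => by rw [hΦf hz]; exact mf hz
  have hi := h.inj_sphere hΦ hΦf
  refine ⟨Φ, hΦ, ?_, ?_, ?_⟩
  · intro z hz w hw e
    rw [← ball_union_sphere] at hz hw
    rcases hz with hz | hz <;> rcases hw with hw | hw
    · rw [hΦf hz, hΦf hw] at e; exact h.inj hz hw e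
    · exact absurd (e ▸ hS hw) (hVΓ _ (hB hz))
    · exact absurd (e ▸ hS hz) (hVΓ _ (hB hw))
    · exact hi hz hw e
  · apply Subset.antisymm (image_subset_iff.2 hB)
    intro v hv
    exact ⟨F v, mF hv, by rw [hΦf (mF hv), fF v hv]⟩
  · set g := Function.invFunOn γ (sphere 0 1) with hg
    have hgc : ContinuousOn g (γ '' sphere 0 1) := cont_inv (isCompact_sphere _ _) hγ hγi
    have hgm : MapsTo g (γ '' sphere 0 1) (sphere 0 1) := (surjOn_image γ _).mapsTo_invFunOn
    have hgr : ∀ y ∈ γ '' sphere 0 1, γ (g y) = y := (surjOn_image γ _).rightInvOn_invFunOn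
    have hcs := circle_surj (h := g ∘ Φ) (hgc.comp (hΦ.mono sphere_subset_closedBall) hS)
      (fun z hz w hw e => hi hz hw (by
        have := congrArg γ e
        simp only [Function.comp] at this
        rwa [hgr _ (hS hz), hgr _ (hS hw)] at this)) (hgm.comp hS)
    apply Subset.antisymm hS.image_subset
    rintro _ ⟨u, hu, rfl⟩
    rw [← hcs] at hu
    obtain ⟨z, hz, rfl⟩ := hu
    exact ⟨z, hz, (hgr _ (hS hz)).symm⟩

end CPR

open Set
namespace CPR
open Complex Metric Topology Filter

theorem cone_ext {σ : ℂ → ℂ} (hc : ContinuousOn σ (sphere 0 1)) (hi : InjOn σ (sphere 0 1))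
    (hm : MapsTo σ (sphere 0 1) (sphere 0 1)) :
    ∃ τ : ℂ → ℂ, ContinuousOn τ (closedBall 0 1) ∧ InjOn τ (closedBall 0 1) ∧ (∀ z ∈ sphere 0 1, τ z = σ z) ∧
      τ '' ball 0 1 = ball 0 1 := by
  have hd : ∀ z : ℂ, z ≠ 0 → z / ‖z‖ ∈ sphere (0:ℂ) 1 := fun z hz => by
    have : ‖z‖ ≠ 0 := norm_ne_zero_iff.2 hz
    simp [this]
  have hσn : ∀ z : ℂ, z ≠ 0 → ‖σ (z / ‖z‖)‖ = 1 := fun z hz => by simpa using hm (hd z hz)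
  set τ : ℂ → ℂ := fun z => ‖z‖ * σ (z / ‖z‖) with hτ
  have hn : ∀ z, ‖τ z‖ = ‖z‖ := by
    intro z
    by_cases hz : z = 0
    · simp [hτ, hz]
    · simp only [hτ, norm_mul, hσn z hz, norm_real, norm_norm, mul_one]
  have hτs : ∀ z ∈ sphere (0:ℂ) 1, τ z = σ z := by
    intro z hz
    have : ‖z‖ = 1 := by simpa using hz
    simp [hτ, this]
  refine ⟨τ, ?_, ?_, hτs, ?_⟩
  · intro z _
    apply ContinuousAt.continuousWithinAt
    by_cases hz : z = 0
    · subst hz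
      rw [ContinuousAt, show τ 0 = 0 by simp [hτ]]
      apply squeeze_zero_norm (fun z => (hn z).le)
      simpa using (continuous_norm (E := ℂ)).tendsto 0
    · have h1 : ContinuousOn τ {z | z ≠ 0} := by
        apply ContinuousOn.mul (by fun_prop)
        apply hc.comp _ (fun z hz => hd z hz)
        apply ContinuousOn.div (by fun_prop) (by fun_prop)
        intro z hz; exact_mod_cast norm_ne_zero_iff.2 hz
      exact h1.continuousAt (isOpen_ne.mem_nhds hz)
  · intro z _ w _ e
    have h1 : ‖z‖ = ‖w‖ := by rw [← hn, e, hn]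
    by_cases hz : z = 0
    · subst hz; rw [norm_zero] at h1; exact (norm_eq_zero.1 h1.symm).symm
    have hz' : (‖z‖ : ℂ) ≠ 0 := by exact_mod_cast norm_ne_zero_iff.2 hz
    have hw : w ≠ 0 := by rintro rfl; simp at h1; exact hz h1
    simp only [hτ] at e
    rw [← h1] at e
    have e2 := hi (hd z hz) (by rw [h1]; exact hd w hw) (mul_left_cancel₀ hz' e)
    field_simp at e2
    exact e2
  · apply Subset.antisymm
    · rintro _ ⟨z, hz, rfl⟩
      rw [mem_ball_zero_iff] at *; rwa [hn]
    · intro w hw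
      by_cases hw0 : w = 0
      · subst hw0; exact ⟨0, by simp, by simp [hτ]⟩
      · have := hd w hw0
        rw [← circle_surj hc hi hm] at this
        obtain ⟨u, hu, e⟩ := this
        have hu1 : ‖u‖ = 1 := by simpa using hu
        have hw' : (‖w‖ : ℂ) ≠ 0 := by exact_mod_cast norm_ne_zero_iff.2 hw0
        refine ⟨‖w‖ * u, ?_, ?_⟩
        · rw [mem_ball_zero_iff] at *; rw [norm_mul, hu1]; simpa using hw
        · have e1 : ‖(‖w‖ : ℂ) * u‖ = ‖w‖ := by rw [norm_mul, hu1]; simp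
          simp only [hτ, e1]
          rw [mul_div_cancel_left₀ _ hw', e]
          field_simp

theorem schoen_disc {V : Set ℂ} {γ : ℂ → ℂ} (hVo : IsOpen V) (hVp : IsPreconnected V) (hVn : V.Nonempty)
    (hVb : Bornology.IsBounded V) (hVc : IsPreconnected Vᶜ) (hγ : ContinuousOn γ (sphere 0 1))
    (hγi : InjOn γ (sphere 0 1)) (hfr : frontier V ⊆ γ '' sphere 0 1) (hVΓ : ∀ z ∈ V, z ∉ γ '' sphere 0 1) :
    ∃ H : ℂ → ℂ, ContinuousOn H (closedBall 0 1) ∧ InjOn H (closedBall 0 1) ∧ H '' ball 0 1 = V ∧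
      ∀ z ∈ sphere 0 1, H z = γ z := by
  obtain ⟨Φ, hΦ, hΦi, hΦb, hΦs⟩ := caratheodory hVo hVp hVn hVb hVc hγ hγi hfr hVΓ
  set g := Function.invFunOn Φ (sphere 0 1) with hg
  have hsc := sphere_subset_closedBall (x := (0:ℂ)) (ε := 1)
  have hgc : ContinuousOn g (Φ '' sphere 0 1) := cont_inv (isCompact_sphere _ _) (hΦ.mono hsc) (hΦi.mono hsc)
  have hgm : MapsTo g (Φ '' sphere 0 1) (sphere 0 1) := (surjOn_image Φ _).mapsTo_invFunOn
  have hgr : ∀ y ∈ Φ '' sphere 0 1, Φ (g y) = y := (surjOn_image Φ _).rightInvOn_invFunOn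
  rw [hΦs] at hgc hgm hgr
  have hγm : MapsTo γ (sphere 0 1) (γ '' sphere 0 1) := mapsTo_image _ _
  obtain ⟨τ, t1, t2, t3, t4⟩ := cone_ext (σ := g ∘ γ) (hgc.comp hγ hγm)
    (fun z hz w hw e => hγi hz hw (by
      have := congrArg Φ e
      simp only [Function.comp] at this
      rwa [hgr _ (hγm hz), hgr _ (hγm hw)] at this)) (hgm.comp hγm)
  have tm : MapsTo τ (closedBall 0 1) (closedBall 0 1) := by
    intro z hz
    rw [← ball_union_sphere] at hz
    rcases hz with hz | hz
    · exact ball_subset_closedBall (t4 ▸ mem_image_of_mem τ hz)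
    · rw [t3 z hz]; exact hsc (hgm (hγm hz))
  refine ⟨Φ ∘ τ, hΦ.comp t1 tm, hΦi.comp t2 tm, ?_, ?_⟩
  · rw [image_comp, t4, hΦb]
  · intro z hz
    simp only [Function.comp, t3 z hz]
    exact hgr _ (hγm hz)

theorem schoen_conv {K : Set ℂ} (hKc : Convex ℝ K) (hK : IsCompact K) (hKi : (interior K).Nonempty)
    {V : Set ℂ} {γ : ℂ → ℂ} (hVo : IsOpen V) (hVp : IsPreconnected V) (hVn : V.Nonempty)
    (hVb : Bornology.IsBounded V) (hVc : IsPreconnected Vᶜ) (hγ : ContinuousOn γ (frontier K))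
    (hγi : InjOn γ (frontier K)) (hfr : frontier V ⊆ γ '' frontier K) (hVΓ : ∀ z ∈ V, z ∉ γ '' frontier K) :
    ∃ H : ℂ → ℂ, ContinuousOn H K ∧ InjOn H K ∧ H '' interior K = V ∧ ∀ z ∈ frontier K, H z = γ z := by
  obtain ⟨ψ, h1, h2, h3⟩ := exists_homeomorph_image_interior_closure_frontier_eq_unitBall hKc hKi hK.isBounded
  rw [hK.isClosed.closure_eq] at h2
  have hm3 : MapsTo ψ.symm (sphere 0 1) (frontier K) := by
    rw [← h3]; rintro _ ⟨z, hz, rfl⟩; simpa using hz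
  have him : (γ ∘ ψ.symm) '' sphere 0 1 = γ '' frontier K := by
    rw [← h3, image_image]; simp
  obtain ⟨H, a1, a2, a3, a4⟩ := schoen_disc (γ := γ ∘ ψ.symm) hVo hVp hVn hVb hVc
    (hγ.comp ψ.symm.continuous.continuousOn hm3) (hγi.comp ψ.symm.injective.injOn hm3)
    (by rw [him]; exact hfr) (by rw [him]; exact hVΓ)
  have hm2 : MapsTo ψ K (closedBall 0 1) := by rw [← h2]; exact mapsTo_image _ _
  refine ⟨H ∘ ψ, a1.comp ψ.continuous.continuousOn hm2, a2.comp ψ.injective.injOn hm2, ?_, ?_⟩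
  · rw [image_comp, h1, a3]
  · intro z hz
    have : ψ z ∈ sphere (0:ℂ) 1 := h3 ▸ mem_image_of_mem ψ hz
    simp [a4 _ this]

end CPR

open Set
namespace CPR
open Complex Metric Topology Filter
open scoped ComplexConjugate

/-- closed half disc on the positive side of the chord -/
def halfD (a b : ℂ) : Set ℂ := closedBall 0 1 ∩ {z | 0 ≤ chl a b z}

theorem chl_comb (a b x y : ℂ) {s t : ℝ} (h : s + t = 1) :
    chl a b (s • x + t • y) = s * chl a b x + t * chl a b y := by
  obtain rfl : s = 1 - t := by linarith
  simp [chl]; ring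

theorem halfD_convex (a b : ℂ) : Convex ℝ (halfD a b) := by
  apply (convex_closedBall (0:ℂ) 1).inter
  intro x hx y hy s t hs ht hst
  have hx' : 0 ≤ chl a b x := hx
  have hy' : 0 ≤ chl a b y := hy
  change 0 ≤ chl a b _
  rw [chl_comb a b x y hst]; positivity

theorem pos_convex (a b : ℂ) : Convex ℝ {z | 0 < chl a b z} := by
  intro x hx y hy s t hs ht hst
  have hx' : 0 < chl a b x := hx
  have hy' : 0 < chl a b y := hy
  change 0 < chl a b _
  rw [chl_comb a b x y hst]
  rcases eq_or_lt_of_le hs with h | h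
  · subst h; have : t = 1 := by linarith
    subst this; simpa using hy'
  · have := mul_pos h hx'
    have := mul_nonneg ht hy'.le
    linarith

theorem halfD_compact (a b : ℂ) : IsCompact (halfD a b) :=
  (isCompact_closedBall _ _).inter_right (isClosed_le continuous_const (chl_cont a b))

theorem interior_halfD {a b : ℂ} (hab : a ≠ b) : interior (halfD a b) = ball 0 1 ∩ {z | 0 < chl a b z} := by
  rw [halfD, interior_inter, interior_closedBall _ one_ne_zero]
  congr 1
  apply Subset.antisymm
  · intro z hz
    have hz0 : 0 ≤ chl a b z := (show z ∈ {z | 0 ≤ chl a b z} from interior_subset hz)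
    by_contra hcon
    have hz1 : chl a b z = 0 := le_antisymm (not_lt.1 hcon) hz0
    have hc : ContinuousAt (fun s : ℝ => z - s * (I * (b - a))) 0 := by fun_prop
    have hev : ∀ᶠ y in 𝓝 z, 0 ≤ chl a b y := mem_interior_iff_mem_nhds.1 hz
    have hc' : Tendsto (fun s : ℝ => z - s * (I * (b - a))) (𝓝 0) (𝓝 z) := by
      have := hc.tendsto
      simpa using this
    have := hc'.eventually hev
    obtain ⟨ε, hε, h⟩ := Metric.eventually_nhds_iff.1 this
    have h1 := h (show dist (ε / 2) 0 < ε by rw [dist_zero_right, Real.norm_of_nonneg (by positivity)]; linarith)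
    have h2 : 0 ≤ chl a b (z - ((ε / 2 : ℝ) : ℂ) * (I * (b - a))) := h1
    have h3 : chl a b (z - ((ε / 2 : ℝ) : ℂ) * (I * (b - a))) = chl a b z - ε / 2 * normSq (b - a) := by
      simp [chl, normSq_apply]; ring
    have h4 : 0 < normSq (b - a) := normSq_pos.2 (sub_ne_zero.2 hab.symm)
    rw [h3, hz1] at h2
    have := mul_pos (half_pos hε) h4
    linarith
  · apply interior_maximal
    · intro z hz; exact le_of_lt (show 0 < chl a b z from hz)
    · exact isOpen_lt continuous_const (chl_cont a b)

theorem frontier_halfD {a b : ℂ} (hab : a ≠ b) : frontier (halfD a b) =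
    (closedBall 0 1 ∩ {z | chl a b z = 0}) ∪ (sphere 0 1 ∩ {z | 0 ≤ chl a b z}) := by
  rw [frontier, (halfD_compact a b).isClosed.closure_eq, interior_halfD hab]
  ext z
  simp only [halfD, Set.mem_sdiff, mem_inter_iff, mem_closedBall_zero_iff, mem_ball_zero_iff, mem_ofPred_eq, mem_union, mem_sphere_zero_iff_norm, not_and, not_lt]
  constructor
  · rintro ⟨⟨h1, h2⟩, h3⟩
    rcases lt_or_eq_of_le h1 with h | h
    · left; exact ⟨h1, le_antisymm (h3 h) h2⟩
    · right; exact ⟨h, h2⟩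
  · rintro (⟨h1, h2⟩ | ⟨h1, h2⟩)
    · exact ⟨⟨h1, h2.ge⟩, fun _ => h2.le⟩
    · exact ⟨⟨h1.le, h2⟩, fun h => absurd h1 h.ne⟩

/-- coordinate along the chord -/
noncomputable def ct (a b z : ℂ) : ℝ := ((z - a) * conj (b - a)).re / normSq (b - a)

theorem ct_cont (a b : ℂ) : Continuous (ct a b) := by unfold ct; fun_prop

theorem ct_chord {a b : ℂ} (hab : a ≠ b) (t : ℝ) : ct a b (a + t * (b - a)) = t := by
  have h4 : normSq (b - a) ≠ 0 := (normSq_pos.2 (sub_ne_zero.2 hab.symm)).ne'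
  rw [ct, div_eq_iff h4]
  simp [normSq_apply]; ring

theorem ct_swap {a b : ℂ} (hab : a ≠ b) (z : ℂ) : ct b a z = 1 - ct a b z := by
  have h4 : normSq (b - a) ≠ 0 := (normSq_pos.2 (sub_ne_zero.2 hab.symm)).ne'
  have h5 : normSq (a - b) = normSq (b - a) := by rw [← normSq_neg]; congr 1; ring
  rw [ct, ct, h5]
  field_simp
  simp [normSq_apply]; ring

theorem halfD_int_nonempty {a b : ℂ} (ha : ‖a‖ = 1) (hb : ‖b‖ = 1) (hab : a ≠ b) :
    (interior (halfD a b)).Nonempty := by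
  obtain ⟨ξ, hξ, hp⟩ := chl_pos_exists ha hb hab
  rw [interior_halfD hab]
  have hU : {z | 0 < chl a b z} ∈ 𝓝 ξ := (isOpen_lt continuous_const (chl_cont a b)).mem_nhds hp
  have hcl : ξ ∈ closure (ball (0:ℂ) 1) := by rw [closure_ball _ one_ne_zero]; simp [hξ]
  obtain ⟨z, hz1, hz2⟩ := mem_closure_iff_nhds.1 hcl _ hU
  exact ⟨z, hz2, hz1⟩

/-- crosscut of the unit disc parametrised by the unit interval -/
structure XC (α : ℝ → ℂ) : Prop where
  cont : ContinuousOn α (Icc 0 1)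
  inj : InjOn α (Icc 0 1)
  s0 : ‖α 0‖ = 1
  s1 : ‖α 1‖ = 1
  ib : ∀ t ∈ Ioo (0:ℝ) 1, ‖α t‖ < 1

namespace XC
variable {α : ℝ → ℂ}

theorem rev (h : XC α) : XC (fun t => α (1 - t)) where
  cont := h.cont.comp (by fun_prop) (fun t ht => ⟨by linarith [ht.2], by linarith [ht.1]⟩)
  inj := fun s hs t ht e => by
    have := h.inj ⟨by linarith [hs.2], by linarith [hs.1]⟩ ⟨by linarith [ht.2], by linarith [ht.1]⟩ e
    linarith
  s0 := by simpa using h.s1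
  s1 := by simpa using h.s0
  ib := fun t ht => h.ib _ ⟨by linarith [ht.2], by linarith [ht.1]⟩

theorem rev_im (α : ℝ → ℂ) : (fun t => α (1 - t)) '' Icc 0 1 = α '' Icc 0 1 := by
  ext z; constructor
  · rintro ⟨t, ht, rfl⟩; exact ⟨1 - t, ⟨by linarith [ht.2], by linarith [ht.1]⟩, rfl⟩
  · rintro ⟨t, ht, rfl⟩; exact ⟨1 - t, ⟨by linarith [ht.2], by linarith [ht.1]⟩, by simp⟩

theorem ne (h : XC α) : α 0 ≠ α 1 := fun e => by
  have := h.inj ⟨le_rfl, zero_le_one⟩ ⟨zero_le_one, le_rfl⟩ e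
  exact zero_ne_one this

theorem cpt (h : XC α) : IsCompact (α '' Icc 0 1) := isCompact_Icc.image_of_continuousOn h.cont

theorem mem_closed (h : XC α) {t : ℝ} (ht : t ∈ Icc (0:ℝ) 1) : ‖α t‖ ≤ 1 := by
  rcases eq_or_lt_of_le ht.1 with h0 | h0
  · subst h0; exact h.s0.le
  rcases eq_or_lt_of_le ht.2 with h1 | h1
  · subst h1; exact h.s1.le
  · exact (h.ib t ⟨h0, h1⟩).le

theorem end_of_sphere (h : XC α) {z : ℂ} (hz : z ∈ α '' Icc 0 1) (hz1 : ‖z‖ = 1) : z = α 0 ∨ z = α 1 := by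
  obtain ⟨t, ht, rfl⟩ := hz
  rcases eq_or_lt_of_le ht.1 with h0 | h0
  · subst h0; exact Or.inl rfl
  rcases eq_or_lt_of_le ht.2 with h1 | h1
  · subst h1; exact Or.inr rfl
  · exact absurd hz1 (h.ib t ⟨h0, h1⟩).ne

theorem end_of_chl (h : XC α) {z : ℂ} (hz1 : ‖z‖ = 1) (hz : chl (α 0) (α 1) z = 0) : z = α 0 ∨ z = α 1 := by
  obtain ⟨t, ht, e⟩ := chord_of_chl h.s0 h.s1 h.ne hz1.le hz
  rcases eq_or_lt_of_le ht.1 with h0 | h0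
  · subst h0; left; simpa using e
  rcases eq_or_lt_of_le ht.2 with h1 | h1
  · subst h1; right; simpa using e
  · have := chord_mem_ball h.s0 h.s1 h.ne ⟨h0, h1⟩
    rw [← e, mem_ball_zero_iff] at this
    exact absurd hz1 this.ne

theorem chl0 (α : ℝ → ℂ) : chl (α 0) (α 1) (α 0) = 0 := by simp [chl]
theorem chl1 (α : ℝ → ℂ) : chl (α 0) (α 1) (α 1) = 0 := by
  simp [chl]; ring

/-- good neighbourhood of a point on the positive open arc -/
def Near (α : ℝ → ℂ) (ξ : ℂ) (ε : ℝ) : Prop :=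
  0 < ε ∧ ‖ξ‖ = 1 ∧ ∀ z ∈ ball ξ ε, z ∉ α '' Icc 0 1 ∧ 0 < chl (α 0) (α 1) z

theorem near_exists (h : XC α) {ξ : ℂ} (hξ : ‖ξ‖ = 1) (hp : 0 < chl (α 0) (α 1) ξ) : ∃ ε, Near α ξ ε := by
  have hA : ξ ∉ α '' Icc 0 1 := by
    intro hm
    rcases h.end_of_sphere hm hξ with e | e
    · rw [e, chl0] at hp; exact hp.false
    · rw [e, chl1] at hp; exact hp.false
  have h1 : ∀ᶠ z in 𝓝 ξ, z ∉ α '' Icc 0 1 := h.cpt.isClosed.isOpen_compl.mem_nhds hA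
  have h2 : ∀ᶠ z in 𝓝 ξ, 0 < chl (α 0) (α 1) z := (isOpen_lt continuous_const (chl_cont _ _)).mem_nhds hp
  obtain ⟨ε, hε, hh⟩ := Metric.eventually_nhds_iff.1 (h1.and h2)
  exact ⟨ε, hε, hξ, fun z hz => hh hz⟩

theorem out_conn {x y : ℂ} (hx : 1 < ‖x‖) (hy : 1 < ‖y‖) : Conn (closedBall (0:ℂ) 1)ᶜ x y :=
  ⟨_, isPreconnected_compl_closedBall 0 1, Subset.rfl, by simpa using hx, by simpa using hy⟩

theorem out_exists {ξ : ℂ} {ε : ℝ} (hε : 0 < ε) (hξ : ‖ξ‖ = 1) : ∃ o ∈ ball ξ ε, 1 < ‖o‖ := by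
  refine ⟨((1 + ε / 2 : ℝ) : ℂ) * ξ, ?_, ?_⟩
  · rw [mem_ball, dist_eq_norm]
    have : ((1 + ε / 2 : ℝ) : ℂ) * ξ - ξ = ((ε / 2 : ℝ) : ℂ) * ξ := by push_cast; ring
    rw [this, norm_mul, hξ, norm_real, Real.norm_of_nonneg (by positivity)]; linarith
  · rw [norm_mul, hξ, norm_real, Real.norm_of_nonneg (by positivity)]; linarith

theorem sep (h : XC α) {ξ η v v' : ℂ} {ε ε' : ℝ} (n1 : Near α ξ ε) (n2 : Near (fun t => α (1 - t)) η ε')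
    (hv : v ∈ ball ξ ε) (hv1 : v ∈ ball (0:ℂ) 1) (hv' : v' ∈ ball η ε') :
    ¬ Conn (ball 0 1 \ α '' Icc 0 1) v v' := by
  intro hc
  have n2' : ∀ z ∈ ball η ε', z ∉ α '' Icc 0 1 ∧ chl (α 0) (α 1) z < 0 := by
    intro z hz
    have := n2.2.2 z hz
    rw [rev_im] at this
    refine ⟨this.1, ?_⟩
    have h2 := this.2
    simp only [sub_zero, sub_self] at h2
    rw [chl_swap] at h2; linarith
  set A := α '' Icc 0 1 with hA
  set X := A ∪ (sphere (0:ℂ) 1 ∩ {z | 0 ≤ chl (α 0) (α 1) z}) with hX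
  set Y := A ∪ (sphere (0:ℂ) 1 ∩ {z | chl (α 0) (α 1) z ≤ 0}) with hY
  obtain ⟨o, ho, ho1⟩ := out_exists n1.1 n1.2.1
  obtain ⟨o', ho', ho1'⟩ := out_exists n2.1 n2.2.1
  have hcA : IsCompact A := h.cpt
  have hAc : A ⊆ closedBall 0 1 := by rintro _ ⟨t, ht, rfl⟩; simpa using h.mem_closed ht
  have cX : IsCompact X := hcA.union ((isCompact_sphere _ _).inter_right (isClosed_le continuous_const (chl_cont _ _)))
  have cY : IsCompact Y := hcA.union ((isCompact_sphere _ _).inter_right (isClosed_le (chl_cont _ _) continuous_const))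
  have hXY : X ∩ Y = A := by
    ext z; constructor
    · rintro ⟨h1 | h1, h2 | h2⟩
      · exact h1
      · exact h1
      · exact h2
      · have : chl (α 0) (α 1) z = 0 := le_antisymm h2.2 h1.2
        rcases h.end_of_chl (by simpa using h1.1) this with e | e
        · rw [e]; exact ⟨0, ⟨le_rfl, zero_le_one⟩, rfl⟩
        · rw [e]; exact ⟨1, ⟨zero_le_one, le_rfl⟩, rfl⟩
    · intro hz; exact ⟨Or.inl hz, Or.inl hz⟩
  have hXc : X ⊆ closedBall 0 1 := union_subset hAc (inter_subset_left.trans sphere_subset_closedBall)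
  have hYc : Y ⊆ closedBall 0 1 := union_subset hAc (inter_subset_left.trans sphere_subset_closedBall)
  have hAp : IsPreconnected A := isPreconnected_Icc.image _ h.cont
  have c1 : Conn Xᶜ v o := by
    have k1 : Conn Xᶜ v v' := hc.mono (by
      rintro z ⟨hz1, hz2⟩ (hz | hz)
      · exact hz2 hz
      · have h3 := hz.1; simp only [mem_ball, mem_sphere] at h3 hz1; linarith)
    have k2 : Conn Xᶜ v' o' := ⟨ball η ε', (convex_ball _ _).isPreconnected, by
      rintro z hz (hz' | hz')
      · exact (n2' z hz).1 hz'
      · exact absurd hz'.2 (not_le.2 (n2' z hz).2), hv', ho'⟩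
    have k3 : Conn Xᶜ o' o := (out_conn ho1' ho1).mono (compl_subset_compl.2 hXc)
    exact (k1.trans k2).trans k3
  have c2 : Conn Yᶜ v o := ⟨ball ξ ε, (convex_ball _ _).isPreconnected, by
      rintro z hz (hz' | hz')
      · exact (n1.2.2 z hz).1 hz'
      · exact absurd hz'.2 (not_le.2 (n1.2.2 z hz).2), hv, ho⟩
  obtain ⟨S, hSp, hSs, hSv, hSo⟩ := janiszewski cX cY (by rw [hXY]; exact hAp) c1 c2
  have := hSp.intermediate_value (f := fun z => ‖z‖) hSv hSo (by fun_prop)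
  obtain ⟨z, hz, hz1⟩ := this (show (1:ℝ) ∈ Icc ‖v‖ ‖o‖ from ⟨(mem_ball_zero_iff.1 hv1).le, ho1.le⟩)
  apply hSs hz
  rcases le_total 0 (chl (α 0) (α 1) z) with h0 | h0
  · exact Or.inl (Or.inr ⟨by simpa using hz1, h0⟩)
  · exact Or.inr (Or.inr ⟨by simpa using hz1, h0⟩)

theorem side (h : XC α) : ∃ ξ ε v, Near α ξ ε ∧ v ∈ ball ξ ε ∧ v ∈ ball (0:ℂ) 1 ∧
    ∃ V, V = connectedComponentIn (ball 0 1 \ α '' Icc 0 1) v ∧ IsOpen V ∧ IsPreconnected V ∧ v ∈ V ∧ V ⊆ ball 0 1 \ α '' Icc 0 1 ∧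
      IsPreconnected Vᶜ ∧ frontier V ⊆ α '' Icc 0 1 ∪ (sphere 0 1 ∩ {z | 0 ≤ chl (α 0) (α 1) z}) := by
  obtain ⟨ξ, hξ, hp⟩ := chl_pos_exists h.s0 h.s1 h.ne
  obtain ⟨ε, hN⟩ := h.near_exists hξ hp
  have hcl : ∀ ξ : ℂ, ‖ξ‖ = 1 → ξ ∈ closure (ball (0:ℂ) 1) := fun ξ hξ => by
    rw [closure_ball _ one_ne_zero]; simp [hξ]
  obtain ⟨v, hv, hv1⟩ := mem_closure_iff_nhds.1 (hcl ξ hξ) _ (ball_mem_nhds ξ hN.1)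
  set U := ball (0:ℂ) 1 \ α '' Icc 0 1 with hU
  have hUo : IsOpen U := isOpen_ball.sdiff h.cpt.isClosed
  have hvU : v ∈ U := ⟨hv1, (hN.2.2 v hv).1⟩
  refine ⟨ξ, ε, v, hN, hv, hv1, connectedComponentIn U v, rfl, hUo.connectedComponentIn,
    isPreconnected_connectedComponentIn, mem_connectedComponentIn hvU, connectedComponentIn_subset _ _, ?_, ?_⟩
  · have hVo : IsOpen (connectedComponentIn U v) := hUo.connectedComponentIn
    have hUc : Uᶜ = (ball (0:ℂ) 1)ᶜ ∪ α '' Icc 0 1 := by rw [hU, Set.sdiff_eq, compl_inter, compl_compl]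
    have hBc : IsPreconnected (ball (0:ℂ) 1)ᶜ := by
      have := (isPreconnected_compl_closedBall (0:ℂ) 1).closure
      rwa [closure_compl, interior_closedBall _ one_ne_zero] at this
    have hUp : IsPreconnected Uᶜ := by
      rw [hUc]
      refine hBc.union (α 0) ?_ ⟨0, ⟨le_rfl, zero_le_one⟩, rfl⟩ (isPreconnected_Icc.image _ h.cont)
      simp [h.s0]
    have hUV : Uᶜ ⊆ (connectedComponentIn U v)ᶜ := compl_subset_compl.2 (connectedComponentIn_subset _ _)
    have key : ∀ x ∈ (connectedComponentIn U v)ᶜ, ∃ y ∈ Uᶜ, Conn (connectedComponentIn U v)ᶜ x y := by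
      intro x hx
      by_cases hxU : x ∈ U
      · have hWo : IsOpen (connectedComponentIn U x) := hUo.connectedComponentIn
        have hd : Disjoint (connectedComponentIn U x) (connectedComponentIn U v) := by
          rw [Set.disjoint_left]
          intro y hy1 hy2
          exact hx (conn_iff.1 ((conn_iff.2 hy2).trans (conn_iff.2 hy1).symm))
        have hcd : closure (connectedComponentIn U x) ⊆ (connectedComponentIn U v)ᶜ :=
          closure_minimal (subset_compl_iff_disjoint_right.2 hd) hVo.isClosed_compl
        have hfn : (frontier (connectedComponentIn U x)).Nonempty := by
          rw [nonempty_frontier_iff]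
          refine ⟨⟨x, mem_connectedComponentIn hxU⟩, fun hh => ?_⟩
          have : (2:ℂ) ∈ connectedComponentIn U x := hh ▸ mem_univ _
          have := (connectedComponentIn_subset _ _ this).1
          simp at this
        obtain ⟨y, hy⟩ := hfn
        exact ⟨y, frontier_component hUo x hy, closure (connectedComponentIn U x),
          isPreconnected_connectedComponentIn.closure, hcd, subset_closure (mem_connectedComponentIn hxU), frontier_subset_closure hy⟩
      · exact ⟨x, hxU, {x}, isPreconnected_singleton, by simpa using hx, rfl, rfl⟩
    apply isPreconnected_of_conn
    intro x hx y hy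
    obtain ⟨x', hx', cx⟩ := key x hx
    obtain ⟨y', hy', cy⟩ := key y hy
    exact (cx.trans ⟨Uᶜ, hUp, hUV, hx', hy'⟩).trans cy.symm
  · intro η hη
    have h1 := frontier_component hUo v hη
    have h2 : η ∈ closedBall (0:ℂ) 1 := by
      rw [← closure_ball _ one_ne_zero]
      exact closure_mono ((connectedComponentIn_subset _ _).trans sdiff_subset) (frontier_subset_closure hη)
    by_cases hηA : η ∈ α '' Icc 0 1
    · exact Or.inl hηA
    have hη1 : ‖η‖ = 1 := by
      apply le_antisymm (by simpa using h2)
      by_contra hlt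
      exact h1 ⟨by simpa using hlt, hηA⟩
    refine Or.inr ⟨by simpa using hη1, ?_⟩
    by_contra hneg
    have hneg' : chl (α 0) (α 1) η < 0 := not_le.1 hneg
    obtain ⟨ε', hN'⟩ := h.rev.near_exists hη1 (by simp only [sub_zero, sub_self]; rw [chl_swap]; linarith)
    obtain ⟨v', hv', hv1'⟩ := mem_closure_iff_nhds.1 (frontier_subset_closure hη) _ (ball_mem_nhds η hN'.1)
    exact h.sep hN hN' hv hv1 hv' (conn_iff.2 hv1')

end XC
end CPR

open Set
namespace CPR
open Complex Metric Topology Filter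
open scoped ComplexConjugate

theorem ct_a {a b : ℂ} : ct a b a = 0 := by simp [ct]
theorem ct_b {a b : ℂ} (hab : a ≠ b) : ct a b b = 1 := by
  have := ct_chord hab 1
  simpa using this

theorem XC.half {α : ℝ → ℂ} (h : XC α) : ∃ ξ ε v V H, XC.Near α ξ ε ∧ v ∈ ball ξ ε ∧ v ∈ ball (0:ℂ) 1 ∧
    V = connectedComponentIn (ball 0 1 \ α '' Icc 0 1) v ∧ V ⊆ ball 0 1 \ α '' Icc 0 1 ∧
    ContinuousOn H (halfD (α 0) (α 1)) ∧ InjOn H (halfD (α 0) (α 1)) ∧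
    H '' (ball 0 1 ∩ {z | 0 < chl (α 0) (α 1) z}) = V ∧
    (∀ z, ‖z‖ = 1 → 0 ≤ chl (α 0) (α 1) z → H z = z) ∧
    ∀ z, ‖z‖ ≤ 1 → chl (α 0) (α 1) z = 0 → H z = α (ct (α 0) (α 1) z) := by
  classical
  obtain ⟨ξ, ε, v, hN, hv, hv1, V, hV, hVo, hVp, hvV, hVs, hVc, hVf⟩ := h.side
  set a := α 0 with ha
  set b := α 1 with hb
  have hab : a ≠ b := h.ne
  let γ : ℂ → ℂ := fun z => if chl a b z = 0 then α (ct a b z) else z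
  have g1 : ∀ z, chl a b z = 0 → γ z = α (ct a b z) := fun z hz => if_pos hz
  have g2 : ∀ z, ‖z‖ = 1 → γ z = z := by
    intro z hz
    by_cases h0 : chl a b z = 0
    · rw [g1 z h0]
      rcases h.end_of_chl hz h0 with e | e
      · rw [e, ct_a]
      · rw [e, ct_b hab]
    · exact if_neg h0
  have g3 : ∀ z, ‖z‖ ≤ 1 → chl a b z = 0 → ct a b z ∈ Icc (0:ℝ) 1 ∧ z = a + ct a b z * (b - a) := by
    intro z hz h0
    obtain ⟨t, ht, e⟩ := chord_of_chl h.s0 h.s1 hab hz h0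
    have : ct a b z = t := by rw [e, ct_chord hab]
    rw [this]; exact ⟨ht, e⟩
  have hfr := frontier_halfD (a := a) (b := b) hab
  have hγc : ContinuousOn γ (frontier (halfD a b)) := by
    rw [hfr]
    apply ContinuousOn.union_of_isClosed
    · apply ContinuousOn.congr (f := fun z => α (ct a b z))
      · exact h.cont.comp (ct_cont a b).continuousOn (fun z hz => (g3 z (by simpa using hz.1) hz.2).1)
      · intro z hz; exact g1 z hz.2
    · apply ContinuousOn.congr (f := fun z => z) continuousOn_id
      intro z hz; exact g2 z (by simpa using hz.1)
    · exact isClosed_closedBall.inter (isClosed_eq (chl_cont a b) continuous_const)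
    · exact isClosed_sphere.inter (isClosed_le continuous_const (chl_cont a b))
  have hγi : InjOn γ (frontier (halfD a b)) := by
    have key : ∀ z w, ‖z‖ ≤ 1 → chl a b z = 0 → ‖w‖ = 1 → γ z = γ w → z = w := by
      intro z w hz h0 hw e
      rw [g1 z h0, g2 w hw] at e
      have hm := (g3 z hz h0)
      rcases h.end_of_sphere ⟨_, hm.1, e⟩ hw with e' | e'
      · rw [e'] at e
        have := h.inj hm.1 ⟨le_rfl, zero_le_one⟩ e
        rw [hm.2, this, e']; simp [ha]
      · rw [e'] at e
        have := h.inj hm.1 ⟨zero_le_one, le_rfl⟩ e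
        rw [hm.2, this, e']; simp [hb]
    rw [hfr]
    rintro z (hz | hz) w (hw | hw) e
    · have hz' := g3 z (by simpa using hz.1) hz.2
      have hw' := g3 w (by simpa using hw.1) hw.2
      rw [g1 z hz.2, g1 w hw.2] at e
      rw [hz'.2, hw'.2, h.inj hz'.1 hw'.1 e]
    · exact key z w (by simpa using hz.1) hz.2 (by simpa using hw.1) e
    · exact (key w z (by simpa using hw.1) hw.2 (by simpa using hz.1) e.symm).symm
    · rwa [g2 z (by simpa using hz.1), g2 w (by simpa using hw.1)] at e
  have him : γ '' frontier (halfD a b) = α '' Icc 0 1 ∪ (sphere 0 1 ∩ {z | 0 ≤ chl a b z}) := by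
    rw [hfr, image_union]
    congr 1
    · ext w; constructor
      · rintro ⟨z, hz, rfl⟩
        rw [g1 z hz.2]; exact ⟨_, (g3 z (by simpa using hz.1) hz.2).1, rfl⟩
      · rintro ⟨t, ht, rfl⟩
        refine ⟨a + t * (b - a), ⟨?_, chl_line a b t⟩, ?_⟩
        · simpa using chord_mem_closed h.s0 h.s1 ht
        · rw [g1 _ (chl_line a b t), ct_chord hab]
    · ext w; constructor
      · rintro ⟨z, hz, rfl⟩; rw [g2 z (by simpa using hz.1)]; exact hz
      · intro hw; exact ⟨w, hw, g2 w (by simpa using hw.1)⟩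
  obtain ⟨H, c1, c2, c3, c4⟩ := schoen_conv (halfD_convex a b) (halfD_compact a b) (halfD_int_nonempty h.s0 h.s1 hab)
    hVo hVp ⟨v, hvV⟩ (isBounded_ball.subset (hVs.trans sdiff_subset)) hVc hγc hγi (by rw [him]; exact hVf) (by
      intro z hz hz'
      rw [him] at hz'
      rcases hz' with hz' | hz'
      · exact (hVs hz).2 hz'
      · have h1 := (hVs hz).1
        have h2 := hz'.1
        simp at h1 h2; linarith)
  refine ⟨ξ, ε, v, V, H, hN, hv, hv1, hV, hVs, c1, c2, by rw [← interior_halfD hab]; exact c3, ?_, ?_⟩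
  · intro z hz h0
    rw [c4 z (by rw [hfr]; right; exact ⟨by simpa using hz, h0⟩), g2 z hz]
  · intro z hz h0
    rw [c4 z (by rw [hfr]; left; exact ⟨by simpa using hz, h0⟩), g1 z h0]

/-- homeomorphism of the closed disc fixing the circle -/
structure BH (h : ℂ → ℂ) : Prop where
  cont : ContinuousOn h (closedBall 0 1)
  inj : InjOn h (closedBall 0 1)
  maps : MapsTo h (closedBall 0 1) (closedBall 0 1)
  idc : ∀ z, ‖z‖ = 1 → h z = z

theorem glue_inj {P Q : Set ℂ} {h : ℂ → ℂ} (hP : InjOn h P) (hQ : InjOn h Q)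
    (hd : ∀ z ∈ P, ∀ w ∈ Q, w ∉ P → h z ≠ h w) : InjOn h (P ∪ Q) := by
  intro z hz w hw e
  by_cases h1 : z ∈ P <;> by_cases h2 : w ∈ P
  · exact hP h1 h2 e
  · exact absurd e (hd z h1 w (hw.resolve_left h2) h2)
  · exact absurd e.symm (hd w h2 z (hz.resolve_left h1) h1)
  · exact hQ (hz.resolve_left h1) (hw.resolve_left h2) e

theorem closedBall_halves (a b : ℂ) : closedBall (0:ℂ) 1 = halfD a b ∪ halfD b a := by
  ext z
  simp only [halfD, mem_union, mem_inter_iff, mem_ofPred_eq, ← and_or_left, chl_swap a b z]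
  constructor
  · intro h; exact ⟨h, by rcases le_total 0 (chl a b z) with h | h; exacts [Or.inl h, Or.inr (by linarith)]⟩
  · exact fun h => h.1

theorem straighten {α : ℝ → ℂ} (hx : XC α) : ∃ h, BH h ∧
    ∀ t ∈ Icc (0:ℝ) 1, h (α 0 + t * (α 1 - α 0)) = α t := by
  classical
  obtain ⟨ξ, ε, v, V, H, n1, hv, hv1, hV, hVs, c1, c2, c3, c4, c5⟩ := hx.half
  obtain ⟨ξ', ε', v', V', H', n1', hv', hv1', hV', hVs', c1', c2', c3', c4', c5'⟩ := hx.rev.half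
  simp only [sub_zero, sub_self, XC.rev_im] at *
  set a := α 0 with ha
  set b := α 1 with hb
  have hab : a ≠ b := hx.ne
  have hVV : Disjoint V V' := by
    rw [Set.disjoint_left]
    intro z hz hz'
    rw [hV] at hz; rw [hV'] at hz'
    exact hx.sep n1 n1' hv hv1 hv' ((conn_iff.2 hz).trans (conn_iff.2 hz').symm)
  have agree : ∀ z, ‖z‖ ≤ 1 → chl a b z = 0 → H z = H' z := by
    intro z hz h0
    rw [c5 z hz h0, c5' z hz (by rw [chl_swap, h0, neg_zero]), ct_swap hab]; simp
  let h : ℂ → ℂ := fun z => if 0 ≤ chl a b z then H z else H' z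
  have e1 : EqOn h H (halfD a b) := fun z hz => if_pos hz.2
  have e2 : EqOn h H' (halfD b a) := by
    intro z hz
    have h1 : ‖z‖ ≤ 1 := by simpa using hz.1
    have h2 : chl a b z ≤ 0 := by have : 0 ≤ chl b a z := hz.2; rw [chl_swap] at this; linarith
    by_cases h0 : 0 ≤ chl a b z
    · change (if _ then _ else _) = _
      rw [if_pos h0]; exact agree z h1 (le_antisymm h2 h0)
    · exact if_neg h0
  have hcls : ∀ a b, IsClosed (halfD a b) := fun a b => (halfD_compact a b).isClosed
  have hcont : ContinuousOn h (closedBall 0 1) := by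
    rw [closedBall_halves a b]
    exact (c1.congr e1).union_of_isClosed (c1'.congr e2) (hcls _ _) (hcls _ _)
  have A1 : ∀ z, ‖z‖ ≤ 1 → chl a b z = 0 → H z ∈ α '' Icc 0 1 := by
    intro z hz h0
    obtain ⟨t, ht, e⟩ := chord_of_chl hx.s0 hx.s1 hab hz h0
    rw [c5 z hz h0, e, ct_chord hab]; exact ⟨t, ht, rfl⟩
  have r1 : ∀ z, ‖z‖ ≤ 1 → 0 ≤ chl a b z → H z ∈ V ∨ (chl a b z = 0 ∧ H z ∈ α '' Icc 0 1) ∨ (‖z‖ = 1 ∧ H z = z) := by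
    intro z hz h0
    rcases eq_or_lt_of_le h0 with h0' | h0'
    · exact Or.inr (Or.inl ⟨h0'.symm, A1 z hz h0'.symm⟩)
    rcases eq_or_lt_of_le hz with hz' | hz'
    · exact Or.inr (Or.inr ⟨hz', c4 z hz' h0⟩)
    · left; rw [← c3]; exact ⟨z, ⟨by simpa using hz', h0'⟩, rfl⟩
  have r2 : ∀ z, ‖z‖ ≤ 1 → chl a b z < 0 → H' z ∈ V' ∨ (‖z‖ = 1 ∧ H' z = z) := by
    intro z hz h0
    have h0' : 0 < chl b a z := by rw [chl_swap]; linarith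
    rcases eq_or_lt_of_le hz with hz' | hz'
    · exact Or.inr ⟨hz', c4' z hz' h0'.le⟩
    · left; rw [← c3']; exact ⟨z, ⟨by simpa using hz', h0'⟩, rfl⟩
  have vb : ∀ z ∈ V, ‖z‖ < 1 ∧ z ∉ α '' Icc 0 1 := fun z hz => ⟨by simpa using (hVs hz).1, (hVs hz).2⟩
  have vb' : ∀ z ∈ V', ‖z‖ < 1 ∧ z ∉ α '' Icc 0 1 := fun z hz => ⟨by simpa using (hVs' hz).1, (hVs' hz).2⟩
  have hinj : InjOn h (closedBall 0 1) := by
    rw [closedBall_halves a b]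
    apply glue_inj (c2.congr e1.symm) (c2'.congr e2.symm)
    intro z hz w hw hwP e
    rw [e1 hz, e2 hw] at e
    have hw1 : ‖w‖ ≤ 1 := by simpa using hw.1
    have hz1 : ‖z‖ ≤ 1 := by simpa using hz.1
    have hw0 : chl a b w < 0 := by
      by_contra hcon; exact hwP ⟨hw.1, not_lt.1 hcon⟩
    rcases r1 z hz1 hz.2 with p | ⟨p1, p2⟩ | ⟨p1, p2⟩ <;> rcases r2 w hw1 hw0 with q | ⟨q1, q2⟩
    · exact Set.disjoint_left.1 hVV p (e ▸ q)
    · have := (vb _ p).1; rw [e, q2] at this; linarith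
    · exact (vb' _ q).2 (e ▸ p2)
    · rcases hx.end_of_sphere p2 (by rw [e, q2, q1]) with e' | e'
      · rw [← q2, ← e, e'] at hw0; rw [ha, hb, XC.chl0] at hw0; exact hw0.false
      · rw [← q2, ← e, e'] at hw0; rw [ha, hb, XC.chl1] at hw0; exact hw0.false
    · have := (vb' _ q).1; rw [← e, p2] at this; linarith
    · have hz0 : 0 ≤ chl a b z := hz.2
      rw [← p2, e, q2] at hz0; linarith
  refine ⟨h, ⟨hcont, hinj, ?_, ?_⟩, ?_⟩
  · intro z hz
    have hz1 : ‖z‖ ≤ 1 := by simpa using hz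
    rw [mem_closedBall_zero_iff]
    by_cases h0 : 0 ≤ chl a b z
    · rw [e1 ⟨hz, h0⟩]
      rcases r1 z hz1 h0 with p | ⟨p1, t, ht, p2⟩ | ⟨p1, p2⟩
      · exact (vb _ p).1.le
      · rw [← p2]; exact hx.mem_closed ht
      · rw [p2]; exact hz1
    · have h0' := not_le.1 h0
      rw [e2 ⟨hz, by change 0 ≤ chl b a z; rw [chl_swap]; linarith⟩]
      rcases r2 z hz1 h0' with p | ⟨p1, p2⟩
      · exact (vb' _ p).1.le
      · rw [p2]; exact hz1
  · intro z hz
    have hz' : z ∈ closedBall (0:ℂ) 1 := by simp [hz]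
    by_cases h0 : 0 ≤ chl a b z
    · rw [e1 ⟨hz', h0⟩]; exact c4 z hz h0
    · have h0' := not_le.1 h0
      have h1 : 0 ≤ chl b a z := by rw [chl_swap]; linarith
      rw [e2 ⟨hz', h1⟩]; exact c4' z hz h1
  · intro t ht
    have h1 : ‖a + t * (b - a)‖ ≤ 1 := by simpa using chord_mem_closed hx.s0 hx.s1 ht
    rw [e1 ⟨by simpa using h1, (chl_line a b t).ge⟩, c5 _ h1 (chl_line a b t), ct_chord hab]

namespace BH
variable {h g : ℂ → ℂ}

theorem surj (hh : BH h) : h '' closedBall 0 1 = closedBall 0 1 := by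
  apply Subset.antisymm hh.maps.image_subset
  intro p hp
  exact no_retraction hh.cont hh.idc (by simpa using hp)

theorem comp (hh : BH h) (hg : BH g) : BH (h ∘ g) where
  cont := hh.cont.comp hg.cont hg.maps
  inj := hh.inj.comp hg.inj hg.maps
  maps := hh.maps.comp hg.maps
  idc := fun z hz => by simp [hg.idc z hz, hh.idc z hz]

theorem norm_lt (hh : BH h) {z : ℂ} (hz : ‖z‖ < 1) : ‖h z‖ < 1 := by
  have h1 : ‖h z‖ ≤ 1 := by simpa using hh.maps (show z ∈ closedBall (0:ℂ) 1 by simpa using hz.le)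
  rcases eq_or_lt_of_le h1 with h2 | h2
  · have := hh.idc _ h2
    have := hh.inj (by simpa using h1) (by simpa using hz.le) this
    rw [this] at h2; linarith
  · exact h2

theorem norm_le (hh : BH h) {z : ℂ} (hz : ‖z‖ ≤ 1) : ‖h z‖ ≤ 1 := by
  simpa using hh.maps (show z ∈ closedBall (0:ℂ) 1 by simpa using hz)

theorem inv (hh : BH h) : ∃ g, BH g ∧ (∀ z, ‖z‖ ≤ 1 → g (h z) = z) ∧ ∀ z, ‖z‖ ≤ 1 → h (g z) = z := by
  have hc := cont_inv (isCompact_closedBall (0:ℂ) 1) hh.cont hh.inj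
  rw [hh.surj] at hc
  set g := Function.invFunOn h (closedBall 0 1) with hg
  have h1 : ∀ z, ‖z‖ ≤ 1 → g z ∈ closedBall (0:ℂ) 1 ∧ h (g z) = z := by
    intro z hz
    have : z ∈ h '' closedBall 0 1 := by rw [hh.surj]; simpa using hz
    exact ⟨Function.invFunOn_mem this, Function.invFunOn_eq this⟩
  have h2 : ∀ z, ‖z‖ ≤ 1 → g (h z) = z := by
    intro z hz
    have := h1 (h z) (hh.norm_le hz)
    exact hh.inj this.1 (by simpa using hz) this.2
  refine ⟨g, ⟨hc, ?_, fun z hz => (h1 z (by simpa using hz)).1, ?_⟩, h2, fun z hz => (h1 z hz).2⟩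
  · intro z hz w hw e
    rw [← (h1 z (by simpa using hz)).2, ← (h1 w (by simpa using hw)).2, e]
  · intro z hz
    have := h2 z hz.le
    rwa [hh.idc z hz] at this
end BH
end CPR

open Set
namespace CPR
open Complex Metric Topology Filter
open scoped ComplexConjugate

/-- sign pattern along a curve with at most one interior zero, which is a sign change -/
def Pat (p q : ℝ) (σ : ℝ → ℝ) : Prop :=
  (∃ c ∈ Ioo p q, σ c = 0 ∧ (∀ t ∈ Ico p c, 0 < σ p * σ t) ∧ (∀ t ∈ Ioo c q, σ p * σ t < 0) ∧ σ p * σ q ≤ 0) ∨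
  ((∀ t ∈ Ico p q, 0 < σ p * σ t) ∧ 0 ≤ σ p * σ q)

theorem same_sign {p q : ℝ} {σ : ℝ → ℝ} (hc : ContinuousOn σ (Icc p q)) (hpq : p ≤ q)
    (hz : ∀ t ∈ Icc p q, σ t ≠ 0) : 0 < σ p * σ q := by
  by_contra hcon
  rw [not_lt] at hcon
  rcases lt_or_gt_of_ne (hz p ⟨le_rfl, hpq⟩) with h | h
  · have h2 : 0 ≤ σ q := by nlinarith
    obtain ⟨t, ht, e⟩ := intermediate_value_Icc hpq hc ⟨h.le, h2⟩
    exact hz t ht e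
  · have h2 : σ q ≤ 0 := by nlinarith
    obtain ⟨t, ht, e⟩ := intermediate_value_Icc' hpq hc ⟨h2, h.le⟩
    exact hz t ht e

theorem limit_sign {p q c : ℝ} {σ : ℝ → ℝ} (hc : ContinuousOn σ (Icc p q)) (hpc : p ≤ c) (hcq : c < q)
    (hs : ∀ t ∈ Ioo c q, 0 ≤ σ t) : 0 ≤ σ q := by
  have h1 : q ∈ closure (Ioo c q) := by rw [closure_Ioo hcq.ne]; exact ⟨hcq.le, le_rfl⟩
  have h2 : ContinuousWithinAt σ (Ioo c q) q :=
    (hc q ⟨by linarith, le_rfl⟩).mono (fun t ht => ⟨by linarith [ht.1], ht.2.le⟩)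
  have h3 := h2.mem_closure_image h1
  have h4 : σ '' Ioo c q ⊆ Ici 0 := by rintro _ ⟨t, ht, rfl⟩; exact hs t ht
  exact closure_minimal h4 isClosed_Ici h3

theorem pat_of {p q : ℝ} {σ : ℝ → ℝ} (hc : ContinuousOn σ (Icc p q)) (hpq : p < q) (hp : σ p ≠ 0)
    (hu : ∀ t ∈ Ioo p q, ∀ t' ∈ Ioo p q, σ t = 0 → σ t' = 0 → t = t')
    (hx : ∀ t u v, p < u → u < t → t < v → v < q → σ t = 0 → ¬ 0 < σ u * σ v) : Pat p q σ := by
  by_cases hz : ∃ c ∈ Ioo p q, σ c = 0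
  · obtain ⟨c, hcm, h0⟩ := hz
    have hne : ∀ t ∈ Ioo p q, t ≠ c → σ t ≠ 0 := fun t ht h e => h (hu t ht c hcm e h0)
    have h1 : ∀ t ∈ Ico p c, 0 < σ p * σ t := by
      intro t ht
      apply same_sign (hc.mono (Icc_subset_Icc le_rfl (by linarith [ht.2, hcm.2]))) ht.1
      intro u hu'
      rcases eq_or_lt_of_le hu'.1 with e | e
      · rwa [← e]
      · exact hne u ⟨e, by linarith [hu'.2, ht.2, hcm.2]⟩ (by linarith [hu'.2, ht.2] : u < c).ne
    have h2 : ∀ t ∈ Ioo c q, σ p * σ t < 0 := by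
      intro t ht
      have hm : (p + c) / 2 ∈ Ico p c := ⟨by linarith [hcm.1], by linarith [hcm.1]⟩
      have a1 := h1 _ hm
      have a2 := hx c ((p + c) / 2) t (by linarith [hcm.1]) hm.2 ht.1 ht.2 h0
      have a3 := hne t ⟨by linarith [ht.1, hcm.1], ht.2⟩ ht.1.ne'
      have a4 : σ p * σ t ≠ 0 := mul_ne_zero hp a3
      by_contra hcon
      have a5 : 0 < σ p * σ t := lt_of_le_of_ne (not_lt.1 hcon) a4.symm
      have := mul_pos a1 a5
      have h6 : 0 < σ p * σ p := mul_self_pos.2 hp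
      apply a2
      by_contra h7
      nlinarith
    refine Or.inl ⟨c, hcm, h0, h1, h2, ?_⟩
    have := limit_sign (σ := fun t => - (σ p * σ t)) (by fun_prop) hcm.1.le hcm.2 (fun t ht => by linarith [h2 t ht])
    linarith
  · push Not at hz
    have h1 : ∀ t ∈ Ico p q, 0 < σ p * σ t := by
      intro t ht
      apply same_sign (hc.mono (Icc_subset_Icc le_rfl ht.2.le)) ht.1
      intro u hu'
      rcases eq_or_lt_of_le hu'.1 with e | e
      · rwa [← e]
      · exact hz u ⟨e, by linarith [hu'.2, ht.2]⟩
    exact Or.inr ⟨h1, limit_sign (σ := fun t => σ p * σ t) (by fun_prop) le_rfl hpq (fun t ht => (h1 t ⟨ht.1.le, ht.2⟩).le)⟩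

/-- two patterns with the same end values and the same zeros have the same signs -/
theorem pat_match {p q : ℝ} {σ τ : ℝ → ℝ} (hpq : p < q) (hσ : Pat p q σ) (hτ : Pat p q τ)
    (ep : σ p = τ p) (eq : σ q = τ q) (hz : ∀ t ∈ Icc p q, σ t = 0 ↔ τ t = 0) {t : ℝ} (ht : t ∈ Icc p q)
    (h : 0 < σ t) : 0 < τ t := by
  rcases eq_or_lt_of_le ht.2 with e | e
  · subst e; rwa [← eq]
  rcases hσ with ⟨c, hc, c0, c1, c2, -⟩ | ⟨c1, -⟩
  · have hτc := (hz c ⟨hc.1.le, hc.2.le⟩).1 c0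
    rcases hτ with ⟨d, hd, d0, d1, d2, -⟩ | ⟨d1, -⟩
    · have hcd : c = d := by
        rcases lt_trichotomy c d with h | h | h
        · have := d1 c ⟨hc.1.le, h⟩; rw [hτc] at this; simp at this
        · exact h
        · have := d2 c ⟨h, hc.2⟩; rw [hτc] at this; simp at this
      subst hcd
      rcases lt_trichotomy t c with h3 | h3 | h3
      · have a1 := c1 t ⟨ht.1, h3⟩
        have a2 := d1 t ⟨ht.1, h3⟩
        rw [← ep] at a2
        have a3 := (pos_iff_pos_of_mul_pos a1).2 h
        exact (pos_iff_pos_of_mul_pos a2).1 a3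
      · subst h3; linarith
      · have a1 := c2 t ⟨h3, e⟩
        have a2 := d2 t ⟨h3, e⟩
        rw [← ep] at a2
        by_contra h4
        nlinarith
    · have := d1 c ⟨hc.1.le, hc.2⟩; rw [hτc] at this; simp at this
  · have a1 := c1 t ⟨ht.1, e⟩
    rcases hτ with ⟨d, hd, d0, d1, d2, -⟩ | ⟨d1, -⟩
    · have := c1 d ⟨hd.1.le, hd.2⟩
      rw [(hz d ⟨hd.1.le, hd.2.le⟩).2 d0] at this; simp at this
    · have a2 := d1 t ⟨ht.1, e⟩
      rw [← ep] at a2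
      have a3 := (pos_iff_pos_of_mul_pos a1).2 h
      exact (pos_iff_pos_of_mul_pos a2).1 a3

/-- the positive piece -/
structure Piece (p q : ℝ) (σ : ℝ → ℝ) (p' q' : ℝ) : Prop where
  le1 : p ≤ p'
  lt : p' < q'
  le2 : q' ≤ q
  pos : ∀ t ∈ Ioo p' q', 0 < σ t
  left : (p' = p ∧ 0 < σ p) ∨ (p < p' ∧ σ p' = 0)
  right : (q' = q ∧ 0 ≤ σ q) ∨ (q' < q ∧ σ q' = 0)
  all : ∀ t ∈ Icc p q, 0 < σ t → t ∈ Icc p' q'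

theorem piece_of {p q : ℝ} {σ : ℝ → ℝ} (hpq : p < q) (h : Pat p q σ) (hp : σ p ≠ 0) (he : ∃ t ∈ Icc p q, 0 < σ t) :
    ∃ p' q', Piece p q σ p' q' := by
  rcases lt_or_gt_of_ne hp with hn | hn
  · rcases h with ⟨c, hc, c0, c1, c2, c3⟩ | ⟨c1, c2⟩
    · refine ⟨c, q, hc.1.le, hc.2, le_rfl, fun t ht => ?_, Or.inr ⟨hc.1, c0⟩, Or.inl ⟨rfl, by nlinarith⟩, fun t ht h0 => ?_⟩
      · have := c2 t ht; by_contra h0; nlinarith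
      · refine ⟨?_, ht.2⟩
        by_contra h1
        have := c1 t ⟨ht.1, not_le.1 h1⟩; nlinarith
    · exfalso
      obtain ⟨t, ht, h0⟩ := he
      rcases eq_or_lt_of_le ht.2 with e | e
      · subst e; nlinarith
      · have := c1 t ⟨ht.1, e⟩; nlinarith
  · rcases h with ⟨c, hc, c0, c1, c2, c3⟩ | ⟨c1, c2⟩
    · refine ⟨p, c, le_rfl, hc.1, hc.2.le, fun t ht => ?_, Or.inl ⟨rfl, hn⟩, Or.inr ⟨hc.2, c0⟩, fun t ht h0 => ?_⟩
      · have := c1 t ⟨ht.1.le, ht.2⟩; exact (pos_iff_pos_of_mul_pos this).1 hn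
      · refine ⟨ht.1, ?_⟩
        by_contra h1
        rcases eq_or_lt_of_le ht.2 with e | e
        · subst e; nlinarith
        · have := c2 t ⟨not_le.1 h1, e⟩; nlinarith
    · refine ⟨p, q, le_rfl, hpq, le_rfl, fun t ht => ?_, Or.inl ⟨rfl, hn⟩, Or.inl ⟨rfl, by nlinarith⟩, fun t ht _ => ht⟩
      have := c1 t ⟨ht.1.le, ht.2⟩; exact (pos_iff_pos_of_mul_pos this).1 hn

theorem Piece.congr {p q p' q' : ℝ} {σ τ : ℝ → ℝ} (h : Piece p q σ p' q')
    (h1 : ∀ t ∈ Icc p q, 0 < σ t ↔ 0 < τ t) (h2 : ∀ t ∈ Icc p q, σ t = 0 ↔ τ t = 0) : Piece p q τ p' q' := by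
  have hle := h.le1; have hlt := h.lt; have hle2 := h.le2
  refine ⟨h.le1, h.lt, h.le2, fun t ht => (h1 t ⟨by linarith [ht.1], by linarith [ht.2]⟩).1 (h.pos t ht), ?_, ?_,
    fun t ht h0 => h.all t ht ((h1 t ht).2 h0)⟩
  · rcases h.left with ⟨e, h0⟩ | ⟨e, h0⟩
    · exact Or.inl ⟨e, (h1 p ⟨le_rfl, by linarith⟩).1 h0⟩
    · exact Or.inr ⟨e, (h2 p' ⟨by linarith, by linarith⟩).1 h0⟩
  · rcases h.right with ⟨e, h0⟩ | ⟨e, h0⟩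
    · refine Or.inl ⟨e, ?_⟩
      have hq : q ∈ Icc p q := ⟨by linarith, le_rfl⟩
      rcases eq_or_lt_of_le h0 with h3 | h3
      · exact ((h2 q hq).1 h3.symm).ge
      · exact ((h1 q hq).1 h3).le
    · exact Or.inr ⟨e, (h2 q' ⟨by linarith, by linarith⟩).1 h0⟩

/-- family of crosscuts -/
structure CC {ι : Type} (s : Finset ι) (p q : ι → ℝ) (α : ι → ℝ → ℂ) : Prop where
  lt : ∀ j ∈ s, p j < q j
  cont : ∀ j ∈ s, ContinuousOn (α j) (Icc (p j) (q j))
  inj : ∀ j ∈ s, InjOn (α j) (Icc (p j) (q j))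
  np : ∀ j ∈ s, ‖α j (p j)‖ = 1
  nq : ∀ j ∈ s, ‖α j (q j)‖ = 1
  ib : ∀ j ∈ s, ∀ t ∈ Ioo (p j) (q j), ‖α j t‖ < 1
  np' : ∀ i ∈ s, ∀ j ∈ s, i ≠ j → α j (p j) ∉ α i '' Icc (p i) (q i)
  uniq : ∀ i ∈ s, ∀ j ∈ s, i ≠ j → ∀ t ∈ Ioo (p j) (q j), ∀ t' ∈ Ioo (p j) (q j),
    α j t ∈ α i '' Icc (p i) (q i) → α j t' ∈ α i '' Icc (p i) (q i) → t = t'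
  cross : ∀ i ∈ s, ∀ j ∈ s, i ≠ j → ∀ t u v, p j < u → u < t → t < v → v < q j →
    α j t ∈ α i '' Icc (p i) (q i) → ¬ Conn (ball 0 1 \ α i '' Icc (p i) (q i)) (α j u) (α j v)
  triple : ∀ i ∈ s, ∀ j ∈ s, ∀ k ∈ s, i ≠ j → i ≠ k → j ≠ k → ∀ t ∈ Ioo (p j) (q j),
    α j t ∈ α i '' Icc (p i) (q i) → α j t ∉ α k '' Icc (p k) (q k)

namespace CC
variable {ι : Type} {s : Finset ι} {p q : ι → ℝ} {α : ι → ℝ → ℂ}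

theorem mem (h : CC s p q α) {j : ι} (hj : j ∈ s) {t : ℝ} (ht : t ∈ Icc (p j) (q j)) : ‖α j t‖ ≤ 1 := by
  rcases eq_or_lt_of_le ht.1 with h0 | h0
  · rw [← h0, h.np j hj]
  rcases eq_or_lt_of_le ht.2 with h1 | h1
  · rw [h1, h.nq j hj]
  · exact (h.ib j hj t ⟨h0, h1⟩).le

theorem map (h : CC s p q α) {g : ℂ → ℂ} (hg : BH g) : CC s p q (fun j t => g (α j t)) := by
  have him : ∀ i ∈ s, (fun t => g (α i t)) '' Icc (p i) (q i) = g '' (α i '' Icc (p i) (q i)) := fun i _ => by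
    rw [image_image]
  have hb : ∀ i ∈ s, ∀ t ∈ Icc (p i) (q i), α i t ∈ closedBall (0:ℂ) 1 := fun i hi t ht => by simpa using h.mem hi ht
  have hpull : ∀ i ∈ s, ∀ z, ‖z‖ ≤ 1 → g z ∈ g '' (α i '' Icc (p i) (q i)) → z ∈ α i '' Icc (p i) (q i) := by
    rintro i hi z hz ⟨_, ⟨t, ht, rfl⟩, e⟩
    rw [← hg.inj (hb i hi t ht) (by simpa using hz) e]; exact ⟨t, ht, rfl⟩
  obtain ⟨k, hk, hk1, hk2⟩ := hg.inv
  constructor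
  · exact h.lt
  · exact fun j hj => hg.cont.comp (h.cont j hj) (hb j hj)
  · exact fun j hj => hg.inj.comp (h.inj j hj) (hb j hj)
  · intro j hj; rw [hg.idc _ (h.np j hj), h.np j hj]
  · intro j hj; rw [hg.idc _ (h.nq j hj), h.nq j hj]
  · exact fun j hj t ht => hg.norm_lt (h.ib j hj t ht)
  · intro i hi j hj hij hm
    rw [him i hi] at hm
    exact h.np' i hi j hj hij (hpull i hi _ (h.np j hj).le hm)
  · intro i hi j hj hij t ht t' ht' hm hm'
    rw [him i hi] at hm hm'
    exact h.uniq i hi j hj hij t ht t' ht' (hpull i hi _ (h.ib j hj t ht).le hm) (hpull i hi _ (h.ib j hj t' ht').le hm')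
  · intro i hi j hj hij t u v h1 h2 h3 h4 hm hc
    rw [him i hi] at hm hc
    have hm' := hpull i hi _ (h.ib j hj t ⟨by linarith, by linarith⟩).le hm
    apply h.cross i hi j hj hij t u v h1 h2 h3 h4 hm'
    obtain ⟨S, S1, S2, S3, S4⟩ := hc
    refine ⟨k '' S, S1.image _ (hk.cont.mono (S2.trans (sdiff_subset.trans ball_subset_closedBall))), ?_, ?_, ?_⟩
    · rintro _ ⟨z, hz, rfl⟩
      have h5 := S2 hz
      have h6 : ‖z‖ < 1 := by simpa using h5.1
      refine ⟨by simpa using hk.norm_lt h6, fun hcon => h5.2 ?_⟩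
      exact ⟨k z, hcon, hk2 z h6.le⟩
    · exact ⟨_, S3, hk1 _ (h.ib j hj u ⟨by linarith, by linarith⟩).le⟩
    · exact ⟨_, S4, hk1 _ (h.ib j hj v ⟨by linarith, by linarith⟩).le⟩
  · intro i hi j hj k hk' h1 h2 h3 t ht hm hm'
    rw [him i hi] at hm
    rw [him k hk'] at hm'
    exact h.triple i hi j hj k hk' h1 h2 h3 t ht (hpull i hi _ (h.ib j hj t ht).le hm) (hpull k hk' _ (h.ib j hj t ht).le hm')
end CC
end CPR

open Set
namespace CPR
open Complex Metric Topology Filter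
open scoped ComplexConjugate

theorem ball_side_conn {a b x y : ℂ} (hx : ‖x‖ < 1) (hy : ‖y‖ < 1) (hx' : 0 < chl a b x) (hy' : 0 < chl a b y) :
    Conn (ball 0 1 ∩ {z | 0 < chl a b z}) x y :=
  ⟨_, ((convex_ball (0:ℂ) 1).inter (pos_convex a b)).isPreconnected, Subset.rfl, ⟨by simpa using hx, hx'⟩, ⟨by simpa using hy, hy'⟩⟩

namespace CC
variable {ι : Type} {s : Finset ι} {p q : ι → ℝ} {α β : ι → ℝ → ℂ}

theorem pat (h : CC s p q α) {a b : ℂ} {i0 j : ι} (hi0 : i0 ∈ s) (hj : j ∈ s) (hne : i0 ≠ j)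
    (hA : ∀ z, ‖z‖ ≤ 1 → (z ∈ α i0 '' Icc (p i0) (q i0) ↔ chl a b z = 0)) :
    Pat (p j) (q j) (fun t => chl a b (α j t)) ∧ chl a b (α j (p j)) ≠ 0 := by
  have hp : chl a b (α j (p j)) ≠ 0 := fun e => h.np' i0 hi0 j hj hne ((hA _ (h.np j hj).le).2 e)
  refine ⟨pat_of ((chl_cont a b).comp_continuousOn (h.cont j hj)) (h.lt j hj) hp ?_ ?_, hp⟩
  · intro t ht t' ht' e e'
    exact h.uniq i0 hi0 j hj hne t ht t' ht' ((hA _ (h.ib j hj t ht).le).2 e) ((hA _ (h.ib j hj t' ht').le).2 e')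
  · intro t u v h1 h2 h3 h4 e hpos
    have hu := h.ib j hj u ⟨h1, by linarith⟩
    have hv := h.ib j hj v ⟨by linarith, h4⟩
    apply h.cross i0 hi0 j hj hne t u v h1 h2 h3 h4 ((hA _ (h.ib j hj t ⟨by linarith, by linarith⟩).le).2 e)
    have sub : ∀ a' b', (∀ z, chl a' b' z ≠ 0 → chl a b z ≠ 0) →
        ball 0 1 ∩ {z | 0 < chl a' b' z} ⊆ ball 0 1 \ α i0 '' Icc (p i0) (q i0) := by
      intro a' b' hab z hz
      refine ⟨hz.1, fun hm => ?_⟩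
      have hz1 : ‖z‖ < 1 := by simpa using hz.1
      exact hab z (ne_of_gt hz.2) ((hA z hz1.le).1 hm)
    rcases lt_or_ge 0 (chl a b (α j u)) with hs | hs
    · exact (ball_side_conn hu hv hs ((pos_iff_pos_of_mul_pos hpos).1 hs)).mono (sub a b fun _ => id)
    · refine (ball_side_conn (a := b) (b := a) hu hv ?_ ?_).mono (sub b a fun z hz => ?_)
      · rw [chl_swap]
        rcases eq_or_lt_of_le hs with h0 | h0
        · rw [h0, zero_mul] at hpos; exact absurd hpos (lt_irrefl _)
        · linarith
      · rw [chl_swap]; by_contra h5; nlinarith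
      · rw [chl_swap] at hz; simpa using hz

theorem half_cc (h : CC s p q α) {a b : ℂ} (hab : a ≠ b) {i0 : ι} (hi0 : i0 ∈ s)
    (hA : ∀ z, ‖z‖ ≤ 1 → (z ∈ α i0 '' Icc (p i0) (q i0) ↔ chl a b z = 0))
    {s' : Finset ι} (hs : s' ⊆ s) (hi : i0 ∉ s') {p' q' : ι → ℝ}
    (hP : ∀ j ∈ s', Piece (p j) (q j) (fun t => chl a b (α j t)) (p' j) (q' j)) (ψ : ℂ ≃ₜ ℂ)
    (hψ1 : ψ '' interior (halfD a b) = ball 0 1) (hψ2 : ψ '' frontier (halfD a b) = sphere 0 1) :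
    CC s' p' q' (fun j t => ψ (α j t)) := by
  have hsub : ∀ j ∈ s', Icc (p' j) (q' j) ⊆ Icc (p j) (q j) := fun j hj => Icc_subset_Icc (hP j hj).le1 (hP j hj).le2
  have hsubo : ∀ j ∈ s', Ioo (p' j) (q' j) ⊆ Ioo (p j) (q j) := fun j hj => Ioo_subset_Ioo (hP j hj).le1 (hP j hj).le2
  have him : ∀ i, (fun t => ψ (α i t)) '' Icc (p' i) (q' i) = ψ '' (α i '' Icc (p' i) (q' i)) := fun i => by rw [image_image]
  have hpull : ∀ i ∈ s', ∀ z, ψ z ∈ ψ '' (α i '' Icc (p' i) (q' i)) → z ∈ α i '' Icc (p i) (q i) := by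
    intro i hi' z hz
    rw [ψ.injective.mem_set_image] at hz
    exact image_mono (hsub i hi') hz
  have hsph : ∀ z, z ∈ frontier (halfD a b) → ‖ψ z‖ = 1 := by
    intro z hz
    have : ψ z ∈ sphere (0:ℂ) 1 := hψ2 ▸ mem_image_of_mem _ hz
    simpa using this
  have hni : ∀ j ∈ s', i0 ≠ j := fun j hj e => hi (e ▸ hj)
  constructor
  · exact fun j hj => (hP j hj).lt
  · exact fun j hj => ψ.continuous.comp_continuousOn ((h.cont j (hs hj)).mono (hsub j hj))
  · exact fun j hj => ψ.injective.injOn.comp ((h.inj j (hs hj)).mono (hsub j hj)) (mapsTo_univ _ _)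
  · intro j hj
    apply hsph
    rw [frontier_halfD hab]
    rcases (hP j hj).left with ⟨e, h0⟩ | ⟨e, h0⟩
    · right; rw [e]; exact ⟨by simpa using h.np j (hs hj), h0.le⟩
    · left
      exact ⟨by simpa using h.mem (hs hj) (hsub j hj ⟨le_rfl, (hP j hj).lt.le⟩), h0⟩
  · intro j hj
    apply hsph
    rw [frontier_halfD hab]
    rcases (hP j hj).right with ⟨e, h0⟩ | ⟨e, h0⟩
    · right; rw [e]; exact ⟨by simpa using h.nq j (hs hj), h0⟩
    · left
      exact ⟨by simpa using h.mem (hs hj) (hsub j hj ⟨(hP j hj).lt.le, le_rfl⟩), h0⟩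
  · intro j hj t ht
    have : ψ (α j t) ∈ ball (0:ℂ) 1 := by
      rw [← hψ1, interior_halfD hab]
      exact ⟨_, ⟨by simpa using h.ib j (hs hj) t (hsubo j hj ht), (hP j hj).pos t ht⟩, rfl⟩
    simpa using this
  · intro i hi' j hj hij hm
    rw [him] at hm
    have hm' := hpull i hi' _ hm
    rcases (hP j hj).left with ⟨e, h0⟩ | ⟨e, h0⟩
    · rw [e] at hm'; exact h.np' i (hs hi') j (hs hj) hij hm'
    · have hp' : p' j ∈ Ioo (p j) (q j) := ⟨e, (hP j hj).lt.trans_le (hP j hj).le2⟩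
      have hm2 := (hA _ (h.ib j (hs hj) _ hp').le).2 h0
      exact h.triple i0 hi0 j (hs hj) i (hs hi') (hni j hj) (hni i hi') hij.symm _ hp' hm2 hm'
  · intro i hi' j hj hij t ht t' ht' hm hm'
    rw [him] at hm hm'
    exact h.uniq i (hs hi') j (hs hj) hij t (hsubo j hj ht) t' (hsubo j hj ht') (hpull i hi' _ hm) (hpull i hi' _ hm')
  · intro i hi' j hj hij t u v h1 h2 h3 h4 hm hc
    rw [him] at hm hc
    apply h.cross i (hs hi') j (hs hj) hij t u v ((hP j hj).le1.trans_lt h1) h2 h3 (h4.trans_le (hP j hj).le2) (hpull i hi' _ hm)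
    have := hc.image (ψ.symm.continuous.continuousOn) (mapsTo_image _ _)
    simp only [Homeomorph.symm_apply_apply] at this
    refine this.mono ?_
    rintro _ ⟨w, ⟨hw1, hw2⟩, rfl⟩
    rw [← hψ1] at hw1
    obtain ⟨z, hz, rfl⟩ := hw1
    rw [ψ.injective.mem_set_image] at hw2
    rw [interior_halfD hab] at hz
    simp only [Homeomorph.symm_apply_apply]
    refine ⟨hz.1, ?_⟩
    rintro ⟨x, hx, rfl⟩
    exact hw2 ⟨x, (hP i hi').all x hx hz.2, rfl⟩
  · intro i hi' j hj k hk' h1 h2 h3 t ht hm hm'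
    rw [him] at hm hm'
    exact h.triple i (hs hi') j (hs hj) k (hs hk') h1 h2 h3 t (hsubo j hj ht) (hpull i hi' _ hm) (hpull k hk' _ hm')
end CC

def Mat {ι : Type} (s : Finset ι) (p q : ι → ℝ) (α β : ι → ℝ → ℂ) : Prop :=
  (∀ j ∈ s, α j (p j) = β j (p j) ∧ α j (q j) = β j (q j)) ∧
  ∀ i ∈ s, ∀ j ∈ s, ∀ u ∈ Icc (p i) (q i), ∀ t ∈ Icc (p j) (q j), (α i u = α j t ↔ β i u = β j t)

/-- the induction claim for a finite set -/
def ECl {ι : Type} (s : Finset ι) : Prop := ∀ (p q : ι → ℝ) (α β : ι → ℝ → ℂ), CC s p q α → CC s p q β → Mat s p q α β →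
  ∃ h, BH h ∧ ∀ j ∈ s, ∀ t ∈ Icc (p j) (q j), h (α j t) = β j t

theorem half_step {ι : Type} {s : Finset ι} {p q : ι → ℝ} {α β : ι → ℝ → ℂ} (hα : CC s p q α) (hβ : CC s p q β)
    (hM : Mat s p q α β) {a b : ℂ} (ha : ‖a‖ = 1) (hb : ‖b‖ = 1) (hab : a ≠ b) {i0 : ι} (hi0 : i0 ∈ s)
    (hA : ∀ z, ‖z‖ ≤ 1 → (z ∈ α i0 '' Icc (p i0) (q i0) ↔ chl a b z = 0))
    (he : ∀ t ∈ Icc (p i0) (q i0), α i0 t = β i0 t) (IH : ∀ s' : Finset ι, s' ⊆ s → i0 ∉ s' → ECl s') :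
    ∃ H : ℂ → ℂ, ContinuousOn H (halfD a b) ∧ InjOn H (halfD a b) ∧ MapsTo H (halfD a b) (halfD a b) ∧
      (∀ z ∈ frontier (halfD a b), H z = z) ∧ (∀ z ∈ halfD a b, 0 < chl a b z → 0 < chl a b (H z)) ∧
      ∀ j ∈ s, ∀ t ∈ Icc (p j) (q j), 0 < chl a b (α j t) → H (α j t) = β j t := by
  classical
  have hB : ∀ z, ‖z‖ ≤ 1 → (z ∈ β i0 '' Icc (p i0) (q i0) ↔ chl a b z = 0) := by
    have : β i0 '' Icc (p i0) (q i0) = α i0 '' Icc (p i0) (q i0) := (image_congr he).symm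
    rw [this]; exact hA
  -- coincidence on the chord
  have hz : ∀ j ∈ s, ∀ t ∈ Icc (p j) (q j), chl a b (α j t) = 0 → α j t = β j t := by
    intro j hj t ht h0
    obtain ⟨u, hu, e⟩ := (hA _ (hα.mem hj ht)).2 h0
    have := (hM.2 i0 hi0 j hj u hu t ht).1 e
    rw [← e, ← this, he u hu]
  have hz' : ∀ j ∈ s, ∀ t ∈ Icc (p j) (q j), chl a b (β j t) = 0 → α j t = β j t := by
    intro j hj t ht h0
    obtain ⟨u, hu, e⟩ := (hB _ (hβ.mem hj ht)).2 h0
    have := (hM.2 i0 hi0 j hj u hu t ht).2 e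
    rw [← e, ← this, he u hu]
  have hz0 : ∀ j ∈ s, ∀ t ∈ Icc (p j) (q j), (chl a b (α j t) = 0 ↔ chl a b (β j t) = 0) := fun j hj t ht =>
    ⟨fun h => hz j hj t ht h ▸ h, fun h => (hz' j hj t ht h).symm ▸ h⟩
  have hsg : ∀ j ∈ s, i0 ≠ j → ∀ t ∈ Icc (p j) (q j), (0 < chl a b (α j t) ↔ 0 < chl a b (β j t)) := by
    intro j hj hne t ht
    have e1 : chl a b (α j (p j)) = chl a b (β j (p j)) := by rw [(hM.1 j hj).1]
    have e2 : chl a b (α j (q j)) = chl a b (β j (q j)) := by rw [(hM.1 j hj).2]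
    exact ⟨pat_match (hα.lt j hj) (hα.pat hi0 hj hne hA).1 (hβ.pat hi0 hj hne hB).1 e1 e2 (hz0 j hj) ht,
      pat_match (hα.lt j hj) (hβ.pat hi0 hj hne hB).1 (hα.pat hi0 hj hne hA).1 e1.symm e2.symm (fun t ht => (hz0 j hj t ht).symm) ht⟩
  let s' := s.filter (fun j => i0 ≠ j ∧ ∃ t ∈ Icc (p j) (q j), 0 < chl a b (α j t))
  have hs' : ∀ j ∈ s', j ∈ s ∧ i0 ≠ j ∧ ∃ t ∈ Icc (p j) (q j), 0 < chl a b (α j t) := fun j hj => by simpa [s'] using hj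
  have hex : ∀ j, ∃ p' q', j ∈ s' → Piece (p j) (q j) (fun t => chl a b (α j t)) p' q' := by
    intro j
    by_cases hj : j ∈ s'
    · obtain ⟨h1, h2, h3⟩ := hs' j hj
      have := hα.pat hi0 h1 h2 hA
      obtain ⟨p', q', h⟩ := piece_of (hα.lt j h1) this.1 this.2 h3
      exact ⟨p', q', fun _ => h⟩
    · exact ⟨0, 0, fun h => absurd h hj⟩
  choose p' q' hP using hex
  have hPβ : ∀ j ∈ s', Piece (p j) (q j) (fun t => chl a b (β j t)) (p' j) (q' j) := fun j hj =>
    (hP j hj).congr (hsg j (hs' j hj).1 (hs' j hj).2.1) (hz0 j (hs' j hj).1)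
  obtain ⟨ψ, hψ1, hψ3, hψ2⟩ := exists_homeomorph_image_interior_closure_frontier_eq_unitBall (halfD_convex a b)
    (halfD_int_nonempty ha hb hab) (halfD_compact a b).isBounded
  rw [(halfD_compact a b).isClosed.closure_eq] at hψ3
  have hss : s' ⊆ s := fun j hj => (hs' j hj).1
  have hi0' : i0 ∉ s' := fun h => (hs' i0 h).2.1 rfl
  have c1 := hα.half_cc hab hi0 hA hss hi0' hP ψ hψ1 hψ2
  have c2 := hβ.half_cc hab hi0 hB hss hi0' hPβ ψ hψ1 hψ2
  have hMat : Mat s' p' q' (fun j t => ψ (α j t)) (fun j t => ψ (β j t)) := by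
    have hsub : ∀ j ∈ s', Icc (p' j) (q' j) ⊆ Icc (p j) (q j) := fun j hj => Icc_subset_Icc (hP j hj).le1 (hP j hj).le2
    refine ⟨fun j hj => ⟨congrArg ψ ?_, congrArg ψ ?_⟩, fun i hi j hj u hu t ht => ?_⟩
    · rcases (hP j hj).left with ⟨e, h0⟩ | ⟨e, h0⟩
      · rw [e]; exact (hM.1 j (hss hj)).1
      · exact hz j (hss hj) _ (hsub j hj ⟨le_rfl, (hP j hj).lt.le⟩) h0
    · rcases (hP j hj).right with ⟨e, h0⟩ | ⟨e, h0⟩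
      · rw [e]; exact (hM.1 j (hss hj)).2
      · exact hz j (hss hj) _ (hsub j hj ⟨(hP j hj).lt.le, le_rfl⟩) h0
    · simp only [ψ.injective.eq_iff]
      exact hM.2 i (hss hi) j (hss hj) u (hsub i hi hu) t (hsub j hj ht)
  obtain ⟨h, hh, hhe⟩ := IH s' hss hi0' p' q' _ _ c1 c2 hMat
  have m1 : MapsTo ψ (halfD a b) (closedBall 0 1) := by rw [← hψ3]; exact mapsTo_image _ _
  have m2 : MapsTo ψ.symm (closedBall 0 1) (halfD a b) := by
    rw [← hψ3]; rintro _ ⟨z, hz, rfl⟩; simpa using hz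
  have m3 : MapsTo ψ.symm (ball 0 1) (interior (halfD a b)) := by
    rw [← hψ1]; rintro _ ⟨z, hz, rfl⟩; simpa using hz
  have hid : ∀ z ∈ frontier (halfD a b), ψ.symm (h (ψ z)) = z := by
    intro z hz
    have : ψ z ∈ sphere (0:ℂ) 1 := hψ2 ▸ mem_image_of_mem _ hz
    rw [hh.idc _ (by simpa using this)]; simp
  refine ⟨fun z => ψ.symm (h (ψ z)), ?_, ?_, ?_, hid, ?_, ?_⟩
  · exact ψ.symm.continuous.comp_continuousOn (hh.cont.comp ψ.continuous.continuousOn m1)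
  · exact ψ.symm.injective.injOn.comp (hh.inj.comp ψ.injective.injOn m1) (mapsTo_univ _ _)
  · exact fun z hz => m2 (hh.maps (m1 hz))
  · intro z hz h0
    by_cases hf : z ∈ frontier (halfD a b)
    · simp only [hid z hf]; exact h0
    · have hzi : z ∈ interior (halfD a b) := by
        rw [(halfD_compact a b).isClosed.frontier_eq] at hf
        by_contra h; exact hf ⟨hz, h⟩
      have h1 : ψ z ∈ ball (0:ℂ) 1 := hψ1 ▸ mem_image_of_mem _ hzi
      have h2 := m3 (show h (ψ z) ∈ ball (0:ℂ) 1 by simpa using hh.norm_lt (by simpa using h1))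
      rw [interior_halfD hab] at h2
      exact h2.2
  · intro j hj t ht h0
    have hne : i0 ≠ j := by
      rintro rfl
      exact h0.ne' ((hA _ (hα.mem hj ht)).1 ⟨t, ht, rfl⟩)
    have hjs : j ∈ s' := by simp only [s', Finset.mem_filter]; exact ⟨hj, hne, t, ht, h0⟩
    have := hhe j hjs t ((hP j hjs).all t ht h0)
    simp only [this, Homeomorph.symm_apply_apply]

theorem glue_step {ι : Type} {s : Finset ι} {p q : ι → ℝ} {α β : ι → ℝ → ℂ} (hα : CC s p q α) (hβ : CC s p q β)
    (hM : Mat s p q α β) {a b : ℂ} (ha : ‖a‖ = 1) (hb : ‖b‖ = 1) (hab : a ≠ b) {i0 : ι} (hi0 : i0 ∈ s)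
    (hA : ∀ z, ‖z‖ ≤ 1 → (z ∈ α i0 '' Icc (p i0) (q i0) ↔ chl a b z = 0))
    (he : ∀ t ∈ Icc (p i0) (q i0), α i0 t = β i0 t) (IH : ∀ s' : Finset ι, s' ⊆ s → i0 ∉ s' → ECl s') :
    ∃ h, BH h ∧ ∀ j ∈ s, ∀ t ∈ Icc (p j) (q j), h (α j t) = β j t := by
  classical
  obtain ⟨H, c1, c2, c3, c4, c5, c6⟩ := half_step hα hβ hM ha hb hab hi0 hA he IH
  obtain ⟨H', c1', c2', c3', c4', c5', c6'⟩ := half_step hα hβ hM hb ha hab.symm hi0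
    (fun z hz => by rw [hA z hz, chl_swap a b z, neg_eq_zero]) he IH
  have fr : ∀ z, ‖z‖ ≤ 1 → chl a b z = 0 → H z = z ∧ H' z = z := by
    intro z hz h0
    refine ⟨c4 z ?_, c4' z ?_⟩
    · rw [frontier_halfD hab]; exact Or.inl ⟨by simpa using hz, h0⟩
    · rw [frontier_halfD hab.symm]; exact Or.inl ⟨by simpa using hz, by change chl b a z = 0; rw [chl_swap, h0, neg_zero]⟩
  let h : ℂ → ℂ := fun z => if 0 ≤ chl a b z then H z else H' z
  have e1 : EqOn h H (halfD a b) := fun z hz => if_pos hz.2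
  have e2 : EqOn h H' (halfD b a) := by
    intro z hz
    have h1 : ‖z‖ ≤ 1 := by simpa using hz.1
    have h2 : chl a b z ≤ 0 := by have : 0 ≤ chl b a z := hz.2; rw [chl_swap] at this; linarith
    by_cases h0 : 0 ≤ chl a b z
    · change (if _ then _ else _) = _
      have := fr z h1 (le_antisymm h2 h0)
      rw [if_pos h0, this.1, this.2]
    · exact if_neg h0
  have hcls : ∀ a b, IsClosed (halfD a b) := fun a b => (halfD_compact a b).isClosed
  have hmem : ∀ z, ‖z‖ ≤ 1 → z ∈ halfD a b ∨ z ∈ halfD b a := by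
    intro z hz
    have : z ∈ closedBall (0:ℂ) 1 := by simpa using hz
    rwa [closedBall_halves a b] at this
  refine ⟨h, ⟨?_, ?_, ?_, ?_⟩, ?_⟩
  · rw [closedBall_halves a b]
    exact (c1.congr e1).union_of_isClosed (c1'.congr e2) (hcls _ _) (hcls _ _)
  · rw [closedBall_halves a b]
    apply glue_inj (c2.congr e1.symm) (c2'.congr e2.symm)
    intro z hz w hw hwP e
    rw [e1 hz, e2 hw] at e
    have hw0 : 0 < chl b a w := by
      rw [chl_swap]
      by_contra hcon; exact hwP ⟨hw.1, by change 0 ≤ chl a b w; linarith⟩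
    have h1 := c5' w hw hw0
    have h2 : 0 ≤ chl a b (H z) := (c3 hz).2
    rw [← e, chl_swap] at h1; linarith
  · intro z hz
    rcases hmem z (by simpa using hz) with h1 | h1
    · rw [e1 h1]; exact (c3 h1).1
    · rw [e2 h1]; exact (c3' h1).1
  · intro z hz
    rcases hmem z hz.le with h1 | h1
    · rw [e1 h1]; apply c4; rw [frontier_halfD hab]; exact Or.inr ⟨by simpa using hz, h1.2⟩
    · rw [e2 h1]; apply c4'; rw [frontier_halfD hab.symm]; exact Or.inr ⟨by simpa using hz, h1.2⟩
  · intro j hj t ht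
    have hz1 := hα.mem hj ht
    have hz2 : α j t ∈ closedBall (0:ℂ) 1 := by simpa using hz1
    rcases lt_trichotomy (chl a b (α j t)) 0 with h0 | h0 | h0
    · have h0' : 0 < chl b a (α j t) := by rw [chl_swap]; linarith
      rw [e2 ⟨hz2, h0'.le⟩]; exact c6' j hj t ht h0'
    · rw [e1 ⟨hz2, h0.ge⟩, (fr _ hz1 h0).1]
      obtain ⟨u, hu, e⟩ := (hA _ hz1).2 h0
      have := (hM.2 i0 hi0 j hj u hu t ht).1 e
      rw [← e, ← this, he u hu]
    · rw [e1 ⟨hz2, h0.le⟩]; exact c6 j hj t ht h0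

theorem straighten_cc {ι : Type} {s : Finset ι} {p q : ι → ℝ} {α : ι → ℝ → ℂ} (hα : CC s p q α) {i0 : ι} (hi0 : i0 ∈ s) :
    ∃ k, BH k ∧ ∀ t ∈ Icc (p i0) (q i0), k (α i0 t) = α i0 (p i0) + (((t - p i0) / (q i0 - p i0) : ℝ) : ℂ) * (α i0 (q i0) - α i0 (p i0)) := by
  have hlt := hα.lt i0 hi0
  have hd : 0 < q i0 - p i0 := by linarith
  let f : ℝ → ℝ := fun t => p i0 + t * (q i0 - p i0)
  have hf : ∀ t ∈ Icc (0:ℝ) 1, f t ∈ Icc (p i0) (q i0) := fun t ht => ⟨by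
    have := mul_nonneg ht.1 hd.le; simp only [f]; linarith, by
    have := mul_nonneg (sub_nonneg.2 ht.2) hd.le; simp only [f]; linarith⟩
  have hf' : ∀ t ∈ Ioo (0:ℝ) 1, f t ∈ Ioo (p i0) (q i0) := fun t ht => ⟨by
    have := mul_pos ht.1 hd; simp only [f]; linarith, by
    have := mul_pos (sub_pos.2 ht.2) hd; simp only [f]; linarith⟩
  have f0 : f 0 = p i0 := by simp [f]
  have f1 : f 1 = q i0 := by simp [f]
  have hx : XC (fun t => α i0 (f t)) := by
    constructor
    · exact (hα.cont i0 hi0).comp (by fun_prop) hf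
    · intro u hu v hv e
      have := hα.inj i0 hi0 (hf u hu) (hf v hv) e
      simp only [f] at this
      have h2 : (u - v) * (q i0 - p i0) = 0 := by linarith
      rcases mul_eq_zero.1 h2 with h | h <;> linarith
    · simp only [f0]; exact hα.np i0 hi0
    · simp only [f1]; exact hα.nq i0 hi0
    · intro t ht; exact hα.ib i0 hi0 _ (hf' t ht)
  obtain ⟨g, hg, he⟩ := straighten hx
  obtain ⟨k, hk, k1, k2⟩ := hg.inv
  refine ⟨k, hk, fun t ht => ?_⟩
  simp only [f0, f1] at he
  have hu : (t - p i0) / (q i0 - p i0) ∈ Icc (0:ℝ) 1 :=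
    ⟨div_nonneg (by linarith [ht.1]) hd.le, (div_le_one hd).2 (by linarith [ht.2])⟩
  have h2 := he _ hu
  have h3 : f ((t - p i0) / (q i0 - p i0)) = t := by simp only [f]; rw [div_mul_cancel₀ _ hd.ne']; ring
  rw [h3] at h2
  rw [← h2, k1 _ (by simpa using chord_mem_closed (hα.np i0 hi0) (hα.nq i0 hi0) hu)]

theorem ext_disc {ι : Type} (s : Finset ι) : ECl s := by
  classical
  induction s using Finset.strongInduction with
  | H s IH =>
    intro p q α β hα hβ hM
    rcases s.eq_empty_or_nonempty with rfl | ⟨i0, hi0⟩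
    · exact ⟨id, ⟨continuousOn_id, injOn_id _, mapsTo_id _, fun _ _ => rfl⟩, by simp⟩
    obtain ⟨k, hk, k1⟩ := straighten_cc hα hi0
    obtain ⟨l, hl, l1⟩ := straighten_cc hβ hi0
    have hα' := hα.map hk
    have hβ' := hβ.map hl
    have hlt := hα.lt i0 hi0
    have hd : 0 < q i0 - p i0 := by linarith
    have hM' : Mat s p q (fun j t => k (α j t)) (fun j t => l (β j t)) := by
      refine ⟨fun j hj => ⟨?_, ?_⟩, fun i hi j hj u hu t ht => ?_⟩
      · simp only [hk.idc _ (hα.np j hj), hl.idc _ (hβ.np j hj)]; exact (hM.1 j hj).1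
      · simp only [hk.idc _ (hα.nq j hj), hl.idc _ (hβ.nq j hj)]; exact (hM.1 j hj).2
      · have := hM.2 i hi j hj u hu t ht
        rw [hk.inj.eq_iff (by simpa using hα.mem hi hu) (by simpa using hα.mem hj ht),
          hl.inj.eq_iff (by simpa using hβ.mem hi hu) (by simpa using hβ.mem hj ht)]
        exact this
    set a := α i0 (p i0) with ha
    set b := α i0 (q i0) with hb
    have na : ‖a‖ = 1 := hα.np i0 hi0
    have nb : ‖b‖ = 1 := hα.nq i0 hi0
    have hab : a ≠ b := fun e => by
      have := hα.inj i0 hi0 ⟨le_rfl, hlt.le⟩ ⟨hlt.le, le_rfl⟩ e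
      linarith
    have hA : ∀ z, ‖z‖ ≤ 1 → (z ∈ (fun t => k (α i0 t)) '' Icc (p i0) (q i0) ↔ chl a b z = 0) := by
      intro z hz
      constructor
      · rintro ⟨t, ht, rfl⟩
        simp only [k1 t ht]; exact chl_line a b _
      · intro h0
        obtain ⟨t, ht, e⟩ := chord_of_chl na nb hab hz h0
        have hm : p i0 + t * (q i0 - p i0) ∈ Icc (p i0) (q i0) := by
          have := mul_nonneg ht.1 hd.le
          have := mul_nonneg (sub_nonneg.2 ht.2) hd.le
          constructor <;> linarith
        refine ⟨_, hm, ?_⟩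
        simp only [k1 _ hm, e]
        rw [add_sub_cancel_left, mul_div_cancel_right₀ _ hd.ne']
    have he : ∀ t ∈ Icc (p i0) (q i0), k (α i0 t) = l (β i0 t) := by
      intro t ht
      rw [k1 t ht, l1 t ht, ← (hM.1 i0 hi0).1, ← (hM.1 i0 hi0).2]
    obtain ⟨h, hh, h1⟩ := glue_step hα' hβ' hM' na nb hab hi0 hA he
      (fun s' hs' hi => IH s' (Finset.ssubset_iff_subset_ne.2 ⟨hs', fun e => hi (e ▸ hi0)⟩))
    obtain ⟨m, hm, m1, m2⟩ := hl.inv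
    refine ⟨m ∘ h ∘ k, hm.comp (hh.comp hk), fun j hj t ht => ?_⟩
    simp only [Function.comp]
    rw [h1 j hj t ht, m1 _ (hβ.mem hj ht)]
end CPR

open Set
namespace CPR
open Complex Metric Topology Filter
open scoped ComplexConjugate

/-- Cayley map and its inverse -/
noncomputable def Cay (z : ℂ) : ℂ := (z - I) / (z + I)
noncomputable def Dec (w : ℂ) : ℂ := I * (1 + w) / (1 - w)

theorem add_I_ne {z : ℂ} (hz : 0 ≤ z.im) : z + I ≠ 0 := fun h => by
  have := congrArg Complex.im h
  simp at this; linarith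

theorem Dec_Cay {z : ℂ} (hz : 0 ≤ z.im) : Dec (Cay z) = z := by
  have h := add_I_ne hz
  have h1 : 1 + Cay z = 2 * z / (z + I) := by unfold Cay; field_simp; ring
  have h2 : 1 - Cay z = 2 * I / (z + I) := by unfold Cay; field_simp; ring
  rw [Dec, h1, h2]; field_simp

theorem Cay_ne_one {z : ℂ} (hz : 0 ≤ z.im) : Cay z ≠ 1 := fun e => by
  have h := add_I_ne hz
  rw [Cay, div_eq_one_iff_eq h] at e
  have := congrArg Complex.im e
  simp at this; linarith

theorem Cay_Dec {w : ℂ} (hw : w ≠ 1) : Cay (Dec w) = w := by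
  have h : 1 - w ≠ 0 := sub_ne_zero.2 hw.symm
  have h1 : Dec w - I = 2 * I * w / (1 - w) := by unfold Dec; field_simp; ring
  have h2 : Dec w + I = 2 * I / (1 - w) := by unfold Dec; field_simp; ring
  rw [Cay, h1, h2]; field_simp

theorem Cay_normSq {z : ℂ} (hz : 0 ≤ z.im) : 1 - ‖Cay z‖ ^ 2 = 4 * z.im / normSq (z + I) := by
  have h : normSq (z + I) ≠ 0 := fun e => add_I_ne hz (normSq_eq_zero.1 e)
  rw [← normSq_eq_norm_sq, Cay, normSq_div]
  field_simp
  simp [normSq_apply]; ring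

theorem Cay_le {z : ℂ} (hz : 0 ≤ z.im) : ‖Cay z‖ ≤ 1 := by
  have := Cay_normSq hz
  have h2 : 0 ≤ 4 * z.im / normSq (z + I) := div_nonneg (by linarith) (normSq_nonneg _)
  have h3 := norm_nonneg (Cay z)
  nlinarith

theorem Cay_lt {z : ℂ} (hz : 0 < z.im) : ‖Cay z‖ < 1 := by
  have := Cay_normSq hz.le
  have h2 : 0 < 4 * z.im / normSq (z + I) := div_pos (by linarith) (normSq_pos.2 (add_I_ne hz.le))
  have h3 := norm_nonneg (Cay z)
  nlinarith

theorem Cay_eq {z : ℂ} (hz : z.im = 0) : ‖Cay z‖ = 1 := by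
  have := Cay_normSq hz.ge
  rw [hz, mul_zero, zero_div] at this
  have h3 := norm_nonneg (Cay z)
  nlinarith

theorem Dec_im {w : ℂ} : (Dec w).im = (1 - ‖w‖ ^ 2) / normSq (1 - w) := by
  rw [← normSq_eq_norm_sq, Dec, div_im]
  by_cases h : normSq (1 - w) = 0
  · simp [h]
  · field_simp
    simp [normSq_apply]; ring

theorem Dec_nonneg {w : ℂ} (hw : ‖w‖ ≤ 1) : 0 ≤ (Dec w).im := by
  rw [Dec_im]; apply div_nonneg _ (normSq_nonneg _)
  have := norm_nonneg w
  nlinarith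

theorem Dec_pos {w : ℂ} (hw : ‖w‖ < 1) : 0 < (Dec w).im := by
  rw [Dec_im]
  apply div_pos
  · have := norm_nonneg w
    nlinarith
  · refine normSq_pos.2 (sub_ne_zero.2 ?_)
    rintro rfl; simp at hw

theorem Cay_cont : ContinuousOn Cay {z | 0 ≤ z.im} :=
  ContinuousOn.div (by fun_prop) (by fun_prop) (fun _ hz => add_I_ne hz)

theorem Dec_cont : ContinuousOn Dec {w | w ≠ 1} :=
  ContinuousOn.div (by fun_prop) (by fun_prop) (fun _ hw => sub_ne_zero.2 (Ne.symm hw))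

theorem Cay_lim : Tendsto Cay (cocompact ℂ) (𝓝 1) := by
  have h1 : Tendsto (fun z : ℂ => z + I) (cocompact ℂ) (cocompact ℂ) := (Homeomorph.addRight I).isClosedEmbedding.tendsto_cocompact
  have h2 : Tendsto (fun z : ℂ => (z + I)⁻¹) (cocompact ℂ) (𝓝 0) := by
    rw [← Metric.cobounded_eq_cocompact] at h1 ⊢
    exact tendsto_inv₀_cobounded.comp h1
  have h3 : Tendsto (fun z : ℂ => 1 - 2 * I * (z + I)⁻¹) (cocompact ℂ) (𝓝 1) := by
    simpa using (h2.const_mul (2 * I)).const_sub 1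
  refine h3.congr' ?_
  have : {-I}ᶜ ∈ cocompact ℂ := isCompact_singleton.compl_mem_cocompact
  filter_upwards [this] with z hz
  have hz' : z + I ≠ 0 := fun h => hz (by simpa using eq_neg_of_add_eq_zero_left h)
  unfold Cay; field_simp; ring

/-- family of rays in the closed upper half plane -/
structure UR {ι : Type} (x : ι → ℝ) (ρ : ι → ℝ → ℂ) : Prop where
  xinj : Function.Injective x
  cont : ∀ j, ContinuousOn (ρ j) (Ici 0)
  inj : ∀ j, InjOn (ρ j) (Ici 0)
  lim : ∀ j, Tendsto (ρ j) atTop (cocompact ℂ)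
  zero : ∀ j, ρ j 0 = x j
  pos : ∀ j, ∀ t, 0 < t → 0 < (ρ j t).im
  uniq : ∀ i j, i ≠ j → ∀ t ∈ Ioi (0:ℝ), ∀ t' ∈ Ioi (0:ℝ), ρ j t ∈ ρ i '' Ici 0 → ρ j t' ∈ ρ i '' Ici 0 → t = t'
  cross : ∀ i j, i ≠ j → ∀ t u v, 0 < u → u < t → t < v → ρ j t ∈ ρ i '' Ici 0 →
    ¬ Conn ({z | 0 < z.im} \ ρ i '' Ici 0) (ρ j u) (ρ j v)
  triple : ∀ i j k, i ≠ j → i ≠ k → j ≠ k → ∀ t ∈ Ioi (0:ℝ), ρ j t ∈ ρ i '' Ici 0 → ρ j t ∉ ρ k '' Ici 0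

noncomputable def tc (τ : ℝ) : ℝ := τ / (1 - τ)
noncomputable def ti (t : ℝ) : ℝ := t / (1 + t)

theorem tc_ti {t : ℝ} (ht : 0 ≤ t) : tc (ti t) = t := by
  have : 1 + t ≠ 0 := by positivity
  unfold tc ti; field_simp; ring

theorem ti_mem {t : ℝ} (ht : 0 ≤ t) : ti t ∈ Ico (0:ℝ) 1 :=
  ⟨div_nonneg ht (by linarith), (div_lt_one (by linarith)).2 (by linarith)⟩

theorem tc_nonneg {τ : ℝ} (h : τ ∈ Ico (0:ℝ) 1) : 0 ≤ tc τ := div_nonneg h.1 (by linarith [h.2])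
theorem tc_pos {τ : ℝ} (h : τ ∈ Ioo (0:ℝ) 1) : 0 < tc τ := div_pos h.1 (by linarith [h.2])

theorem tc_lt {τ τ' : ℝ} (h : τ < τ') (h' : τ' < 1) : tc τ < tc τ' := by
  unfold tc
  rw [div_lt_div_iff₀ (by linarith) (by linarith)]
  nlinarith

theorem tc_inj {τ τ' : ℝ} (h1 : τ < 1) (h2 : τ' < 1) (e : tc τ = tc τ') : τ = τ' := by
  rcases lt_trichotomy τ τ' with h | h | h
  · exact absurd e (tc_lt h h2).ne
  · exact h
  · exact absurd e (tc_lt h h1).ne'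

theorem tc_cont : ContinuousOn tc (Iio 1) :=
  ContinuousOn.div (by fun_prop) (by fun_prop) (fun x hx => by have : x < 1 := hx; exact (by linarith : 0 < 1 - x).ne')

theorem tc_lim : Tendsto tc (𝓝[<] 1) atTop := by
  have h1 : Tendsto (fun τ : ℝ => 1 - τ) (𝓝[<] 1) (𝓝[>] 0) := by
    apply tendsto_nhdsWithin_iff.2
    constructor
    · have : Tendsto (fun τ : ℝ => 1 - τ) (𝓝 1) (𝓝 (1 - 1)) := Continuous.tendsto (by fun_prop) 1
      rw [sub_self] at this
      exact this.mono_left nhdsWithin_le_nhds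
    · filter_upwards [self_mem_nhdsWithin] with τ hτ
      exact sub_pos.2 (show τ < 1 from hτ)
  have h2 := tendsto_inv_nhdsGT_zero.comp h1
  have h3 : Tendsto (fun τ : ℝ => τ) (𝓝[<] 1) (𝓝 1) := nhdsWithin_le_nhds
  exact h3.pos_mul_atTop one_pos h2

/-- ray moved to the disc -/
noncomputable def mv (ρ : ℝ → ℂ) (τ : ℝ) : ℂ := if τ < 1 then Cay (ρ (tc τ)) else 1

namespace UR
variable {ι : Type} {x : ι → ℝ} {ρ ρ' : ι → ℝ → ℂ}

theorem nn (h : UR x ρ) (j : ι) {t : ℝ} (ht : 0 ≤ t) : 0 ≤ (ρ j t).im := by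
  rcases eq_or_lt_of_le ht with e | e
  · rw [← e, h.zero]; simp
  · exact (h.pos j t e).le

theorem xc (h : UR x ρ) (j : ι) : ContinuousOn (mv (ρ j)) (Icc 0 1) := by
  intro τ hτ
  rcases eq_or_lt_of_le hτ.2 with e | e
  · subst e
    have h1 : Tendsto (fun τ => Cay (ρ j (tc τ))) (𝓝[<] 1) (𝓝 1) := Cay_lim.comp ((h.lim j).comp tc_lim)
    have h2 : ContinuousWithinAt (mv (ρ j)) (Iio 1) 1 := by
      have : mv (ρ j) 1 = 1 := by simp [mv]
      rw [ContinuousWithinAt, this]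
      refine h1.congr' ?_
      filter_upwards [self_mem_nhdsWithin] with t ht
      exact (if_pos ht).symm
    have h3 : ContinuousWithinAt (mv (ρ j)) (insert 1 (Iio 1)) 1 := h2.insert
    refine h3.mono ?_
    intro t ht
    rcases eq_or_lt_of_le ht.2 with e | e
    · exact Or.inl e
    · exact Or.inr e
  · have h1 : ContinuousOn (fun τ => Cay (ρ j (tc τ))) (Ico 0 1) := by
      apply Cay_cont.comp ((h.cont j).comp (tc_cont.mono fun t ht => ht.2) (fun t ht => tc_nonneg ht))
      intro t ht; exact h.nn j (tc_nonneg ht)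
    have h2 : ContinuousWithinAt (mv (ρ j)) (Ico 0 1) τ := by
      refine (h1 τ ⟨hτ.1, e⟩).congr (fun t ht => if_pos ht.2) (if_pos e)
    apply h2.mono_of_mem_nhdsWithin
    have : Iio (1:ℝ) ∈ 𝓝[Icc 0 1] τ := mem_nhdsWithin_of_mem_nhds (Iio_mem_nhds e)
    filter_upwards [this, self_mem_nhdsWithin] with t h1 h2
    exact ⟨h2.1, h1⟩

theorem mv_iff (h : UR x ρ) (i j : ι) {s t : ℝ} (hs : s ∈ Icc (0:ℝ) 1) (ht : t ∈ Icc (0:ℝ) 1) :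
    mv (ρ i) s = mv (ρ j) t ↔ (s = 1 ∧ t = 1) ∨ (s < 1 ∧ t < 1 ∧ ρ i (tc s) = ρ j (tc t)) := by
  rcases eq_or_lt_of_le hs.2 with e | e <;> rcases eq_or_lt_of_le ht.2 with e' | e'
  · simp [e, e', mv]
  · have := Cay_ne_one (h.nn j (tc_nonneg ⟨ht.1, e'⟩))
    simp [e, e', mv, e'.ne, this.symm]
  · have := Cay_ne_one (h.nn i (tc_nonneg ⟨hs.1, e⟩))
    simp [e, e', mv, e.ne, this]
  · simp only [mv, e, e', if_true, e.ne, e'.ne, true_and, false_and, false_or]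
    constructor
    · intro hh
      rw [← Dec_Cay (h.nn i (tc_nonneg ⟨hs.1, e⟩)), hh, Dec_Cay (h.nn j (tc_nonneg ⟨ht.1, e'⟩))]
    · intro hh; rw [hh]

theorem mv_mem (h : UR x ρ) {i j : ι} {t : ℝ} (ht : t ∈ Ico (0:ℝ) 1) (hm : mv (ρ j) t ∈ mv (ρ i) '' Icc 0 1) :
    ρ j (tc t) ∈ ρ i '' Ici 0 := by
  obtain ⟨s, hs, e⟩ := hm
  rcases (h.mv_iff i j hs ⟨ht.1, ht.2.le⟩).1 e with ⟨-, h1⟩ | ⟨h1, h2, h3⟩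
  · exact absurd h1 ht.2.ne
  · exact ⟨tc s, tc_nonneg ⟨hs.1, h1⟩, h3⟩

theorem cc (h : UR x ρ) (s : Finset ι) : CC s (fun _ => 0) (fun _ => 1) (fun j => mv (ρ j)) := by
  have hv : ∀ j, ∀ t ∈ Ioo (0:ℝ) 1, ‖mv (ρ j) t‖ < 1 := fun j t ht => by
    rw [mv, if_pos ht.2]; exact Cay_lt (h.pos j _ (tc_pos ht))
  have h0 : ∀ j, mv (ρ j) 0 = Cay (x j) := fun j => by rw [mv, if_pos one_pos]; simp [tc, h.zero]
  constructor
  · simp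
  · exact fun j _ => h.xc j
  · intro j _ u hu v hv e
    rcases (h.mv_iff j j hu hv).1 e with ⟨h1, h2⟩ | ⟨h1, h2, h3⟩
    · rw [h1, h2]
    · exact tc_inj h1 h2 (h.inj j (tc_nonneg ⟨hu.1, h1⟩) (tc_nonneg ⟨hv.1, h2⟩) h3)
  · intro j _; simp only [h0]; exact Cay_eq (by simp)
  · intro j _; simp [mv]
  · exact fun j _ => hv j
  · rintro i _ j _ hij hm
    obtain ⟨s, hs, e⟩ := h.mv_mem ⟨le_rfl, one_pos⟩ hm
    have t0 : tc 0 = 0 := by simp [tc]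
    rw [t0, h.zero] at e
    rcases eq_or_lt_of_le (show 0 ≤ s from hs) with e' | e'
    · rw [← e', h.zero] at e
      exact hij (h.xinj (by exact_mod_cast e))
    · have := h.pos i s e'
      rw [e] at this; simp at this
  · intro i _ j _ hij t ht t' ht' hm hm'
    exact tc_inj ht.2 ht'.2 (h.uniq i j hij _ (tc_pos ht) _ (tc_pos ht') (h.mv_mem ⟨ht.1.le, ht.2⟩ hm) (h.mv_mem ⟨ht'.1.le, ht'.2⟩ hm'))
  · intro i _ j _ hij t u v h1 h2 h3 h4 hm hc
    refine h.cross i j hij (tc t) (tc u) (tc v) (tc_pos ⟨h1, by linarith⟩) (tc_lt h2 (by linarith)) (tc_lt h3 h4)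
      (h.mv_mem ⟨by linarith, by linarith⟩ hm) ?_
    have hd : ∀ u ∈ Ioo (0:ℝ) 1, Dec (mv (ρ j) u) = ρ j (tc u) := fun u hu => by
      rw [mv, if_pos hu.2, Dec_Cay (h.pos j _ (tc_pos hu)).le]
    have := hc.image (G := {z | 0 < z.im} \ ρ i '' Ici 0) (Dec_cont.mono ?_) ?_
    · rwa [hd u ⟨h1, by linarith⟩, hd v ⟨by linarith, h4⟩] at this
    · rintro w hw rfl
      have := hw.1; simp at this
    · intro w hw
      have hw1 : ‖w‖ < 1 := by simpa using hw.1
      refine ⟨Dec_pos hw1, ?_⟩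
      rintro ⟨r, hr, e⟩
      refine hw.2 ⟨ti r, ⟨(ti_mem hr).1, (ti_mem hr).2.le⟩, ?_⟩
      rw [mv, if_pos (ti_mem hr).2, tc_ti hr, e, Cay_Dec]
      rintro rfl; simp at hw1
  · intro i _ j _ k _ h1 h2 h3 t ht hm hm'
    exact h.triple i j k h1 h2 h3 _ (tc_pos ht) (h.mv_mem ⟨ht.1.le, ht.2⟩ hm) (h.mv_mem ⟨ht.1.le, ht.2⟩ hm')

theorem lift_bh {h : ℂ → ℂ} (hh : BH h) : ContinuousOn (fun z => Dec (h (Cay z))) {z | 0 ≤ z.im} ∧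
    (∀ z : ℂ, 0 ≤ z.im → 0 ≤ (Dec (h (Cay z))).im ∧ Cay (Dec (h (Cay z))) = h (Cay z)) ∧
    ∀ z : ℂ, z.im = 0 → Dec (h (Cay z)) = z := by
  have hne : ∀ z : ℂ, 0 ≤ z.im → h (Cay z) ≠ 1 := by
    intro z hz e
    apply Cay_ne_one hz
    apply hh.inj (by simpa using Cay_le hz) (by simp)
    rw [e, hh.idc 1 (by simp)]
  refine ⟨?_, ?_, ?_⟩
  · apply Dec_cont.comp (hh.cont.comp Cay_cont ?_) hne
    intro z hz; simpa using Cay_le hz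
  · exact fun z hz => ⟨Dec_nonneg (hh.norm_le (Cay_le hz)), Cay_Dec (hne z hz)⟩
  · intro z hz; rw [hh.idc _ (Cay_eq hz), Dec_Cay hz.ge]

theorem ext_half [Fintype ι] (h : UR x ρ) (h' : UR x ρ')
    (hm : ∀ i j, ∀ s ∈ Ici (0:ℝ), ∀ t ∈ Ici (0:ℝ), (ρ i s = ρ j t ↔ ρ' i s = ρ' j t)) :
    ∃ H G : ℂ → ℂ, ContinuousOn H {z | 0 ≤ z.im} ∧ ContinuousOn G {z | 0 ≤ z.im} ∧
      (∀ z : ℂ, 0 ≤ z.im → 0 ≤ (H z).im ∧ G (H z) = z) ∧ (∀ z : ℂ, 0 ≤ z.im → 0 ≤ (G z).im ∧ H (G z) = z) ∧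
      (∀ z : ℂ, z.im = 0 → H z = z ∧ G z = z) ∧ ∀ j, ∀ t ∈ Ici (0:ℝ), H (ρ j t) = ρ' j t := by
  have hM : Mat Finset.univ (fun _ => 0) (fun _ => 1) (fun j => mv (ρ j)) (fun j => mv (ρ' j)) := by
    refine ⟨fun j _ => ⟨?_, ?_⟩, fun i _ j _ s hs t ht => ?_⟩
    · simp [mv, tc, h.zero, h'.zero]
    · simp [mv]
    · rw [h.mv_iff i j hs ht, h'.mv_iff i j hs ht]
      refine or_congr Iff.rfl ?_
      constructor
      · rintro ⟨h1, h2, h3⟩; exact ⟨h1, h2, (hm i j _ (tc_nonneg ⟨hs.1, h1⟩) _ (tc_nonneg ⟨ht.1, h2⟩)).1 h3⟩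
      · rintro ⟨h1, h2, h3⟩; exact ⟨h1, h2, (hm i j _ (tc_nonneg ⟨hs.1, h1⟩) _ (tc_nonneg ⟨ht.1, h2⟩)).2 h3⟩
  obtain ⟨k, hk, hke⟩ := ext_disc Finset.univ _ _ _ _ (h.cc _) (h'.cc _) hM
  obtain ⟨l, hl, l1, l2⟩ := hk.inv
  obtain ⟨a1, a2, a3⟩ := lift_bh hk
  obtain ⟨b1, b2, b3⟩ := lift_bh hl
  refine ⟨_, _, a1, b1, fun z hz => ⟨(a2 z hz).1, ?_⟩, fun z hz => ⟨(b2 z hz).1, ?_⟩, fun z hz => ⟨a3 z hz, b3 z hz⟩, ?_⟩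
  · simp only [(a2 z hz).2, l1 _ (Cay_le hz), Dec_Cay hz]
  · simp only [(b2 z hz).2, l2 _ (Cay_le hz), Dec_Cay hz]
  · intro j t ht
    have hm := ti_mem (show 0 ≤ t from ht)
    have := hke j (Finset.mem_univ _) (ti t) ⟨hm.1, hm.2.le⟩
    simp only [mv, hm.2, if_true, tc_ti (show 0 ≤ t from ht)] at this
    simp only [this, Dec_Cay (h'.nn j ht)]
end UR

/-- glueing two half plane maps -/
noncomputable def gl (H K : ℂ → ℂ) (z : ℂ) : ℂ := open Classical in if 0 ≤ z.im then H z else conj (K (conj z))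

theorem gl_up {H K : ℂ → ℂ} {z : ℂ} (hz : 0 ≤ z.im) : gl H K z = H z := if_pos hz
theorem gl_dn {H K : ℂ → ℂ} (h1 : ∀ z : ℂ, z.im = 0 → H z = z) (h2 : ∀ z : ℂ, z.im = 0 → K z = z) {z : ℂ} (hz : z.im ≤ 0) :
    gl H K z = conj (K (conj z)) := by
  by_cases h : 0 ≤ z.im
  · have h0 := le_antisymm hz h
    rw [gl_up h, h1 z h0, h2 _ (by simp [h0])]; simp
  · exact if_neg h

theorem gl_cont {H K : ℂ → ℂ} (h1 : ∀ z : ℂ, z.im = 0 → H z = z) (h2 : ∀ z : ℂ, z.im = 0 → K z = z)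
    (hH : ContinuousOn H {z | 0 ≤ z.im}) (hK : ContinuousOn K {z | 0 ≤ z.im}) : Continuous (gl H K) := by
  rw [← continuousOn_univ]
  have : (univ : Set ℂ) = {z | 0 ≤ z.im} ∪ {z | z.im ≤ 0} := by
    ext z; simpa using le_total 0 z.im
  rw [this]
  apply ContinuousOn.union_of_isClosed
  · exact hH.congr fun z hz => gl_up hz
  · apply ContinuousOn.congr (f := fun z => conj (K (conj z)))
    · apply continuous_conj.comp_continuousOn
      apply hK.comp continuous_conj.continuousOn
      intro z hz
      simpa using hz
    · exact fun z hz => gl_dn h1 h2 hz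
  · exact isClosed_le continuous_const continuous_im
  · exact isClosed_le continuous_im continuous_const

theorem gl_inv {H K G L : ℂ → ℂ} (h1 : ∀ z : ℂ, z.im = 0 → H z = z) (h2 : ∀ z : ℂ, z.im = 0 → K z = z)
    (g1 : ∀ z : ℂ, z.im = 0 → G z = z) (g2 : ∀ z : ℂ, z.im = 0 → L z = z)
    (hH : ∀ z : ℂ, 0 ≤ z.im → 0 ≤ (H z).im ∧ G (H z) = z) (hK : ∀ z : ℂ, 0 ≤ z.im → 0 ≤ (K z).im ∧ L (K z) = z) (z : ℂ) :
    gl G L (gl H K z) = z := by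
  rcases le_total 0 z.im with h | h
  · rw [gl_up h, gl_up (hH z h).1, (hH z h).2]
  · have h' : 0 ≤ (conj z).im := by simpa using h
    have := hK _ h'
    rw [gl_dn h1 h2 h, gl_dn g1 g2 (by simpa using this.1)]
    simp [this.2]

/-- extension theorem in the plane -/
theorem ext_plane {ι : Type} [Fintype ι] {x : ι → ℝ} {γ δ : ι → ℝ → ℂ}
    (u1 : UR x (fun j t => γ j (-t))) (u2 : UR x (fun j t => δ j (-t)))
    (l1 : UR x (fun j t => conj (γ j t))) (l2 : UR x (fun j t => conj (δ j t)))
    (hm : ∀ i j s t, γ i s = γ j t ↔ δ i s = δ j t) :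
    ∃ h : ℂ ≃ₜ ℂ, (∀ z : ℂ, z.im = 0 → h z = z) ∧ ∀ j t, h (γ j t) = δ j t := by
  obtain ⟨H, G, a1, a2, a3, a4, a5, a6⟩ := u1.ext_half u2 (fun i j s _ t _ => hm i j _ _)
  obtain ⟨K, L, b1, b2, b3, b4, b5, b6⟩ := l1.ext_half l2 (fun i j s _ t _ => by
    rw [(starRingEnd ℂ).injective.eq_iff, (starRingEnd ℂ).injective.eq_iff]; exact hm i j _ _)
  have i1 := fun z hz => (a5 z hz).1
  have i2 := fun z hz => (b5 z hz).1
  have i3 := fun z hz => (a5 z hz).2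
  have i4 := fun z hz => (b5 z hz).2
  refine ⟨⟨⟨gl H K, gl G L, gl_inv i1 i2 i3 i4 a3 b3, gl_inv i3 i4 i1 i2 a4 b4⟩, gl_cont i1 i2 a1 b1, gl_cont i3 i4 a2 b2⟩, ?_, ?_⟩
  · intro z hz
    change gl H K z = z
    rw [gl_up hz.ge, i1 z hz]
  · intro j t
    change gl H K (γ j t) = δ j t
    rcases le_total t 0 with ht | ht
    · have h1 := u1.nn j (t := -t) (by linarith)
      have h2 := a6 j (-t) (show 0 ≤ -t by linarith)
      simp only [neg_neg] at h1 h2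
      rw [gl_up h1, h2]
    · have h1 := l1.nn j (t := t) ht
      have h2 := b6 j t ht
      rw [gl_dn i1 i2 (by simpa using h1), h2]; simp
end CPR

open Set
namespace CPR
open Complex Metric Topology Filter
open scoped ComplexConjugate

theorem flip_one {p q c : ℝ} {σ : ℝ → ℝ} (hc : ContinuousOn σ (Icc p q)) (h1 : p < c) (h2 : c < q)
    (hz : ∀ t ∈ Icc p q, σ t = 0 → t = c)
    (hl : ∃ ε > 0, ∀ u ∈ Ioo (c - ε) c, ∀ v ∈ Ioo c (c + ε), ¬ 0 < σ u * σ v) : σ p * σ q < 0 := by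
  obtain ⟨ε, hε, hl⟩ := hl
  obtain ⟨u, hu1, hu2⟩ := exists_between (max_lt h1 (show c - ε < c by linarith))
  obtain ⟨v, hv1, hv2⟩ := exists_between (lt_min h2 (show c < c + ε by linarith))
  have hu := max_lt_iff.1 hu1
  have hv := lt_min_iff.1 hv2
  have a1 : 0 < σ p * σ u := same_sign (hc.mono (Icc_subset_Icc le_rfl (by linarith))) hu.1.le
    (fun t ht e => by have := hz t ⟨ht.1, by linarith [ht.2]⟩ e; linarith [ht.2])
  have a2 : 0 < σ v * σ q := same_sign (hc.mono (Icc_subset_Icc (by linarith) le_rfl)) hv.1.le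
    (fun t ht e => by have := hz t ⟨by linarith [ht.1], ht.2⟩ e; linarith [ht.1])
  have a3 := not_lt.1 (hl u ⟨hu.2, hu2⟩ v ⟨hv1, hv.2⟩)
  have a4 : σ u ≠ 0 := fun e => by rw [e, mul_zero] at a1; exact a1.false
  have a5 : σ v ≠ 0 := fun e => by rw [e, zero_mul] at a2; exact a2.false
  have a6 : σ u * σ v < 0 := lt_of_le_of_ne a3 (mul_ne_zero a4 a5)
  by_contra h
  have h' := not_lt.1 h
  have := mul_pos a1 a2
  nlinarith [mul_nonneg h' (neg_nonneg.2 a6.le)]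

theorem flip_two {p q c d : ℝ} {σ : ℝ → ℝ} (hc : ContinuousOn σ (Icc p q)) (h1 : p < c) (h3 : c < d) (h2 : d < q)
    (hz : ∀ t ∈ Icc p q, σ t = 0 → t = c ∨ t = d)
    (hl : ∃ ε > 0, ∀ u ∈ Ioo (c - ε) c, ∀ v ∈ Ioo c (c + ε), ¬ 0 < σ u * σ v)
    (hl' : ∃ ε > 0, ∀ u ∈ Ioo (d - ε) d, ∀ v ∈ Ioo d (d + ε), ¬ 0 < σ u * σ v) : 0 < σ p * σ q := by
  obtain ⟨m, hm1, hm2⟩ := exists_between h3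
  have a1 := flip_one (q := m) (hc.mono (Icc_subset_Icc le_rfl (by linarith))) h1 hm1
    (fun t ht e => (hz t ⟨ht.1, by linarith [ht.2]⟩ e).resolve_right (by linarith [ht.2] : t < d).ne) hl
  have a2 := flip_one (p := m) (hc.mono (Icc_subset_Icc (by linarith) le_rfl)) hm2 h2
    (fun t ht e => (hz t ⟨by linarith [ht.1], ht.2⟩ e).resolve_left (by linarith [ht.1] : c < t).ne') hl'
  have := mul_pos_of_neg_of_neg a1 a2
  by_contra h
  have h' := not_lt.1 h
  nlinarith [mul_self_nonneg (σ m)]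

section
variable {ι : Type} {s : Finset ι} {α : ι → ℝ → ℂ}

theorem local_flip (h : CC s (fun _ => 0) (fun _ => 1) α) {P : ℝ → ℂ} (hP : XC P) {h' g : ℂ → ℂ} (hh : BH h') (hg : BH g)
    (hhe : ∀ t ∈ Icc (0:ℝ) 1, h' (P 0 + t * (P 1 - P 0)) = P t) (hgh : ∀ z, ‖z‖ ≤ 1 → h' (g z) = z)
    {i k : ι} (hi : i ∈ s) (hk : k ∈ s) (hik : i ≠ k) {S τ : ℝ} (hτ : τ ∈ Ioo (0:ℝ) 1) (hS : S ∈ Icc (0:ℝ) 1)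
    (hm : α k τ ∈ α i '' Ico 0 S) (hiP : α i '' Icc 0 S ⊆ P '' Icc 0 1) :
    ∃ ε > 0, ∀ u ∈ Ioo (τ - ε) τ, ∀ v ∈ Ioo τ (τ + ε), ¬ 0 < chl (P 0) (P 1) (g (α k u)) * chl (P 0) (P 1) (g (α k v)) := by
  set a := P 0 with ha
  set b := P 1 with hb
  set E := α i '' Icc S 1 with hE
  have hEc : IsClosed E := (isCompact_Icc.image_of_continuousOn ((h.cont i hi).mono (Icc_subset_Icc hS.1 le_rfl))).isClosed
  have hmE : α k τ ∉ E := by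
    obtain ⟨u, hu, e⟩ := hm
    rintro ⟨w, hw, e'⟩
    have := h.inj i hi ⟨hu.1, by linarith [hu.2, hS.2]⟩ ⟨by linarith [hw.1, hS.1], hw.2⟩ (e.trans e'.symm)
    linarith [hu.2, hw.1]
  have hmA : α k τ ∈ α i '' Icc 0 1 := image_mono (show Ico 0 S ⊆ Icc (0:ℝ) 1 from fun u hu => ⟨hu.1, by linarith [hu.2, hS.2]⟩) hm
  have nk := h.ib k hk τ hτ
  have nz := hg.norm_lt nk
  have hcont : ContinuousAt h' (g (α k τ)) := hh.cont.continuousAt (mem_of_superset (isOpen_ball.mem_nhds (by simpa using nz)) ball_subset_closedBall)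
  have hev : ∀ᶠ z in 𝓝 (g (α k τ)), h' z ∉ E := by
    have h0 : ∀ᶠ y in 𝓝 (h' (g (α k τ))), y ∉ E := by
      rw [hgh _ nk.le]; exact hEc.isOpen_compl.mem_nhds hmE
    exact hcont.eventually h0
  have hev2 : ∀ᶠ z in 𝓝 (g (α k τ)), z ∈ ball (0:ℂ) 1 := isOpen_ball.mem_nhds (by simpa using nz)
  obtain ⟨ε1, hε1, hb1⟩ := Metric.eventually_nhds_iff_ball.1 (hev.and hev2)
  have hcα : ContinuousAt (fun t => g (α k t)) τ :=
    (hg.cont.comp (h.cont k hk) (fun t ht => by simpa using h.mem hk ht)).continuousAt (Icc_mem_nhds hτ.1 hτ.2)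
  obtain ⟨ε2, hε2, hb2⟩ := Metric.continuousAt_iff.1 hcα ε1 hε1
  refine ⟨min ε2 (min τ (1 - τ)), lt_min hε2 (lt_min hτ.1 (by linarith [hτ.2])), ?_⟩
  intro u hu v hv hpos
  have m1 := min_le_left ε2 (min τ (1 - τ))
  have m2 := (min_le_right ε2 (min τ (1 - τ))).trans (min_le_left _ _)
  have m3 := (min_le_right ε2 (min τ (1 - τ))).trans (min_le_right _ _)
  have hu' := hb2 (show dist u τ < ε2 by rw [Real.dist_eq, abs_lt]; constructor <;> linarith [hu.1, hu.2])
  have hv' := hb2 (show dist v τ < ε2 by rw [Real.dist_eq, abs_lt]; constructor <;> linarith [hv.1, hv.2])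
  have u0 : 0 < u := by linarith [hu.1]
  have v1 : v < 1 := by linarith [hv.2]
  apply h.cross i hi k hk hik τ u v u0 hu.2 hv.1 v1 hmA
  have key : ∀ a' b', (∀ z, chl a' b' z ≠ 0 → chl a b z ≠ 0) → 0 < chl a' b' (g (α k u)) → 0 < chl a' b' (g (α k v)) →
      Conn (ball 0 1 \ α i '' Icc 0 1) (α k u) (α k v) := by
    intro a' b' hz pu pv
    have c0 : Conn (ball (g (α k τ)) ε1 ∩ {z | 0 < chl a' b' z}) (g (α k u)) (g (α k v)) :=
      ⟨_, ((convex_ball _ _).inter (pos_convex a' b')).isPreconnected, Subset.rfl, ⟨hu', pu⟩, ⟨hv', pv⟩⟩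
    have c1 := c0.image (G := ball 0 1 \ α i '' Icc 0 1) (f := h') (hh.cont.mono fun z hz => ball_subset_closedBall (hb1 z hz.1).2) ?_
    · rwa [hgh _ (h.mem hk ⟨u0.le, by linarith [hu.2, hτ.2]⟩), hgh _ (h.mem hk ⟨by linarith [hv.1, hτ.1], v1.le⟩)] at c1
    · intro z hzz
      have hz1 : ‖z‖ < 1 := by simpa using (hb1 z hzz.1).2
      refine ⟨by simpa using hh.norm_lt hz1, ?_⟩
      rintro ⟨w, hw, e⟩
      rcases le_total w S with hwS | hwS
      · obtain ⟨t, ht, e2⟩ := hiP ⟨w, ⟨hw.1, hwS⟩, rfl⟩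
        rw [e, ← hhe t ht] at e2
        have := hh.inj (by simpa using chord_mem_closed hP.s0 hP.s1 ht) (by simpa using hz1.le) e2
        refine hz z (ne_of_gt hzz.2) ?_
        rw [← this]; exact chl_line a b t
      · exact (hb1 z hzz.1).1 ⟨w, ⟨hwS, hw.2⟩, e⟩
  rcases lt_or_ge 0 (chl a b (g (α k u))) with hs | hs
  · exact key a b (fun _ => id) hs ((pos_iff_pos_of_mul_pos hpos).1 hs)
  · refine key b a (fun z hz => ?_) ?_ ?_
    · rw [chl_swap] at hz; simpa using hz
    · rw [chl_swap]
      rcases eq_or_lt_of_le hs with h0 | h0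
      · rw [h0, zero_mul] at hpos; exact absurd hpos (lt_irrefl _)
      · linarith
    · rw [chl_swap]; by_contra h5; nlinarith

theorem parity_disc (h : CC s (fun _ => 0) (fun _ => 1) α) {i j k : ι} (hi : i ∈ s) (hj : j ∈ s) (hk : k ∈ s)
    (hij : i ≠ j) (hik : i ≠ k) (hjk : j ≠ k) {S T : ℝ} (hS : S ∈ Ioo (0:ℝ) 1) (hT : T ∈ Ioo (0:ℝ) 1) (hST : α i S = α j T) :
    0 < chl (α i 0) (α j 0) (α k 0) * chl (α i 0) (α j 0) (α k 1) ↔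
      ((∃ τ ∈ Ioo (0:ℝ) 1, α k τ ∈ α i '' Ico 0 S) ↔ (∃ τ ∈ Ioo (0:ℝ) 1, α k τ ∈ α j '' Ico 0 T)) := by
  classical
  have meet : ∀ u ∈ Icc (0:ℝ) 1, ∀ v ∈ Icc (0:ℝ) 1, v < 1 → α i u = α j v → u = S ∧ v = T := by
    intro u hu v hv hv1 e
    have hv0 : 0 < v := by
      rcases eq_or_lt_of_le hv.1 with h0 | h0
      · exact absurd ⟨u, hu, by rw [e, ← h0]⟩ (h.np' i hi j hj hij)
      · exact h0
    have h2 := h.uniq i hi j hj hij v ⟨hv0, hv1⟩ T hT ⟨u, hu, e⟩ ⟨S, ⟨hS.1.le, hS.2.le⟩, hST⟩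
    refine ⟨h.inj i hi hu ⟨hS.1.le, hS.2.le⟩ ?_, h2⟩
    rw [e, h2, hST]
  let P : ℝ → ℂ := fun τ => if τ ≤ 1 / 2 then α i (2 * τ * S) else α j ((2 - 2 * τ) * T)
  have P1 : ∀ τ, τ ≤ 1 / 2 → P τ = α i (2 * τ * S) := fun τ hτ => if_pos hτ
  have P2 : ∀ τ, 1 / 2 ≤ τ → P τ = α j ((2 - 2 * τ) * T) := by
    intro τ hτ
    rcases eq_or_lt_of_le hτ with e | e
    · rw [P1 τ e.ge, ← e]; norm_num [hST]
    · exact if_neg (not_le.2 e)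
  have r1 : ∀ τ ∈ Icc (0:ℝ) (1 / 2), 2 * τ * S ∈ Icc (0:ℝ) S := fun τ hτ => by
    have := hS.1
    constructor
    · have := hτ.1; positivity
    · nlinarith [hτ.2]
  have r2 : ∀ τ ∈ Icc (1 / 2 : ℝ) 1, (2 - 2 * τ) * T ∈ Icc (0:ℝ) T := fun τ hτ => by
    have := hT.1
    constructor
    · exact mul_nonneg (by linarith [hτ.2]) this.le
    · nlinarith [hτ.1]
  have sS : ∀ u ∈ Icc (0:ℝ) S, u ∈ Icc (0:ℝ) 1 := fun u hu => ⟨hu.1, by linarith [hu.2, hS.2]⟩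
  have sT : ∀ u ∈ Icc (0:ℝ) T, u ∈ Icc (0:ℝ) 1 := fun u hu => ⟨hu.1, by linarith [hu.2, hT.2]⟩
  have P0 : P 0 = α i 0 := by rw [P1 0 (by norm_num)]; simp
  have Pe : P 1 = α j 0 := by rw [P2 1 (by norm_num)]; simp
  have hPx : XC P := by
    constructor
    · have : Icc (0:ℝ) 1 = Icc 0 (1 / 2) ∪ Icc (1 / 2) 1 := (Icc_union_Icc_eq_Icc (by norm_num) (by norm_num)).symm
      rw [this]
      apply ContinuousOn.union_of_isClosed
      · refine ContinuousOn.congr (f := fun τ => α i (2 * τ * S)) ?_ (fun τ hτ => P1 τ hτ.2)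
        exact (h.cont i hi).comp (by fun_prop) (fun τ hτ => sS _ (r1 τ hτ))
      · refine ContinuousOn.congr (f := fun τ => α j ((2 - 2 * τ) * T)) ?_ (fun τ hτ => P2 τ hτ.1)
        exact (h.cont j hj).comp (by fun_prop) (fun τ hτ => sT _ (r2 τ hτ))
      · exact isClosed_Icc
      · exact isClosed_Icc
    · have key : ∀ u ∈ Icc (0:ℝ) (1 / 2), ∀ v ∈ Icc (1 / 2 : ℝ) 1, P u = P v → u = v := by
        intro u hu v hv e
        rw [P1 u hu.2, P2 v hv.1] at e
        have := meet _ (sS _ (r1 u hu)) _ (sT _ (r2 v hv)) (by linarith [(r2 v hv).2, hT.2]) e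
        have e1 : u = 1 / 2 := by have := mul_right_cancel₀ hS.1.ne' (this.1.trans (one_mul S).symm); linarith
        have e2 : v = 1 / 2 := by have := mul_right_cancel₀ hT.1.ne' (this.2.trans (one_mul T).symm); linarith
        rw [e1, e2]
      intro u hu v hv e
      rcases le_total u (1 / 2) with hu2 | hu2 <;> rcases le_total v (1 / 2) with hv2 | hv2
      · rw [P1 u hu2, P1 v hv2] at e
        have := h.inj i hi (sS _ (r1 u ⟨hu.1, hu2⟩)) (sS _ (r1 v ⟨hv.1, hv2⟩)) e
        have := mul_right_cancel₀ hS.1.ne' this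
        linarith
      · exact key u ⟨hu.1, hu2⟩ v ⟨hv2, hv.2⟩ e
      · exact (key v ⟨hv.1, hv2⟩ u ⟨hu2, hu.2⟩ e.symm).symm
      · rw [P2 u hu2, P2 v hv2] at e
        have := h.inj j hj (sT _ (r2 u ⟨hu2, hu.2⟩)) (sT _ (r2 v ⟨hv2, hv.2⟩)) e
        have := mul_right_cancel₀ hT.1.ne' this
        linarith
    · rw [P0]; exact h.np i hi
    · rw [Pe]; exact h.np j hj
    · intro t ht
      rcases le_total t (1 / 2) with h2 | h2
      · rw [P1 t h2]
        apply h.ib i hi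
        have := r1 t ⟨ht.1.le, h2⟩
        exact ⟨by have := mul_pos ht.1 hS.1; linarith, by linarith [this.2, hS.2]⟩
      · rw [P2 t h2]
        apply h.ib j hj
        have := r2 t ⟨h2, ht.2.le⟩
        exact ⟨mul_pos (by linarith [ht.2]) hT.1, by linarith [this.2, hT.2]⟩
  have im1 : α i '' Icc 0 S ⊆ P '' Icc 0 1 := by
    rintro _ ⟨u, hu, rfl⟩
    have h1 : u / S ≤ 1 := (div_le_one hS.1).2 hu.2
    have h0 : 0 ≤ u / S := div_nonneg hu.1 hS.1.le
    refine ⟨u / S / 2, ⟨by linarith, by linarith⟩, ?_⟩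
    rw [P1 _ (by linarith)]; congr 1; field_simp [hS.1.ne']
  have im2 : α j '' Icc 0 T ⊆ P '' Icc 0 1 := by
    rintro _ ⟨u, hu, rfl⟩
    have h1 : u / T ≤ 1 := (div_le_one hT.1).2 hu.2
    have h0 : 0 ≤ u / T := div_nonneg hu.1 hT.1.le
    refine ⟨1 - u / T / 2, ⟨by linarith, by linarith⟩, ?_⟩
    rw [P2 _ (by linarith)]; congr 1
    have : T ≠ 0 := hT.1.ne'
    field_simp; ring
  have im3 : P '' Icc 0 1 ⊆ α i '' Icc 0 S ∪ α j '' Icc 0 T := by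
    rintro _ ⟨t, ht, rfl⟩
    rcases le_total t (1 / 2) with h2 | h2
    · left; rw [P1 t h2]; exact ⟨_, r1 t ⟨ht.1, h2⟩, rfl⟩
    · right; rw [P2 t h2]; exact ⟨_, r2 t ⟨h2, ht.2⟩, rfl⟩
  obtain ⟨h', hh, hhe⟩ := straighten hPx
  obtain ⟨g, hg, g1, g2⟩ := hh.inv
  let σ : ℝ → ℝ := fun τ => chl (P 0) (P 1) (g (α k τ))
  have hσc : ContinuousOn σ (Icc 0 1) :=
    (chl_cont _ _).comp_continuousOn (hg.cont.comp (h.cont k hk) (fun t ht => by simpa using h.mem hk ht))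
  have zP : ∀ τ ∈ Icc (0:ℝ) 1, (σ τ = 0 ↔ α k τ ∈ P '' Icc 0 1) := by
    intro τ hτ
    have hn := h.mem hk hτ
    constructor
    · intro h0
      obtain ⟨t, ht, e⟩ := chord_of_chl hPx.s0 hPx.s1 hPx.ne (hg.norm_le hn) h0
      refine ⟨t, ht, ?_⟩
      rw [← hhe t ht, ← e, g2 _ hn]
    · rintro ⟨t, ht, e⟩
      have : g (α k τ) = P 0 + t * (P 1 - P 0) := by
        rw [← e, ← hhe t ht, g1 _ (by simpa using chord_mem_closed hPx.s0 hPx.s1 ht)]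
      change chl _ _ (g (α k τ)) = 0
      rw [this]; exact chl_line _ _ _
  have inI : ∀ τ ∈ Icc (0:ℝ) 1, σ τ = 0 → τ ∈ Ioo (0:ℝ) 1 := by
    intro τ hτ h0
    have hm := im3 ((zP τ hτ).1 h0)
    constructor
    · rcases eq_or_lt_of_le hτ.1 with e | e
      · rw [← e] at hm
        rcases hm with hm | hm
        · exact absurd (image_mono sS hm) (h.np' i hi k hk hik)
        · exact absurd (image_mono sT hm) (h.np' j hj k hk hjk)
      · exact e
    · rcases eq_or_lt_of_le hτ.2 with e | e
      · rw [e] at hm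
        have hn := h.nq k hk
        have hkm : ∀ l ∈ s, l ≠ k → ∀ S ∈ Ioo (0:ℝ) 1, α k 1 ∉ α l '' Icc 0 S := by
          rintro l hl hlk S hS ⟨u, hu, e2⟩
          rcases eq_or_lt_of_le hu.1 with h3 | h3
          · rw [← h3] at e2
            exact h.np' k hk l hl hlk.symm ⟨1, ⟨zero_le_one, le_rfl⟩, e2.symm⟩
          · have := h.ib l hl u ⟨h3, by linarith [hu.2, hS.2]⟩
            rw [e2] at this; linarith
        rcases hm with hm | hm
        · exact absurd hm (hkm i hi hik S hS)
        · exact absurd hm (hkm j hj hjk T hT)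
      · exact e
  have toI : ∀ τ ∈ Ioo (0:ℝ) 1, α k τ ∈ α i '' Icc 0 S → α k τ ∈ α i '' Ico 0 S := by
    rintro τ hτ ⟨u, hu, e⟩
    refine ⟨u, ⟨hu.1, lt_of_le_of_ne hu.2 ?_⟩, e⟩
    rintro rfl
    exact h.triple i hi k hk j hj hik hij hjk.symm τ hτ ⟨u, sS u hu, e⟩ ⟨T, ⟨hT.1.le, hT.2.le⟩, by rw [← hST, e]⟩
  have toJ : ∀ τ ∈ Ioo (0:ℝ) 1, α k τ ∈ α j '' Icc 0 T → α k τ ∈ α j '' Ico 0 T := by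
    rintro τ hτ ⟨u, hu, e⟩
    refine ⟨u, ⟨hu.1, lt_of_le_of_ne hu.2 ?_⟩, e⟩
    rintro rfl
    exact h.triple i hi k hk j hj hik hij hjk.symm τ hτ ⟨S, ⟨hS.1.le, hS.2.le⟩, by rw [hST, e]⟩ ⟨u, sT u hu, e⟩
  have lI : ∀ τ ∈ Ioo (0:ℝ) 1, α k τ ∈ α i '' Ico 0 S → _ := fun τ hτ hm =>
    local_flip h hPx hh hg hhe g2 hi hk hik hτ ⟨hS.1.le, hS.2.le⟩ hm im1
  have lJ : ∀ τ ∈ Ioo (0:ℝ) 1, α k τ ∈ α j '' Ico 0 T → _ := fun τ hτ hm =>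
    local_flip h hPx hh hg hhe g2 hj hk hjk hτ ⟨hT.1.le, hT.2.le⟩ hm im2
  have bI : α i '' Ico 0 S ⊆ α i '' Icc 0 1 := image_mono fun u hu => sS u ⟨hu.1, hu.2.le⟩
  have bJ : α j '' Ico 0 T ⊆ α j '' Icc 0 1 := image_mono fun u hu => sT u ⟨hu.1, hu.2.le⟩
  have zz : ∀ τ ∈ Icc (0:ℝ) 1, σ τ = 0 → τ ∈ Ioo (0:ℝ) 1 ∧ (α k τ ∈ α i '' Ico 0 S ∨ α k τ ∈ α j '' Ico 0 T) := by
    intro τ hτ h0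
    have hI := inI τ hτ h0
    exact ⟨hI, (im3 ((zP τ hτ).1 h0)).imp (toI τ hI) (toJ τ hI)⟩
  have uI : ∀ c ∈ Ioo (0:ℝ) 1, ∀ d ∈ Ioo (0:ℝ) 1, α k c ∈ α i '' Ico 0 S → α k d ∈ α i '' Ico 0 S → c = d :=
    fun c hc d hd h1 h2 => h.uniq i hi k hk hik c hc d hd (bI h1) (bI h2)
  have uJ : ∀ c ∈ Ioo (0:ℝ) 1, ∀ d ∈ Ioo (0:ℝ) 1, α k c ∈ α j '' Ico 0 T → α k d ∈ α j '' Ico 0 T → c = d :=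
    fun c hc d hd h1 h2 => h.uniq j hj k hk hjk c hc d hd (bJ h1) (bJ h2)
  have goal : 0 < σ 0 * σ 1 ↔
      ((∃ τ ∈ Ioo (0:ℝ) 1, α k τ ∈ α i '' Ico 0 S) ↔ (∃ τ ∈ Ioo (0:ℝ) 1, α k τ ∈ α j '' Ico 0 T)) := by
    by_cases hI : ∃ τ ∈ Ioo (0:ℝ) 1, α k τ ∈ α i '' Ico 0 S <;> by_cases hJ : ∃ τ ∈ Ioo (0:ℝ) 1, α k τ ∈ α j '' Ico 0 T
    · simp only [hI, hJ, iff_true]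
      obtain ⟨c, hc, hcm⟩ := hI
      obtain ⟨d, hd, hdm⟩ := hJ
      rcases lt_trichotomy c d with hcd | hcd | hcd
      · exact flip_two hσc hc.1 hcd hd.2 (fun t ht e => by
          obtain ⟨h1, h2⟩ := zz t ht e
          exact h2.imp (fun h3 => uI t h1 c hc h3 hcm) (fun h3 => uJ t h1 d hd h3 hdm)) (lI c hc hcm) (lJ d hd hdm)
      · subst hcd
        exact absurd (bJ hdm) (h.triple i hi k hk j hj hik hij hjk.symm c hc (bI hcm))
      · exact flip_two hσc hd.1 hcd hc.2 (fun t ht e => by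
          obtain ⟨h1, h2⟩ := zz t ht e
          exact h2.symm.imp (fun h3 => uJ t h1 d hd h3 hdm) (fun h3 => uI t h1 c hc h3 hcm)) (lJ d hd hdm) (lI c hc hcm)
    · simp only [hI, hJ, iff_false, not_true, not_lt]
      obtain ⟨c, hc, hcm⟩ := hI
      exact (flip_one hσc hc.1 hc.2 (fun t ht e => by
          obtain ⟨h1, h2⟩ := zz t ht e
          rcases h2 with h3 | h3
          · exact uI t h1 c hc h3 hcm
          · exact absurd ⟨t, h1, h3⟩ hJ) (lI c hc hcm)).le
    · simp only [hI, hJ, false_iff, iff_true, iff_false, not_true, not_lt]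
      obtain ⟨c, hc, hcm⟩ := hJ
      exact (flip_one hσc hc.1 hc.2 (fun t ht e => by
          obtain ⟨h1, h2⟩ := zz t ht e
          rcases h2 with h3 | h3
          · exact absurd ⟨t, h1, h3⟩ hI
          · exact uJ t h1 c hc h3 hcm) (lJ c hc hcm)).le
    · simp only [hI, hJ, iff_true]
      exact same_sign hσc zero_le_one (fun t ht e => by
        obtain ⟨h1, h2 | h2⟩ := zz t ht e
        · exact hI ⟨t, h1, h2⟩
        · exact hJ ⟨t, h1, h2⟩)
  have e0 : σ 0 = chl (α i 0) (α j 0) (α k 0) := by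
    simp only [σ, P0, Pe, hg.idc _ (h.np k hk)]
  have e1 : σ 1 = chl (α i 0) (α j 0) (α k 1) := by
    simp only [σ, P0, Pe, hg.idc _ (h.nq k hk)]
  rw [e0, e1] at goal
  exact goal
end

theorem chl_cay (a b x : ℝ) : chl (Cay a) (Cay b) (Cay x) = 4 * (x - a) * (b - a) * (x - b) / ((x ^ 2 + 1) * (a ^ 2 + 1) * (b ^ 2 + 1)) := by
  have h : ∀ y : ℝ, Cay y = (((y ^ 2 - 1) / (y ^ 2 + 1) : ℝ) : ℂ) + ((-2 * y / (y ^ 2 + 1) : ℝ) : ℂ) * I := by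
    intro y
    have h1 : (y : ℂ) + I ≠ 0 := add_I_ne (by simp)
    have h2 : ((y : ℂ) ^ 2 + 1) ≠ 0 := by
      have : (y ^ 2 + 1 : ℝ) ≠ 0 := by positivity
      exact_mod_cast this
    rw [Cay]; push_cast
    field_simp
    ring_nf
    simp [I_sq, show I ^ 3 = -I by rw [pow_succ, I_sq]; ring]
    ring
  have hx : x ^ 2 + 1 ≠ 0 := by positivity
  have ha : a ^ 2 + 1 ≠ 0 := by positivity
  have hb : b ^ 2 + 1 ≠ 0 := by positivity
  rw [h, h, h]
  simp only [chl, map_sub, map_add, map_mul, conj_ofReal, conj_I, mul_im, sub_re, sub_im, add_re, add_im, mul_re, ofReal_re, ofReal_im, I_re, I_im, neg_re, neg_im]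
  field_simp
  ring

theorem chl_cay_one (a b : ℝ) : chl (Cay a) (Cay b) 1 = 4 * (b - a) / ((a ^ 2 + 1) * (b ^ 2 + 1)) := by
  have h : ∀ y : ℝ, Cay y = (((y ^ 2 - 1) / (y ^ 2 + 1) : ℝ) : ℂ) + ((-2 * y / (y ^ 2 + 1) : ℝ) : ℂ) * I := by
    intro y
    have h1 : (y : ℂ) + I ≠ 0 := add_I_ne (by simp)
    have h2 : ((y : ℂ) ^ 2 + 1) ≠ 0 := by
      have : (y ^ 2 + 1 : ℝ) ≠ 0 := by positivity
      exact_mod_cast this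
    rw [Cay]; push_cast
    field_simp
    ring_nf
    simp [I_sq, show I ^ 3 = -I by rw [pow_succ, I_sq]; ring]
    ring
  have ha : a ^ 2 + 1 ≠ 0 := by positivity
  have hb : b ^ 2 + 1 ≠ 0 := by positivity
  rw [h, h]
  simp only [chl, map_sub, map_add, map_mul, conj_ofReal, conj_I, mul_im, sub_re, sub_im, add_re, add_im, mul_re, ofReal_re, ofReal_im, I_re, I_im, neg_re, neg_im, one_re, one_im]
  field_simp
  ring

theorem UR.parity {ι : Type} [Fintype ι] {x : ι → ℝ} {ρ : ι → ℝ → ℂ} (h : UR x ρ) {i j k : ι} (hij : i ≠ j) (hik : i ≠ k) (hjk : j ≠ k)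
    {s t : ℝ} (hs : 0 < s) (ht : 0 < t) (he : ρ i s = ρ j t) :
    0 < (x k - x i) * (x k - x j) ↔
      ((∃ u ∈ Ioo 0 s, ρ i u ∈ ρ k '' Ici 0) ↔ (∃ v ∈ Ioo 0 t, ρ j v ∈ ρ k '' Ici 0)) := by
  have hsm := ti_mem hs.le
  have htm := ti_mem ht.le
  have hs0 : 0 < ti s := div_pos hs (by linarith)
  have ht0 : 0 < ti t := div_pos ht (by linarith)
  have key : ∀ i k s, i ≠ k → 0 < s → ((∃ τ ∈ Ioo (0:ℝ) 1, mv (ρ k) τ ∈ mv (ρ i) '' Ico 0 (ti s)) ↔ ∃ u ∈ Ioo 0 s, ρ i u ∈ ρ k '' Ici 0) := by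
    intro i k s hik hs
    have hsm := ti_mem hs.le
    constructor
    · rintro ⟨τ, hτ, w, hw, e⟩
      rcases (h.mv_iff i k ⟨hw.1, by linarith [hw.2, hsm.2]⟩ ⟨hτ.1.le, hτ.2.le⟩).1 e with ⟨-, h1⟩ | ⟨h1, h2, h3⟩
      · exact absurd h1 hτ.2.ne
      · refine ⟨tc w, ⟨?_, ?_⟩, tc τ, tc_nonneg ⟨hτ.1.le, hτ.2⟩, h3.symm⟩
        · rcases eq_or_lt_of_le (tc_nonneg ⟨hw.1, h1⟩) with h4 | h4
          · have := h.pos k _ (tc_pos hτ)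
            rw [← h3, ← h4, h.zero] at this; simp at this
          · exact h4
        · have := tc_lt hw.2 hsm.2
          rwa [tc_ti hs.le] at this
    · rintro ⟨u, hu, r, hr, e⟩
      have hr0 : 0 < r := by
        rcases eq_or_lt_of_le (show 0 ≤ r from hr) with h4 | h4
        · have := h.pos i u hu.1
          rw [← e, ← h4, h.zero] at this; simp at this
        · exact h4
      have hum := ti_mem hu.1.le
      have hrm := ti_mem hr0.le
      refine ⟨ti r, ⟨div_pos hr0 (by linarith), hrm.2⟩, ti u, ⟨hum.1, ?_⟩, ?_⟩
      · by_contra hcon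
        rcases eq_or_lt_of_le (not_lt.1 hcon) with h5 | h5
        · have := congrArg tc h5
          rw [tc_ti hs.le, tc_ti hu.1.le] at this
          linarith [hu.2]
        · have := tc_lt h5 hum.2
          rw [tc_ti hs.le, tc_ti hu.1.le] at this
          linarith [hu.2]
      · rw [mv, mv, if_pos hum.2, if_pos hrm.2, tc_ti hu.1.le, tc_ti hr0.le, e]
  have hp := parity_disc (h.cc Finset.univ) (Finset.mem_univ i) (Finset.mem_univ j) (Finset.mem_univ k) hij hik hjk
    ⟨hs0, hsm.2⟩ ⟨ht0, htm.2⟩ (by simp only [mv, if_pos hsm.2, if_pos htm.2, tc_ti hs.le, tc_ti ht.le, he])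
  rw [key i k s hik hs, key j k t hjk ht] at hp
  rw [← hp]
  have h0 : ∀ j, mv (ρ j) 0 = Cay (x j) := fun j => by rw [mv, if_pos one_pos]; simp [tc, h.zero]
  have h1 : ∀ j, mv (ρ j) 1 = 1 := fun j => by simp [mv]
  rw [h0, h0, h0, h1, chl_cay, chl_cay_one]
  have hba : x j - x i ≠ 0 := sub_ne_zero.2 fun e => hij (h.xinj e.symm)
  have e : 4 * (x k - x i) * (x j - x i) * (x k - x j) / ((x k ^ 2 + 1) * (x i ^ 2 + 1) * (x j ^ 2 + 1)) *
      (4 * (x j - x i) / ((x i ^ 2 + 1) * (x j ^ 2 + 1))) =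
      ((x k - x i) * (x k - x j)) * (16 * (x j - x i) ^ 2 / ((x k ^ 2 + 1) * (x i ^ 2 + 1) * (x j ^ 2 + 1) * ((x i ^ 2 + 1) * (x j ^ 2 + 1)))) := by
    have hx : x k ^ 2 + 1 ≠ 0 := by positivity
    have ha : x i ^ 2 + 1 ≠ 0 := by positivity
    have hb : x j ^ 2 + 1 ≠ 0 := by positivity
    field_simp
    ring
  rw [e]
  have hpos : 0 < 16 * (x j - x i) ^ 2 / ((x k ^ 2 + 1) * (x i ^ 2 + 1) * (x j ^ 2 + 1) * ((x i ^ 2 + 1) * (x j ^ 2 + 1))) := by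
    have := sq_pos_of_ne_zero hba
    positivity
  exact (mul_pos_iff_of_pos_right hpos).symm
end CPR

open Set
namespace CPR
open Complex Metric Topology Filter
open scoped ComplexConjugate

/-- Validity of a word of adjacent transpositions. -/
def Val {ι : Type} [DecidableEq ι] : (ι → ℝ) → List (ι × ι) → Prop
  | _, [] => True
  | r, p :: w => r p.1 < r p.2 ∧ (∀ m, ¬ (r p.1 < r m ∧ r m < r p.2)) ∧ Val (r ∘ Equiv.swap p.1 p.2) w

/-- End state of a word. -/
def EndS {ι : Type} [DecidableEq ι] : (ι → ℝ) → List (ι × ι) → (ι → ℝ)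
  | r, [] => r
  | r, p :: w => EndS (r ∘ Equiv.swap p.1 p.2) w

theorem val_append {ι : Type} [DecidableEq ι] (r : ι → ℝ) (u v : List (ι × ι)) :
    Val r (u ++ v) ↔ Val r u ∧ Val (EndS r u) v := by
  induction u generalizing r with
  | nil => simp [Val, EndS]
  | cons p u ih => simp [Val, EndS, ih, and_assoc]

theorem end_append {ι : Type} [DecidableEq ι] (r : ι → ℝ) (u v : List (ι × ι)) :
    EndS r (u ++ v) = EndS (EndS r u) v := by
  induction u generalizing r with
  | nil => simp [EndS]
  | cons p u ih => simp [EndS, ih]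

theorem end_inj {ι : Type} [DecidableEq ι] (r : ι → ℝ) (u : List (ι × ι)) (hr : Function.Injective r) :
    Function.Injective (EndS r u) := by
  induction u generalizing r with
  | nil => simpa [EndS] using hr
  | cons p u ih => exact ih _ (hr.comp (Equiv.injective _))

/-- reversed word -/
def rv {ι : Type} (w : List (ι × ι)) : List (ι × ι) := (w.map Prod.swap).reverse

theorem val_rv {ι : Type} [DecidableEq ι] (r : ι → ℝ) (w : List (ι × ι)) (h : Val r w) :
    Val (EndS r w) (rv w) ∧ EndS (EndS r w) (rv w) = r := by
  induction w generalizing r with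
  | nil => simp [Val, EndS, rv]
  | cons p w ih =>
    obtain ⟨h1, h2, h3⟩ := h
    obtain ⟨i1, i2⟩ := ih _ h3
    have e : rv (p :: w) = rv w ++ [p.swap] := by simp [rv]
    have hs : (r ∘ Equiv.swap p.1 p.2) ∘ Equiv.swap p.2 p.1 = r := by
      funext m; simp [Equiv.swap_comm p.2 p.1]
    rw [e, val_append, end_append]
    simp only [EndS, i2, Val, Prod.fst_swap, Prod.snd_swap, hs, and_true]
    refine ⟨i1, by simpa using h1, fun m => ?_⟩
    have := h2 (Equiv.swap p.1 p.2 m)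
    simpa using this

/-- order of crossings on each curve -/
def OK {ι : Type} (t : ι → ι → ℝ) (w : List (ι × ι)) : Prop :=
  w.Pairwise (fun p q => ∀ i j k, (p = (i, j) ∨ p = (j, i)) → (q = (i, k) ∨ q = (k, i)) → t i j < t i k)

theorem OK.rv {ι : Type} {t : ι → ι → ℝ} {w : List (ι × ι)} (h : OK (fun i j => - t i j) w) : OK t (rv w) := by
  unfold OK CPR.rv at *
  rw [List.pairwise_reverse, List.pairwise_map]
  refine h.imp ?_
  rintro ⟨a, b⟩ ⟨c, d⟩ H i j k h1 h2
  have := H i k j (by simp at h2 ⊢; tauto) (by simp at h1 ⊢; tauto)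
  linarith

theorem word_exists {ι : Type} [Fintype ι] [DecidableEq ι] (N : ℕ) : ∀ (c : ι → ι → Prop) (t : ι → ι → ℝ) (r : ι → ℝ)
    (_ : Set.ncard {p : ι × ι | c p.1 p.2} ≤ N)
    (_ : ∀ i j, c i j → c j i) (_ : ∀ i, ¬ c i i)
    (_ : ∀ i j k, c i j → c i k → j ≠ k → t i j ≠ t i k) (_ : Function.Injective r)
    (_ : ∀ i j k, i ≠ j → i ≠ k → j ≠ k → c i j → ((r i < r k ↔ r j < r k) ↔
      ((c i k ∧ t i k < t i j) ↔ (c j k ∧ t j k < t j i)))),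
    ∃ w, Val r w ∧ OK t w ∧ ∀ i j, c i j ↔ ((i, j) ∈ w ∨ (j, i) ∈ w) := by
  induction N with
  | zero =>
    intro c t r hN hs hi ht hr hp
    have : {p : ι × ι | c p.1 p.2} = ∅ := by
      rw [← Set.ncard_eq_zero (Set.toFinite _)]; omega
    refine ⟨[], trivial, List.Pairwise.nil, fun i j => ?_⟩
    simp only [List.not_mem_nil, or_self, iff_false]
    intro h
    have : (i, j) ∈ {p : ι × ι | c p.1 p.2} := h
    simp_all
  | succ N ih =>
    intro c t r hN hs hi ht hr hp
    by_cases hne : ∃ i j, c i j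
    swap
    · push Not at hne
      exact ⟨[], trivial, List.Pairwise.nil, fun i j => by simp [hne]⟩
    have key : ∃ i j, c i j ∧ (∀ k, c i k → t i j ≤ t i k) ∧ (∀ k, c j k → t j i ≤ t j k) := by
      have ff : ∀ i j, c i j → ∃ j', c i j' ∧ ∀ k, c i k → t i j' ≤ t i k := fun i j h => by
        obtain ⟨j', h1, h2⟩ := Set.exists_min_image {k | c i k} (t i) (Set.toFinite _) ⟨j, h⟩
        exact ⟨j', h1, h2⟩
      obtain ⟨i0, j0, h0⟩ := hne
      obtain ⟨j1, h1⟩ := ff i0 j0 h0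
      obtain ⟨⟨i, j⟩, ⟨hij, hmin⟩, hm⟩ := Set.exists_min_image {p : ι × ι | c p.1 p.2 ∧ ∀ k, c p.1 k → t p.1 p.2 ≤ t p.1 k}
        (fun p => |r p.1 - r p.2|) (Set.toFinite _) ⟨(i0, j1), h1⟩
      simp only at hij hmin hm
      refine ⟨i, j, hij, hmin, ?_⟩
      obtain ⟨k, hk, hkm⟩ := ff j i (hs _ _ hij)
      by_cases hki : k = i
      · subst hki; exact hkm
      have hle := hm (j, k) ⟨hk, hkm⟩
      have nij : i ≠ j := fun e => hi i (by simpa [← e] using hij)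
      have njk : j ≠ k := fun e => hi j (by simpa [← e] using hk)
      have hlt : t j k < t j i := lt_of_le_of_ne (hkm i (hs _ _ hij)) (ht j k i hk (hs _ _ hij) hki)
      have P := hp i j k nij (Ne.symm hki) njk hij
      have hn : ¬ (c i k ∧ t i k < t i j) := fun h => absurd (hmin k h.1) (by linarith [h.2])
      have hy : (c j k ∧ t j k < t j i) := ⟨hk, hlt⟩
      simp only [hn, hy, false_iff, and_self, not_true, iff_false] at P
      exfalso
      have r1 : r i ≠ r k := fun e => hki (hr e).symm
      have r2 : r j ≠ r k := fun e => njk (hr e)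
      simp only at hle
      rcases lt_or_gt_of_ne r1 with a | a <;> rcases lt_or_gt_of_ne r2 with b | b
      · exact P (by simp [a, b])
      · rw [abs_of_neg (by linarith), abs_of_pos (by linarith)] at hle; linarith
      · rw [abs_of_pos (by linarith), abs_of_neg (by linarith)] at hle; linarith
      · exact P ⟨fun h => absurd h (by linarith), fun h => absurd h (by linarith)⟩
    have key2 : ∃ i j, r i < r j ∧ c i j ∧ (∀ k, c i k → t i j ≤ t i k) ∧ (∀ k, c j k → t j i ≤ t j k) := by
      obtain ⟨i, j, h1, h2, h3⟩ := key
      rcases lt_trichotomy (r i) (r j) with h | h | h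
      · exact ⟨i, j, h, h1, h2, h3⟩
      · exact absurd h1 (by rw [hr h]; exact hi j)
      · exact ⟨j, i, h, hs _ _ h1, h3, h2⟩
    obtain ⟨i, j, hlt, hij, mi, mj⟩ := key2
    have nij : i ≠ j := fun e => by simp [e] at hlt
    have hji := hs _ _ hij
    have adj : ∀ k, k ≠ i → k ≠ j → (r i < r k ↔ r j < r k) := fun k k1 k2 => by
      rw [hp i j k nij k1.symm k2.symm hij]
      have h1 : ¬ (c i k ∧ t i k < t i j) := fun h => absurd (mi k h.1) (by linarith [h.2])
      have h2 : ¬ (c j k ∧ t j k < t j i) := fun h => absurd (mj k h.1) (by linarith [h.2])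
      simp [h1, h2]
    have adj' : ∀ k, k ≠ i → k ≠ j → (r k < r i ↔ r k < r j) := fun k k1 k2 => by
      have := adj k k1 k2
      have a1 : r i ≠ r k := fun e => k1 (hr e).symm
      have a2 : r j ≠ r k := fun e => k2 (hr e).symm
      rw [← not_iff_not, not_lt, not_lt, le_iff_lt_or_eq, le_iff_lt_or_eq]
      simp [a1, a2, this]
    set c' : ι → ι → Prop := fun a b => c a b ∧ (a, b) ≠ (i, j) ∧ (a, b) ≠ (j, i) with hc'
    set r' := r ∘ Equiv.swap i j with hr'
    have r'i : r' i = r j := by simp [hr']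
    have r'j : r' j = r i := by simp [hr']
    have r'k : ∀ k, k ≠ i → k ≠ j → r' k = r k := fun k h1 h2 => by simp [hr', Equiv.swap_apply_of_ne_of_ne h1 h2]
    have cmp : ∀ a b, a ≠ b → (a, b) ≠ (i, j) → (a, b) ≠ (j, i) → (r' a < r' b ↔ r a < r b) := fun a b hab h1 h2 => by
      simp only [ne_eq, Prod.mk.injEq, not_and] at h1 h2
      by_cases a1 : a = i
      · subst a1
        have b1 := h1 rfl
        rw [r'i, r'k b (Ne.symm hab) b1]; exact (adj b (Ne.symm hab) b1).symm
      by_cases a2 : a = j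
      · subst a2
        have b1 := h2 rfl
        rw [r'j, r'k b b1 (Ne.symm hab)]; exact (adj b b1 (Ne.symm hab))
      rw [r'k a a1 a2]
      by_cases b1 : b = i
      · subst b1; rw [r'i]; exact (adj' a a1 a2).symm
      by_cases b2 : b = j
      · subst b2; rw [r'j]; exact (adj' a a1 a2)
      rw [r'k b b1 b2]
    have fi : ∀ k, k ≠ j → c i k → t i j < t i k := fun k h1 h2 => lt_of_le_of_ne (mi k h2) (ht i j k hij h2 h1.symm)
    have fj : ∀ k, k ≠ i → c j k → t j i < t j k := fun k h1 h2 => lt_of_le_of_ne (mj k h2) (ht j i k hji h2 h1.symm)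
    obtain ⟨w, w1, w2, w3⟩ := ih c' t r' (by
        have : {p : ι × ι | c' p.1 p.2} ⊂ {p : ι × ι | c p.1 p.2} := by
          refine ⟨fun p hp => hp.1, fun h => ?_⟩
          have : (i, j) ∈ {p : ι × ι | c' p.1 p.2} := h hij
          exact this.2.1 rfl
        have := Set.ncard_lt_ncard this (Set.toFinite _)
        omega)
      (fun a b h => ⟨hs _ _ h.1, fun e => h.2.2 (by simp only [Prod.mk.injEq] at e ⊢; tauto), fun e => h.2.1 (by simp only [Prod.mk.injEq] at e ⊢; tauto)⟩)
      (fun a h => hi a h.1) (fun a b d h1 h2 => ht a b d h1.1 h2.1)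
      (hr.comp (Equiv.injective _)) (by
        intro a b k hab hak hbk h
        obtain ⟨h, e1, e2⟩ := h
        have P := hp a b k hab hak hbk h
        have hba := hs _ _ h
        by_cases z1 : (a, k) = (i, j)
        · simp only [Prod.mk.injEq] at z1
          obtain ⟨rfl, rfl⟩ := z1
          have q := cmp b k hbk (fun e => by simp at e; exact hab e.symm) (by simp [nij.symm])
          have f := fi b hbk h
          rw [q, r'i, r'j]
          have g1 : ¬ (r k < r a) := by linarith
          have g2 : ¬ c' a k := fun h => h.2.1 rfl
          have g3 : c' b k ↔ c b k := ⟨fun h => h.1, fun h => ⟨h, by simp [hab.symm], by simp [hbk]⟩⟩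
          simp only [hlt, hij, f, g1, g2, g3, true_iff, and_self, false_iff, false_and] at P ⊢
          rw [P]
        by_cases z2 : (a, k) = (j, i)
        · simp only [Prod.mk.injEq] at z2
          obtain ⟨rfl, rfl⟩ := z2
          have q := cmp b k hbk (by simp [nij]) (fun e => by simp at e; exact hab e.symm)
          have f := fj b hbk h
          rw [q, r'i, r'j]
          have g1 : ¬ (r a < r k) := by linarith
          have g2 : ¬ c' a k := fun h => h.2.2 rfl
          have g3 : c' b k ↔ c b k := ⟨fun h => h.1, fun h => ⟨h, by simp [hbk], by simp [hab.symm]⟩⟩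
          simp only [hlt, hji, f, g1, g2, g3, true_iff, and_self, false_iff, false_and] at P ⊢
          tauto
        by_cases z3 : (b, k) = (i, j)
        · simp only [Prod.mk.injEq] at z3
          obtain ⟨rfl, rfl⟩ := z3
          have q := cmp a k hak (fun e => by simp at e; exact hab e) (by simp [nij.symm])
          have f := fi a hak hba
          rw [q, r'i, r'j]
          have g1 : ¬ (r k < r b) := by linarith
          have g2 : ¬ c' b k := fun h => h.2.1 rfl
          have g3 : c' a k ↔ c a k := ⟨fun h => h.1, fun h => ⟨h, by simp [hab], by simp [hak]⟩⟩
          simp only [hlt, hij, f, g1, g2, g3, iff_true, and_self, iff_false, false_and] at P ⊢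
          tauto
        by_cases z4 : (b, k) = (j, i)
        · simp only [Prod.mk.injEq] at z4
          obtain ⟨rfl, rfl⟩ := z4
          have q := cmp a k hak (by simp [nij]) (fun e => by simp at e; exact hab e)
          have f := fj a hak hba
          rw [q, r'i, r'j]
          have g1 : ¬ (r b < r k) := by linarith
          have g2 : ¬ c' b k := fun h => h.2.2 rfl
          have g3 : c' a k ↔ c a k := ⟨fun h => h.1, fun h => ⟨h, by simp [hak], by simp [hab]⟩⟩
          simp only [hlt, hji, f, g1, g2, g3, iff_true, and_self, iff_false, false_and] at P ⊢
          tauto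
        rw [cmp a k hak z1 z2, cmp b k hbk z3 z4]
        have g1 : c' a k ↔ c a k := ⟨fun h => h.1, fun h => ⟨h, z1, z2⟩⟩
        have g2 : c' b k ↔ c b k := ⟨fun h => h.1, fun h => ⟨h, z3, z4⟩⟩
        rw [g1, g2]; exact P)
    refine ⟨(i, j) :: w, ⟨hlt, fun m hm => ?_, w1⟩, List.pairwise_cons.2 ⟨?_, w2⟩, ?_⟩
    · simp only at hm
      have m1 : m ≠ i := fun e => by simp [e] at hm
      have m2 : m ≠ j := fun e => by simp [e] at hm
      have := (adj m m1 m2).1 hm.1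
      linarith [hm.2]
    · rintro ⟨a, b⟩ hab a1 b1 k1 e1 e2
      have hcab : c' a b := (w3 a b).2 (Or.inl hab)
      have hcba : c' b a := (w3 b a).2 (Or.inr hab)
      have hak : c' a1 k1 := by
        rcases e2 with e | e <;> simp only [Prod.mk.injEq] at e <;> obtain ⟨rfl, rfl⟩ := e <;> assumption
      rcases e1 with e | e <;> simp only [Prod.mk.injEq] at e <;> obtain ⟨rfl, rfl⟩ := e
      · exact fi k1 (fun e => hak.2.1 (by rw [e])) hak.1
      · exact fj k1 (fun e => hak.2.2 (by rw [e])) hak.1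
    · intro a b
      have := w3 a b
      simp only [List.mem_cons]
      by_cases q1 : (a, b) = (i, j)
      · simp only [Prod.mk.injEq] at q1; obtain ⟨rfl, rfl⟩ := q1; simp [hij]
      by_cases q2 : (a, b) = (j, i)
      · simp only [Prod.mk.injEq] at q2; obtain ⟨rfl, rfl⟩ := q2; simp [hji]
      have q3 : (b, a) ≠ (i, j) := fun e => q2 (by simp only [Prod.mk.injEq] at e ⊢; tauto)
      have q4 : c' a b ↔ c a b := ⟨fun h => h.1, fun h => ⟨h, q1, q2⟩⟩
      simp only [q1, q3, false_or, ← q4, this]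
end CPR

open Set
namespace CPR
open Complex Metric Topology Filter
open scoped ComplexConjugate

/-- sum of kinks -/
def ks : List (ℝ × ℝ) → ℝ → ℝ
  | [], _ => 0
  | p :: K, x => p.2 * max (x - p.1) 0 + ks K x

/-- sorted kinks after a time -/
def KO : ℝ → List (ℝ × ℝ) → Prop
  | _, [] => True
  | τ, p :: K => τ ≤ p.1 ∧ 0 ≤ p.2 ∧ KO p.1 K

theorem KO.mono {τ τ' : ℝ} {K : List (ℝ × ℝ)} (h : KO τ K) (h' : τ' ≤ τ) : KO τ' K := by
  cases K with
  | nil => trivial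
  | cons p K => exact ⟨h'.trans h.1, h.2⟩

theorem KO.zero {τ x : ℝ} {K : List (ℝ × ℝ)} (h : KO τ K) (hx : x ≤ τ) : ks K x = 0 := by
  induction K generalizing τ with
  | nil => rfl
  | cons p K ih =>
    obtain ⟨h1, h2, h3⟩ := h
    simp [ks, max_eq_right (show x - p.1 ≤ 0 by linarith), ih h3 (by linarith)]

theorem ks_cont (K : List (ℝ × ℝ)) : Continuous (ks K) := by
  induction K with
  | nil => exact continuous_const
  | cons p K ih =>
    show Continuous fun x => p.2 * max (x - p.1) 0 + ks K x
    fun_prop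

theorem KO.convex {τ : ℝ} {K : List (ℝ × ℝ)} (h : KO τ K) : ConvexOn ℝ univ (ks K) := by
  induction K generalizing τ with
  | nil => exact convexOn_const 0 convex_univ
  | cons p K ih =>
    obtain ⟨h1, h2, h3⟩ := h
    have : ConvexOn ℝ univ (fun x : ℝ => max (x - p.1) 0) := by
      refine ⟨convex_univ, fun x _ y _ a b ha hb hab => ?_⟩
      simp only [smul_eq_mul]
      have e : a * x + b * y - p.1 = a * (x - p.1) + b * (y - p.1) := by
        linear_combination p.1 * hab
      rw [e]
      refine max_le ?_ ?_
      · exact add_le_add (mul_le_mul_of_nonneg_left (le_max_left _ _) ha) (mul_le_mul_of_nonneg_left (le_max_left _ _) hb)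
      · exact add_nonneg (mul_nonneg ha (le_max_right _ _)) (mul_nonneg hb (le_max_right _ _))
    have := (this.smul h2).add (ih h3)
    exact this

theorem lin_between {s s' y y' τ τ' x : ℝ} (h1 : y < y') (h2 : y + s * (τ' - τ) < y' + s' * (τ' - τ)) (hx : τ ≤ x) (hx' : x ≤ τ') :
    y + s * (x - τ) < y' + s' * (x - τ) := by
  by_cases h : s ≤ s'
  · nlinarith [mul_nonneg (sub_nonneg.2 h) (sub_nonneg.2 hx)]
  · push Not at h
    nlinarith [mul_nonneg (sub_nonneg.2 h.le) (sub_nonneg.2 hx')]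

def NR {κ : Type} (w : List (κ × κ)) : Prop := w.Pairwise (fun p q => q ≠ p ∧ q ≠ p.swap)

theorem tail {κ : Type} [Fintype κ] [DecidableEq κ] (w : List (κ × κ)) : ∀ (r : κ → ℝ) (_ : Function.Injective r) (_ : Val r w) (_ : NR w)
    (τ : ℝ) (y s : κ → ℝ) (_ : ∀ a b, r a < r b → y a < y b) (_ : ∀ a b, r a < r b → s a < s b),
    ∃ (f : κ → ℝ → ℝ) (K : κ → List (ℝ × ℝ)) (X : κ × κ → ℝ),
      (∀ k x, f k x = y k + s k * (x - τ) + ks (K k) x) ∧ (∀ k, KO τ (K k)) ∧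
      (∀ k, (K k).length ≤ w.countP (fun p => p.1 = k)) ∧
      (∀ p ∈ w, τ < X p ∧ ∀ x, τ ≤ x → (f p.1 x < f p.2 x ↔ x < X p) ∧ (f p.1 x = f p.2 x ↔ x = X p)) ∧
      (∀ a b, r a < r b → (a, b) ∉ w → (b, a) ∉ w → ∀ x, τ ≤ x → f a x < f b x) ∧
      w.Pairwise (fun p q => X p < X q) := by
  induction w with
  | nil =>
    intro r hr hv hn τ y s hy hs
    refine ⟨fun k x => y k + s k * (x - τ), fun _ => [], fun _ => 0, fun k x => by simp [ks], fun _ => trivial,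
      fun _ => by simp, by simp, fun a b hab _ _ x hx => ?_, List.Pairwise.nil⟩
    nlinarith [hy a b hab, mul_nonneg (sub_nonneg.2 (hs a b hab).le) (sub_nonneg.2 hx)]
  | cons p w ih =>
    obtain ⟨i, j⟩ := p
    intro r hr hv hn τ y s hy hs
    obtain ⟨hlt, hadj, hv⟩ := hv
    obtain ⟨hn1, hn2⟩ := List.pairwise_cons.1 hn
    simp only at hlt hadj hv
    have nij : i ≠ j := fun e => by simp [e] at hlt
    obtain ⟨s', hs1, hs2⟩ : ∃ s', s j < s' ∧ ∀ k, s j < s k → s' < s k := by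
      by_cases h : ∃ k, s j < s k
      · obtain ⟨k, h1, h2⟩ := Set.exists_min_image {k | s j < s k} s (Set.toFinite _) h
        have h1' : s j < s k := h1
        exact ⟨(s j + s k) / 2, by linarith, fun k' hk' => by have := h2 k' hk'; linarith⟩
      · push Not at h
        exact ⟨s j + 1, by linarith, fun k hk => absurd hk (by linarith [h k])⟩
    have hyij := hy i j hlt
    have hsij := hs i j hlt
    set D := (y j - y i) / (s' - s j) with hD
    have hDp : 0 < D := div_pos (by linarith) (by linarith)
    have hDe : D * (s' - s j) = y j - y i := div_mul_cancel₀ _ (by linarith)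
    set sn : κ → ℝ := Function.update s i s' with hsn
    have sni : sn i = s' := by simp [hsn]
    have snk : ∀ k, k ≠ i → sn k = s k := fun k h => by simp [hsn, h]
    set d := D + 1 with hd
    set τ' := τ + d with hτ'
    set yn : κ → ℝ := fun k => y k + sn k * d with hyn
    set r' := r ∘ Equiv.swap i j with hr'
    have r'i : r' i = r j := by simp [hr']
    have r'j : r' j = r i := by simp [hr']
    have r'k : ∀ k, k ≠ i → k ≠ j → r' k = r k := fun k h1 h2 => by simp [hr', Equiv.swap_apply_of_ne_of_ne h1 h2]
    have below : ∀ k, k ≠ i → k ≠ j → r k < r j → r k < r i := fun k h1 h2 h => by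
      by_contra h'
      have : r i ≠ r k := fun e => h1 (hr e).symm
      exact hadj k ⟨lt_of_le_of_ne (not_lt.1 h') this, h⟩
    have above : ∀ k, k ≠ i → k ≠ j → r i < r k → r j < r k := fun k h1 h2 h => by
      by_contra h'
      have : r k ≠ r j := fun e => h2 (hr e)
      exact hadj k ⟨h, lt_of_le_of_ne (not_lt.1 h') this⟩
    have hdp : 0 < d := by linarith
    -- order relations after the swap
    have ord : ∀ a b, r' a < r' b → sn a < sn b ∧ yn a < yn b ∧ ((a = j ∧ b = i) ∨ r a < r b) := by
      have lin : ∀ a b, y a < y b → sn a < sn b → yn a < yn b := fun a b h1 h2 => by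
        simp only [hyn]; nlinarith
      intro a b hab
      by_cases a1 : a = i
      · subst a1
        rw [r'i] at hab
        have b1 : b ≠ a := fun e => by rw [e, r'i] at hab; linarith
        have b2 : b ≠ j := fun e => by rw [e, r'j] at hab; linarith
        rw [r'k b b1 b2] at hab
        have q : sn a < sn b := by rw [sni, snk b b1]; exact hs2 b (hs _ _ hab)
        exact ⟨q, lin _ _ (by linarith [hy _ _ hab]) q, Or.inr (by linarith)⟩
      by_cases a2 : a = j
      · subst a2
        rw [r'j] at hab
        by_cases b1 : b = i
        · subst b1
          refine ⟨by rw [sni, snk a a1]; exact hs1, ?_, Or.inl ⟨rfl, rfl⟩⟩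
          simp only [hyn]; rw [sni, snk a a1]; nlinarith
        have b2 : b ≠ a := fun e => by rw [e, r'j] at hab; linarith
        rw [r'k b b1 b2] at hab
        have h2 := above b b1 b2 hab
        have q : sn a < sn b := by rw [snk a a1, snk b b1]; exact hs _ _ h2
        exact ⟨q, lin _ _ (hy _ _ h2) q, Or.inr h2⟩
      rw [r'k a a1 a2] at hab
      by_cases b1 : b = i
      · subst b1
        rw [r'i] at hab
        have h2 := below a a1 a2 hab
        have q : sn a < sn b := by rw [snk a a1, sni]; linarith [hs _ _ h2]
        exact ⟨q, lin _ _ (hy _ _ h2) q, Or.inr h2⟩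
      by_cases b2 : b = j
      · subst b2
        rw [r'j] at hab
        have h2 : r a < r b := by linarith
        have q : sn a < sn b := by rw [snk a a1, snk b b1]; exact hs _ _ h2
        exact ⟨q, lin _ _ (hy _ _ h2) q, Or.inr h2⟩
      rw [r'k b b1 b2] at hab
      have q : sn a < sn b := by rw [snk a a1, snk b b1]; exact hs _ _ hab
      exact ⟨q, lin _ _ (hy _ _ hab) q, Or.inr hab⟩
    obtain ⟨g, K, X, g1, g2, g3, g4, g5, g6⟩ := ih r' (hr.comp (Equiv.injective _)) hv hn2 τ' yn sn
      (fun a b h => (ord a b h).2.1) (fun a b h => (ord a b h).1)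
    set K' : κ → List (ℝ × ℝ) := fun k => if k = i then (τ, s' - s i) :: K i else K k with hK'
    have K'i : K' i = (τ, s' - s i) :: K i := by simp [hK']
    have K'k : ∀ k, k ≠ i → K' k = K k := fun k h => by simp [hK', h]
    have fg : ∀ k x, τ ≤ x → y k + s k * (x - τ) + ks (K' k) x = g k x := by
      intro k x hx
      rw [g1]
      by_cases h : k = i
      · subst h
        rw [K'i]; simp only [ks, hyn, sni, hτ', max_eq_left (sub_nonneg.2 hx)]; ring
      · rw [K'k k h]; simp only [hyn, snk k h, hτ']; ring
    have glin : ∀ k x, x ≤ τ' → g k x = y k + sn k * (x - τ) := fun k x hx => by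
      rw [g1, (g2 k).zero hx]; simp only [hyn, hτ']; ring
    have gτ' : ∀ k, g k τ' = yn k := fun k => by rw [glin k τ' le_rfl]; simp only [hyn, hτ']; ring
    have wne : ∀ q ∈ w, q ≠ (i, j) ∧ q ≠ (j, i) := fun q hq => hn1 q hq
    set X' : κ × κ → ℝ := Function.update X (i, j) (τ + D) with hX'
    have X'0 : X' (i, j) = τ + D := by simp [hX']
    have X'q : ∀ q ∈ w, X' q = X q := fun q hq => by simp [hX', (wne q hq).1]
    have yord : ∀ a b, yn a < yn b → r' a < r' b := fun a b h => by
      by_contra h'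
      rcases (not_lt.1 h').lt_or_eq with h'' | h''
      · linarith [(ord _ _ h'').2.1]
      · have := (hr.comp (Equiv.injective (Equiv.swap i j))) h''; subst this; exact lt_irrefl _ h
    have early : ∀ a b, r a < r b → r' a < r' b → ∀ x, τ ≤ x → x ≤ τ' → g a x < g b x := fun a b h1 h2 x hx hx' => by
      rw [glin a x hx', glin b x hx']
      refine lin_between (hy _ _ h1) ?_ hx hx'
      have := (ord _ _ h2).2.1
      simpa [hyn, hτ'] using this
    refine ⟨fun k x => y k + s k * (x - τ) + ks (K' k) x, K', X', fun _ _ => rfl, ?_, ?_, ?_, ?_, ?_⟩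
    · intro k
      by_cases h : k = i
      · subst h; rw [K'i]; exact ⟨le_rfl, by simp only; linarith, (g2 k).mono (by simp only; linarith)⟩
      · rw [K'k k h]; exact (g2 k).mono (by linarith)
    · intro k
      by_cases h : k = i
      · subst h; rw [K'i]; simpa using g3 k
      · rw [K'k k h, List.countP_cons]; exact (g3 k).trans (Nat.le_add_right _ _)
    · intro q hq
      rcases List.mem_cons.1 hq with rfl | hq
      · rw [X'0]
        refine ⟨by linarith, fun x hx => ?_⟩
        simp only
        rw [fg i x hx, fg j x hx]
        by_cases hx' : x ≤ τ'
        · rw [glin i x hx', glin j x hx', sni, snk j nij.symm]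
          constructor
          · constructor <;> intro h <;> nlinarith
          · constructor
            · intro h
              have : (x - τ - D) * (s' - s j) = 0 := by linarith
              rcases mul_eq_zero.1 this with h | h <;> linarith
            · rintro rfl; linarith
        · push Not at hx'
          have := g5 j i (by rw [r'i, r'j]; exact hlt) (fun h => (wne _ h).2 rfl) (fun h => (wne _ h).1 rfl) x hx'.le
          exact ⟨⟨fun h => by linarith, fun h => by linarith⟩, ⟨fun h => by linarith, fun h => by linarith⟩⟩
      · obtain ⟨h1, h2⟩ := g4 q hq
        rw [X'q q hq]
        refine ⟨by linarith, fun x hx => ?_⟩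
        simp only
        rw [fg _ x hx, fg _ x hx]
        by_cases hx' : τ' ≤ x
        · exact h2 x hx'
        push Not at hx'
        have a1 := (h2 τ' le_rfl).1.2 h1
        rw [gτ', gτ'] at a1
        have a2 := yord _ _ a1
        have a3 : r q.1 < r q.2 := by
          rcases (ord _ _ a2).2.2 with h | h
          · exact absurd (Prod.ext h.1 h.2) (wne q hq).2
          · exact h
        have := early _ _ a3 a2 x hx hx'.le
        exact ⟨⟨fun h => by linarith, fun h => by linarith⟩, ⟨fun h => by linarith, fun h => by linarith⟩⟩
    · intro a b hab h1 h2 x hx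
      simp only
      rw [fg _ x hx, fg _ x hx]
      simp only [List.mem_cons, not_or] at h1 h2
      have hab' : r' a < r' b := by
        by_contra h'
        rcases (not_lt.1 h').lt_or_eq with h'' | h''
        · rcases (ord _ _ h'').2.2 with h | h
          · exact h1.1 (by rw [h.1, h.2])
          · linarith
        · have := (hr.comp (Equiv.injective (Equiv.swap i j))) h''; subst this; exact lt_irrefl _ hab
      by_cases hx' : x ≤ τ'
      · exact early a b hab hab' x hx hx'
      · exact g5 a b hab' h1.2 h2.2 x (not_le.1 hx').le
    · refine List.pairwise_cons.2 ⟨fun q hq => ?_, ?_⟩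
      · rw [X'0, X'q q hq]; linarith [(g4 q hq).1]
      · exact g6.imp_of_mem (fun {a b} ha hb h => by rw [X'q a ha, X'q b hb]; exact h)

theorem target {κ : Type} [Fintype κ] [DecidableEq κ] (w : List (κ × κ)) (r : κ → ℝ) (hr : Function.Injective r) (hv : Val r w) (hn : NR w)
    (b : κ) (hb : ∀ k, r b ≤ r k) :
    ∃ (f : κ → ℝ → ℝ) (X : κ × κ → ℝ),
      (∀ k, ∃ (a s τ : ℝ) (K : List (ℝ × ℝ)), (∀ x, f k x = a + s * x + ks K x) ∧ KO τ K ∧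
        K.length ≤ w.countP (fun p => p.1 = k) + (if k = b then 0 else 1)) ∧
      (∀ p ∈ w, ∀ x, (f p.1 x < f p.2 x ↔ x < X p) ∧ (f p.1 x = f p.2 x ↔ x = X p)) ∧
      w.Pairwise (fun p q => X p < X q) := by
  obtain ⟨g, K, X, g1, g2, g3, g4, g5, g6⟩ := tail w r hr hv hn 1 (fun k => r k + (r k - r b)) (fun k => r k - r b)
    (fun a b h => by linarith) (fun a b h => by linarith)
  set f : κ → ℝ → ℝ := fun k x => r k + (r k - r b) * max x 0 + ks (K k) x with hf
  have e1 : ∀ k x, 1 ≤ x → f k x = g k x := fun k x hx => by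
    simp only [hf]; rw [g1, max_eq_left (by linarith)]; ring
  refine ⟨f, X, fun k => ?_, fun p hp x => ?_, g6⟩
  · by_cases h : k = b
    · subst h
      refine ⟨r k, 0, 1, K k, fun x => by simp [hf], g2 k, by simpa using g3 k⟩
    · refine ⟨r k, 0, 0, (0, r k - r b) :: K k, fun x => by simp [hf, ks]; ring, ⟨le_rfl, by simpa using hb k, (g2 k).mono (by simp)⟩, ?_⟩
      simpa [h] using g3 k
  · obtain ⟨h1, h2⟩ := g4 p hp
    by_cases hx : 1 ≤ x
    · rw [e1 _ x hx, e1 _ x hx]; exact h2 x hx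
    push Not at hx
    have h3 := (h2 1 le_rfl).1.2 h1
    rw [g1, g1, (g2 _).zero le_rfl, (g2 _).zero le_rfl] at h3
    have h4 : f p.1 x < f p.2 x := by
      simp only [hf]
      rw [(g2 _).zero hx.le, (g2 _).zero hx.le]
      have : r p.1 < r p.2 := by linarith
      nlinarith [mul_nonneg (sub_nonneg.2 this.le) (le_max_right x 0)]
    exact ⟨⟨fun _ => by linarith, fun _ => h4⟩, ⟨fun h => by linarith, fun h => by linarith⟩⟩
end CPR

open Set
namespace CPR
open Complex Metric Topology Filter
open scoped ComplexConjugate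

structure Arr {ι : Type} (x : ι → ℝ) (T : ι → ι → ℝ) (γ : ι → ℝ → ℂ) (g : ι → ℂ → ℝ) : Prop where
  xinj : Function.Injective x
  cont : ∀ j, Continuous (γ j)
  inj : ∀ j, Function.Injective (γ j)
  limT : ∀ j, Tendsto (γ j) atTop (cocompact ℂ)
  limB : ∀ j, Tendsto (γ j) atBot (cocompact ℂ)
  zero : ∀ j, γ j 0 = x j
  up : ∀ j t, t < 0 → 0 < (γ j t).im
  dn : ∀ j t, 0 < t → (γ j t).im < 0
  gc : ∀ i, Continuous (g i)
  gz : ∀ i z, g i z = 0 ↔ z ∈ range (γ i)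
  gi : ∀ i j, i ≠ j → ∀ t, g i (γ j t) = 0 ↔ t = T j i
  gs : ∀ i j, i ≠ j → ∀ t t', t < T j i → T j i < t' → g i (γ j t) * g i (γ j t') < 0
  meet : ∀ i j, i ≠ j → γ i (T i j) = γ j (T j i)
  tri : ∀ i j k, i ≠ j → i ≠ k → j ≠ k → T j i ≠ T j k

theorem not_conn_of_sign {F : Set ℂ} {g : ℂ → ℝ} (hg : Continuous g) (h0 : ∀ z ∈ F, g z ≠ 0) {p q : ℂ} (h : g p * g q < 0) : ¬ Conn F p q := by
  rintro ⟨S, hS, hSF, hp, hq⟩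
  have := hS.image g hg.continuousOn
  have h2 := this.ordConnected
  rcases mul_neg_iff.1 h with ⟨a, b⟩ | ⟨a, b⟩
  · obtain ⟨z, hz, e⟩ := h2.out ⟨q, hq, rfl⟩ ⟨p, hp, rfl⟩ (show (0:ℝ) ∈ Icc _ _ from ⟨b.le, a.le⟩)
    exact h0 z (hSF hz) e
  · obtain ⟨z, hz, e⟩ := h2.out ⟨p, hp, rfl⟩ ⟨q, hq, rfl⟩ (show (0:ℝ) ∈ Icc _ _ from ⟨a.le, b.le⟩)
    exact h0 z (hSF hz) e

namespace Arr
variable {ι : Type} {x : ι → ℝ} {T : ι → ι → ℝ} {γ : ι → ℝ → ℂ} {g : ι → ℂ → ℝ}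

theorem conj' (h : Arr x T γ g) : Arr x (fun i j => - T i j) (fun j t => conj (γ j (-t))) (fun i z => g i (conj z)) where
  xinj := h.xinj
  cont j := continuous_conj.comp ((h.cont j).comp continuous_neg)
  inj j := (star_injective (R := ℂ)).comp ((h.inj j).comp neg_injective)
  limT j := (Complex.conjCLE.toHomeomorph.isClosedEmbedding.tendsto_cocompact).comp ((h.limB j).comp tendsto_neg_atTop_atBot)
  limB j := (Complex.conjCLE.toHomeomorph.isClosedEmbedding.tendsto_cocompact).comp ((h.limT j).comp tendsto_neg_atBot_atTop)
  zero j := by simp [h.zero]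
  up j t ht := by simpa using h.dn j (-t) (by linarith)
  dn j t ht := by simpa using h.up j (-t) (by linarith)
  gc i := (h.gc i).comp continuous_conj
  gz i z := by
    rw [h.gz]
    constructor
    · rintro ⟨t, e⟩; exact ⟨-t, by simp [e]⟩
    · rintro ⟨t, e⟩; exact ⟨-t, by rw [← e]; simp⟩
  gi i j hij t := by
    simp only [conj_conj]
    rw [h.gi i j hij]; constructor <;> intro h <;> linarith
  gs i j hij t t' h1 h2 := by
    simp only [conj_conj]
    rw [mul_comm]; exact h.gs i j hij _ _ (by linarith) (by linarith)
  meet i j hij := by simp [h.meet i j hij]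
  tri i j k h1 h2 h3 e := h.tri i j k h1 h2 h3 (by simpa using e)

theorem T_of_mem (h : Arr x T γ g) {i j : ι} (hij : i ≠ j) {s t : ℝ} (e : γ i s = γ j t) : s = T i j ∧ t = T j i := by
  constructor
  · rw [← h.gi j i hij.symm, e, h.gz]; exact ⟨t, rfl⟩
  · rw [← h.gi i j hij, ← e, h.gz]; exact ⟨s, rfl⟩

theorem eq_iff (h : Arr x T γ g) (i j : ι) (s t : ℝ) : γ i s = γ j t ↔ (i = j ∧ s = t) ∨ (i ≠ j ∧ s = T i j ∧ t = T j i) := by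
  by_cases hij : i = j
  · subst hij; simpa using (h.inj i).eq_iff
  · simp only [hij, false_and, ne_eq, not_false_eq_true, true_and, false_or]
    refine ⟨h.T_of_mem hij, ?_⟩
    rintro ⟨rfl, rfl⟩; exact h.meet i j hij

theorem neg_of_pos (h : Arr x T γ g) {j : ι} {t : ℝ} (ht : 0 < (γ j t).im) : t < 0 := by
  by_contra h'
  rcases (not_lt.1 h').lt_or_eq with h1 | h1
  · linarith [h.dn j t h1]
  · rw [← h1, h.zero] at ht; simp at ht

theorem T_ne (h : Arr x T γ g) {i j : ι} (hij : i ≠ j) : T i j ≠ 0 := by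
  intro e
  have m := h.meet i j hij
  rw [e, h.zero] at m
  have : T j i = 0 := by
    rcases lt_trichotomy (T j i) 0 with q | q | q
    · have := h.up j _ q; rw [← m] at this; simp at this
    · exact q
    · have := h.dn j _ q; rw [← m] at this; simp at this
  rw [this, h.zero] at m
  exact hij (h.xinj (by exact_mod_cast m))

theorem T_symm (h : Arr x T γ g) {i j : ι} (hij : i ≠ j) (ht : T i j < 0) : T j i < 0 := by
  have := h.up i _ ht
  rw [h.meet i j hij] at this
  exact h.neg_of_pos this

theorem mem_iff (h : Arr x T γ g) {i k : ι} (hik : i ≠ k) {u : ℝ} (hu : 0 < u) :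
    γ i (-u) ∈ (fun t => γ k (-t)) '' Ici 0 ↔ -u = T i k := by
  constructor
  · rintro ⟨t, _, e⟩
    exact (h.T_of_mem hik e.symm).1
  · intro e
    refine ⟨- T k i, ?_, by simp only [neg_neg]; rw [e, h.meet i k hik]⟩
    have := h.T_symm hik (by linarith)
    simp only [mem_Ici]; linarith

theorem ur (h : Arr x T γ g) : UR x (fun j t => γ j (-t)) where
  xinj := h.xinj
  cont j := ((h.cont j).comp continuous_neg).continuousOn
  inj j := ((h.inj j).comp neg_injective).injOn
  lim j := (h.limB j).comp tendsto_neg_atTop_atBot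
  zero j := by simp [h.zero]
  pos j t ht := h.up j _ (by linarith)
  uniq i j hij t ht t' ht' h1 h2 := by
    have a := (h.mem_iff hij.symm ht).1 h1
    have b := (h.mem_iff hij.symm ht').1 h2
    linarith
  cross i j hij t u v hu hut htv h1 := by
    have a := (h.mem_iff hij.symm (hu.trans hut)).1 h1
    refine not_conn_of_sign (h.gc i) (fun z hz e => ?_) ?_
    · obtain ⟨s, rfl⟩ := (h.gz i z).1 e
      have := h.neg_of_pos hz.1
      exact hz.2 ⟨-s, by simp only [mem_Ici]; linarith, by simp⟩
    · rw [mul_comm]; exact h.gs i j hij _ _ (by linarith) (by linarith)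
  triple i j k hij hik hjk t ht h1 h2 := by
    have a := (h.mem_iff hij.symm ht).1 h1
    have b := (h.mem_iff hjk ht).1 h2
    exact h.tri i j k hij hik hjk (by rw [← a, ← b])

theorem lr (h : Arr x T γ g) : UR x (fun j t => conj (γ j t)) := by
  have := h.conj'.ur
  simpa using this

theorem word [Fintype ι] [DecidableEq ι] (h : Arr x T γ g) : ∃ w, Val x w ∧ OK (fun i j => - T i j) w ∧
    ∀ i j, (i ≠ j ∧ T i j < 0) ↔ ((i, j) ∈ w ∨ (j, i) ∈ w) := by
  refine word_exists _ (fun i j => i ≠ j ∧ T i j < 0) (fun i j => - T i j) x le_rfl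
    (fun i j hh => ⟨hh.1.symm, h.T_symm hh.1 hh.2⟩) (fun i hh => hh.1 rfl)
    (fun i j k h1 h2 h3 e => h.tri j i k h1.1.symm h3 h2.1 (by simpa using e)) h.xinj ?_
  intro i j k hij hik hjk hc
  have P := h.ur.parity hij hik hjk (s := - T i j) (t := - T j i) (by linarith [hc.2]) (by linarith [h.T_symm hij hc.2])
    (by simpa using h.meet i j hij)
  have q : ∀ a, a ≠ k → ∀ s, (∃ u ∈ Ioo 0 s, γ a (-u) ∈ (fun t => γ k (-t)) '' Ici 0) ↔ ((a ≠ k ∧ T a k < 0) ∧ - T a k < s) := fun a hak s => by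
    constructor
    · rintro ⟨u, hu, m⟩
      have := (h.mem_iff hak hu.1).1 m
      exact ⟨⟨hak, by linarith [hu.1]⟩, by linarith [hu.2]⟩
    · rintro ⟨⟨_, h1⟩, h2⟩
      exact ⟨- T a k, ⟨by linarith, h2⟩, (h.mem_iff hak (by linarith)).2 (by simp)⟩
  rw [← q i hik, ← q j hjk, ← P]
  have r1 : x k - x i ≠ 0 := sub_ne_zero.2 (fun e => hik (h.xinj e).symm)
  have r2 : x k - x j ≠ 0 := sub_ne_zero.2 (fun e => hjk (h.xinj e).symm)
  rcases lt_or_gt_of_ne r1 with a | a <;> rcases lt_or_gt_of_ne r2 with b | b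
  · simp [mul_pos_of_neg_of_neg a b, (show ¬ x i < x k by linarith), (show ¬ x j < x k by linarith), -not_lt]
  · simp [(mul_neg_of_neg_of_pos a b).le, (show ¬ x i < x k by linarith), (show x j < x k by linarith)]
  · simp [(mul_neg_of_pos_of_neg a b).le, (show x i < x k by linarith), (show ¬ x j < x k by linarith)]
  · simp [mul_pos a b, (show x i < x k by linarith), (show x j < x k by linarith)]

end Arr
end CPR

open Set
namespace CPR
open Complex Metric Topology Filter
open scoped ComplexConjugate

theorem Val.congr' {ι : Type} [DecidableEq ι] {w : List (ι × ι)} : ∀ {r r' : ι → ℝ}, Val r w → (∀ a b, r a < r b ↔ r' a < r' b) → Val r' w := by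
  induction w with
  | nil => intros; trivial
  | cons p w ih =>
    intro r r' h e
    exact ⟨(e _ _).1 h.1, fun m hm => h.2.1 m ⟨(e _ _).2 hm.1, (e _ _).2 hm.2⟩, ih h.2.2 (fun a b => e _ _)⟩

/-- extension of a state by one value -/
def el {ι : Type} (c : ℝ) (r : ι → ℝ) : Option ι → ℝ
  | none => c
  | some i => r i

/-- lifted pair -/
def lf {ι : Type} (p : ι × ι) : Option ι × Option ι := (some p.1, some p.2)

theorem el_swap {ι : Type} [DecidableEq ι] (c : ℝ) (r : ι → ℝ) (a b : ι) :
    el c r ∘ Equiv.swap (some a) (some b) = el c (r ∘ Equiv.swap a b) := by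
  funext o
  cases o with
  | none => simp [el, Equiv.swap_apply_of_ne_of_ne]
  | some k =>
    simp only [Function.comp, Equiv.swap_apply_def, el, Option.some.injEq]
    split_ifs <;> rfl

theorem val_lift {ι : Type} [DecidableEq ι] (c : ℝ) (w : List (ι × ι)) : ∀ (r : ι → ℝ), ((∀ i, c < r i) ∨ (∀ i, r i < c)) → Val r w →
    Val (el c r) (w.map lf) ∧ EndS (el c r) (w.map lf) = el c (EndS r w) := by
  induction w with
  | nil => intros; exact ⟨trivial, rfl⟩
  | cons p w ih =>
    intro r hc h
    have := ih (r ∘ Equiv.swap p.1 p.2) (hc.imp (fun h i => h _) (fun h i => h _)) h.2.2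
    simp only [List.map_cons, Val, EndS, lf, el_swap]
    refine ⟨⟨h.1, fun m hm => ?_, this.1⟩, this.2⟩
    cases m with
    | none => rcases hc with hc | hc
              · have := hc p.1; simp only [el] at hm; linarith
              · have := hc p.2; simp only [el] at hm; linarith
    | some k => exact h.2.1 k hm

/-- times on the extended family -/
def T' {ι : Type} (x : ι → ℝ) (T : ι → ι → ℝ) : Option ι → Option ι → ℝ
  | some i, some j => T i j
  | some _, none => 0
  | none, some j => x j
  | none, none => 0

theorem ok_lift {ι : Type} (x : ι → ℝ) (T : ι → ι → ℝ) (w : List (ι × ι)) (h : OK T w) : OK (T' x T) (w.map lf) := by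
  unfold OK at *
  rw [List.pairwise_map]
  refine h.imp ?_
  rintro ⟨a, b⟩ ⟨c, d⟩ H i j k h1 h2
  cases i <;> cases j <;> cases k <;> simp [lf] at h1 h2
  exact H _ _ _ (by simpa using h1) (by simpa using h2)

theorem val_mid {ι : Type} [DecidableEq ι] (x : ι → ℝ) (l : List ι) : ∀ (r : Option ι → ℝ)
    (_ : Function.Injective x) (_ : l.Pairwise (fun a b => x a < x b))
    (_ : ∀ a ∈ l, r none < r (some a)) (_ : ∀ a, a ∉ l → r (some a) < r none) (_ : ∀ a b, r (some a) < r (some b) ↔ x a < x b),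
    Val r (l.map (fun a => (none, some a))) ∧ (∀ a, EndS r (l.map (fun a => (none, some a))) (some a) < EndS r (l.map (fun a => (none, some a))) none) ∧
    ∀ a b, EndS r (l.map (fun a => (none, some a))) (some a) < EndS r (l.map (fun a => (none, some a))) (some b) ↔ x a < x b := by
  induction l with
  | nil =>
    intro r hx hl h1 h2 h3
    exact ⟨trivial, fun a => h2 a (by simp), h3⟩
  | cons i l ih =>
    intro r hx hl h1 h2 h3
    obtain ⟨l1, l2⟩ := List.pairwise_cons.1 hl
    have hi := h1 i (by simp)
    set r' := r ∘ Equiv.swap none (some i) with hr'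
    have rn : r' none = r (some i) := by simp [hr']
    have ri : r' (some i) = r none := by simp [hr']
    have rk : ∀ k, k ≠ i → r' (some k) = r (some k) := fun k hk => by
      simp [hr', Equiv.swap_apply_of_ne_of_ne, hk]
    have il : i ∉ l := fun h => lt_irrefl _ (l1 i h)
    have := ih r' hx l2 (fun a ha => by
        rw [rn, rk a (fun e => il (e ▸ ha)), h3]; exact l1 a ha)
      (fun a ha => by
        by_cases e : a = i
        · subst e; rw [ri, rn]; exact hi
        · rw [rk a e, rn]; linarith [h2 a (by simp [e, ha])])
      (fun a b => by
        by_cases ea : a = i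
        · subst ea
          by_cases eb : b = a
          · subst eb; simp
          rw [ri, rk b eb]
          by_cases hb : b ∈ l
          · exact ⟨fun _ => l1 b hb, fun _ => h1 b (by simp [hb])⟩
          · have q := h2 b (by simp [eb, hb])
            have := (h3 b a).1 (by linarith)
            exact ⟨fun h => by linarith, fun h => by linarith⟩
        rw [rk a ea]
        by_cases eb : b = i
        · subst eb
          rw [ri]
          by_cases ha : a ∈ l
          · have q := h1 a (by simp [ha])
            have := l1 a ha
            exact ⟨fun h => by linarith, fun h => by linarith⟩
          · have q := h2 a (by simp [ea, ha])
            exact ⟨fun h => (h3 a b).1 (by linarith), fun _ => q⟩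
        rw [rk b eb, h3])
    refine ⟨⟨hi, fun m hm => ?_, this.1⟩, this.2⟩
    cases m with
    | none => exact lt_irrefl _ hm.1
    | some a =>
      simp only at hm
      by_cases ha : a ∈ i :: l
      · rcases List.mem_cons.1 ha with rfl | ha
        · exact lt_irrefl _ hm.2
        · have := (h3 a i).1 hm.2
          linarith [l1 a ha]
      · linarith [h2 a ha, hm.1]

theorem sorted_list {ι : Type} [Fintype ι] [DecidableEq ι] (x : ι → ℝ) (hx : Function.Injective x) :
    ∃ l : List ι, l.Pairwise (fun a b => x a < x b) ∧ ∀ a, a ∈ l := by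
  have : ∀ s : Finset ι, ∃ l : List ι, l.Pairwise (fun a b => x a < x b) ∧ ∀ a, a ∈ l ↔ a ∈ s := by
    intro s
    induction s using Finset.induction_on_max_value x with
    | empty => exact ⟨[], List.Pairwise.nil, by simp⟩
    | insert a s ha hle ih =>
      obtain ⟨l, h1, h2⟩ := ih
      refine ⟨l ++ [a], List.pairwise_append.2 ⟨h1, List.pairwise_singleton _ _, fun b hb c hc => ?_⟩, fun b => ?_⟩
      · rw [List.mem_singleton] at hc; subst hc
        have hb' := (h2 b).1 hb
        exact lt_of_le_of_ne (hle b hb') (fun e => ha (hx e ▸ hb'))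
      · simp [h2, or_comm]
  obtain ⟨l, h1, h2⟩ := this Finset.univ
  exact ⟨l, h1, fun a => (h2 a).2 (Finset.mem_univ a)⟩

theorem exists_bounds {ι : Type} [Fintype ι] (x : ι → ℝ) : ∃ c C : ℝ, ∀ i, c < x i ∧ x i < C := by
  obtain ⟨M, hM⟩ := (Set.finite_range x).bddAbove
  obtain ⟨m, hm⟩ := (Set.finite_range x).bddBelow
  exact ⟨m - 1, M + 1, fun i => ⟨by linarith [hm ⟨i, rfl⟩], by linarith [hM ⟨i, rfl⟩]⟩⟩

theorem Arr.full {ι : Type} [Fintype ι] [DecidableEq ι] {x : ι → ℝ} {T : ι → ι → ℝ} {γ : ι → ℝ → ℂ} {g : ι → ℂ → ℝ} (h : Arr x T γ g) :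
    ∃ (W : List (Option ι × Option ι)) (r : Option ι → ℝ), Function.Injective r ∧ (∀ k, r none ≤ r k) ∧ Val r W ∧ OK (T' x T) W ∧
      (∀ k l, k ≠ l → (k, l) ∈ W ∨ (l, k) ∈ W) ∧ (∀ i, (none, some i) ∈ W) := by
  obtain ⟨wu, u1, u2, u3⟩ := h.word
  obtain ⟨wl, l1, l2, l3⟩ := h.conj'.word
  simp only [neg_neg] at l2
  obtain ⟨l, s1, s2⟩ := sorted_list x h.xinj
  set mid : List (Option ι × Option ι) := l.map (fun a => (none, some a)) with hmid
  obtain ⟨v1, v2⟩ := val_rv x wu u1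
  set x0 := EndS x wu with hx0
  have x0i : Function.Injective x0 := end_inj x wu h.xinj
  obtain ⟨c1, C1, hc1⟩ := exists_bounds x
  obtain ⟨c2, C2, hc2⟩ := exists_bounds x0
  set c := min c1 c2 with hc
  have cx : ∀ i, c < x i := fun i => (min_le_left _ _).trans_lt (hc1 i).1
  have cx0 : ∀ i, c < x0 i := fun i => (min_le_right _ _).trans_lt (hc2 i).1
  obtain ⟨a1, a2⟩ := val_lift c (rv wu) x0 (Or.inl cx0) v1
  rw [v2] at a2
  obtain ⟨m1, m2, m3⟩ := val_mid x l (el c x) h.xinj s1 (fun a _ => cx a) (fun a ha => absurd (s2 a) ha) (fun a b => Iff.rfl)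
  obtain ⟨b1, _⟩ := val_lift C1 wl x (Or.inr (fun i => (hc1 i).2)) l1
  have b2 : Val (EndS (el c x) mid) (wl.map lf) := by
    refine b1.congr' ?_
    intro a b
    cases a with
    | none => cases b with
      | none => simp
      | some b => have q := m2 b; have q2 := (hc1 b).2; exact ⟨fun h => absurd h (by simp only [el]; linarith), fun h => absurd h (by linarith)⟩
    | some a => cases b with
      | none => exact ⟨fun _ => m2 a, fun _ => (hc1 a).2⟩
      | some b => exact (m3 a b).symm
  have mem_u : ∀ p ∈ (rv wu).map lf, ∃ i j, p = (some i, some j) ∧ i ≠ j ∧ T i j < 0 ∧ T j i < 0 := by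
    intro p hp
    obtain ⟨⟨i, j⟩, hq, rfl⟩ := List.mem_map.1 hp
    simp only [rv, List.mem_reverse, List.mem_map] at hq
    obtain ⟨⟨i', j'⟩, hq, e⟩ := hq
    simp only [Prod.swap, Prod.mk.injEq] at e
    obtain ⟨rfl, rfl⟩ := e
    have k1 := (u3 i' j').2 (Or.inl hq)
    exact ⟨_, _, rfl, k1.1.symm, h.T_symm k1.1 k1.2, k1.2⟩
  have mem_l : ∀ p ∈ wl.map lf, ∃ i j, p = (some i, some j) ∧ i ≠ j ∧ 0 < T i j ∧ 0 < T j i := by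
    intro p hp
    obtain ⟨⟨i, j⟩, hq, rfl⟩ := List.mem_map.1 hp
    have k1 := (l3 i j).2 (Or.inl hq)
    have k2 := (l3 j i).2 (Or.inr hq)
    exact ⟨_, _, rfl, k1.1, by linarith [k1.2], by linarith [k2.2]⟩
  have mem_m : ∀ p ∈ mid, ∃ i, p = (none, some i) := by
    intro p hp
    obtain ⟨i, hq, rfl⟩ := List.mem_map.1 hp
    exact ⟨i, rfl⟩
  refine ⟨(rv wu).map lf ++ (mid ++ wl.map lf), el c x0, ?_, ?_, ?_, ?_, ?_, ?_⟩
  · intro a b e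
    cases a <;> cases b <;> simp only [el] at e
    · rfl
    · exact absurd e (cx0 _).ne
    · exact absurd e (cx0 _).ne'
    · rw [x0i e]
  · intro k; cases k
    · exact le_rfl
    · exact (cx0 _).le
  · rw [val_append, val_append, a2]; exact ⟨a1, m1, b2⟩
  · unfold OK
    rw [List.pairwise_append, List.pairwise_append]
    refine ⟨ok_lift x T _ (OK.rv u2), ⟨?_, ok_lift x T _ l2, ?_⟩, ?_⟩
    · rw [hmid, List.pairwise_map]
      refine s1.imp ?_
      intro a b hab i j k e1 e2
      cases i <;> cases j <;> cases k <;> simp at e1 e2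
      · subst e1 e2; exact hab
      · subst e1; subst e2; exact absurd hab (lt_irrefl _)
    · intro p hp q hq i j k e1 e2
      obtain ⟨a, rfl⟩ := mem_m p hp
      obtain ⟨b, b', rfl, _, q1, q2⟩ := mem_l q hq
      cases i <;> cases j <;> cases k <;> simp at e1 e2
      subst e1
      rcases e2 with ⟨rfl, rfl⟩ | ⟨rfl, rfl⟩ <;> assumption
    · intro p hp q hq i j k e1 e2
      obtain ⟨b, b', rfl, _, q1, q2⟩ := mem_u p hp
      rcases List.mem_append.1 hq with hq | hq
      · obtain ⟨a, rfl⟩ := mem_m q hq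
        cases i <;> cases j <;> cases k <;> simp at e1 e2
        subst e2
        rcases e1 with ⟨rfl, rfl⟩ | ⟨rfl, rfl⟩ <;> assumption
      · obtain ⟨d, d', rfl, _, q3, q4⟩ := mem_l q hq
        cases i <;> cases j <;> cases k <;> simp at e1 e2
        simp only [T']
        rcases e1 with ⟨rfl, rfl⟩ | ⟨rfl, rfl⟩ <;> rcases e2 with ⟨rfl, rfl⟩ | ⟨rfl, rfl⟩ <;> linarith
  · have mm : ∀ i, ((none, some i) : Option ι × Option ι) ∈ mid := fun i => List.mem_map.2 ⟨i, s2 i, rfl⟩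
    have lm : ∀ w : List (ι × ι), ∀ i j, (i, j) ∈ w → ((some i, some j) : Option ι × Option ι) ∈ w.map lf := fun w i j h => List.mem_map.2 ⟨_, h, rfl⟩
    have rm : ∀ i j, (i, j) ∈ wu → (j, i) ∈ rv wu := fun i j h => by
      simp only [rv, List.mem_reverse, List.mem_map]; exact ⟨_, h, rfl⟩
    intro k l' hkl
    simp only [List.mem_append]
    cases k with
    | none => cases l' with
      | none => exact absurd rfl hkl
      | some i => exact Or.inl (Or.inr (Or.inl (mm i)))
    | some j => cases l' with
      | none => exact Or.inr (Or.inr (Or.inl (mm j)))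
      | some i =>
        have ne : j ≠ i := fun e => hkl (by rw [e])
        rcases lt_or_gt_of_ne (h.T_ne ne) with q | q
        · rcases (u3 j i).1 ⟨ne, q⟩ with q | q
          · exact Or.inr (Or.inl (lm _ _ _ (rm _ _ q)))
          · exact Or.inl (Or.inl (lm _ _ _ (rm _ _ q)))
        · rcases (l3 j i).1 ⟨ne, by simpa using q⟩ with q | q
          · exact Or.inl (Or.inr (Or.inr (lm _ _ _ q)))
          · exact Or.inr (Or.inr (Or.inr (lm _ _ _ q)))
  · intro i
    simp only [List.mem_append]
    exact Or.inr (Or.inl (List.mem_map.2 ⟨i, s2 i, rfl⟩))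
end CPR

open Set
namespace CPR
open Complex Metric Topology Filter
open scoped ComplexConjugate

theorem pw_forall {α : Type} {R : α → α → Prop} {l : List α} (h : l.Pairwise R) : ∀ a ∈ l, ∀ b ∈ l, a ≠ b → R a b ∨ R b a := by
  induction h with
  | nil => simp
  | @cons c l h1 h2 ih =>
    intro a ha b hb hab
    rcases List.mem_cons.1 ha with rfl | ha2
    · rcases List.mem_cons.1 hb with rfl | hb
      · exact absurd rfl hab
      · exact Or.inl (h1 b hb)
    · rcases List.mem_cons.1 hb with rfl | hb
      · exact Or.inr (h1 a ha2)
      · exact ih a ha2 b hb hab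

theorem Val.ne {ι : Type} [DecidableEq ι] {w : List (ι × ι)} : ∀ {r : ι → ℝ}, Val r w → ∀ p ∈ w, p.1 ≠ p.2 := by
  induction w with
  | nil => intro r _ p hp; simp at hp
  | cons q w ih =>
    intro r h p hp
    rcases List.mem_cons.1 hp with rfl | hp
    · intro e; have := h.1; rw [e] at this; exact lt_irrefl _ this
    · exact ih h.2.2 p hp

theorem OK.nr {ι : Type} {t : ι → ι → ℝ} {w : List (ι × ι)} (h : OK t w) : NR w := by
  refine List.Pairwise.imp ?_ h
  rintro ⟨a, b⟩ q H
  refine ⟨fun e => ?_, fun e => ?_⟩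
  · exact lt_irrefl _ (H a b b (Or.inl rfl) (Or.inl e))
  · exact lt_irrefl _ (H a b b (Or.inl rfl) (Or.inr e))

theorem count_le {κ : Type} [DecidableEq κ] (w : List (κ × κ)) (hw : w.Nodup) (k : κ) (s : Finset κ) (hs : ∀ l, (k, l) ∈ w → l ∈ s) :
    w.countP (fun p => p.1 = k) ≤ s.card := by
  rw [List.countP_eq_length_filter]
  have h1 : ((w.filter (fun p => p.1 = k)).map Prod.snd).Nodup := by
    refine List.Nodup.map_on ?_ (hw.filter _)
    rintro ⟨a, b⟩ ha ⟨c, d⟩ hc e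
    simp at ha hc e
    simp [ha.2, hc.2, e]
  rw [← List.length_map (f := Prod.snd), ← List.toFinset_card_of_nodup h1]
  refine Finset.card_le_card (fun l hl => ?_)
  simp at hl
  exact hs l hl

theorem Arr.funcs {ι : Type} [Fintype ι] [DecidableEq ι] {x : ι → ℝ} {T : ι → ι → ℝ} {γ : ι → ℝ → ℂ} {g : ι → ℂ → ℝ} (h : Arr x T γ g) :
    ∃ (f : Option ι → ℝ → ℝ) (Y : Option ι → Option ι → ℝ),
      (∀ k, ∃ (a s τ : ℝ) (K : List (ℝ × ℝ)), (∀ x, f k x = a + s * x + ks K x) ∧ KO τ K ∧ K.length ≤ Fintype.card ι) ∧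
      (∀ k l, k ≠ l → Y k l = Y l k ∧ (∀ x, f k x = f l x ↔ x = Y k l) ∧
        ∀ x x', x < Y k l → Y k l < x' → (f k x - f l x) * (f k x' - f l x') < 0) ∧
      (∀ j x, f none x < f (some j) x ↔ x < Y none (some j)) ∧
      (∀ k l l', k ≠ l → k ≠ l' → T' x T k l < T' x T k l' → Y k l < Y k l') := by
  obtain ⟨W, r, r1, r2, v, ok, cov, non⟩ := h.full
  have nr := ok.nr
  obtain ⟨f, X, f1, f2, f3⟩ := target W r r1 v nr none r2
  have nd : W.Nodup := by
    refine List.Pairwise.imp ?_ nr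
    intro a b h e; exact h.1 e.symm
  have nsw : ∀ k l, k ≠ l → (k, l) ∈ W → (l, k) ∉ W := by
    intro k l hkl h1 h2
    rcases pw_forall nr _ h1 _ h2 (fun e => hkl (by simp at e; exact e.1)) with h | h
    · exact h.2 rfl
    · exact h.2 rfl
  set Y : Option ι → Option ι → ℝ := fun k l => if (k, l) ∈ W then X (k, l) else X (l, k) with hY
  have Y1 : ∀ k l, (k, l) ∈ W → Y k l = X (k, l) := fun k l h => by simp [hY, h]
  have Y2 : ∀ k l, k ≠ l → (l, k) ∈ W → Y k l = X (l, k) := fun k l hkl h => by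
    have := nsw l k hkl.symm h
    simp [hY, this]
  have sgn : ∀ p ∈ W, ∀ x x', x < X p → X p < x' → (f p.1 x - f p.2 x) * (f p.1 x' - f p.2 x') < 0 := by
    intro p hp x x' h1 h2
    have a := (f2 p hp x).1.2 h1
    have b : f p.2 x' < f p.1 x' := by
      have b1 := (f2 p hp x').1
      have b2 := (f2 p hp x').2
      have b3 : ¬ f p.1 x' < f p.2 x' := fun h => by linarith [b1.1 h]
      have b4 : f p.1 x' ≠ f p.2 x' := fun h => by linarith [b2.1 h]
      exact lt_of_le_of_ne (not_lt.1 b3) b4.symm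
    exact mul_neg_of_neg_of_pos (by linarith) (by linarith)
  refine ⟨f, Y, fun k => ?_, fun k l hkl => ?_, fun j x => ?_, fun k l l' hkl hkl' hT => ?_⟩
  · obtain ⟨a, s, τ, K, e, ko, len⟩ := f1 k
    refine ⟨a, s, τ, K, e, ko, len.trans ?_⟩
    cases k with
    | none =>
      have := count_le W nd none (Finset.univ.erase none) (fun l hl => by
        simp only [Finset.mem_erase, Finset.mem_univ, and_true]; exact (v.ne _ hl).symm)
      rw [Finset.card_erase_of_mem (Finset.mem_univ _), Finset.card_univ, Fintype.card_option] at this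
      simpa using this
    | some i =>
      have := count_le W nd (some i) ((Finset.univ.erase none).erase (some i)) (fun l hl => by
        simp only [Finset.mem_erase, Finset.mem_univ, and_true]
        exact ⟨(v.ne _ hl).symm, fun e => nsw none (some i) (by simp) (non i) (by rw [← e]; exact hl)⟩)
      rw [Finset.card_erase_of_mem (by simp), Finset.card_erase_of_mem (Finset.mem_univ _), Finset.card_univ, Fintype.card_option] at this
      have pos : 0 < Fintype.card ι := Fintype.card_pos_iff.2 ⟨i⟩
      simp at this ⊢
      omega
  · rcases cov k l hkl with q | q
    · rw [Y1 k l q, Y2 l k hkl.symm q]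
      exact ⟨rfl, fun x => (f2 _ q x).2, sgn _ q⟩
    · rw [Y1 l k q, Y2 k l hkl q]
      refine ⟨rfl, fun x => ?_, fun x x' h1 h2 => ?_⟩
      · rw [eq_comm]; exact (f2 _ q x).2
      · have := sgn _ q x x' h1 h2
        simp only at this
        linarith
  · rw [Y1 _ _ (non j)]; exact (f2 _ (non j) x).1
  · have get : ∀ l, k ≠ l → ∃ p ∈ W, (p = (k, l) ∨ p = (l, k)) ∧ Y k l = X p := fun l hl => by
      rcases cov k l hl with q | q
      · exact ⟨_, q, Or.inl rfl, Y1 _ _ q⟩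
      · exact ⟨_, q, Or.inr rfl, Y2 _ _ hl q⟩
    obtain ⟨p, hp, e1, e2⟩ := get l hkl
    obtain ⟨q, hq, e3, e4⟩ := get l' hkl'
    have hpq : p ≠ q := by
      rintro rfl
      have : l ≠ l' := fun e => by rw [e] at hT; exact lt_irrefl _ hT
      rcases e1 with rfl | rfl <;> rcases e3 with e | e <;> simp at e
      · exact this e
      · exact hkl' e.1
      · exact hkl' e.2
      · exact this e
    rcases pw_forall (ok.and f3) _ hp _ hq hpq with h | h
    · rw [e2, e4]; exact h.2
    · have := h.1 k l' l e3 e1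
      linarith
end CPR

open Set
namespace CPR
open Complex Metric Topology Filter
open scoped ComplexConjugate

theorem bend (l β : ℝ) (hl : 0 < l) : ∃ χ : ℝ ≃o ℝ, (∀ y, y ≤ β → χ y = y) ∧ ∀ y, β ≤ y → χ y = β + l * (y - β) := by
  let F : ℝ → ℝ → ℝ := fun l y => if y ≤ β then y else β + l * (y - β)
  have F1 : ∀ l y, y ≤ β → F l y = y := fun l y h => by simp [F, h]
  have F2 : ∀ l y, β ≤ y → F l y = β + l * (y - β) := fun l y h => by
    rcases h.lt_or_eq with h | h
    · simp [F, not_le.2 h]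
    · subst h; simp [F]
  have hm : StrictMono (F l) := by
    intro a b hab
    rcases le_total a β with h1 | h1 <;> rcases le_total b β with h2 | h2
    · rw [F1 _ _ h1, F1 _ _ h2]; exact hab
    · rw [F1 _ _ h1, F2 _ _ h2]
      rcases h1.lt_or_eq with h3 | h3
      · nlinarith [mul_nonneg hl.le (sub_nonneg.2 h2)]
      · have := mul_pos hl (show 0 < b - β by linarith); linarith
    · linarith
    · rw [F2 _ _ h1, F2 _ _ h2]; nlinarith
  refine ⟨StrictMono.orderIsoOfRightInverse (F l) hm (F l⁻¹) (fun y => ?_), F1 l, F2 l⟩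
  rcases le_total y β with h | h
  · rw [F1 _ y h, F1 _ y h]
  · rw [F2 _ y h, F2]
    · field_simp; ring
    · have := mul_nonneg (inv_pos.2 hl).le (sub_nonneg.2 h); linarith

theorem interp {α : Type} [DecidableEq α] (u v : α → ℝ) (s : Finset α) (hi : ∀ a ∈ s, ∀ b ∈ s, u a = u b → a = b) (hm : ∀ a ∈ s, ∀ b ∈ s, u a < u b → v a < v b) :
    ∃ ψ : ℝ ≃o ℝ, ∀ a ∈ s, ψ (u a) = v a := by
  induction s using Finset.induction_on_max_value u with
  | empty => exact ⟨OrderIso.refl ℝ, by simp⟩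
  | insert a s ha hle ih =>
    obtain ⟨ψ, hψ⟩ := ih (fun b hb c hc => hi b (by simp [hb]) c (by simp [hc])) (fun b hb c hc => hm b (by simp [hb]) c (by simp [hc]))
    rcases s.eq_empty_or_nonempty with rfl | hne
    · exact ⟨OrderIso.addRight (v a - u a), by simp⟩
    obtain ⟨b, hb, hbm⟩ := Finset.exists_max_image s u hne
    have hba : u b < u a := lt_of_le_of_ne (hle b hb) (fun e => ha (hi b (by simp [hb]) a (by simp) e ▸ hb))
    have h1 : v b < v a := hm b (by simp [hb]) a (by simp) hba
    have h2 : v b < ψ (u a) := by rw [← hψ b hb]; exact ψ.strictMono hba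
    obtain ⟨χ, c1, c2⟩ := bend ((v a - v b) / (ψ (u a) - v b)) (v b) (div_pos (by linarith) (by linarith))
    refine ⟨ψ.trans χ, fun c hc => ?_⟩
    rcases Finset.mem_insert.1 hc with rfl | hc
    · show χ (ψ (u c)) = _
      rw [c2 _ h2.le, div_mul_cancel₀ _ (by linarith)]; ring
    · show χ (ψ (u c)) = _
      rw [hψ c hc]
      refine c1 _ ?_
      rw [← hψ c hc, ← hψ b hb]
      exact ψ.monotone (hbm c hc)

theorem cocompact_of_norm {l : Filter ℝ} {γ : ℝ → ℂ} (h : Tendsto (fun t => |(γ t).re|) l atTop) : Tendsto γ l (cocompact ℂ) := by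
  rw [← Metric.cobounded_eq_cocompact, ← tendsto_norm_atTop_iff_cobounded]
  exact tendsto_atTop_mono (fun t => abs_re_le_norm _) h

/-- graph -/
def G (f : ℝ → ℝ) : Set Plane := {p | p 1 = f (p 0)}

/-- graph homeomorphism -/
noncomputable def gh (ψ : ℝ ≃o ℝ) (f : ℝ → ℝ) (hf : Continuous f) : ℂ ≃ₜ Plane where
  toFun z := !₂[ψ.symm z.re, z.im + f (ψ.symm z.re)]
  invFun p := ⟨ψ (p 0), p 1 - f (p 0)⟩
  left_inv z := by simp
  right_inv p := by
    ext i; fin_cases i <;> simp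
  continuous_toFun := by
    have := ψ.symm.continuous
    refine (PiLp.continuous_toLp 2 _).comp (continuous_pi fun i => ?_)
    fin_cases i <;> simp <;> fun_prop
  continuous_invFun := by
    have := ψ.continuous
    have e : (fun p : Plane => (⟨ψ (p 0), p 1 - f (p 0)⟩ : ℂ)) = fun p => ((ψ (p 0) : ℝ) : ℂ) + ((p 1 - f (p 0) : ℝ) : ℂ) * I := by
      funext p; apply Complex.ext <;> simp
    rw [e]
    fun_prop

theorem Arr.real {ι : Type} [Fintype ι] [DecidableEq ι] {x : ι → ℝ} {T : ι → ι → ℝ} {γ : ι → ℝ → ℂ} {g : ι → ℂ → ℝ} (h : Arr x T γ g) :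
    ∃ (H : ℂ ≃ₜ Plane) (f : Option ι → ℝ → ℝ),
      (∀ k, ∃ (a s τ : ℝ) (K : List (ℝ × ℝ)), (∀ x, f k x = a + s * x + ks K x) ∧ KO τ K ∧ K.length ≤ Fintype.card ι) ∧
      H '' {z | z.im = 0} = G (f none) ∧ ∀ j, H '' range (γ j) = G (f (some j)) := by
  obtain ⟨f, Y, f1, f2, f3, f4⟩ := h.funcs
  have fc : ∀ k, Continuous (f k) := fun k => by
    obtain ⟨a, s, τ, K, e, _⟩ := f1 k
    rw [funext e]
    have := ks_cont K
    fun_prop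
  have hΦ : ∀ j, ∃ Φ : ℝ ≃o ℝ, ∀ k, k ≠ some j → Φ (T' x T (some j) k) = Y (some j) k := fun j => by
    obtain ⟨Φ, hΦ⟩ := interp (T' x T (some j)) (Y (some j)) (Finset.univ.erase (some j)) (fun a ha b hb e => by
        simp only [Finset.mem_erase, Finset.mem_univ, and_true] at ha hb
        cases a <;> cases b <;> simp only [T'] at e
        · rfl
        · exact absurd e.symm (h.T_ne (fun q => hb (by rw [q])))
        · exact absurd e (h.T_ne (fun q => ha (by rw [q])))
        · rename_i a b
          by_contra q
          exact h.tri a j b (fun e => ha (by rw [e])) (fun e => q (by rw [e])) (fun e => hb (by rw [e])) e)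
      (fun a ha b hb e => f4 _ _ _ (Finset.ne_of_mem_erase ha).symm (Finset.ne_of_mem_erase hb).symm e)
    exact ⟨Φ, fun k hk => hΦ k (by simp [hk])⟩
  choose Φ hΦ using hΦ
  obtain ⟨ψ', hψ'⟩ := interp (T' x T none ∘ some) (Y none ∘ some) (Finset.univ : Finset ι) (fun a _ b _ e => h.xinj e)
    (fun a _ b _ e => f4 _ _ _ (by simp) (by simp) e)
  set ψ := ψ'.symm with hψd
  have hψ : ∀ j, ψ (Y none (some j)) = x j := fun j => by
    have := hψ' j (Finset.mem_univ j)
    simp only [Function.comp, T'] at this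
    rw [hψd, ← this]; simp
  have Φ0 : ∀ j, Φ j 0 = Y none (some j) := fun j => by
    rw [(f2 none (some j) (by simp)).1]; exact hΦ j none (by simp)
  have ΦT : ∀ j i, i ≠ j → Φ j (T j i) = Y (some j) (some i) := fun j i hij => hΦ j (some i) (by simpa using hij)
  have fne : ∀ j y, Y none (some j) < y → f (some j) y < f none y := fun j y hy => by
    have a : ¬ f none y < f (some j) y := fun q => by linarith [(f3 j y).1 q]
    have b : f none y ≠ f (some j) y := fun q => by linarith [((f2 none (some j) (by simp)).2.1 y).1 q]
    exact lt_of_le_of_ne (not_lt.1 a) b.symm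
  let δ : ι → ℝ → ℂ := fun j t => ⟨ψ (Φ j t), f (some j) (Φ j t) - f none (Φ j t)⟩
  let gδ : ι → ℂ → ℝ := fun i z => z.im - (f (some i) (ψ.symm z.re) - f none (ψ.symm z.re))
  have gδδ : ∀ i j t, gδ i (δ j t) = f (some j) (Φ j t) - f (some i) (Φ j t) := fun i j t => by
    simp [gδ, δ]
  have A : Arr x T δ gδ :=
    { xinj := h.xinj
      cont := fun j => by
        have := fc (some j); have := fc none; have := ψ.continuous; have := (Φ j).continuous
        have e : δ j = fun t => ((ψ (Φ j t) : ℝ) : ℂ) + ((f (some j) (Φ j t) - f none (Φ j t) : ℝ) : ℂ) * I := by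
          funext p; apply Complex.ext <;> simp [δ]
        rw [e]; fun_prop
      inj := fun j a b e => by
        have := congrArg Complex.re e
        simpa [δ] using this
      limT := fun j => cocompact_of_norm (tendsto_abs_atTop_atTop.comp (ψ.tendsto_atTop.comp (Φ j).tendsto_atTop))
      limB := fun j => cocompact_of_norm (tendsto_abs_atBot_atTop.comp (ψ.tendsto_atBot.comp (Φ j).tendsto_atBot))
      zero := fun j => by
        apply Complex.ext
        · simp [δ, Φ0, hψ]
        · simp only [δ, Φ0, ofReal_im]
          linarith [((f2 none (some j) (by simp)).2.1 _).2 rfl]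
      up := fun j t ht => by
        have : Φ j t < Y none (some j) := by rw [← Φ0]; exact (Φ j).strictMono ht
        simp only [δ]; linarith [(f3 j _).2 this]
      dn := fun j t ht => by
        have : Y none (some j) < Φ j t := by rw [← Φ0]; exact (Φ j).strictMono ht
        simp only [δ]; linarith [fne j _ this]
      gc := fun i => by
        have := fc (some i); have := fc none; have := ψ.symm.continuous
        simp only [gδ]
        fun_prop
      gz := fun i z => by
        constructor
        · intro e
          refine ⟨(Φ i).symm (ψ.symm z.re), ?_⟩
          simp only [gδ] at e
          apply Complex.ext
          · simp [δ]
          · simp only [δ, OrderIso.apply_symm_apply]; linarith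
        · rintro ⟨t, rfl⟩
          rw [gδδ]; ring
      gi := fun i j hij t => by
        rw [gδδ, sub_eq_zero, (f2 (some j) (some i) (by simpa using hij.symm)).2.1, ← ΦT j i hij, (Φ j).injective.eq_iff]
      gs := fun i j hij t t' h1 h2 => by
        rw [gδδ, gδδ]
        refine (f2 (some j) (some i) (by simpa using hij.symm)).2.2 _ _ ?_ ?_
        · rw [← ΦT j i hij]; exact (Φ j).strictMono h1
        · rw [← ΦT j i hij]; exact (Φ j).strictMono h2
      meet := fun i j hij => by
        obtain ⟨q1, q2, _⟩ := f2 (some i) (some j) (by simpa using hij)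
        have e := (q2 _).2 rfl
        simp only [δ]
        rw [ΦT i j hij.symm, ΦT j i hij, ← q1, e]
      tri := h.tri }
  obtain ⟨H, H1, H2⟩ := ext_plane h.ur A.ur h.lr A.lr (fun i j s t => by rw [h.eq_iff, A.eq_iff])
  refine ⟨H.trans (gh ψ (f none) (fc none)), f, f1, ?_, fun j => ?_⟩
  · ext p
    constructor
    · rintro ⟨z, hz, rfl⟩
      show (gh ψ (f none) (fc none)) (H z) ∈ _
      rw [H1 z hz]
      have : z.im = 0 := hz
      simp [gh, G, this]
    · intro hp
      refine ⟨⟨ψ (p 0), 0⟩, rfl, ?_⟩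
      show (gh ψ (f none) (fc none)) (H _) = _
      rw [H1 _ rfl]
      have hp' : p 1 = f none (p 0) := hp
      ext i; fin_cases i <;> simp [gh, hp']
  · ext p
    constructor
    · rintro ⟨_, ⟨t, rfl⟩, rfl⟩
      show (gh ψ (f none) (fc none)) (H _) ∈ _
      rw [H2]
      simp [gh, G, δ]
    · intro hp
      refine ⟨γ j ((Φ j).symm (p 0)), ⟨_, rfl⟩, ?_⟩
      show (gh ψ (f none) (fc none)) (H _) = _
      rw [H2]
      have hp' : p 1 = f (some j) (p 0) := hp
      ext i; fin_cases i <;> simp [gh, hp', δ]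
end CPR

open Set
namespace CPR
open Complex Metric Topology Filter
open scoped ComplexConjugate

theorem seg_line (a s u v : ℝ) (huv : u ≤ v) : IsSegment {p : Plane | u ≤ p 0 ∧ p 0 ≤ v ∧ p 1 = a + s * p 0} := by
  refine ⟨!₂[u, a + s * u], !₂[v, a + s * v], ?_⟩
  ext p
  rw [segment_eq_image]
  constructor
  · rintro ⟨h1, h2, h3⟩
    rcases huv.eq_or_lt with e | e
    · subst e
      have e : p 0 = u := le_antisymm h2 h1
      refine ⟨0, by simp, ?_⟩
      ext i; fin_cases i
      · simp [e]
      · simp [h3, e]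
    · have hd : 0 < v - u := by linarith
      refine ⟨(p 0 - u) / (v - u), ⟨div_nonneg (by linarith) hd.le, (div_le_one hd).2 (by linarith)⟩, ?_⟩
      ext i; fin_cases i
      · simp; field_simp; ring
      · simp [h3]; field_simp; ring
  · rintro ⟨t, ⟨h1, h2⟩, rfl⟩
    simp only [mem_ofPred_eq, PiLp.add_apply, PiLp.smul_apply, smul_eq_mul]
    simp
    refine ⟨by nlinarith, by nlinarith, by ring⟩

theorem ray_right (a s u : ℝ) : IsRay {p : Plane | u ≤ p 0 ∧ p 1 = a + s * p 0} := by
  refine ⟨!₂[u, a + s * u], !₂[1, s], fun h => ?_, ?_⟩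
  · have := congrArg (fun p : Plane => p 0) h
    simp at this
  · ext p
    constructor
    · rintro ⟨h1, h2⟩
      refine ⟨p 0 - u, by linarith, ?_⟩
      ext i; fin_cases i
      · simp
      · simp [h2]; ring
    · rintro ⟨t, ht, rfl⟩
      simp [ht]; ring

theorem ray_left (a s u : ℝ) : IsRay {p : Plane | p 0 ≤ u ∧ p 1 = a + s * p 0} := by
  refine ⟨!₂[u, a + s * u], !₂[-1, -s], fun h => ?_, ?_⟩
  · have := congrArg (fun p : Plane => p 0) h
    simp at this
  · ext p
    constructor
    · rintro ⟨h1, h2⟩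
      refine ⟨u - p 0, by linarith, ?_⟩
      ext i; fin_cases i
      · simp
      · simp [h2]; ring
    · rintro ⟨t, ht, rfl⟩
      simp [ht]; ring

theorem right_part (K : List (ℝ × ℝ)) : ∀ (τ a s : ℝ), KO τ K → ∃ (R : Set Plane) (m : ℕ) (S : Fin m → Set Plane),
    IsRay R ∧ m ≤ K.length ∧ (∀ k, IsSegment (S k)) ∧
      {p : Plane | τ ≤ p 0 ∧ p 1 = a + s * p 0 + ks K (p 0)} = R ∪ ⋃ k, S k := by
  induction K with
  | nil =>
    intro τ a s _
    refine ⟨_, 0, Fin.elim0, ray_right a s τ, le_rfl, fun k => k.elim0, ?_⟩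
    simp [ks]
  | cons q K ih =>
    intro τ a s h
    obtain ⟨h1, h2, h3⟩ := h
    obtain ⟨R, m, S, r1, r2, r3, r4⟩ := ih q.1 (a - q.2 * q.1) (s + q.2) h3
    refine ⟨R, m + 1, Fin.cons {p : Plane | τ ≤ p 0 ∧ p 0 ≤ q.1 ∧ p 1 = a + s * p 0} S, r1, by simpa using r2, ?_, ?_⟩
    · intro k
      refine Fin.cases ?_ (fun k => ?_) k
      · simpa using seg_line a s τ q.1 h1
      · simpa using r3 k
    · have e : (⋃ k, (Fin.cons {p : Plane | τ ≤ p 0 ∧ p 0 ≤ q.1 ∧ p 1 = a + s * p 0} S : Fin (m + 1) → Set Plane) k) = {p : Plane | τ ≤ p 0 ∧ p 0 ≤ q.1 ∧ p 1 = a + s * p 0} ∪ ⋃ k, S k := by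
        ext p
        simp only [mem_iUnion, mem_union, Fin.exists_fin_succ, Fin.cons_zero, Fin.cons_succ]
      rw [e, union_left_comm, ← r4]
      ext p
      simp only [mem_ofPred_eq, mem_union, ks]
      rcases le_total (p 0) q.1 with hp | hp
      · rw [max_eq_right (by linarith), h3.zero hp]
        constructor
        · rintro ⟨a1, a2⟩; left; exact ⟨a1, hp, by linarith⟩
        · rintro (⟨a1, _, a2⟩ | ⟨a1, a2⟩)
          · exact ⟨a1, by linarith⟩
          · have : p 0 = q.1 := le_antisymm hp a1
            exact ⟨by linarith, by rw [a2, this]; ring⟩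
      · rw [max_eq_left (by linarith)]
        constructor
        · rintro ⟨a1, a2⟩; right; exact ⟨hp, by rw [a2]; ring⟩
        · rintro (⟨a1, a3, a2⟩ | ⟨a1, a2⟩)
          · have : p 0 = q.1 := le_antisymm a3 hp
            refine ⟨a1, ?_⟩
            rw [a2, h3.zero a3, this]; ring
          · exact ⟨by linarith, by rw [a2]; ring⟩

theorem chain_graph {f : ℝ → ℝ} {a s τ : ℝ} {K : List (ℝ × ℝ)} (hf : ∀ x, f x = a + s * x + ks K x) (hK : KO τ K) :
    ∃ (R₁ R₂ : Set Plane) (m : ℕ) (S : Fin m → Set Plane), IsRay R₁ ∧ IsRay R₂ ∧ m ≤ K.length - 1 ∧ (∀ k, IsSegment (S k)) ∧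
      G f = R₁ ∪ R₂ ∪ ⋃ k, S k := by
  cases K with
  | nil =>
    refine ⟨_, _, 0, Fin.elim0, ray_left a s 0, ray_right a s 0, by simp, fun k => k.elim0, ?_⟩
    ext p
    simp only [G, mem_ofPred_eq, hf, ks, mem_union, iUnion_of_empty, mem_empty_iff_false, or_false, add_zero]
    have := le_total (p 0) 0
    tauto
  | cons q K =>
    obtain ⟨h1, h2, h3⟩ := hK
    obtain ⟨R, m, S, r1, r2, r3, r4⟩ := right_part K q.1 (a - q.2 * q.1) (s + q.2) h3
    refine ⟨_, R, m, S, ray_left a s q.1, r1, by simpa using r2, r3, ?_⟩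
    rw [union_assoc, ← r4]
    ext p
    simp only [G, mem_ofPred_eq, hf, ks, mem_union]
    rcases le_total (p 0) q.1 with hp | hp
    · rw [max_eq_right (by linarith), h3.zero hp]
      constructor
      · intro a2; left; exact ⟨hp, by linarith⟩
      · rintro (⟨_, a2⟩ | ⟨a1, a2⟩)
        · linarith
        · have : p 0 = q.1 := le_antisymm hp a1
          rw [a2, this]; ring
    · rw [max_eq_left (by linarith)]
      constructor
      · intro a2; right; exact ⟨hp, by rw [a2]; ring⟩
      · rintro (⟨a3, a2⟩ | ⟨a1, a2⟩)
        · have : p 0 = q.1 := le_antisymm a3 hp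
          rw [a2, h3.zero a3, this]; ring
        · rw [a2]; ring

theorem convex_graph {f : ℝ → ℝ} {a s τ : ℝ} {K : List (ℝ × ℝ)} (hf : ∀ x, f x = a + s * x + ks K x) (hK : KO τ K) :
    InConvexBoundary (G f) := by
  have fc : Continuous f := by
    rw [funext hf]
    have := ks_cont K
    fun_prop
  have c0 : Continuous (fun p : Plane => p 0) := by fun_prop
  have c1 : Continuous (fun p : Plane => p 1) := by fun_prop
  have hcl : IsClosed {p : Plane | f (p 0) ≤ p 1} := isClosed_le (fc.comp c0) c1
  refine ⟨{p | f (p 0) ≤ p 1}, hcl, ?_, ?_, ?_⟩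
  · intro p hp q hq α β hα hβ hαβ
    have hp' : f (p 0) ≤ p 1 := hp
    have hq' : f (q 0) ≤ q 1 := hq
    have hc := hK.convex.2 (mem_univ (p 0)) (mem_univ (q 0)) hα hβ hαβ
    rw [hf] at hp' hq'
    simp only [smul_eq_mul] at hc
    show f ((α • p + β • q) 0) ≤ (α • p + β • q) 1
    simp only [PiLp.add_apply, PiLp.smul_apply, smul_eq_mul]
    rw [hf]
    have e1 := mul_le_mul_of_nonneg_left hp' hα
    have e2 := mul_le_mul_of_nonneg_left hq' hβ
    have e3 : a = α * a + β * a := by rw [← add_mul, hαβ, one_mul]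
    nlinarith
  · refine ⟨!₂[0, f 0 + 1], ?_⟩
    refine mem_interior.2 ⟨{p | f (p 0) < p 1}, fun p (hp : f (p 0) < p 1) => (show f (p 0) ≤ p 1 from hp.le), isOpen_lt (fc.comp c0) c1, ?_⟩
    simp
  · intro p hp
    have hp' : p 1 = f (p 0) := hp
    refine ⟨subset_closure (le_of_eq hp'.symm), fun hi => ?_⟩
    have cφ : Continuous (fun t : ℝ => (!₂[p 0, t] : Plane)) := by
      refine (PiLp.continuous_toLp 2 _).comp (continuous_pi fun i => ?_)
      fin_cases i <;> simp <;> fun_prop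
    have ho : IsOpen ((fun t : ℝ => (!₂[p 0, t] : Plane)) ⁻¹' interior {p : Plane | f (p 0) ≤ p 1}) := isOpen_interior.preimage cφ
    have hs : ((fun t : ℝ => (!₂[p 0, t] : Plane)) ⁻¹' interior {p : Plane | f (p 0) ≤ p 1}) ⊆ Ici (p 1) := by
      intro t ht
      have := interior_subset ht
      simpa [hp'] using this
    have hm : p 1 ∈ interior (Ici (p 1)) := by
      refine mem_interior.2 ⟨_, hs, ho, ?_⟩
      have : (!₂[p 0, p 1] : Plane) = p := by ext i; fin_cases i <;> simp
      rw [mem_preimage, this]; exact hi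
    rw [interior_Ici] at hm
    exact lt_irrefl _ (mem_Ioi.1 hm)
end CPR

open Set
namespace CPR
open Complex Metric Topology Filter
open scoped ComplexConjugate

theorem pl_straighten {L : Set Plane} (h : IsPseudoline L) : ∃ E : Plane ≃ₜ ℂ, ∀ p, p ∈ L ↔ (E p).im = 0 := by
  obtain ⟨h, ℓ, ⟨a, u, hu, rfl⟩, rfl⟩ := h
  let φ := Complex.orthonormalBasisOneI.repr.symm
  have hφu : φ u ≠ 0 := by simpa using hu
  refine ⟨h.symm.trans (φ.toHomeomorph.trans ((Homeomorph.addRight (-φ a)).trans (Homeomorph.mulRight₀ (φ u)⁻¹ (inv_ne_zero hφu)))), fun p => ?_⟩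
  show _ ↔ ((φ (h.symm p) + -φ a) * (φ u)⁻¹).im = 0
  constructor
  · rintro ⟨_, ⟨t, rfl⟩, rfl⟩
    have : (φ (h.symm (h (a + t • u))) + -φ a) * (φ u)⁻¹ = (t : ℂ) := by
      rw [Homeomorph.symm_apply_apply, map_add, map_smul, Complex.real_smul]
      field_simp; ring
    rw [this, ofReal_im]
  · intro e
    set t := ((φ (h.symm p) + -φ a) * (φ u)⁻¹).re with ht
    have e2 : (φ (h.symm p) + -φ a) * (φ u)⁻¹ = (t : ℂ) := Complex.ext (by simp [ht]) (by simp [e])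
    refine ⟨h.symm p, ⟨t, ?_⟩, by simp⟩
    apply φ.injective
    rw [map_add, map_smul, Complex.real_smul, ← e2]
    field_simp; ring

theorem same_sign' {s : ℝ → ℝ} (hs : Continuous s) {t0 : ℝ} (hz : ∀ t, s t = 0 ↔ t = t0) {a b : ℝ}
    (h : (a < t0 ∧ b < t0) ∨ (t0 < a ∧ t0 < b)) : 0 < s a * s b := by
  by_contra hn
  push Not at hn
  have h0 : (0 : ℝ) ∈ uIcc (s a) (s b) := by
    rcases mul_nonpos_iff.1 hn with ⟨h1, h2⟩ | ⟨h1, h2⟩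
    · exact mem_uIcc.2 (Or.inr ⟨h2, h1⟩)
    · exact mem_uIcc.2 (Or.inl ⟨h1, h2⟩)
  obtain ⟨t, ht, e⟩ := intermediate_value_uIcc hs.continuousOn h0
  have := (hz t).1 e
  rcases mem_uIcc.1 ht with ⟨h1, h2⟩ | ⟨h1, h2⟩ <;> rcases h with ⟨h3, h4⟩ | ⟨h3, h4⟩ <;> linarith

theorem opp_sign {s : ℝ → ℝ} (hs : Continuous s) {t0 : ℝ} (hz : ∀ t, s t = 0 ↔ t = t0) {t1 t2 : ℝ} (h1 : 0 < s t1) (h2 : s t2 < 0)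
    {t t' : ℝ} (ht : t < t0) (ht' : t0 < t') : s t * s t' < 0 := by
  have n1 : t1 ≠ t0 := fun e => h1.ne' ((hz _).2 e)
  have n2 : t2 ≠ t0 := fun e => h2.ne ((hz _).2 e)
  have S := @same_sign' s hs t0 hz
  rcases lt_or_gt_of_ne n1 with l1 | l1 <;> rcases lt_or_gt_of_ne n2 with l2 | l2
  · have := S (Or.inl ⟨l1, l2⟩); nlinarith
  · have b := S (Or.inr ⟨ht', l2⟩)
    have a' : 0 < s t := by
      have := S (Or.inl ⟨ht, l1⟩); exact (pos_iff_pos_of_mul_pos this).2 h1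
    have b' : s t' < 0 := (neg_iff_neg_of_mul_pos b).2 h2
    exact mul_neg_of_pos_of_neg a' b'
  · have a' : s t < 0 := (neg_iff_neg_of_mul_pos (S (Or.inl ⟨ht, l2⟩))).2 h2
    have b' : 0 < s t' := (pos_iff_pos_of_mul_pos (S (Or.inr ⟨ht', l1⟩))).2 h1
    exact mul_neg_of_neg_of_pos a' b'
  · have := S (Or.inr ⟨l1, l2⟩); nlinarith

theorem comp_sign {M : Set Plane} {E : Plane ≃ₜ ℂ} (hE : ∀ p, p ∈ M ↔ (E p).im = 0) {x y : Plane} (hx : x ∈ Mᶜ)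
    (hy : y ∈ connectedComponentIn Mᶜ x) : 0 < (E x).im * (E y).im := by
  by_contra hn
  push Not at hn
  have hc : Continuous fun p => (E p).im := Complex.continuous_im.comp E.continuous
  have h0 : (0 : ℝ) ∈ (fun p => (E p).im) '' connectedComponentIn Mᶜ x := by
    have hp := (isPreconnected_connectedComponentIn (F := Mᶜ) (x := x)).image _ hc.continuousOn
    have mx := mem_image_of_mem (fun p => (E p).im) (mem_connectedComponentIn hx)
    have my := mem_image_of_mem (fun p => (E p).im) hy
    rcases mul_nonpos_iff.1 hn with ⟨h1, h2⟩ | ⟨h1, h2⟩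
    · exact hp.Icc_subset my mx ⟨h2, h1⟩
    · exact hp.Icc_subset mx my ⟨h1, h2⟩
  obtain ⟨z, hz, e⟩ := h0
  exact connectedComponentIn_subset _ _ hz ((hE z).2 e)

theorem cross_sign {M N : Set Plane} {E F : Plane ≃ₜ ℂ} (hE : ∀ p, p ∈ M ↔ (E p).im = 0) (hF : ∀ p, p ∈ N ↔ (F p).im = 0)
    (hc : ∀ x ∈ Mᶜ, (N ∩ connectedComponentIn Mᶜ x).Nonempty) {t0 : ℝ}
    (hz : ∀ t : ℝ, (E (F.symm t)).im = 0 ↔ t = t0) {t t' : ℝ} (ht : t < t0) (ht' : t0 < t') :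
    (E (F.symm t)).im * (E (F.symm t')).im < 0 := by
  have hs : Continuous fun t : ℝ => (E (F.symm t)).im :=
    Complex.continuous_im.comp (E.continuous.comp (F.symm.continuous.comp Complex.continuous_ofReal))
  have key : ∀ w : ℂ, w.im ≠ 0 → ∃ t : ℝ, 0 < w.im * (E (F.symm t)).im := by
    intro w hw
    have hx : E.symm w ∈ Mᶜ := fun h => hw (by simpa using (hE _).1 h)
    obtain ⟨y, hyN, hy⟩ := hc _ hx
    have := comp_sign hE hx hy
    refine ⟨(F y).re, ?_⟩
    have e : (((F y).re : ℝ) : ℂ) = F y := Complex.ext (by simp) (by simp [(hF y).1 hyN])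
    rw [e]; simpa using this
  obtain ⟨t1, h1⟩ := key I (by simp)
  obtain ⟨t2, h2⟩ := key (-I) (by simp)
  simp at h1 h2
  exact opp_sign hs hz h1 h2 ht ht'

theorem to_arr {m : ℕ} {L : Fin (m + 1) → Set Plane} (hA : IsArrangement L) (hS : IsSimple L) :
    ∃ (e : Plane ≃ₜ ℂ) (x : Fin m → ℝ) (T : Fin m → Fin m → ℝ) (γ : Fin m → ℝ → ℂ) (g : Fin m → ℂ → ℝ), Arr x T γ g ∧
      e '' L 0 = {z | z.im = 0} ∧ ∀ j : Fin m, e '' L j.succ = range (γ j) := by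
  obtain ⟨⟨_, h1, h2, h3⟩, h4⟩ := hA
  choose E hE using fun i => pl_straighten (h1 i)
  choose! c hc using h4
  have hcs : ∀ i j, i ≠ j → c i j = c j i := fun i j hij => h2 i j hij (hc i j hij) (hc j i hij.symm).symm
  let P : Fin (m + 1) → Fin (m + 1) → ℝ := fun i j => (E i (c i j)).re
  have hP : ∀ i j, i ≠ j → ((P i j : ℝ) : ℂ) = E i (c i j) := fun i j hij =>
    Complex.ext (by simp [P]) (by simp [(hE i _).1 (hc i j hij).1])
  have memL : ∀ i (t : ℝ), (E i).symm t ∈ L i := fun i t => by rw [hE]; simp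
  have hz : ∀ i j, i ≠ j → ∀ t : ℝ, (E i ((E j).symm t)).im = 0 ↔ t = P j i := fun i j hij t => by
    rw [← hE]
    constructor
    · intro h
      have := h2 i j hij ⟨h, memL j t⟩ (hc i j hij)
      rw [hcs i j hij] at this
      have e : ((t : ℝ) : ℂ) = (P j i : ℝ) := by
        rw [hP j i hij.symm, ← this]; simp
      exact_mod_cast e
    · rintro rfl
      rw [hP j i hij.symm]; simpa using (hc j i hij.symm).2
  have hsg : ∀ i j, i ≠ j → ∀ t t' : ℝ, t < P j i → P j i < t' → (E i ((E j).symm t)).im * (E i ((E j).symm t')).im < 0 := fun i j hij t t' ht ht' =>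
    cross_sign (hE i) (hE j) (h3 i j hij _ (hc i j hij)).2.2 (hz i j hij) ht ht'
  have Pne : ∀ i j k, i ≠ j → i ≠ k → j ≠ k → P i j ≠ P i k := fun i j k hij hik hjk e => by
    have e' : c i j = c i k := by
      apply (E i).injective
      rw [← hP i j hij, ← hP i k hik, e]
    rcases hS (c i j) i j k (hc i j hij).1 (hc i j hij).2 (e' ▸ (hc i k hik).2) with q | q | q
    · exact hij q
    · exact hik q
    · exact hjk q
  have z0 : ∀ j : Fin m, (0 : Fin (m + 1)) ≠ j.succ := fun j => (Fin.succ_ne_zero j).symm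
  have sn : ∀ i j : Fin m, i ≠ j → i.succ ≠ j.succ := fun i j h e => h (Fin.succ_injective _ e)
  have hσ : ∀ j : Fin m, ∃ σ : ℝ, (σ = 1 ∨ σ = -1) ∧ (∀ t, t < 0 → 0 < (E 0 ((E j.succ).symm ((P j.succ 0 + σ * t : ℝ) : ℂ))).im) ∧
      (∀ t, 0 < t → (E 0 ((E j.succ).symm ((P j.succ 0 + σ * t : ℝ) : ℂ))).im < 0) := fun j => by
    have S := hsg 0 j.succ (z0 j)
    set s : ℝ → ℝ := fun t => (E 0 ((E j.succ).symm t)).im with hs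
    have S' : ∀ t t' : ℝ, t < P j.succ 0 → P j.succ 0 < t' → s t * s t' < 0 := S
    set p := P j.succ 0
    have hne : s (p - 1) ≠ 0 := fun e => by have := (hz 0 j.succ (z0 j) _).1 e; linarith
    have r : ∀ t, p < t → s (p - 1) * s t < 0 := fun t ht => S' _ _ (by linarith) ht
    have l : ∀ t, t < p → s t * s (p + 1) < 0 := fun t ht => S' _ _ ht (by linarith)
    have m := r (p + 1) (by linarith)
    rcases lt_or_gt_of_ne hne with q | q
    · refine ⟨-1, Or.inr rfl, fun t ht => ?_, fun t ht => ?_⟩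
      · have := r (p + -1 * t) (by linarith)
        show 0 < s (p + -1 * t)
        nlinarith
      · have q' : 0 < s (p + 1) := by nlinarith
        have := l (p + -1 * t) (by linarith)
        show s (p + -1 * t) < 0
        nlinarith
    · refine ⟨1, Or.inl rfl, fun t ht => ?_, fun t ht => ?_⟩
      · have q' : s (p + 1) < 0 := by nlinarith
        have := l (p + 1 * t) (by linarith)
        show 0 < s (p + 1 * t)
        nlinarith
      · have := r (p + 1 * t) (by linarith)
        show s (p + 1 * t) < 0
        nlinarith
  choose σ s1 s2 s3 using hσ
  have σσ : ∀ j, σ j * σ j = 1 := fun j => by rcases s1 j with h | h <;> rw [h] <;> norm_num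
  have σ0 : ∀ j, σ j ≠ 0 := fun j h => by have := σσ j; rw [h] at this; norm_num at this
  let q : Fin m → ℝ → ℝ := fun j t => P j.succ 0 + σ j * t
  let γ : Fin m → ℝ → ℂ := fun j t => E 0 ((E j.succ).symm (q j t : ℝ))
  let g : Fin m → ℂ → ℝ := fun i z => (E i.succ ((E 0).symm z)).im
  let T : Fin m → Fin m → ℝ := fun j i => σ j * (P j.succ i.succ - P j.succ 0)
  have gγ : ∀ i j t, g i (γ j t) = (E i.succ ((E j.succ).symm (q j t : ℝ))).im := fun i j t => by simp [g, γ]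
  have qT : ∀ j i, q j (T j i) = P j.succ i.succ := fun j i => by
    simp only [q, T]; rw [← mul_assoc, σσ]; ring
  have qc : ∀ j, Continuous (q j) := fun j => by simp only [q]; fun_prop
  have qi : ∀ j, Function.Injective (q j) := fun j a b e => by
    simp only [q] at e
    exact mul_left_cancel₀ (σ0 j) (by linarith)
  have qs : ∀ j z, ∃ t, q j t = z := fun j z => ⟨σ j * (z - P j.succ 0), by simp only [q]; rw [← mul_assoc, σσ]; ring⟩
  have lim : ∀ j (l : Filter ℝ), Tendsto (q j) l (cocompact ℝ) → Tendsto (γ j) l (cocompact ℂ) := fun j l h =>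
    (E 0).isClosedEmbedding.tendsto_cocompact.comp ((E j.succ).symm.isClosedEmbedding.tendsto_cocompact.comp
      (Complex.isometry_ofReal.isClosedEmbedding.tendsto_cocompact.comp h))
  have qh : ∀ j, ∃ Q : ℝ ≃ₜ ℝ, ∀ t, Q t = q j t := fun j =>
    ⟨(Homeomorph.mulLeft₀ (σ j) (σ0 j)).trans (Homeomorph.addLeft (P j.succ 0)), fun t => rfl⟩
  have ql : ∀ j, Tendsto (q j) (cocompact ℝ) (cocompact ℝ) := fun j => by
    obtain ⟨Q, hQ⟩ := qh j
    rw [← (funext hQ : (Q : ℝ → ℝ) = q j)]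
    exact Q.isClosedEmbedding.tendsto_cocompact
  have rg : ∀ j : Fin m, ∀ z, z ∈ range (γ j) ↔ (E 0).symm z ∈ L j.succ := fun j z => by
    constructor
    · rintro ⟨t, rfl⟩
      simpa [γ] using memL j.succ (q j t)
    · intro h
      obtain ⟨t, ht⟩ := qs j (E j.succ ((E 0).symm z)).re
      refine ⟨t, ?_⟩
      have e : (((E j.succ ((E 0).symm z)).re : ℝ) : ℂ) = E j.succ ((E 0).symm z) := Complex.ext (by simp) (by simp [(hE _ _).1 h])
      simp only [γ]; rw [ht, e]; simp
  refine ⟨E 0, fun j => P 0 j.succ, T, γ, g, ?_, ?_, ?_⟩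
  · exact
    { xinj := fun i j e => by
        by_contra hij
        exact Pne 0 i.succ j.succ (z0 i) (z0 j) (sn i j hij) e
      cont := fun j => (E 0).continuous.comp ((E j.succ).symm.continuous.comp (Complex.continuous_ofReal.comp (qc j)))
      inj := fun j a b e => by
        simp only [γ] at e
        have := (E j.succ).symm.injective ((E 0).injective e)
        exact qi j (by exact_mod_cast this)
      limT := fun j => lim j _ ((ql j).mono_left atTop_le_cocompact)
      limB := fun j => lim j _ ((ql j).mono_left atBot_le_cocompact)
      zero := fun j => by
        simp only [γ, q, mul_zero, add_zero]
        rw [hP _ _ (z0 j).symm, hP _ _ (z0 j), Homeomorph.symm_apply_apply, hcs _ _ (z0 j)]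
      up := fun j t ht => s2 j t ht
      dn := fun j t ht => s3 j t ht
      gc := fun i => Complex.continuous_im.comp ((E i.succ).continuous.comp (E 0).symm.continuous)
      gz := fun i z => by rw [rg, hE]
      gi := fun i j hij t => by
        rw [gγ, hz _ _ (sn i j hij), ← qT, (qi j).eq_iff]
      gs := fun i j hij t t' a b => by
        rw [gγ, gγ]
        rcases s1 j with h | h
        · refine hsg _ _ (sn i j hij) _ _ ?_ ?_ <;> rw [← qT] <;> simp only [q, h] <;> linarith
        · rw [mul_comm]
          refine hsg _ _ (sn i j hij) _ _ ?_ ?_ <;> rw [← qT] <;> simp only [q, h] <;> linarith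
      meet := fun i j hij => by
        simp only [γ]
        rw [qT, qT, hP _ _ (sn i j hij), hP _ _ (sn j i hij.symm), Homeomorph.symm_apply_apply, Homeomorph.symm_apply_apply, hcs _ _ (sn i j hij)]
      tri := fun i j k hij hik hjk e => by
        refine Pne j.succ i.succ k.succ (sn j i hij.symm) (sn j k hjk) (sn i k hik) ?_
        rw [← qT, ← qT, e] }
  · ext z
    rw [← (E 0).symm_symm, Homeomorph.image_symm]
    simp [hE]
  · intro j
    ext z
    rw [rg, ← (E 0).symm_symm, Homeomorph.image_symm]
    simp
end CPR

/-- Theorem 2. Every `n`-element simple (non-weak) pseudoline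
arrangement can be drawn with convex polygonal chains, each of complexity at most
`n`: each chain is the union of two closed rays and at most `n - 2` line segments. -/
theorem convex_polyline_representation {n : ℕ} (L : Fin n → Set Plane)
    (hA : IsArrangement L) (hS : IsSimple L) :
    ∃ (h : Plane ≃ₜ Plane) (C : Fin n → Set Plane),
      (∀ i, h '' L i = C i) ∧
      (∀ i, ∃ (R₁ R₂ : Set Plane) (m : ℕ) (S : Fin m → Set Plane),
        IsRay R₁ ∧ IsRay R₂ ∧ m ≤ n - 2 ∧ (∀ k, IsSegment (S k)) ∧
        C i = R₁ ∪ R₂ ∪ ⋃ k, S k) ∧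
      (∀ i, InConvexBoundary (C i)) := by
  cases n with
  | zero => exact ⟨Homeomorph.refl _, L, fun i => i.elim0, fun i => i.elim0, fun i => i.elim0⟩
  | succ m =>
    obtain ⟨e, x, T, γ, g, A, e0, ej⟩ := CPR.to_arr hA hS
    obtain ⟨H, f, f1, f2, f3⟩ := A.real
    refine ⟨e.trans H, fun i => CPR.G (f (Fin.cases none some i)), fun i => ?_, fun i => ?_, fun i => ?_⟩
    · have hc : ∀ U : Set Plane, (e.trans H) '' U = H '' (e '' U) := fun U => image_comp H e U
      rw [hc]
      refine Fin.cases ?_ (fun j => ?_) i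
      · rw [e0]; exact f2
      · rw [ej]; exact f3 j
    · obtain ⟨a, s, τ, K, h1, h2, h3⟩ := f1 (Fin.cases none some i)
      obtain ⟨R₁, R₂, l, S, r1, r2, r3, r4, r5⟩ := CPR.chain_graph h1 h2
      rw [Fintype.card_fin] at h3
      exact ⟨R₁, R₂, l, S, r1, r2, by omega, r4, r5⟩
    · obtain ⟨a, s, τ, K, h1, h2, h3⟩ := f1 (Fin.cases none some i)
      exact CPR.convex_graph h1 h2
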